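/- There exists r₁ > 2/3 such that for every r > r₁ and every ζ > 2/5 there exists ε₀ > 0 with the following property for every ε ∈ (0, ε₀). Write X₁ = (0,0,2), X₂ = (q_{b,+}(r,u_b(r)), 0, u_b(r)) and δ = ‖X₁ − X₂‖/3 (Euclidean norm on ℝ³). (i) There exist D > 0 and μ ∈ ℝ such that, with s = −ζ − μ, the traveling-wave system admits a nonconstant solution converging to X₁ as ξ → −∞ and as ξ → +∞ and passing within distance δ of X₂ at some ξ (a simple impulse of X₁). (ii) There exist D > 0 and μ such that the system admits a nonconstant solution converging to X₂ at both ξ → ±∞ and passing within δ of X₁ (a simple impulse of X₂). (iii) There exist D > 0 and μ such that the system admits a solution converging to X₂ as ξ → −∞ and to X₁ as ξ → +∞, together with ξ₁ < ξ₂ such that the solution at ξ₁ lies within δ of X₁ and at ξ₂ lies within δ of X₂ (a 1-back). -/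

import Mathlib

open Filter Topology

noncomputable section

/-- The cubic `K(u;r)`. -/
def Kc (u r : ℝ) : ℝ := 40*u^3 - (50*r + 169)*u^2 + (160*r + 224)*u - 120*r - 96

/-- `q_{b,+}(r,u) = 1 + √((r + u − 2)/(r + 1/10))`. -/
def qbp (r u : ℝ) : ℝ := 1 + Real.sqrt ((r + u - 2) / (r + 1/10))

/-- Reaction term `f(q,u;r)` of the pipe-flow model. -/
def fq (q u r : ℝ) : ℝ := q * (r + u - 2 - (r + 1/10) * (q - 1)^2)

/-- Reaction term `g(q,u)` of the pipe-flow model. -/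
def gq (q u : ℝ) : ℝ := 2 - u + 2*q*(1 - u)

/-- `(Q,P,U)` is a solution of the traveling-wave system
`q_ξ = p`, `p_ξ = D⁻¹((u + μ)p − f(q,u;r))`, `u_ξ = ε g(q,u)/(u − s)`. -/
def IsTWSol (D μ s ε r : ℝ) (Q P U : ℝ → ℝ) : Prop :=
  (∀ ξ : ℝ, U ξ ≠ s) ∧
  (∀ ξ : ℝ, HasDerivAt Q (P ξ) ξ) ∧
  (∀ ξ : ℝ, HasDerivAt P ((1/D) * ((U ξ + μ) * P ξ - fq (Q ξ) (U ξ) r)) ξ) ∧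
  (∀ ξ : ℝ, HasDerivAt U (ε * gq (Q ξ) (U ξ) / (U ξ - s)) ξ)

/-- Euclidean distance on ℝ³ (realized as ℝ × ℝ × ℝ). -/
def dist3 (a b : ℝ × ℝ × ℝ) : ℝ :=
  Real.sqrt ((a.1 - b.1)^2 + (a.2.1 - b.2.1)^2 + (a.2.2 - b.2.2)^2)

open Set

/-- A continuous path starting in an open set either stays there or has a first exit time. -/
lemma first_exit {E : Type*} [TopologicalSpace E] {X : ℝ → E} (hX : Continuous X) {U : Set E}
    (hU : IsOpen U) {a : ℝ} (ha : X a ∈ U) (b : ℝ) :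
    (∀ t ∈ Icc a b, X t ∈ U) ∨ ∃ t ∈ Ioc a b, X t ∉ U ∧ ∀ s ∈ Ico a t, X s ∈ U := by
  by_cases h : ∀ t ∈ Icc a b, X t ∈ U
  · exact Or.inl h
  right
  push Not at h
  obtain ⟨t₀, ht₀, ht₀U⟩ := h
  have hc : IsCompact (Icc a b ∩ X ⁻¹' Uᶜ) :=
    isCompact_Icc.inter_right (hU.isClosed_compl.preimage hX)
  obtain ⟨t, ht, hmin⟩ := hc.exists_isLeast ⟨t₀, ht₀, ht₀U⟩
  refine ⟨t, ⟨lt_of_le_of_ne ht.1.1 ?_, ht.1.2⟩, ht.2, fun s hs => ?_⟩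
  · rintro rfl; exact ht.2 ha
  · by_contra hsU
    exact absurd (hmin ⟨⟨hs.1, hs.2.le.trans ht.1.2⟩, hsU⟩) (not_le.2 hs.2)

lemma deriv_nonpos_of_pos_left {f : ℝ → ℝ} {f' a t : ℝ} (hat : a < t)
    (hpos : ∀ s ∈ Ico a t, 0 ≤ f s) (ht : f t ≤ 0) (hf : HasDerivAt f f' t) : f' ≤ 0 := by
  have h := (hasDerivAt_iff_tendsto_slope_left_right.1 hf).1
  refine le_of_tendsto h ?_
  filter_upwards [Ico_mem_nhdsLT hat] with s hs
  rw [slope_def_field]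
  exact div_nonpos_of_nonneg_of_nonpos (by linarith [hpos s hs]) (by linarith [hs.2])

/-- Barrier principle with information on the past. -/
lemma barrier_pos {f : ℝ → ℝ} {a b : ℝ} (hc : Continuous f) (ha : 0 < f a)
    (h : ∀ t ∈ Ioc a b, (∀ s ∈ Ico a t, 0 < f s) → f t = 0 → ∃ f', 0 < f' ∧ HasDerivAt f f' t) :
    ∀ t ∈ Icc a b, 0 < f t := by
  rcases first_exit hc (isOpen_Ioi (a := (0:ℝ))) ha b with h1 | ⟨t, ht, htU, hs⟩
  · exact h1
  exfalso
  have h0 : f t = 0 := by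
    refine le_antisymm (not_lt.1 htU) ?_
    refine ge_of_tendsto (hc.continuousWithinAt (s := Iio t) (x := t)) ?_
    filter_upwards [Ico_mem_nhdsLT ht.1] with s hs' using (hs s hs').le
  obtain ⟨f', hf', hd⟩ := h t ht hs h0
  exact absurd (deriv_nonpos_of_pos_left ht.1 (fun s hs' => (hs s hs').le) h0.le hd) (not_le.2 hf')

/-- If `f a = 0` with positive derivative then `f > 0` just to the right of `a`. -/
lemma pos_right_of_deriv_pos {f : ℝ → ℝ} {f' a : ℝ} (hf : HasDerivAt f f' a) (h0 : 0 ≤ f a)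
    (hf' : 0 < f') : ∃ d > 0, ∀ t ∈ Ioo a (a + d), 0 < f t := by
  have h := (hasDerivAt_iff_tendsto_slope_left_right.1 hf).2
  have h2 := h.eventually (lt_mem_nhds hf')
  obtain ⟨c, hc, hc'⟩ := mem_nhdsGT_iff_exists_Ioo_subset.1 h2
  refine ⟨c - a, by simpa using hc, fun t ht => ?_⟩
  have h3 : 0 < slope f a t := hc' ⟨ht.1, by linarith [ht.2]⟩
  rw [slope_def_field] at h3
  have h4 : 0 < t - a := by linarith [ht.1]
  have := (div_pos_iff_of_pos_right h4).1 h3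
  linarith

/-- Nonstrict barrier: starting at `f a ≥ 0`, with positive derivative at zeros, `f > 0` after `a`. -/
lemma barrier_pos' {f : ℝ → ℝ} {a b : ℝ} (hc : Continuous f) (ha : 0 ≤ f a)
    (h : ∀ t ∈ Icc a b, (∀ s ∈ Icc a t, 0 ≤ f s) → f t = 0 → ∃ f', 0 < f' ∧ HasDerivAt f f' t) :
    ∀ t ∈ Ioc a b, 0 < f t := by
  intro t ht
  have key : ∃ d > 0, ∀ s ∈ Ioo a (a + d), 0 < f s := by
    rcases ha.eq_or_lt with h0 | h0
    · obtain ⟨f', hf', hd⟩ := h a ⟨le_rfl, ht.1.le.trans ht.2⟩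
        (fun s hs => by rw [le_antisymm hs.2 hs.1]; exact ha) h0.symm
      exact pos_right_of_deriv_pos hd ha hf'
    · have := (hc.tendsto a).eventually (lt_mem_nhds h0)
      obtain ⟨d, hd, hd'⟩ := Metric.eventually_nhds_iff.1 this
      refine ⟨d, hd, fun s hs => hd' ?_⟩
      rw [Real.dist_eq, abs_of_pos (by linarith [hs.1])]
      linarith [hs.2]
  obtain ⟨d, hd, hdp⟩ := key
  set a' := a + min d (t - a) / 2 with ha'
  have hm : 0 < min d (t - a) := lt_min hd (by linarith [ht.1])
  have hm1 := min_le_left d (t - a)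
  have hm2 := min_le_right d (t - a)
  have haa : 0 < f a' := hdp a' ⟨by linarith, by linarith⟩
  refine barrier_pos hc haa (b := b) (fun s hs hpos h0 => h s ⟨by linarith [hs.1], hs.2⟩ ?_ h0) t
    ⟨by linarith, ht.2⟩
  intro v hv
  rcases lt_or_ge v a' with h1 | h1
  · rcases hv.1.eq_or_lt with h2 | h2
    · rw [← h2]; exact ha
    · exact (hdp v ⟨h2, by linarith⟩).le
  · rcases hv.2.eq_or_lt with h2 | h2
    · rw [h2, h0]
    · exact (hpos v ⟨h1, h2⟩).le

/-- Monotonicity from a pointwise derivative bound, lower version. -/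
lemma le_of_deriv_ge {f : ℝ → ℝ} {a b c : ℝ} (hab : a ≤ b) (hc : ContinuousOn f (Icc a b))
    (h : ∀ t ∈ Ioo a b, ∃ f', c ≤ f' ∧ HasDerivAt f f' t) : f a + c * (b - a) ≤ f b := by
  rcases hab.eq_or_lt with rfl | hab
  · simp
  have hd : DifferentiableOn ℝ f (Ioo a b) := fun t ht => by
    obtain ⟨f', _, hf⟩ := h t ht; exact hf.differentiableAt.differentiableWithinAt
  obtain ⟨t, ht, hft⟩ := exists_deriv_eq_slope f hab hc hd
  obtain ⟨f', hf', hf⟩ := h t ht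
  rw [hf.deriv] at hft
  rw [hft, le_div_iff₀ (by linarith)] at hf'
  linarith

lemma ge_of_deriv_le {f : ℝ → ℝ} {a b c : ℝ} (hab : a ≤ b) (hc : ContinuousOn f (Icc a b))
    (h : ∀ t ∈ Ioo a b, ∃ f', f' ≤ c ∧ HasDerivAt f f' t) : f b ≤ f a + c * (b - a) := by
  have := le_of_deriv_ge (f := fun t => - f t) (c := -c) hab hc.neg (fun t ht => by
    obtain ⟨f', h1, h2⟩ := h t ht
    exact ⟨-f', by linarith, h2.neg⟩)
  linarith

/-- Exponential comparison, lower version. -/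
lemma exp_le_of_deriv_ge {f : ℝ → ℝ} {a b c : ℝ} (hab : a ≤ b) (hc : ContinuousOn f (Icc a b))
    (h : ∀ t ∈ Ioo a b, ∃ f', c * f t ≤ f' ∧ HasDerivAt f f' t) :
    f a * Real.exp (c * (b - a)) ≤ f b := by
  have := le_of_deriv_ge (f := fun t => f t * Real.exp (- (c * (t - a)))) (c := 0) hab
    (hc.mul (by fun_prop)) (fun t ht => by
      obtain ⟨f', h1, h2⟩ := h t ht
      have h3 : HasDerivAt (fun t => Real.exp (- (c * (t - a))))
          (Real.exp (- (c * (t - a))) * (-(c * 1))) t :=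
        ((((hasDerivAt_id t).sub_const a).const_mul c).neg).exp
      refine ⟨_, ?_, h2.mul h3⟩
      have := Real.exp_pos (- (c * (t - a)))
      nlinarith)
  simp only [sub_self, mul_zero, neg_zero, Real.exp_zero, mul_one, zero_mul, add_zero] at this
  calc f a * Real.exp (c * (b - a)) ≤ f b * Real.exp (-(c * (b - a))) * Real.exp (c * (b - a)) := by
        gcongr
    _ = f b := by rw [mul_assoc, ← Real.exp_add]; simp

lemma le_exp_of_deriv_le {f : ℝ → ℝ} {a b c : ℝ} (hab : a ≤ b) (hc : ContinuousOn f (Icc a b))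
    (h : ∀ t ∈ Ioo a b, ∃ f', f' ≤ c * f t ∧ HasDerivAt f f' t) :
    f b ≤ f a * Real.exp (c * (b - a)) := by
  have := exp_le_of_deriv_ge (f := fun t => - f t) (c := c) hab hc.neg (fun t ht => by
    obtain ⟨f', h1, h2⟩ := h t ht
    exact ⟨-f', by linarith, h2.neg⟩)
  linarith

section flow
variable {E : Type*} [NormedAddCommGroup E] [NormedSpace ℝ E]

lemma eq_of_lipschitz_ode {v : E → E} {K : NNReal} (hv : LipschitzWith K v) {f g : ℝ → E} {T : ℝ}
    (hf : ∀ t ∈ Ioo (-T) T, HasDerivAt f (v (f t)) t)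
    (hg : ∀ t ∈ Ioo (-T) T, HasDerivAt g (v (g t)) t) (h0 : f 0 = g 0) :
    ∀ t ∈ Ioo (-T) T, f t = g t := by
  intro t ht
  have hT : 0 < T := by linarith [ht.1, ht.2]
  exact ODE_solution_unique_of_mem_Ioo (v := fun _ => v) (s := fun _ => univ) (K := K) (t₀ := 0)
    (fun _ _ => hv.lipschitzOnWith) ⟨by linarith, hT⟩ (fun s hs => ⟨hf s hs, trivial⟩)
    (fun s hs => ⟨hg s hs, trivial⟩) h0 ht

lemma dist_le_of_lipschitz_ode_right {v : E → E} {K : NNReal} (hv : LipschitzWith K v) {f g : ℝ → E}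
    (hf : ∀ t, HasDerivAt f (v (f t)) t) (hg : ∀ t, HasDerivAt g (v (g t)) t) {t : ℝ}
    (ht : 0 ≤ t) : dist (f t) (g t) ≤ dist (f 0) (g 0) * Real.exp (K * t) := by
  have := dist_le_of_trajectories_ODE (v := fun _ => v) (K := K) (f := f) (g := g) (a := 0) (b := t)
    (fun _ => hv)
    (fun s _ => (hf s).continuousAt.continuousWithinAt) (fun s _ => (hf s).hasDerivWithinAt)
    (fun s _ => (hg s).continuousAt.continuousWithinAt) (fun s _ => (hg s).hasDerivWithinAt)
    le_rfl t ⟨ht, le_rfl⟩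
  simpa using this

lemma dist_le_of_lipschitz_ode {v : E → E} {K : NNReal} (hv : LipschitzWith K v) {f g : ℝ → E}
    (hf : ∀ t, HasDerivAt f (v (f t)) t) (hg : ∀ t, HasDerivAt g (v (g t)) t) (t : ℝ) :
    dist (f t) (g t) ≤ dist (f 0) (g 0) * Real.exp (K * |t|) := by
  rcases le_total 0 t with h | h
  · rw [abs_of_nonneg h]; exact dist_le_of_lipschitz_ode_right hv hf hg h
  · rw [abs_of_nonpos h]
    have key : ∀ k : ℝ → E, (∀ t, HasDerivAt k (v (k t)) t) →
        ∀ t, HasDerivAt (fun s => k (-s)) (- v (k (-t))) t := by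
      intro k hk t
      simpa [Function.comp_def] using (hk (-t)).scomp t (hasDerivAt_neg t)
    have := dist_le_of_lipschitz_ode_right (v := fun x => - v x) (K := K) hv.neg
      (key f hf) (key g hg) (t := -t) (by linarith)
    simpa using this

/-- A bounded globally Lipschitz vector field generates a global continuous flow. -/
lemma exists_flow [CompleteSpace E] {v : E → E} {K L : NNReal} (hv : LipschitzWith K v)
    (hL : ∀ x, ‖v x‖ ≤ L) :
    ∃ φ : ℝ → E → E, (∀ x, φ 0 x = x) ∧ (∀ x t, HasDerivAt (fun s => φ s x) (v (φ t x)) t) ∧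
      (∀ s t x, φ (s + t) x = φ s (φ t x)) ∧ Continuous (fun p : ℝ × E => φ p.1 p.2) := by
  have loc : ∀ (x : E) (n : ℕ), ∃ α : ℝ → E, α 0 = x ∧
      ∀ t ∈ Ioo (-((n : ℝ) + 1)) ((n : ℝ) + 1), HasDerivAt α (v (α t)) t := by
    intro x n
    have hpl : IsPicardLindelof (fun _ => v) (tmin := -((n : ℝ) + 1)) (tmax := (n : ℝ) + 1)
        ⟨0, by constructor <;> linarith [n.cast_nonneg (α := ℝ)]⟩ x (L * (n + 1)) 0 L K :=
      IsPicardLindelof.of_time_independent (fun y _ => hL y) hv.lipschitzOnWith (by simp)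
    obtain ⟨α, h0, h⟩ := hpl.exists_eq_forall_mem_Icc_hasDerivWithinAt₀
    exact ⟨α, h0, fun t ht => (h t ⟨ht.1.le, ht.2.le⟩).hasDerivAt (Icc_mem_nhds ht.1 ht.2)⟩
  choose α hα0 hα using loc
  have hN : ∀ t : ℝ, t ∈ Ioo (-((⌈|t|⌉₊ : ℝ) + 1)) ((⌈|t|⌉₊ : ℝ) + 1) := fun t => by
    have := Nat.le_ceil |t|
    constructor <;> linarith [neg_abs_le t, le_abs_self t]
  have hagree : ∀ (x : E) (n : ℕ) (t : ℝ), t ∈ Ioo (-((n : ℝ) + 1)) ((n : ℝ) + 1) →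
      α x ⌈|t|⌉₊ t = α x n t := by
    intro x n t ht
    have ht' := hN t
    rcases le_total n ⌈|t|⌉₊ with h | h
    · have h' : (n : ℝ) ≤ ⌈|t|⌉₊ := by exact_mod_cast h
      exact eq_of_lipschitz_ode hv (fun s hs => hα x _ s ⟨by linarith [hs.1], by linarith [hs.2]⟩)
        (hα x n) ((hα0 x _).trans (hα0 x n).symm) t ht
    · have h' : (⌈|t|⌉₊ : ℝ) ≤ n := by exact_mod_cast h
      exact eq_of_lipschitz_ode hv (hα x _)
        (fun s hs => hα x n s ⟨by linarith [hs.1], by linarith [hs.2]⟩)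
        ((hα0 x _).trans (hα0 x n).symm) t ht'
  set φ : ℝ → E → E := fun t x => α x ⌈|t|⌉₊ t with hφ
  have hd : ∀ x t, HasDerivAt (fun s => φ s x) (v (φ t x)) t := by
    intro x t
    refine (hα x ⌈|t|⌉₊ t (hN t)).congr_of_eventuallyEq ?_
    filter_upwards [Ioo_mem_nhds (hN t).1 (hN t).2] with s hs using hagree x _ s hs
  have h0 : ∀ x, φ 0 x = x := fun x => hα0 x _
  have hlip : ∀ x y t, dist (φ t x) (φ t y) ≤ dist x y * Real.exp (K * |t|) := by
    intro x y t
    simpa [h0] using dist_le_of_lipschitz_ode hv (hd x) (hd y) t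
  refine ⟨φ, h0, hd, ?_, ?_⟩
  · intro s t x
    have h1 : ∀ s, HasDerivAt (fun s => φ (s + t) x) (v (φ (s + t) x)) s := fun s =>
      (hd x (s + t)).comp_add_const s t
    have := dist_le_of_lipschitz_ode hv h1 (hd (φ t x)) s
    simpa [h0] using this
  · rw [continuous_iff_continuousAt]
    rintro ⟨t, x⟩
    have hc : ContinuousOn (fun p : ℝ × E => φ p.1 p.2) (Ioo (t - 1) (t + 1) ×ˢ univ) := by
      refine continuousOn_prod_of_continuousOn_lipschitzOnWith' (fun p : ℝ × E => φ p.1 p.2)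
        (Real.toNNReal (Real.exp (K * (|t| + 1)))) ?_ ?_
      · intro s hs
        refine LipschitzOnWith.of_dist_le_mul fun y _ z _ => ?_
        rw [Real.coe_toNNReal _ (Real.exp_pos _).le, mul_comm]
        refine (hlip y z s).trans ?_
        have : |s| ≤ |t| + 1 := by
          have := abs_sub_abs_le_abs_sub s t
          have h2 : |s - t| ≤ 1 := abs_le.2 ⟨by linarith [hs.1], by linarith [hs.2]⟩
          linarith
        gcongr
      · intro y _
        exact fun s _ => (hd y s).continuousAt.continuousWithinAt
    exact hc.continuousAt (prod_mem_nhds (Ioo_mem_nhds (by linarith) (by linarith)) univ_mem)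
end flow

/-- Clamping a real number to an interval. -/
def clampR (a b x : ℝ) : ℝ := max a (min x b)

lemma clampR_eq {a b x : ℝ} (h : x ∈ Icc a b) : clampR a b x = x := by
  rw [clampR, min_eq_left h.2, max_eq_right h.1]

lemma clampR_mem {a b : ℝ} (hab : a ≤ b) (x : ℝ) : clampR a b x ∈ Icc a b :=
  ⟨le_max_left _ _, max_le hab (min_le_right _ _)⟩

lemma lipschitz_clampR (a b : ℝ) : LipschitzWith 1 (clampR a b) :=
  (LipschitzWith.id.min_const b).const_max a

/-- The phase space `(q, y, u, μ)`. -/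
abbrev St := ℝ × ℝ × ℝ × ℝ

/-- The region in which the vector field is left untouched. -/
def Box (q y u μ : ℝ) : Prop :=
  -1 ≤ q ∧ q ≤ 3 ∧ -20 ≤ y ∧ y ≤ 20 ∧ 1 ≤ u ∧ u ≤ 21/10 ∧ -3 ≤ μ ∧ μ ≤ 0 ∧ -39/100 ≤ u + μ

/-- Second component of the rescaled vector field. -/
noncomputable def FY (e q y u μ : ℝ) : ℝ := 8 * (u + μ) * y - 2 * q * (q * (2 - q) - (21/10 - u) * e)

/-- Third component of the rescaled vector field. -/
noncomputable def FU (η ζ q u μ : ℝ) : ℝ := η * (2 - u + 2 * q * (1 - u)) / (u + μ + ζ)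

/-- A global continuous flow that follows the rescaled traveling wave system inside the box. -/
structure PFlow (e η ζ : ℝ) (φ : ℝ → St → St) : Prop where
  cont : Continuous (fun p : ℝ × St => φ p.1 p.2)
  zero : ∀ x, φ 0 x = x
  add : ∀ s t x, φ (s + t) x = φ s (φ t x)
  mu : ∀ t x, (φ t x).2.2.2 = x.2.2.2
  dq : ∀ t x, Box (φ t x).1 (φ t x).2.1 (φ t x).2.2.1 x.2.2.2 →
    HasDerivAt (fun s => (φ s x).1) (φ t x).2.1 t
  dy : ∀ t x, Box (φ t x).1 (φ t x).2.1 (φ t x).2.2.1 x.2.2.2 →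
    HasDerivAt (fun s => (φ s x).2.1) (FY e (φ t x).1 (φ t x).2.1 (φ t x).2.2.1 x.2.2.2) t
  du : ∀ t x, Box (φ t x).1 (φ t x).2.1 (φ t x).2.2.1 x.2.2.2 →
    HasDerivAt (fun s => (φ s x).2.2.1) (FU η ζ (φ t x).1 (φ t x).2.2.1 x.2.2.2) t

lemma exists_pflow (e η ζ : ℝ) (hζ : 2/5 < ζ) : ∃ φ, PFlow e η ζ φ := by
  let G : ℝ × ℝ × ℝ × ℝ × ℝ → St := fun x => (x.2.1, FY e x.1 x.2.1 x.2.2.1 x.2.2.2.1,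
    η * (2 - x.2.2.1 + 2 * x.1 * (1 - x.2.2.1)) / (x.2.2.2.2 + ζ), 0)
  let S : Set (ℝ × ℝ × ℝ × ℝ × ℝ) := Icc (-1, -20, 1, -3, -39/100) (3, 20, 21/10, 0, 3)
  let T : St → ℝ × ℝ × ℝ × ℝ × ℝ := fun x => (clampR (-1) 3 x.1, clampR (-20) 20 x.2.1,
    clampR 1 (21/10) x.2.2.1, clampR (-3) 0 x.2.2.2, clampR (-39/100) 3 (x.2.2.1 + x.2.2.2))
  have hT : ∀ x, T x ∈ S := by
    intro x
    have h1 := clampR_mem (show (-1:ℝ) ≤ 3 by norm_num) x.1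
    have h2 := clampR_mem (show (-20:ℝ) ≤ 20 by norm_num) x.2.1
    have h3 := clampR_mem (show (1:ℝ) ≤ 21/10 by norm_num) x.2.2.1
    have h4 := clampR_mem (show (-3:ℝ) ≤ 0 by norm_num) x.2.2.2
    have h5 := clampR_mem (show (-39/100:ℝ) ≤ 3 by norm_num) (x.2.2.1 + x.2.2.2)
    exact ⟨⟨h1.1, h2.1, h3.1, h4.1, h5.1⟩, ⟨h1.2, h2.2, h3.2, h4.2, h5.2⟩⟩
  have hGc : ContDiffOn ℝ 1 G S := by
    have hden : ∀ x ∈ S, x.2.2.2.2 + ζ ≠ 0 := by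
      intro x hx
      have : -39/100 ≤ x.2.2.2.2 := hx.1.2.2.2.2
      linarith
    refine ContDiffOn.prodMk (by fun_prop) (ContDiffOn.prodMk ?_ (ContDiffOn.prodMk ?_ ?_))
    · unfold FY; fun_prop
    · exact ContDiffOn.div (by fun_prop) (by fun_prop) hden
    · exact contDiffOn_const
  obtain ⟨K, hK⟩ := hGc.exists_lipschitzOnWith one_ne_zero (convex_Icc _ _) isCompact_Icc
  obtain ⟨L, hL⟩ := (isCompact_Icc (a := ((-1, -20, 1, -3, -39/100) : ℝ × ℝ × ℝ × ℝ × ℝ))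
    (b := (3, 20, 21/10, 0, 3))).exists_bound_of_continuousOn hGc.continuousOn
  have hTl : ∃ K', LipschitzWith K' T := by
    have p1 : LipschitzWith 1 (fun x : St => x.1) := LipschitzWith.prod_fst
    have p2 : LipschitzWith 1 (fun x : St => x.2) := LipschitzWith.prod_snd
    have q1 : LipschitzWith (1 * 1) (fun x : St => x.2.1) := LipschitzWith.prod_fst.comp p2
    have q2 : LipschitzWith (1 * 1) (fun x : St => x.2.2) := LipschitzWith.prod_snd.comp p2
    have r1 : LipschitzWith (1 * (1 * 1)) (fun x : St => x.2.2.1) := LipschitzWith.prod_fst.comp q2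
    have r2 : LipschitzWith (1 * (1 * 1)) (fun x : St => x.2.2.2) := LipschitzWith.prod_snd.comp q2
    exact ⟨_, ((lipschitz_clampR _ _).comp p1).prodMk (((lipschitz_clampR _ _).comp q1).prodMk
      (((lipschitz_clampR _ _).comp r1).prodMk (((lipschitz_clampR _ _).comp r2).prodMk
      ((lipschitz_clampR _ _).comp (r1.add r2)))))⟩
  obtain ⟨K', hK'⟩ := hTl
  have hv : LipschitzWith (K * K') (fun x => G (T x)) := by
    rw [← lipschitzOnWith_univ]
    exact hK.comp hK'.lipschitzOnWith (fun x _ => hT x)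
  obtain ⟨φ, h0, hd, hadd, hc⟩ := exists_flow (v := fun x => G (T x)) (L := L.toNNReal) hv
    (fun x => (hL _ (hT x)).trans (Real.le_coe_toNNReal L))
  have hmu : ∀ t x, (φ t x).2.2.2 = x.2.2.2 := by
    intro t x
    have h1 : ∀ t, HasDerivAt (fun s => (φ s x).2.2.2) 0 t := fun t => by
      have := (hd x t).hasFDerivAt.snd.snd.snd.hasDerivAt
      simpa [G] using this
    have := is_const_of_deriv_eq_zero (fun t => (h1 t).differentiableAt) (fun t => (h1 t).deriv) t 0
    simpa [h0] using this
  have hbox : ∀ t x, Box (φ t x).1 (φ t x).2.1 (φ t x).2.2.1 x.2.2.2 →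
      T (φ t x) = ((φ t x).1, (φ t x).2.1, (φ t x).2.2.1, x.2.2.2, (φ t x).2.2.1 + x.2.2.2) := by
    intro t x hb
    obtain ⟨b1, b2, b3, b4, b5, b6, b7, b8, b9⟩ := hb
    simp only [T, hmu]
    rw [clampR_eq ⟨b1, b2⟩, clampR_eq ⟨b3, b4⟩, clampR_eq ⟨b5, b6⟩, clampR_eq ⟨b7, b8⟩,
      clampR_eq ⟨b9, by linarith⟩]
  refine ⟨φ, hc, h0, hadd, hmu, fun t x hb => ?_, fun t x hb => ?_, fun t x hb => ?_⟩
  · have := (hd x t).hasFDerivAt.fst.hasDerivAt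
    simpa [G, hbox t x hb] using this
  · have := (hd x t).hasFDerivAt.snd.fst.hasDerivAt
    simpa [G, hbox t x hb] using this
  · have := (hd x t).hasFDerivAt.snd.snd.fst.hasDerivAt
    simpa [G, hbox t x hb, FU] using this

/-- Smallness assumptions on the parameters. -/
structure Par (e η ζ : ℝ) : Prop where
  e0 : 0 < e
  e1 : e ≤ 1/100000
  h0 : 0 < η
  h1 : η ≤ e^4/10^20
  z : 2/5 < ζ

/-- An orbit of the rescaled traveling wave system, as long as it remains in the box. -/
structure Orb (e η ζ μ : ℝ) (q y u : ℝ → ℝ) : Prop where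
  cq : Continuous q
  cy : Continuous y
  cu : Continuous u
  dq : ∀ t, Box (q t) (y t) (u t) μ → HasDerivAt q (y t) t
  dy : ∀ t, Box (q t) (y t) (u t) μ → HasDerivAt y (FY e (q t) (y t) (u t) μ) t
  du : ∀ t, Box (q t) (y t) (u t) μ → HasDerivAt u (FU η ζ (q t) (u t) μ) t

/-- The open working window. -/
structure GU (ulo q y u : ℝ) : Prop where
  q0 : 0 < q
  q1 : q < 21/10
  y0 : -(8*q) < y
  y1 : y < 8*q
  u0 : ulo < u
  u1 : u < 401/200

/-- Admissible parameters for the window. -/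
structure MU (ulo μ : ℝ) : Prop where
  lo : 119/100 ≤ ulo
  g0 : -(36/100) ≤ ulo + μ
  g1 : 401/200 + μ ≤ 6/10
  m0 : -2 ≤ μ
  m1 : μ ≤ -1

lemma Par.hsmall {e η ζ : ℝ} (hp : Par e η ζ) : η ≤ e/10^35 ∧ η ≤ e^2/10^30 ∧ η ≤ e^3/10^25 := by
  have h0 := hp.e0
  have h1 := hp.e1
  have h2 := hp.h1
  have a2 : e^2 ≤ e/10^5 := by nlinarith
  have a3 : e^3 ≤ e^2/10^5 := by nlinarith [sq_nonneg e]
  have a4 : e^4 ≤ e^3/10^5 := by nlinarith [pow_pos h0 3]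
  refine ⟨by linarith, by linarith, by linarith⟩

lemma GU.box {ulo μ q y u : ℝ} (h : GU ulo q y u) (hm : MU ulo μ) : Box q y u μ := by
  obtain ⟨a1, a2, a3, a4, a5, a6⟩ := h
  obtain ⟨b1, b2, b3, b4, b5⟩ := hm
  refine ⟨?_, ?_, ?_, ?_, ?_, ?_, ?_, ?_, ?_⟩ <;> linarith

lemma Orb.shift {e η ζ μ : ℝ} {q y u : ℝ → ℝ} (h : Orb e η ζ μ q y u) (a : ℝ) :
    Orb e η ζ μ (fun t => q (t + a)) (fun t => y (t + a)) (fun t => u (t + a)) where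
  cq := h.cq.comp (by fun_prop)
  cy := h.cy.comp (by fun_prop)
  cu := h.cu.comp (by fun_prop)
  dq t hb := (h.dq _ hb).comp_add_const t a
  dy t hb := (h.dy _ hb).comp_add_const t a
  du t hb := (h.du _ hb).comp_add_const t a

lemma PFlow.orb {e η ζ : ℝ} {φ : ℝ → St → St} (h : PFlow e η ζ φ) (x : St) :
    Orb e η ζ x.2.2.2 (fun t => (φ t x).1) (fun t => (φ t x).2.1) (fun t => (φ t x).2.2.1) where
  cq := (continuous_fst.comp h.cont).comp (by fun_prop : Continuous fun t : ℝ => (t, x))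
  cy := ((continuous_fst.comp continuous_snd).comp h.cont).comp
    (by fun_prop : Continuous fun t : ℝ => (t, x))
  cu := ((continuous_fst.comp (continuous_snd.comp continuous_snd)).comp h.cont).comp
    (by fun_prop : Continuous fun t : ℝ => (t, x))
  dq t hb := h.dq t x hb
  dy t hb := h.dy t x hb
  du t hb := h.du t x hb

/-- Bound on the slow vector field. -/
lemma abs_FU_le {e η ζ q u μ : ℝ} (hp : Par e η ζ) (hq0 : 0 ≤ q) (hq1 : q ≤ 21/10)
    (hu0 : 1 ≤ u) (hu1 : u ≤ 401/200) (hg : -(36/100) ≤ u + μ) : |FU η ζ q u μ| ≤ 200 * η := by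
  have hη := hp.h0
  have hd : 4/100 ≤ u + μ + ζ := by linarith [hp.z]
  have hd0 : 0 < u + μ + ζ := by linarith
  unfold FU
  rw [abs_div, abs_of_pos hd0, div_le_iff₀ hd0, abs_mul, abs_of_pos hη]
  have : |2 - u + 2 * q * (1 - u)| ≤ 8 := by
    rw [abs_le]; constructor <;> nlinarith
  nlinarith

lemma GU.du_le {e η ζ ulo μ q y u : ℝ} (hp : Par e η ζ) (h : GU ulo q y u) (hm : MU ulo μ) :
    |FU η ζ q u μ| ≤ 200 * η :=
  abs_FU_le hp h.q0.le h.q1.le (by linarith [h.u0, hm.lo]) h.u1.le (by linarith [h.u0, hm.g0])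

lemma continuous_GU_isOpen (ulo : ℝ) :
    IsOpen {x : ℝ × ℝ × ℝ | GU ulo x.1 x.2.1 x.2.2} := by
  have : {x : ℝ × ℝ × ℝ | GU ulo x.1 x.2.1 x.2.2} =
      {x | 0 < x.1} ∩ {x | x.1 < 21/10} ∩ {x | -(8*x.1) < x.2.1} ∩ {x | x.2.1 < 8*x.1}
      ∩ {x | ulo < x.2.2} ∩ {x | x.2.2 < 401/200} := by
    ext x
    constructor
    · rintro ⟨a1, a2, a3, a4, a5, a6⟩; exact ⟨⟨⟨⟨⟨a1, a2⟩, a3⟩, a4⟩, a5⟩, a6⟩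
    · rintro ⟨⟨⟨⟨⟨a1, a2⟩, a3⟩, a4⟩, a5⟩, a6⟩; exact ⟨a1, a2, a3, a4, a5, a6⟩
  rw [this]
  refine (((((isOpen_lt ?_ ?_).inter (isOpen_lt ?_ ?_)).inter (isOpen_lt ?_ ?_)).inter
    (isOpen_lt ?_ ?_)).inter (isOpen_lt ?_ ?_)).inter (isOpen_lt ?_ ?_) <;> fun_prop

section basic
variable {e η ζ μ ulo : ℝ} {q y u : ℝ → ℝ}

/-- The slow variable moves by at most `200 η` per unit time. -/
lemma Orb.u_drift (ho : Orb e η ζ μ q y u) (hp : Par e η ζ) (hm : MU ulo μ) {a b : ℝ} (hab : a ≤ b)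
    (hU : ∀ t ∈ Ioo a b, GU ulo (q t) (y t) (u t)) : |u b - u a| ≤ 200 * η * (b - a) := by
  have h1 := le_of_deriv_ge (f := u) (c := -(200*η)) hab ho.cu.continuousOn (fun t ht =>
    ⟨_, (abs_le.1 ((hU t ht).du_le hp hm)).1, ho.du t ((hU t ht).box hm)⟩)
  have h2 := ge_of_deriv_le (f := u) (c := 200*η) hab ho.cu.continuousOn (fun t ht =>
    ⟨_, (abs_le.1 ((hU t ht).du_le hp hm)).2, ho.du t ((hU t ht).box hm)⟩)
  rw [abs_le]; constructor <;> linarith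

/-- The upper bound on `u` is forward invariant. -/
lemma Orb.u_lt (ho : Orb e η ζ μ q y u) (hp : Par e η ζ) (hm : MU ulo μ) {a b : ℝ}
    (h0 : u a < 401/200) (hB : ∀ t ∈ Ioc a b, Box (q t) (y t) (u t) μ ∧ 0 ≤ q t) :
    ∀ t ∈ Icc a b, u t < 401/200 := by
  have := barrier_pos (f := fun t => 401/200 - u t) (a := a) (b := b) (by have := ho.cu; fun_prop)
    (by simpa using h0) (fun t ht _ hz => by
      obtain ⟨hb, hq⟩ := hB t ht
      refine ⟨_, ?_, (ho.du t hb).const_sub _⟩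
      have hu : u t = 401/200 := by linarith
      have hd : 0 < u t + μ + ζ := by have := hb.2.2.2.2.2.2.2.2; have := hp.z; linarith
      unfold FU
      rw [neg_pos, div_neg_iff]
      right
      refine ⟨?_, hd⟩
      rw [hu]
      have := hp.h0
      nlinarith)
  intro t ht
  linarith [this t ht]

/-- Lower bounds on `u` that are forward invariant. -/
lemma Orb.lt_u (ho : Orb e η ζ μ q y u) (hp : Par e η ζ) {ℓ qm : ℝ} {a b : ℝ}
    (h0 : ℓ < u a) (hℓ : 1 ≤ ℓ) (hq : 0 < 2 - ℓ + 2 * qm * (1 - ℓ))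
    (hB : ∀ t ∈ Ioc a b, Box (q t) (y t) (u t) μ ∧ q t ≤ qm) :
    ∀ t ∈ Icc a b, ℓ < u t := by
  have := barrier_pos (f := fun t => u t - ℓ) (a := a) (b := b) (by have := ho.cu; fun_prop)
    (by simpa using h0) (fun t ht _ hz => by
      obtain ⟨hb, hq⟩ := hB t ht
      refine ⟨_, ?_, (ho.du t hb).sub_const _⟩
      have hu : u t = ℓ := by linarith
      have hd : 0 < u t + μ + ζ := by have := hb.2.2.2.2.2.2.2.2; have := hp.z; linarith
      unfold FU
      apply div_pos _ hd
      rw [hu]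
      have := hp.h0
      apply mul_pos this
      nlinarith)
  intro t ht
  linarith [this t ht]

end basic

lemma le_of_le_on_Ico {f g : ℝ → ℝ} {a t : ℝ} (hat : a < t) (hf : Continuous f) (hg : Continuous g)
    (h : ∀ s ∈ Ico a t, f s ≤ g s) : f t ≤ g t := by
  refine le_of_tendsto_of_tendsto (hf.continuousWithinAt (s := Iio t) (x := t))
    (hg.continuousWithinAt (s := Iio t) (x := t)) ?_
  filter_upwards [Ico_mem_nhdsLT hat] with s hs using h s hs

/-- The window together with the condition that the orbit has not yet turned back. -/
def GF (e ulo q y u : ℝ) : Prop := GU ulo q y u ∧ (1/40 < q ∨ y < -(e/100*q))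

lemma isOpen_GF (e ulo : ℝ) : IsOpen {x : ℝ × ℝ × ℝ | GF e ulo x.1 x.2.1 x.2.2} := by
  have h1 : IsOpen {x : ℝ × ℝ × ℝ | 1/40 < x.1} := isOpen_lt (by fun_prop) (by fun_prop)
  have h2 : IsOpen {x : ℝ × ℝ × ℝ | x.2.1 < -(e/100*x.1)} := isOpen_lt (by fun_prop) (by fun_prop)
  exact (continuous_GU_isOpen ulo).inter (h1.union h2)

section fall
variable {e η ζ μ ulo : ℝ} {q y u : ℝ → ℝ}

lemma Orb.cont3 (ho : Orb e η ζ μ q y u) : Continuous fun t => (q t, y t, u t) :=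
  ho.cq.prodMk (ho.cy.prodMk ho.cu)

lemma GU.closure (ho : Orb e η ζ μ q y u) (hm : MU ulo μ) {a t : ℝ} (hat : a < t)
    (h : ∀ s ∈ Ico a t, GU ulo (q s) (y s) (u s)) :
    0 ≤ q t ∧ q t ≤ 21/10 ∧ -(8 * q t) ≤ y t ∧ y t ≤ 8 * q t ∧ ulo ≤ u t ∧ u t ≤ 401/200 ∧
      Box (q t) (y t) (u t) μ := by
  have cq := ho.cq
  have cy := ho.cy
  have cu := ho.cu
  have h1 := le_of_le_on_Ico (f := fun _ => (0:ℝ)) (g := q) hat (by fun_prop) cq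
    (fun s hs => (h s hs).q0.le)
  have h2 := le_of_le_on_Ico (f := q) (g := fun _ => 21/10) hat cq (by fun_prop)
    (fun s hs => (h s hs).q1.le)
  have h3 := le_of_le_on_Ico (f := fun s => -(8 * q s)) (g := y) hat (by fun_prop) cy
    (fun s hs => (h s hs).y0.le)
  have h4 := le_of_le_on_Ico (f := y) (g := fun s => 8 * q s) hat cy (by fun_prop)
    (fun s hs => (h s hs).y1.le)
  have h5 := le_of_le_on_Ico (f := fun _ => ulo) (g := u) hat (by fun_prop) cu
    (fun s hs => (h s hs).u0.le)
  have h6 := le_of_le_on_Ico (f := u) (g := fun _ => 401/200) hat cu (by fun_prop)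
    (fun s hs => (h s hs).u1.le)
  refine ⟨h1, h2, h3, h4, h5, h6, ?_⟩
  obtain ⟨b1, b2, b3, b4, b5⟩ := hm
  refine ⟨?_, ?_, ?_, ?_, ?_, ?_, ?_, ?_, ?_⟩ <;> linarith

/-- In the window `q` decays at most exponentially. -/
lemma Orb.q_pos (ho : Orb e η ζ μ q y u) (hm : MU ulo μ) {a t : ℝ} (hat : a < t)
    (h : ∀ s ∈ Ico a t, GU ulo (q s) (y s) (u s)) : 0 < q t := by
  have := exp_le_of_deriv_ge (f := q) (c := -8) hat.le ho.cq.continuousOn (fun s hs =>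
    ⟨_, by have := (h s ⟨hs.1.le, hs.2⟩).y0; linarith,
      ho.dq s ((h s ⟨hs.1.le, hs.2⟩).box hm)⟩)
  have h2 := (h a ⟨le_rfl, hat⟩).q0
  have := mul_pos h2 (Real.exp_pos (-8 * (t - a)))
  linarith

/-- Below the line `y = -7 q` there is no return while `q > 0`. -/
lemma Orb.absorb_O (ho : Orb e η ζ μ q y u) (hp : Par e η ζ) (hm : MU ulo μ) {a b : ℝ}
    (h0 : y a < -(7 * q a)) (h : ∀ s ∈ Icc a b, GU ulo (q s) (y s) (u s)) :
    ∀ t ∈ Icc a b, y t < -(7 * q t) := by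
  have cq := ho.cq
  have cy := ho.cy
  have := barrier_pos (f := fun t => -(y t + 7 * q t)) (a := a) (b := b) (by fun_prop)
    (by linarith) (fun t ht _ hz => by
      have hU := h t ⟨ht.1.le, ht.2⟩
      have hb := hU.box hm
      refine ⟨_, ?_, ((ho.dy t hb).add ((ho.dq t hb).const_mul 7)).neg⟩
      have hy : y t = -(7 * q t) := by linarith
      rw [hy, FY]
      have e0 := hp.e0
      have e1 := hp.e1
      have := hm.g0
      have : 0 < 49 + 7 * (8 * (u t + μ)) + 2 * (q t * (2 - q t) - (21/10 - u t) * e) := by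
        have h1 : (21/10 - u t) * e ≤ 1 * (1/100000) :=
          mul_le_mul (by linarith [hm.lo, hU.u0]) e1 e0.le (by norm_num)
        have h2 : -1 ≤ q t * (2 - q t) := by nlinarith [hU.q0, hU.q1]
        linarith [hU.u0]
      nlinarith [mul_pos hU.q0 this])
  intro t ht
  linarith [this t ht]

/-- Lower bound for the reaction term between the two zeros. -/
lemma reaction_pos {e q u : ℝ} (he : 0 < e) (he1 : e ≤ 1/100000) (hq0 : 1/40 ≤ q) (hq1 : q ≤ 2 - 2*e)
    (hu0 : 119/100 ≤ u) : e ≤ q * (2 - q) - (21/10 - u) * e := by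
  have h1 : (21/10 - u) * e ≤ 91/100 * e := mul_le_mul_of_nonneg_right (by linarith) he.le
  have h2 : 2 * e ≤ q * (2 - q) := by
    nlinarith [mul_nonneg (sub_nonneg.2 hq0) (sub_nonneg.2 hq1)]
  linarith

/-- The orbit cannot touch the line `y = -e/100 q` from below without crossing it. -/
lemma Orb.no_touch (ho : Orb e η ζ μ q y u) (hp : Par e η ζ) (hm : MU ulo μ) {t' : ℝ}
    (ht0 : 0 < t') (hGU' : ∀ s ∈ Icc 0 t', GU ulo (q s) (y s) (u s)) (hq2 : q t' < 1/40)
    (hyeq : y t' = -(e/100 * q t')) (hmax : IsLocalMax (fun s => y s + e/100 * q s) t')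
    (hin : ∀ s ∈ Ico 0 t', q s < 1/40 → y s < -(e/100 * q s)) : False := by
  have e0 := hp.e0
  have e1 := hp.e1
  have cq := ho.cq
  have cy := ho.cy
  have cu := ho.cu
  have hlo' := hm.lo
  have hGU := hGU' t' ⟨ht0.le, le_rfl⟩
  have hbox : ∀ s ∈ Icc 0 t', Box (q s) (y s) (u s) μ := fun s hs => (hGU' s hs).box hm
  have hd : HasDerivAt (fun s => y s + e/100 * q s)
        (FY e (q t') (y t') (u t') μ + e/100 * y t') t' :=
      (ho.dy t' (hbox t' ⟨ht0.le, le_rfl⟩)).add ((ho.dq t' (hbox t' ⟨ht0.le, le_rfl⟩)).const_mul _)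
  have h0 := hmax.hasDerivAt_eq_zero hd
  set Θ : ℝ → ℝ := fun s => (e/100)^2 + 8 * (u s + μ) * (e/100) + 2 * q s * (2 - q s)
    - 2 * ((21/10 - u s) * e) with hΘ
  have hqt := hGU.q0
  have hΘ0 : Θ t' = 0 := by
    have : q t' * Θ t' = 0 := by
      rw [FY, hyeq] at h0
      simp only [hΘ]
      linarith
    rcases mul_eq_zero.1 this with h | h
    · linarith
    · exact h
  have hΘd : HasDerivAt Θ (8 * (FU η ζ (q t') (u t') μ) * (e/100) + (2 * y t' * (2 - q t') +
      2 * q t' * (- y t')) - 2 * (- FU η ζ (q t') (u t') μ * e)) t' := by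
    have d1 := ho.du t' (hbox t' ⟨ht0.le, le_rfl⟩)
    have d2 := ho.dq t' (hbox t' ⟨ht0.le, le_rfl⟩)
    exact ((((d1.add_const μ).const_mul 8).mul_const (e/100)).const_add ((e/100)^2)).add
      ((d2.const_mul 2).mul (d2.const_sub 2)) |>.sub (((d1.const_sub (21/10)).mul_const e).const_mul 2)
  have hΘneg : 8 * (FU η ζ (q t') (u t') μ) * (e/100) + (2 * y t' * (2 - q t') +
      2 * q t' * (- y t')) - 2 * (- FU η ζ (q t') (u t') μ * e) < 0 := by
    have hF := (abs_le.1 (hGU.du_le hp hm)).2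
    have hη := hp.hsmall.2.1
    have hqlow : 3/100 * e ≤ q t' := by
      simp only [hΘ] at hΘ0
      have g1 := hGU.u0
      have g2 := hGU.u1
      have g3 := hm.g0
      have g4 := hm.g1
      have : 8 * (u t' + μ) * (e/100) ≤ 48/1000 * e := by nlinarith
      have : 95/1000 * e ≤ (21/10 - u t') * e := by nlinarith
      nlinarith
    rw [hyeq]
    have h1 : FU η ζ (q t') (u t') μ * (2*e + 8 * (e/100)) ≤ (200 * (e^2/10^30)) * 1 := by
      by_cases hs : FU η ζ (q t') (u t') μ ≤ 0
      · have : FU η ζ (q t') (u t') μ * (2*e + 8 * (e/100)) ≤ 0 :=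
          mul_nonpos_of_nonpos_of_nonneg hs (by linarith)
        have : 0 ≤ (200 * (e^2/10^30)) * 1 := by positivity
        linarith
      · push Not at hs
        exact mul_le_mul (by linarith) (by linarith) (by linarith) (by positivity)
    have h2 : e/100 * (3/100 * e) * 3 ≤ e/100 * q t' * (4 - 4 * q t') := by
      apply mul_le_mul _ (by linarith) (by norm_num) (by positivity)
      exact mul_le_mul_of_nonneg_left hqlow (by linarith)
    have h3 := pow_pos e0 2
    nlinarith
  -- `Θ > 0` on the left
  have hleft : ∃ a ∈ Ioo 0 t', ∀ s ∈ Ioo a t', 0 < Θ s ∧ q s < 1/40 := by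
    have hs := (hasDerivAt_iff_tendsto_slope_left_right.1 hΘd).1.eventually (gt_mem_nhds hΘneg)
    have hq' : ∀ᶠ r in 𝓝[<] t', q r < 1/40 :=
      ((cq.tendsto t').eventually (gt_mem_nhds hq2)).filter_mono nhdsWithin_le_nhds
    obtain ⟨c, hc, hc'⟩ := mem_nhdsLT_iff_exists_Ioo_subset.1 (hs.and hq')
    refine ⟨max c (t'/2), ⟨by have := le_max_right c (t'/2); linarith [ht0],
      max_lt hc (by linarith [ht0])⟩, fun s hs => ?_⟩
    have hs2 := hc' ⟨(le_max_left c (t'/2)).trans_lt hs.1, hs.2⟩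
    refine ⟨?_, hs2.2⟩
    have h3 : slope Θ t' s < 0 := hs2.1
    rw [slope_def_field, hΘ0, div_neg_iff] at h3
    rcases h3 with h3 | h3
    · linarith [h3.1]
    · linarith [hs.2, h3.2]
  obtain ⟨a, ha, ha'⟩ := hleft
  set b := (a + t')/2
  have hb : a < b ∧ b < t' := by constructor <;> simp only [b] <;> linarith [ha.2]
  have hfneg : ∀ s ∈ Ico b t', y s + e/100 * q s < 0 := by
    intro s hs
    have h1 := (ha' s ⟨hb.1.trans_le hs.1, hs.2⟩).2
    have h2 := hin s ⟨by linarith [ha.1, hs.1], hs.2⟩ h1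
    linarith
  have := le_exp_of_deriv_le (f := fun s => y s + e/100 * q s) (c := -3) hb.2.le
    (by fun_prop) (fun s hs => by
      have hsI : s ∈ Icc 0 t' := ⟨by linarith [ha.1, hs.1], hs.2.le⟩
      refine ⟨_, ?_, (ho.dy s (hbox s hsI)).add ((ho.dq s (hbox s hsI)).const_mul _)⟩
      have h1 := (ha' s ⟨hb.1.trans hs.1, hs.2⟩).1
      have h2 := hfneg s ⟨hs.1.le, hs.2⟩
      have h3 := mul_pos (hGU' s hsI).q0 h1
      have g : -3 ≤ 8 * (u s + μ) + e/100 := by linarith [(hGU' s hsI).u0, hm.g0]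
      have h4 : FY e (q s) (y s) (u s) μ + e/100 * y s =
        (8 * (u s + μ) + e/100) * (y s + e/100 * q s) - q s * Θ s := by
        simp only [hΘ, FY]; ring
      rw [h4]
      nlinarith)
  have h5 := mul_neg_of_neg_of_pos (hfneg b ⟨le_rfl, hb.2⟩) (Real.exp_pos (-3 * (t' - b)))
  linarith

/-- Core of the analysis of the downward jump. -/
lemma Orb.fall (ho : Orb e η ζ μ q y u) (hp : Par e η ζ) (hm : MU ulo μ) {T : ℝ}
    (hq0 : 1/20 ≤ q 0) (hq1 : q 0 ≤ 2 - 2*e) (hy0 : -(7 * q 0) ≤ y 0) (hy1 : y 0 ≤ 0)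
    (hu0 : ulo < u 0) (hu1 : u 0 < 401/200)
    (hlo : ∀ t ∈ Icc 0 T, (∀ s ∈ Ico 0 t, GU ulo (q s) (y s) (u s)) → (∀ s ∈ Icc 0 t, y s ≤ 0) →
      Box (q t) (y t) (u t) μ → ulo < u t)
    (hV : ∀ t ∈ Icc 0 T, (∀ s ∈ Icc 0 t, GU ulo (q s) (y s) (u s)) → q t < 1/40 →
      y t ≤ -(e/100 * q t))
    (hO : ∀ t ∈ Icc 0 T, (∀ s ∈ Icc 0 t, GF e ulo (q s) (y s) (u s)) → -(7 * q t) ≤ y t) :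
    ∀ t ∈ Ico 0 T, (∀ s ∈ Icc 0 t, GF e ulo (q s) (y s) (u s)) ∧ (0 < t → y t < 0) := by
  have e0 := hp.e0
  have e1 := hp.e1
  have cq := ho.cq
  have cy := ho.cy
  have cu := ho.cu
  have hlo' := hm.lo
  -- facts available on any interval without exit
  have key : ∀ t ∈ Icc 0 T, 0 < t → (∀ s ∈ Ico 0 t, GF e ulo (q s) (y s) (u s)) →
      GU ulo (q t) (y t) (u t) ∧ (∀ s ∈ Ioc 0 t, y s < 0) := by
    intro t ht ht0 hG
    have hGU : ∀ s ∈ Ico 0 t, GU ulo (q s) (y s) (u s) := fun s hs => (hG s hs).1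
    obtain ⟨b1, b2, b3, b4, b5, b6, hb⟩ := GU.closure ho hm ht0 hGU
    have hqt := ho.q_pos hm ht0 hGU
    have hy7 : -(7 * q t) ≤ y t := by
      refine le_of_le_on_Ico (f := fun s => -(7 * q s)) ht0 (by fun_prop) cy fun s hs => ?_
      exact hO s ⟨hs.1, hs.2.le.trans ht.2⟩ fun r hr => hG r ⟨hr.1, hr.2.trans_lt hs.2⟩
    have hbox : ∀ s ∈ Icc 0 t, Box (q s) (y s) (u s) μ := by
      intro s hs
      rcases hs.2.eq_or_lt with h | h
      · rw [h]; exact hb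
      · exact (hGU s ⟨hs.1, h⟩).box hm
    have hul : ∀ s ∈ Icc 0 t, ulo ≤ u s ∧ 0 < q s := by
      intro s hs
      rcases hs.2.eq_or_lt with h | h
      · rw [h]; exact ⟨b5, hqt⟩
      · exact ⟨(hGU s ⟨hs.1, h⟩).u0.le, (hGU s ⟨hs.1, h⟩).q0⟩
    have hneg : ∀ s ∈ Ioc 0 t, 0 < - y s := by
      refine barrier_pos' (f := fun s => - y s) (by fun_prop) (by linarith) fun s hs hpast hz => ?_
      refine ⟨_, ?_, (ho.dy s (hbox s hs)).neg⟩
      have hys : y s = 0 := by linarith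
      have hqs1 : q s ≤ q 0 := by
        have := ge_of_deriv_le (f := q) (c := 0) hs.1 cq.continuousOn fun r hr =>
          ⟨_, by have := hpast r ⟨hr.1.le, hr.2.le⟩; linarith,
            ho.dq r (hbox r ⟨hr.1.le, hr.2.le.trans hs.2⟩)⟩
        linarith
      have hqs0 : 1/40 ≤ q s := by
        rcases hs.1.eq_or_lt with h | h
        · rw [← h]; linarith
        by_contra hlt
        push Not at hlt
        have hq' : ∀ᶠ r in 𝓝[<] s, q r < 1/40 :=
          ((cq.tendsto s).eventually (gt_mem_nhds hlt)).filter_mono nhdsWithin_le_nhds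
        have : y s ≤ -(e/100 * q s) := by
          refine le_of_tendsto_of_tendsto (cy.continuousWithinAt (s := Iio s) (x := s))
            ((by fun_prop : Continuous fun r => -(e/100 * q r)).continuousWithinAt
              (s := Iio s) (x := s)) ?_
          filter_upwards [hq', Ico_mem_nhdsLT h] with r hr hr2
          rcases (hG r ⟨hr2.1, hr2.2.trans_le hs.2⟩).2 with h3 | h3
          · linarith
          · exact h3.le
        have := mul_pos (show 0 < e/100 by linarith) (hul s hs).2
        linarith
      have hr := reaction_pos e0 e1 hqs0 (by linarith) (hlo'.trans (hul s hs).1)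
      rw [FY, hys]
      have : 0 < q s * (q s * (2 - q s) - (21/10 - u s) * e) :=
        mul_pos (hul s hs).2 (by linarith)
      nlinarith
    have hy1' : ∀ s ∈ Icc 0 t, y s ≤ 0 := by
      intro s hs
      rcases hs.1.eq_or_lt with h | h
      · rw [← h]; exact hy1
      · linarith [hneg s ⟨h, hs.2⟩]
    have hqle : q t ≤ q 0 := by
      have := ge_of_deriv_le (f := q) (c := 0) ht.1 cq.continuousOn fun r hr =>
        ⟨_, hy1' r ⟨hr.1.le, hr.2.le⟩, ho.dq r (hbox r ⟨hr.1.le, hr.2.le⟩)⟩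
      linarith
    refine ⟨⟨hqt, by linarith, by linarith, by linarith [hy1' t ⟨ht.1, le_rfl⟩],
      hlo t ht hGU hy1' hb, ?_⟩, fun s hs => by linarith [hneg s hs]⟩
    exact ho.u_lt hp hm hu1 (fun s hs => ⟨hbox s ⟨hs.1.le, hs.2⟩, (hul s ⟨hs.1.le, hs.2⟩).2.le⟩) t
      ⟨ht.1, le_rfl⟩
  have hstart : GF e ulo (q 0) (y 0) (u 0) := by
    exact ⟨⟨by linarith, by linarith, by linarith, by linarith, hu0, hu1⟩, Or.inl (by linarith)⟩
  intro t ht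
  rcases first_exit ho.cont3 (isOpen_GF e ulo) (a := 0) hstart t with h | ⟨t', ht', hex, hin⟩
  · refine ⟨h, fun h0 => (key t ⟨ht.1, ht.2.le⟩ h0 fun s hs => h s ⟨hs.1, hs.2.le⟩).2 t ⟨h0, le_rfl⟩⟩
  exfalso
  have htT : t' < T := ht'.2.trans_lt ht.2
  obtain ⟨hGU, hneg⟩ := key t' ⟨ht'.1.le, htT.le⟩ ht'.1 hin
  have hGU' : ∀ s ∈ Icc 0 t', GU ulo (q s) (y s) (u s) := by
    intro s hs
    rcases hs.2.eq_or_lt with h | h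
    · rw [h]; exact hGU
    · exact (hin s ⟨hs.1, h⟩).1
  have hbox : ∀ s ∈ Icc 0 t', Box (q s) (y s) (u s) μ := fun s hs => (hGU' s hs).box hm
  have hy1' : ∀ s ∈ Icc 0 t', y s ≤ 0 := by
    intro s hs
    rcases hs.1.eq_or_lt with h | h
    · rw [← h]; exact hy1
    · exact (hneg s ⟨h, hs.2⟩).le
  have hnot : ¬ (1/40 < q t' ∨ y t' < -(e/100 * q t')) := fun h => hex ⟨hGU, h⟩
  push Not at hnot
  obtain ⟨hq2, hyσ⟩ := hnot
  have hanti : ∀ s ∈ Icc 0 t', ∀ r ∈ Icc s t', q r ≤ q s := by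
    intro s hs r hr
    have := ge_of_deriv_le (f := q) (c := 0) hr.1 cq.continuousOn fun v hv =>
        ⟨_, hy1' v ⟨hs.1.trans hv.1.le, hv.2.le.trans hr.2⟩,
          ho.dq v (hbox v ⟨hs.1.trans hv.1.le, hv.2.le.trans hr.2⟩)⟩
    linarith
  rcases hq2.eq_or_lt with hq2 | hq2
  · -- barrier `y ≤ -c (1/20 - q) q`
    have hb := barrier_pos' (f := fun s => - y s - 4/5 * e * (1/20 - q s) * q s) (a := 0) (b := t')
      (by fun_prop) (by
        have : 0 ≤ 4/5 * e * ((q 0 - 1/20) * q 0) :=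
          mul_nonneg (by linarith) (mul_nonneg (by linarith) (by linarith))
        linarith) (fun s hs hpast hz => by
          have hq40 : 1/40 ≤ q s := by rw [← hq2]; exact hanti s hs t' ⟨hs.2, le_rfl⟩
          have hqd := (ho.dq s (hbox s hs))
          refine ⟨_, ?_, ((ho.dy s (hbox s hs)).neg).sub
            (((hqd.const_sub (1/20)).const_mul (4/5*e)).mul hqd)⟩
          have hys : y s = -(4/5 * e * (1/20 - q s) * q s) := by linarith
          have hyn := hy1' s hs
          have hq20 : q s ≤ 1/20 := by
            by_contra hc
            push Not at hc
            have : 0 < 4/5 * e * ((q s - 1/20) * q s) :=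
              mul_pos (by linarith) (mul_pos (by linarith) (by linarith))
            linarith
          have hyl : -(e * q s) ≤ y s := by
            rw [hys]
            have : 0 ≤ e * q s := mul_nonneg e0.le (by linarith)
            nlinarith
          have hr : 1/30 ≤ q s * (2 - q s) - (21/10 - u s) * e := by
            have h1 : (21/10 - u s) * e ≤ 1 * (1/100000) :=
              mul_le_mul (by linarith [hm.lo, (hGU' s hs).u0]) e1 e0.le (by norm_num)
            nlinarith
          rw [FY]
          have h3 : 1/15 * q s ≤ 2 * q s * (q s * (2 - q s) - (21/10 - u s) * e) := by nlinarith
          have h4 : -(5 * (1/100000 * q s)) ≤ - (8 * (u s + μ) * y s) := by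
            have g1 := (hGU' s hs).u0
            have g2 := (hGU' s hs).u1
            have g3 := hm.g0
            have g4 := hm.g1
            have : e * q s ≤ 1/100000 * q s := by nlinarith
            nlinarith
          have h5 : |4/5 * e * (-y s) * q s + 4/5 * e * (1/20 - q s) * y s| ≤ 1/100000 * q s := by
            have : 4/5 * e * (-y s) * q s + 4/5 * e * (1/20 - q s) * y s
              = e * (y s * (4/5 * (1/20 - 2 * q s))) := by ring
            rw [this, abs_mul, abs_of_pos e0, abs_mul]
            have h6 : |y s| ≤ q s := by rw [abs_le]; constructor <;> nlinarith
            have h7 : |4/5 * (1/20 - 2 * q s)| ≤ 1 := by rw [abs_le]; constructor <;> linarith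
            have h8 : |y s| * |4/5 * (1/20 - 2 * q s)| ≤ q s * 1 :=
              mul_le_mul h6 h7 (abs_nonneg _) (by linarith)
            calc e * (|y s| * |4/5 * (1/20 - 2 * q s)|) ≤ 1/100000 * (q s * 1) :=
                  mul_le_mul e1 h8 (by positivity) (by norm_num)
              _ = _ := by ring
          have := (abs_le.1 h5).2
          linarith)
    have := hb t' ⟨ht'.1, le_rfl⟩
    rw [hq2] at this hyσ
    linarith
  · have hyeq : y t' = -(e/100 * q t') :=
      le_antisymm (hV t' ⟨ht'.1.le, htT.le⟩ hGU' hq2) hyσ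
    have hmax : IsLocalMax (fun s => y s + e/100 * q s) t' := by
      have ev1 : ∀ᶠ s in 𝓝 t', GU ulo (q s) (y s) (u s) ∧ q s < 1/40 := by
        refine (ho.cont3.tendsto t').eventually (p := fun x => GU ulo x.1 x.2.1 x.2.2 ∧ x.1 < 1/40) ?_
        exact ((continuous_GU_isOpen ulo).inter (isOpen_lt continuous_fst continuous_const)).mem_nhds
          ⟨hGU, hq2⟩
      obtain ⟨d, hd0, hd1⟩ := Metric.eventually_nhds_iff.1 ev1
      have : ∀ᶠ s in 𝓝 t', s < T ∧ 0 < s ∧ dist s t' < d :=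
        (gt_mem_nhds htT).and ((lt_mem_nhds ht'.1).and (Metric.ball_mem_nhds t' hd0))
      filter_upwards [this] with s hs
      have hval : y t' + e/100 * q t' = 0 := by linarith
      rw [hval]
      have h2 := hV s ⟨hs.2.1.le, hs.1.le⟩ (fun r hr => by
        rcases le_or_gt r t' with h | h
        · exact hGU' r ⟨hr.1, h⟩
        · refine (hd1 ?_).1
          have := hs.2.2
          rw [Real.dist_eq, abs_lt] at this ⊢
          constructor <;> linarith [hr.2]) (hd1 hs.2.2).2
      linarith
    exact ho.no_touch hp hm ht'.1 hGU' hq2 hyeq hmax fun s hs h1 => by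
      rcases (hin s ⟨hs.1, hs.2⟩).2 with h | h <;> linarith

end fall

section land
variable {e η ζ μ ulo : ℝ} {q y u : ℝ → ℝ}

lemma Orb.q_anti (ho : Orb e η ζ μ q y u) (hm : MU ulo μ) {a b : ℝ} (hab : a ≤ b)
    (h : ∀ s ∈ Icc a b, GU ulo (q s) (y s) (u s) ∧ y s ≤ 0) : q b ≤ q a := by
  have := ge_of_deriv_le (f := q) (c := 0) hab ho.cq.continuousOn fun s hs =>
    ⟨_, (h s ⟨hs.1.le, hs.2.le⟩).2, ho.dq s ((h s ⟨hs.1.le, hs.2.le⟩).1.box hm)⟩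
  linarith

lemma Orb.dw (ho : Orb e η ζ μ q y u) {t : ℝ} (hb : Box (q t) (y t) (u t) μ) (hq : 0 < q t) :
    HasDerivAt (fun s => y s / q s) (-(y t / q t)^2 + 8 * (u t + μ) * (y t / q t)
      + 2 * ((21/10 - u t) * e) - 2 * q t * (2 - q t)) t := by
  refine ((ho.dy t hb).div (ho.dq t hb) hq.ne').congr_deriv ?_
  rw [FY]
  field_simp
  ring

lemma Orb.dW (ho : Orb e η ζ μ q y u) {t : ℝ} (hb : Box (q t) (y t) (u t) μ) (hq : 0 < q t) :
    HasDerivAt (fun s => -(y s / q s)) ((-(y t / q t))^2 + 8 * (u t + μ) * (-(y t / q t))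
      + 2 * q t * (2 - q t) - 2 * ((21/10 - u t) * e)) t := by
  refine (ho.dw hb hq).neg.congr_deriv ?_
  ring

/-- Time needed to cross the middle region downwards. -/
lemma Orb.fall_time (ho : Orb e η ζ μ q y u) (hp : Par e η ζ) (hm : MU ulo μ) {T : ℝ} (hT : 0 ≤ T)
    (h : ∀ s ∈ Icc 0 T, GU ulo (q s) (y s) (u s) ∧ y s ≤ 0 ∧ 1/40 ≤ q s ∧
      q s ≤ 2 - 2*e) : T ≤ 26/e := by
  have e0 := hp.e0
  have e1 := hp.e1
  have cq := ho.cq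
  have cy := ho.cy
  have h1 := le_of_deriv_ge (f := fun s => -y s - 5 * q s) (c := e) hT (by fun_prop) fun s hs => by
    obtain ⟨hU, hy, hq0, hq1⟩ := h s ⟨hs.1.le, hs.2.le⟩
    refine ⟨_, ?_, (ho.dy s (hU.box hm)).neg.sub ((ho.dq s (hU.box hm)).const_mul 5)⟩
    rw [FY]
    have hr := reaction_pos e0 e1 hq0 hq1 (hm.lo.trans hU.u0.le)
    have hF : e/2 ≤ q s * (q s * (2 - q s) - (21/10 - u s) * e) := by
      rcases le_total 1 (q s) with hc | hc
      · nlinarith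
      · have h2 : (21/10 - u s) * e ≤ 1 * (1/100000) :=
          mul_le_mul (by linarith [hm.lo, hU.u0]) e1 e0.le (by norm_num)
        nlinarith
    have : 8 * (u s + μ) * y s + 5 * y s ≤ 0 := by
      have := hU.u0
      have := hm.g0
      nlinarith
    linarith
  have h2 := h 0 ⟨le_rfl, hT⟩
  have h3 := h T ⟨hT, le_rfl⟩
  rw [le_div_iff₀ e0]
  linarith [h2.2.1, h3.1.y0]

/-- If the drift is not too negative, the orbit falls through. -/
lemma Orb.forced_O (ho : Orb e η ζ μ q y u) (hp : Par e η ζ) (hm : MU ulo μ) {T κ g : ℝ}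
    (hT : 200/e^2 ≤ T) (hκ0 : 1/20 ≤ κ) (hκ1 : κ ≤ q 0) (hκg : 4/100 ≤ κ + g) (hκ4 : 0 ≤ 4 - 3*κ - g)
    (h0 : q 0 ≤ 2 - 2*e)
    (h : ∀ s ∈ Icc 0 T, GU ulo (q s) (y s) (u s) ∧ y s ≤ 0 ∧ -(7 * q s) ≤ y s ∧
      g ≤ 8 * (u s + μ)) : False := by
  have e0 := hp.e0
  have e1 := hp.e1
  have cq := ho.cq
  have cy := ho.cy
  have hT0 : 0 < T := lt_of_lt_of_le (by positivity) hT
  have hκg2 : 2/1000 ≤ κ * (κ + g) := by nlinarith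
  have bar : ∀ s ∈ Ioc 0 T, 0 < - y s + q s * (q s - κ) := by
    refine barrier_pos' (by fun_prop) ?_ fun s hs _ hz => ?_
    · have := (h 0 ⟨le_rfl, hT0.le⟩)
      nlinarith [this.2.1, this.1.q0]
    · obtain ⟨hU, hy, hy7, hg⟩ := h s hs
      have dq := ho.dq s (hU.box hm)
      refine ⟨_, ?_, (ho.dy s (hU.box hm)).neg.add (dq.mul (dq.sub_const κ))⟩
      have hq := hU.q0
      have hyq : y s = q s * (q s - κ) := by linarith
      have hqκ : q s ≤ κ := by
        by_contra hc
        push Not at hc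
        have := mul_pos hq (sub_pos.2 hc)
        linarith
      have h2 : (21/10 - u s) * e ≤ 1 * (1/100000) :=
          mul_le_mul (by linarith [hm.lo, hU.u0]) e1 e0.le (by norm_num)
      have h3 : g * (κ - q s) ≤ 8 * (u s + μ) * (κ - q s) :=
        mul_le_mul_of_nonneg_right hg (by linarith)
      have h4 : 0 ≤ q s * (4 - 3 * κ - g) := mul_nonneg hq.le hκ4
      have h5 : 0 < 8 * (u s + μ) * (κ - q s) + κ^2 + q s * (4 - 3*κ) - 2 * ((21/10 - u s) * e) := by
        nlinarith
      have h6 : -FY e (q s) (y s) (u s) μ + (y s * (q s - κ) + q s * y s) =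
        q s * (8 * (u s + μ) * (κ - q s) + κ^2 + q s * (4 - 3*κ) - 2 * ((21/10 - u s) * e)) := by
        rw [FY, hyq]; ring
      rw [h6]
      exact mul_pos hq h5
  have hTe : 26/e + 1 + 20001 ≤ T := by
    refine le_trans ?_ hT
    rw [div_add' _ _ _ e0.ne', div_add' _ _ _ e0.ne', div_le_div_iff₀ e0 (by positivity)]
    nlinarith
  set t1 := 26/e + 1 with ht1
  have ht10 : 0 < t1 := by positivity
  have hq40 : q t1 < 1/40 := by
    by_contra hc
    push Not at hc
    have := ho.fall_time hp hm ht10.le fun s hs => by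
      have hsT : s ≤ T := hs.2.trans (by linarith)
      obtain ⟨a1, a2, a3, a4⟩ := h s ⟨hs.1, hsT⟩
      refine ⟨a1, a2, ?_, ?_⟩
      · have := ho.q_anti hm hs.2 fun r hr =>
          ⟨(h r ⟨hs.1.trans hr.1, by linarith [hr.2]⟩).1, (h r ⟨hs.1.trans hr.1, by linarith [hr.2]⟩).2.1⟩
        linarith
      · have := ho.q_anti hm hs.1 fun r hr =>
          ⟨(h r ⟨hr.1, by linarith [hr.2]⟩).1, (h r ⟨hr.1, by linarith [hr.2]⟩).2.1⟩
        linarith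
    linarith
  have hfin := le_of_deriv_ge (f := fun s => -(y s / q s)) (c := 35/100000) (a := t1) (b := T)
    (by linarith) (by
      refine ContinuousOn.neg (cy.continuousOn.div cq.continuousOn fun s hs => ?_)
      exact (h s ⟨by linarith [hs.1], hs.2⟩).1.q0.ne') fun s hs => by
    have hsI : s ∈ Ioc 0 T := ⟨by linarith [hs.1], hs.2.le⟩
    obtain ⟨hU, hy, hy7, hg⟩ := h s ⟨hsI.1.le, hsI.2⟩
    refine ⟨_, ?_, ho.dW (hU.box hm) hU.q0⟩
    have hq := hU.q0
    have hqs : q s < 1/40 := by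
      have := ho.q_anti hm hs.1.le fun r hr =>
          ⟨(h r ⟨by linarith [hr.1], hr.2.trans hsI.2⟩).1, (h r ⟨by linarith [hr.1], hr.2.trans hsI.2⟩).2.1⟩
      linarith
    have hW : κ - q s < -(y s / q s) := by
      rw [← neg_div, lt_div_iff₀ hq]
      linarith [bar s hsI]
    have h2 : (21/10 - u s) * e ≤ 1 * (1/100000) :=
      mul_le_mul (by linarith [hm.lo, hU.u0]) e1 e0.le (by norm_num)
    generalize -(y s / q s) = W at *
    have hW0 : 1/40 < W := by linarith
    have h3 : g * W ≤ 8 * (u s + μ) * W := mul_le_mul_of_nonneg_right hg (by linarith)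
    have h4 : (κ - q s) * (κ + g - q s) ≤ W * (W + g) :=
      mul_le_mul (by linarith) (by linarith) (by linarith) (by linarith)
    have h5 : 1/40 * (15/1000) ≤ (κ - q s) * (κ + g - q s) :=
      mul_le_mul (by linarith) (by linarith) (by norm_num) (by linarith)
    nlinarith
  have hW1 : 0 ≤ -(y t1 / q t1) := by
    have := h t1 ⟨ht10.le, by linarith⟩
    rw [← neg_div]
    exact div_nonneg (by linarith [this.2.1]) this.1.q0.le
  have hWT : -(y T / q T) ≤ 7 := by
    have := h T ⟨hT0.le, le_rfl⟩
    rw [← neg_div, div_le_iff₀ this.1.q0]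
    linarith [this.2.2.1]
  nlinarith

/-- Exponential decay of `q` on the landing manifold. -/
lemma Orb.q_decay (ho : Orb e η ζ μ q y u) (hm : MU ulo μ) {a b c : ℝ} (hab : a ≤ b)
    (h : ∀ s ∈ Icc a b, GU ulo (q s) (y s) (u s) ∧ y s ≤ -(c * q s)) :
    q b ≤ q a * Real.exp (-c * (b - a)) :=
  le_exp_of_deriv_le hab ho.cq.continuousOn fun s hs =>
    ⟨_, by linarith [(h s ⟨hs.1.le, hs.2.le⟩).2], ho.dq s ((h s ⟨hs.1.le, hs.2.le⟩).1.box hm)⟩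

/-- If the drift is very negative, the orbit turns back. -/
lemma Orb.forced_V (ho : Orb e η ζ μ q y u) (hp : Par e η ζ) (hm : MU ulo μ) {T : ℝ}
    (hT : 200/e^2 ≤ T) (hq0 : 1/20 ≤ q 0) (h0 : q 0 ≤ 2 - 2*e) (hw : 0 ≤ y 0 + q 0 * (21/10 - q 0))
    (h : ∀ s ∈ Icc 0 T, GU ulo (q s) (y s) (u s) ∧ y s ≤ 0 ∧ -(7 * q s) ≤ y s ∧
      8 * (u s + μ) ≤ -(215/100) ∧ (q s < 1/40 → y s ≤ -(e/100 * q s))) : False := by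
  have e0 := hp.e0
  have e1 := hp.e1
  have cq := ho.cq
  have cy := ho.cy
  have hT0 : 0 < T := lt_of_lt_of_le (by positivity) hT
  have bar : ∀ s ∈ Ioc 0 T, 0 < y s + q s * (21/10 - q s) := by
    refine barrier_pos' (by fun_prop) hw fun s hs _ hz => ?_
    obtain ⟨hU, hy, hy7, hg, -⟩ := h s hs
    have dq := ho.dq s (hU.box hm)
    refine ⟨_, ?_, (ho.dy s (hU.box hm)).add (dq.mul (dq.const_sub (21/10)))⟩
    have hq := hU.q0
    have hyq : y s = - (q s * (21/10 - q s)) := by linarith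
    have h2 : 0 ≤ (21/10 - u s) * e := mul_nonneg (by linarith [hU.u1]) e0.le
    have h3 : 8 * (u s + μ) * (21/10 - q s) ≤ -(215/100) * (21/10 - q s) :=
      mul_le_mul_of_nonneg_right hg (by linarith [hU.q1])
    have h6 : FY e (q s) (y s) (u s) μ + (y s * (21/10 - q s) + q s * -y s) =
      -(q s * (8 * (u s + μ) * (21/10 - q s) + (21/10)^2 + q s * (4 - 63/10) -
        2 * ((21/10 - u s) * e))) := by
      rw [FY, hyq]; ring
    rw [h6, neg_pos]
    exact mul_neg_of_pos_of_neg hq (by nlinarith)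
  have hTe : 26/e + 1 + 125/e^2 + 22/e ≤ T := by
    refine le_trans ?_ hT
    rw [show 26/e + 1 + 125/e^2 + 22/e = (26 * e + e^2 + 125 + 22*e)/e^2 by field_simp]
    gcongr
    nlinarith
  set t1 := 26/e + 1 with ht1
  set t2 := t1 + 125/e^2 with ht2
  have ht10 : 0 < t1 := by positivity
  have ht12 : t1 ≤ t2 := by have : 0 < 125/e^2 := by positivity
                            linarith
  have ht2T : 22/e ≤ T - t2 := by linarith
  have ht2T' : t2 < T := by have : 0 < 22/e := by positivity
                            linarith
  have anti : ∀ a b : ℝ, 0 ≤ a → a ≤ b → b ≤ T → q b ≤ q a := fun a b ha hab hb =>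
    ho.q_anti hm hab fun r hr =>
          ⟨(h r ⟨by linarith [hr.1], hr.2.trans hb⟩).1, (h r ⟨by linarith [hr.1], hr.2.trans hb⟩).2.1⟩
  have hq40 : q t1 < 1/40 := by
    by_contra hc
    push Not at hc
    have := ho.fall_time hp hm ht10.le fun s hs => by
      have hsT : s ≤ T := hs.2.trans (by linarith)
      obtain ⟨a1, a2, a3, -⟩ := h s ⟨hs.1, hsT⟩
      exact ⟨a1, a2, hc.trans (anti _ _ hs.1 hs.2 (by linarith)),
        (anti _ _ le_rfl hs.1 hsT).trans h0⟩
    linarith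
  have hland : ∀ s ∈ Icc t1 T, y s ≤ -(e/100 * q s) := fun s hs =>
    (h s ⟨by linarith [hs.1], hs.2⟩).2.2.2.2 ((anti t1 s ht10.le hs.1 hs.2).trans_lt hq40)
  have hq2 : q t2 ≤ 2/100 * e := by
    have hd := ho.q_decay hm (c := e/100) ht12 fun s hs =>
      ⟨(h s ⟨by linarith [hs.1], by linarith [hs.2]⟩).1, hland s ⟨hs.1, by linarith [hs.2]⟩⟩
    have he : Real.exp (-(e/100) * (t2 - t1)) ≤ 80/100 * e := by
      have h1 : -(e/100) * (t2 - t1) = -(125/100/e) := by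
        rw [ht2]; field_simp; ring
      rw [h1, Real.exp_neg, inv_le_comm₀ (Real.exp_pos _) (by positivity)]
      have := Real.add_one_le_exp (125/100/e)
      have h3 : (80/100 * e)⁻¹ = 125/100/e := by field_simp; norm_num
      rw [h3]; linarith
    have : q t1 * Real.exp (-(e/100) * (t2 - t1)) ≤ 1/40 * (80/100 * e) :=
      mul_le_mul hq40.le he (Real.exp_pos _).le (by norm_num)
    linarith
  have hfin := ge_of_deriv_le (f := fun s => -(y s / q s)) (c := -(1/10*e)) (a := t2) (b := T)
    ht2T'.le (by
      refine ContinuousOn.neg (cy.continuousOn.div cq.continuousOn fun s hs => ?_)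
      exact (h s ⟨by linarith [hs.1], hs.2⟩).1.q0.ne') fun s hs => by
    have hsI : s ∈ Ioc 0 T := ⟨by linarith [hs.1], hs.2.le⟩
    obtain ⟨hU, hy, hy7, hg, -⟩ := h s ⟨hsI.1.le, hsI.2⟩
    refine ⟨_, ?_, ho.dW (hU.box hm) hU.q0⟩
    have hq := hU.q0
    have hqs : q s ≤ 2/100 * e := (anti t2 s (by linarith) hs.1.le hsI.2).trans hq2
    have hW : -(y s / q s) < 21/10 - q s := by
      rw [← neg_div, div_lt_iff₀ hq]
      linarith [bar s hsI]
    have hW0 : 0 ≤ -(y s / q s) := by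
      rw [← neg_div]
      exact div_nonneg (by linarith) hq.le
    have h2 : 95/1000 * e ≤ (21/10 - u s) * e :=
      mul_le_mul_of_nonneg_right (by linarith [hU.u1]) e0.le
    generalize -(y s / q s) = W at *
    have h3 : 8 * (u s + μ) * W ≤ -(215/100) * W := mul_le_mul_of_nonneg_right hg hW0
    have h4 : W^2 ≤ 21/10 * W := by nlinarith
    nlinarith
  have hW1 : -(y t2 / q t2) ≤ 21/10 := by
    have h3 := bar t2 ⟨by linarith, ht2T'.le⟩
    have h4 := (h t2 ⟨by linarith, ht2T'.le⟩).1.q0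
    rw [← neg_div, div_le_iff₀ h4]
    nlinarith
  have hWT : 0 ≤ -(y T / q T) := by
    have := h T ⟨hT0.le, le_rfl⟩
    rw [← neg_div]
    exact div_nonneg (by linarith [this.2.1]) this.1.q0.le
  have : 22 ≤ (T - t2) * e := by rwa [div_le_iff₀ e0] at ht2T
  nlinarith

/-- Landing orbits converge to the laminar state. -/
lemma Orb.landing (ho : Orb e η ζ μ q y u) (hp : Par e η ζ) (hm : MU ulo μ) {t1 : ℝ}
    (h : ∀ s, t1 ≤ s → GU ulo (q s) (y s) (u s) ∧ y s ≤ -(e/100 * q s)) :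
    Tendsto q atTop (𝓝 0) ∧ Tendsto y atTop (𝓝 0) ∧ Tendsto u atTop (𝓝 2) := by
  have e0 := hp.e0
  have e1 := hp.e1
  have η0 := hp.h0
  have cq := ho.cq
  have cu := ho.cu
  have hexp : ∀ c : ℝ, 0 < c → ∀ C : ℝ, Tendsto (fun t => C * Real.exp (-c * (t - t1))) atTop (𝓝 0) := by
    intro c hc C
    have h1 : Tendsto (fun t => c * (t - t1)) atTop atTop :=
      (tendsto_id.atTop_add tendsto_const_nhds (C := -t1)).const_mul_atTop hc
    have h2 := (Real.tendsto_exp_neg_atTop_nhds_zero.comp h1).const_mul C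
    simpa [Function.comp_def] using h2
  have hq : Tendsto q atTop (𝓝 0) := by
    refine tendsto_of_tendsto_of_tendsto_of_le_of_le' tendsto_const_nhds
      (hexp (e/100) (by positivity) (q t1)) ?_ ?_
    · filter_upwards [eventually_ge_atTop t1] with s hs using (h s hs).1.q0.le
    · filter_upwards [eventually_ge_atTop t1] with s hs
      exact ho.q_decay hm hs fun r hr => h r hr.1
  have hy : Tendsto y atTop (𝓝 0) := by
    have h8 : Tendsto (fun s => 8 * q s) atTop (𝓝 0) := by simpa using hq.const_mul 8
    have h8' : Tendsto (fun s => -(8 * q s)) atTop (𝓝 0) := by simpa using h8.neg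
    refine tendsto_of_tendsto_of_tendsto_of_le_of_le' h8' h8 ?_ ?_
    · filter_upwards [eventually_ge_atTop t1] with s hs using (h s hs).1.y0.le
    · filter_upwards [eventually_ge_atTop t1] with s hs using (h s hs).1.y1.le
  refine ⟨hq, hy, ?_⟩
  set M := 20000 * η / e with hM
  have hM0 : 0 < M := by positivity
  have hz := hp.z
  set lam := min (2 * η / (ζ + 6/10)) (e/200) with hlam
  have hlam0 : 0 < lam := lt_min (by positivity) (by positivity)
  have hv : Tendsto (fun t => (2 - u t)^2) atTop (𝓝 0) := by
    refine tendsto_of_tendsto_of_tendsto_of_le_of_le' tendsto_const_nhds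
      (hexp lam hlam0 ((2 - u t1)^2 + M * q t1)) (Eventually.of_forall fun s => sq_nonneg _) ?_
    filter_upwards [eventually_ge_atTop t1] with s hs
    have := le_exp_of_deriv_le (f := fun t => (2 - u t)^2 + M * q t) (c := -lam) hs (by fun_prop)
      fun r hr => by
        obtain ⟨hU, hyr⟩ := h r hr.1.le
        refine ⟨_, ?_, (((ho.du r (hU.box hm)).const_sub 2).pow 2).add
          ((ho.dq r (hU.box hm)).const_mul M)⟩
        have hd0 : 4/100 ≤ u r + μ + ζ := by linarith [hU.u0, hm.g0]
        have hd1 : u r + μ + ζ ≤ ζ + 6/10 := by linarith [hU.u1, hm.g1]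
        have hdp : 0 < u r + μ + ζ := by linarith
        have hq := hU.q0
        have g1 : lam * (2 - u r)^2 ≤ 2 * η / (u r + μ + ζ) * (2 - u r)^2 := by
          apply mul_le_mul_of_nonneg_right _ (sq_nonneg _)
          refine (min_le_left _ _).trans ?_
          gcongr
        have g2 : lam * (M * q r) ≤ e/200 * (M * q r) :=
          mul_le_mul_of_nonneg_right (min_le_right _ _) (by positivity)
        have g3 : M * y r ≤ -(e/100 * (M * q r)) := by nlinarith
        have g4 : η / (u r + μ + ζ) * (4 * q r * ((2 - u r) * (u r - 1))) ≤ e/200 * (M * q r) := by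
          have h1 : e/200 * (M * q r) = η * (100 * q r) := by rw [hM]; field_simp; ring
          rw [h1, div_mul_eq_mul_div, div_le_iff₀ hdp]
          have h2 : (2 - u r) * (u r - 1) ≤ 1 := by nlinarith
          have h3 : 4 * q r * ((2 - u r) * (u r - 1)) ≤ 4 * q r * 1 :=
            mul_le_mul_of_nonneg_left h2 (by linarith)
          have h4 : 4 * q r * 1 ≤ 100 * q r * (u r + μ + ζ) := by nlinarith
          calc η * (4 * q r * ((2 - u r) * (u r - 1))) ≤ η * (100 * q r * (u r + μ + ζ)) :=
              mul_le_mul_of_nonneg_left (h3.trans h4) η0.le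
            _ = _ := by ring
        have hFU : ((2:ℕ):ℝ) * (2 - u r)^(2-1) * (-FU η ζ (q r) (u r) μ) =
          -(2 * η / (u r + μ + ζ) * (2 - u r)^2)
            + η / (u r + μ + ζ) * (4 * q r * ((2 - u r) * (u r - 1))) := by
          rw [FU]; push_cast; simp only [pow_one]; field_simp; ring
        rw [hFU]
        linarith
    have h3 : 0 ≤ M * q s := mul_nonneg hM0.le (h s hs).1.q0.le
    linarith
  have h3 : Tendsto (fun t => |2 - u t|) atTop (𝓝 0) := by
    have := (Real.continuous_sqrt.tendsto 0).comp hv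
    simpa [Function.comp_def, Real.sqrt_sq_eq_abs] using this
  have h4 := (tendsto_zero_iff_abs_tendsto_zero (fun t => 2 - u t)).2 h3
  simpa using h4.const_sub 2

end land

/-- The set of points reaching `V` while staying in `U`. -/
def Reach (φ : ℝ → St → St) (U V : Set St) : Set St :=
  {x | ∃ t, 0 ≤ t ∧ φ t x ∈ V ∧ ∀ s ∈ Icc 0 t, φ s x ∈ U}

/-- Tube lemma along an orbit segment. -/
lemma eventually_forall_Icc {φ : ℝ → St → St} (hφ : Continuous fun p : ℝ × St => φ p.1 p.2)
    {U : Set St} (hU : IsOpen U) {x : St} {a b : ℝ} (h : ∀ s ∈ Icc a b, φ s x ∈ U) :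
    ∀ᶠ z in 𝓝 x, ∀ s ∈ Icc a b, φ s z ∈ U := by
  have := (isCompact_Icc (a := a) (b := b)).eventually_forall_of_forall_eventually
    (P := fun z s => φ s z ∈ U) (x₀ := x) fun s hs => by
      have h1 : Continuous fun z : St × ℝ => φ z.2 z.1 := hφ.comp continuous_swap
      exact h1.continuousAt.eventually (hU.mem_nhds (h s hs))
  exact this

lemma isOpen_Reach {φ : ℝ → St → St} (hφ : Continuous fun p : ℝ × St => φ p.1 p.2)
    {U V : Set St} (hU : IsOpen U) (hV : IsOpen V) : IsOpen (Reach φ U V) := by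
  rw [isOpen_iff_mem_nhds]
  rintro x ⟨t, ht, hxV, hxU⟩
  have h1 : Continuous fun z : St => φ t z := hφ.comp (continuous_const.prodMk continuous_id)
  filter_upwards [h1.continuousAt.eventually (hV.mem_nhds hxV), eventually_forall_Icc hφ hU hxU]
    with z hz1 hz2 using ⟨t, ht, hz1, hz2⟩

/-- Connectedness: two disjoint open alternatives cannot cover an interval. -/
lemma exists_neither {A B : Set St} (hA : IsOpen A) (hB : IsOpen B) {c : ℝ → St} {a b : ℝ}
    (hab : a ≤ b) (hc : ContinuousOn c (Icc a b))
    (hdis : ∀ m ∈ Icc a b, ¬ (c m ∈ A ∧ c m ∈ B)) (ha : c a ∈ A) (hb : c b ∈ B) :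
    ∃ m ∈ Icc a b, c m ∉ A ∧ c m ∉ B := by
  by_contra hcon
  push Not at hcon
  have hpre : IsPreconnected (c '' Icc a b) := isPreconnected_Icc.image c hc
  obtain ⟨z, ⟨m, hm, rfl⟩, hz⟩ := hpre A B hA hB (by
    rintro _ ⟨m, hm, rfl⟩
    by_cases h : c m ∈ A
    · exact Or.inl h
    · exact Or.inr (hcon m hm h)) ⟨c a, ⟨a, ⟨le_rfl, hab⟩, rfl⟩, ha⟩ ⟨c b, ⟨b, ⟨hab, le_rfl⟩, rfl⟩, hb⟩
  exact hdis m hm hz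

/-- The working window as a subset of phase space. -/
def SU (ulo : ℝ) : Set St := {x | GU ulo x.1 x.2.1 x.2.2.1}
def SF (e ulo : ℝ) : Set St := {x | GF e ulo x.1 x.2.1 x.2.2.1}
/-- Points that have turned back above the landing manifold. -/
def SV (e : ℝ) : Set St := {x | x.1 < 1/40 ∧ -(e/100 * x.1) < x.2.1}
/-- Points that fall through below the landing manifold. -/
def SO : Set St := {x | x.2.1 < -(7 * x.1)}

lemma continuous_drop : Continuous fun x : St => ((x.1, x.2.1, x.2.2.1) : ℝ × ℝ × ℝ) := by fun_prop

lemma isOpen_SU (ulo : ℝ) : IsOpen (SU ulo) := (continuous_GU_isOpen ulo).preimage continuous_drop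
lemma isOpen_SF (e ulo : ℝ) : IsOpen (SF e ulo) := (isOpen_GF e ulo).preimage continuous_drop
lemma isOpen_SV (e : ℝ) : IsOpen (SV e) := by
  have h1 : IsOpen {x : St | x.1 < 1/40} := isOpen_lt (by fun_prop) (by fun_prop)
  have h2 : IsOpen {x : St | -(e/100 * x.1) < x.2.1} := isOpen_lt (by fun_prop) (by fun_prop)
  exact h1.inter h2
lemma isOpen_SO : IsOpen SO := isOpen_lt (by fun_prop) (by fun_prop)

/-- Initial points that turn back. -/
def VC (φ : ℝ → St → St) (e ulo : ℝ) : Set St := Reach φ (SU ulo) (SV e)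
/-- Initial points that fall through. -/
def OC (φ : ℝ → St → St) (e ulo : ℝ) : Set St := Reach φ (SF e ulo) SO

section land
variable {e η ζ μ ulo : ℝ} {q y u : ℝ → ℝ} {φ : ℝ → St → St}

lemma isOpen_VC (hφ : PFlow e η ζ φ) : IsOpen (VC φ e ulo) :=
  isOpen_Reach hφ.cont (isOpen_SU _) (isOpen_SV _)
lemma isOpen_OC (hφ : PFlow e η ζ φ) : IsOpen (OC φ e ulo) :=
  isOpen_Reach hφ.cont (isOpen_SF _ _) isOpen_SO

lemma not_VC_OC (hφ : PFlow e η ζ φ) (hp : Par e η ζ) {x : St} (hm : MU ulo x.2.2.2) :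
    ¬ (x ∈ VC φ e ulo ∧ x ∈ OC φ e ulo) := by
  rintro ⟨⟨t, ht, hV, hU⟩, ⟨t', ht', hO, hF⟩⟩
  rcases le_or_gt t t' with h | h
  · rcases (hF t ⟨ht, h⟩).2 with h1 | h1
    · exact absurd hV.1 (not_lt.2 h1.le)
    · exact absurd hV.2 (not_lt.2 h1.le)
  · have := (hφ.orb x).absorb_O hp hm hO (fun s hs => hU s ⟨ht'.trans hs.1, hs.2⟩) t ⟨h.le, le_rfl⟩
    have h2 := hV.2
    have h3 := (hU t ⟨ht, le_rfl⟩).q0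
    have e0 := hp.e0
    have e1 := hp.e1
    have h4 : -(7 * (φ t x).1) > (φ t x).2.1 := this
    have h5 : 0 < (φ t x).1 := h3
    nlinarith

/-- The lower bound on `u` during a downward jump. -/
lemma Orb.fall_lo (ho : Orb e η ζ μ q y u) (hp : Par e η ζ) (hm : MU ulo μ)
    (hq1 : q 0 ≤ 2 - 2*e) (hu0 : ulo < u 0)
    (hℓ : ulo = 119/100 ∨ (ulo = 143/100 ∧ 145/100 ≤ u 0)) {t : ℝ} (ht : 0 ≤ t)
    (hU : ∀ s ∈ Ico 0 t, GU ulo (q s) (y s) (u s)) (hy : ∀ s ∈ Icc 0 t, y s ≤ 0)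
    (hb : Box (q t) (y t) (u t) μ) : ulo < u t := by
  have e0 := hp.e0
  have cq := ho.cq
  rcases ht.eq_or_lt with rfl | ht0
  · exact hu0
  have hbox : ∀ s ∈ Ioc 0 t, Box (q s) (y s) (u s) μ := by
      intro s hs
      rcases hs.2.eq_or_lt with h | h
      · rw [h]; exact hb
      · exact (hU s ⟨hs.1.le, h⟩).box hm
  have anti : ∀ a b : ℝ, 0 ≤ a → a ≤ b → b ≤ t → q b ≤ q a := fun a b ha hab hbt => by
    have := ge_of_deriv_le (f := q) (c := 0) hab cq.continuousOn fun r hr =>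
      ⟨_, hy r ⟨by linarith [hr.1], by linarith [hr.2]⟩,
        ho.dq r (hbox r ⟨by linarith [hr.1], by linarith [hr.2]⟩)⟩
    linarith
  rcases hℓ with rfl | ⟨rfl, hu⟩
  · refine ho.lt_u hp (qm := 21/10) hu0 (by norm_num) (by norm_num) (fun s hs => ⟨hbox s hs, ?_⟩) t
      ⟨ht, le_rfl⟩
    linarith [anti 0 s le_rfl hs.1.le hs.2]
  · have main : ∀ s ∈ Icc 0 t, (∀ r ∈ Ico 0 s, 1/40 ≤ q r) → 144/100 ≤ u s := by
      intro s hs hqs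
      have h1 : s ≤ 27/e := by
        by_contra hc
        push Not at hc
        have h27 : 26/e < 27/e := by gcongr; norm_num
        have := ho.fall_time hp hm (T := 27/e) (by positivity) fun r hr =>
          ⟨hU r ⟨hr.1, by linarith [hr.2, hs.2]⟩, hy r ⟨hr.1, by linarith [hr.2, hs.2]⟩,
            hqs r ⟨hr.1, by linarith [hr.2]⟩,
            (anti 0 r le_rfl hr.1 (by linarith [hr.2, hs.2])).trans hq1⟩
        linarith
      have h2 := (abs_le.1 (ho.u_drift hp hm hs.1 fun r hr => hU r ⟨hr.1.le, hr.2.trans_le hs.2⟩)).1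
      have h3 : 200 * η * (s - 0) ≤ 200 * (e/10^35) * (27/e) := by
        have := hp.h0
        have := hp.hsmall.1
        apply mul_le_mul (by linarith) (by linarith) (by linarith [hs.1]) (by positivity)
      have h4 : 200 * (e/10^35) * (27/e) ≤ 1/100 := by
        rw [show 200 * (e/10^35) * (27/e) = 5400/10^35 by field_simp; norm_num]
        norm_num
      linarith
    by_cases hqt : 1/40 ≤ q t
    · have := main t ⟨ht, le_rfl⟩ fun r hr => hqt.trans (anti r t hr.1 hr.2.le le_rfl)
      linarith
    push Not at hqt
    by_cases hq0 : q 0 ≤ 1/40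
    · refine ho.lt_u hp (qm := 1/40) hu0 (by norm_num) (by norm_num) (fun s hs => ⟨hbox s hs, ?_⟩) t
        ⟨ht, le_rfl⟩
      linarith [anti 0 s le_rfl hs.1.le hs.2]
    push Not at hq0
    obtain ⟨τ, hτ, hτq⟩ := intermediate_value_Icc' ht cq.continuousOn ⟨hqt.le, hq0.le⟩
    have h1 := main τ hτ fun r hr => by
      rw [← hτq]; exact anti r τ hr.1 hr.2.le hτ.2
    refine ho.lt_u hp (qm := 1/40) (a := τ) (b := t) (by linarith) (by norm_num) (by norm_num)
      (fun s hs => ⟨hbox s ⟨hτ.1.trans_lt hs.1, hs.2⟩, ?_⟩) t ⟨hτ.2, le_rfl⟩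
    rw [← hτq]
    exact anti τ s hτ.1 hs.1.le hs.2

/-- What is known on a downward jump that neither turns back nor falls through up to time `T`. -/
structure Desc (e ulo μ : ℝ) (q y u : ℝ → ℝ) (T : ℝ) : Prop where
  gf : ∀ s ∈ Ico 0 T, GF e ulo (q s) (y s) (u s)
  y0 : ∀ s ∈ Ico 0 T, y s ≤ 0
  y7 : ∀ s ∈ Ico 0 T, -(7 * q s) ≤ y s

lemma Orb.desc (ho : Orb e η ζ μ q y u) (hp : Par e η ζ) (hm : MU ulo μ) {T : ℝ}
    (hq0 : 1/20 ≤ q 0) (hq1 : q 0 ≤ 2 - 2*e) (hU0 : GU ulo (q 0) (y 0) (u 0)) (hy1 : y 0 ≤ 0)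
    (hℓ : ulo = 119/100 ∨ (ulo = 143/100 ∧ 145/100 ≤ u 0))
    (hV : ∀ t ∈ Icc 0 T, (∀ s ∈ Icc 0 t, GU ulo (q s) (y s) (u s)) → q t < 1/40 →
      y t ≤ -(e/100 * q t))
    (hO : ∀ t ∈ Icc 0 T, (∀ s ∈ Icc 0 t, GF e ulo (q s) (y s) (u s)) → -(7 * q t) ≤ y t) :
    Desc e ulo μ q y u T := by
  have main : ∀ t ∈ Ico 0 T, _ := fun t ht => ho.fall hp hm hq0 hq1 (hO 0 ⟨le_rfl, ht.1.trans ht.2.le⟩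
    (fun s hs => by
      rw [le_antisymm hs.2 hs.1]
      exact ⟨hU0, Or.inl (by linarith)⟩)) hy1 hU0.u0 hU0.u1
    (fun t ht hU hy hb => ho.fall_lo hp hm hq1 hU0.u0 hℓ ht.1 hU hy hb) hV hO t ht
  refine ⟨fun s hs => (main s hs).1 s ⟨hs.1, le_rfl⟩, fun s hs => ?_, fun s hs =>
    hO s ⟨hs.1, hs.2.le⟩ (main s hs).1⟩
  rcases hs.1.eq_or_lt with h | h
  · rw [← h]; exact hy1
  · exact ((main s hs).2 h).le

/-- A downward jump that never turns back nor falls through lands at the laminar state. -/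
lemma Orb.desc_lands (ho : Orb e η ζ μ q y u) (hp : Par e η ζ) (hm : MU ulo μ)
    (hq1 : q 0 ≤ 2 - 2*e) (h : ∀ T, Desc e ulo μ q y u T) :
    Tendsto q atTop (𝓝 0) ∧ Tendsto y atTop (𝓝 0) ∧ Tendsto u atTop (𝓝 2) := by
  have e0 := hp.e0
  have h1 : ∀ s, 0 ≤ s → GF e ulo (q s) (y s) (u s) ∧ y s ≤ 0 := fun s hs =>
    ⟨(h (s+1)).gf s ⟨hs, by linarith⟩, (h (s+1)).y0 s ⟨hs, by linarith⟩⟩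
  have anti : ∀ a b : ℝ, 0 ≤ a → a ≤ b → q b ≤ q a := fun a b ha hab =>
    ho.q_anti hm hab fun r hr => ⟨(h1 r (by linarith [hr.1])).1.1, (h1 r (by linarith [hr.1])).2⟩
  have hq : q (27/e) < 1/40 := by
    by_contra hc
    push Not at hc
    have := ho.fall_time hp hm (T := 27/e) (by positivity) fun s hs =>
      ⟨(h1 s hs.1).1.1, (h1 s hs.1).2, hc.trans (anti s _ hs.1 hs.2), (anti 0 s le_rfl hs.1).trans hq1⟩
    have h27 : 26/e < 27/e := by gcongr; norm_num
    linarith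
  have h27 : 0 < 27/e := by positivity
  refine ho.landing hp hm (t1 := 27/e) fun s hs => ?_
  obtain ⟨⟨a1, a2⟩, a3⟩ := h1 s (by linarith)
  refine ⟨a1, ?_⟩
  have := anti (27/e) s h27.le hs
  rcases a2 with a2 | a2
  · linarith
  · exact a2.le

end land

/-- The upward jump is still undecided. -/
def SRp (e q y : ℝ) : Prop := q < 2 ∧ (0 < y ∨ 2 - 2*e < q)

section lap
variable {e η ζ μ ulo : ℝ} {q y u : ℝ → ℝ} {φ : ℝ → St → St}

lemma Orb.lap_key (ho : Orb e η ζ μ q y u) (hp : Par e η ζ) (hm : MU ulo μ) {t s : ℝ}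
    (hq0 : q 0 = 1/20) (hy0 : 0 < y 0) (hy1 : y 0 ≤ 7/20)
    (hR : ∀ s ∈ Ico 0 t, SRp e (q s) (y s)) (hs0 : 0 < s) (hst : s ≤ t)
    (hU : ∀ r ∈ Ico 0 s, GU ulo (q r) (y r) (u r)) :
    1/20 ≤ q s ∧ q s ≤ 2 ∧ y s ≤ 7 * q s ∧ (y s < 0 → 2 - 2*e ≤ q s) ∧
      -(10 * (2 - q s) + 1/10) ≤ y s ∧ Box (q s) (y s) (u s) μ := by
  have e0 := hp.e0
  have e1 := hp.e1
  have cq := ho.cq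
  have cy := ho.cy
  obtain ⟨b1, b2, b3, b4, b5, b6, hb⟩ := GU.closure ho hm hs0 hU
  have hbox : ∀ r ∈ Icc 0 s, Box (q r) (y r) (u r) μ := by
    intro r hr
    rcases hr.2.eq_or_lt with h | h
    · rw [h]; exact hb
    · exact (hU r ⟨hr.1, h⟩).box hm
  have hul : ∀ r ∈ Icc 0 s, ulo ≤ u r ∧ u r ≤ 401/200 := by
    intro r hr
    rcases hr.2.eq_or_lt with h | h
    · rw [h]; exact ⟨b5, b6⟩
    · exact ⟨(hU r ⟨hr.1, h⟩).u0.le, (hU r ⟨hr.1, h⟩).u1.le⟩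
  have hqlow' : ∀ r ∈ Ico 0 s, 1/20 ≤ q r := by
    intro r hr
    rcases hr.1.eq_or_lt with h | h
    · rw [← h, hq0]
    have := barrier_pos' (f := fun v => q v - 1/20) (a := 0) (b := r) (by fun_prop)
      (by rw [hq0]; norm_num) (fun v hv _ hz => by
        refine ⟨_, ?_, (ho.dq v (hbox v ⟨hv.1, hv.2.trans hr.2.le⟩)).sub_const _⟩
        rcases (hR v ⟨hv.1, by linarith [hv.2, hr.2]⟩).2 with h1 | h1
        · exact h1
        · linarith) r ⟨h, le_rfl⟩
    linarith
  have hqs := le_of_le_on_Ico (f := fun _ => 1/20) (g := q) hs0 (by fun_prop) cq hqlow'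
  have hqlow : ∀ r ∈ Icc 0 s, 1/20 ≤ q r := by
    intro r hr
    rcases hr.2.eq_or_lt with h | h
    · rw [h]; exact hqs
    · exact hqlow' r ⟨hr.1, h⟩
  have hqup : ∀ r ∈ Icc 0 s, q r ≤ 2 := by
    intro r hr
    rcases hr.1.eq_or_lt with h | h
    · rw [← h]; linarith
    exact le_of_le_on_Ico (f := q) (g := fun _ => 2) h cq (by fun_prop)
      (fun v hv => (hR v ⟨hv.1, by linarith [hv.2, hr.2]⟩).1.le)
  have hneg : ∀ r ∈ Icc 0 s, y r < 0 → 2 - 2*e ≤ q r := by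
    intro r hr hyr
    rcases hr.1.eq_or_lt with h | h
    · rw [← h] at hyr; linarith
    have ev : ∀ᶠ v in 𝓝[<] r, y v < 0 :=
      ((cy.tendsto r).eventually (gt_mem_nhds hyr)).filter_mono nhdsWithin_le_nhds
    refine ge_of_tendsto (cq.continuousWithinAt (s := Iio r) (x := r)) ?_
    filter_upwards [ev, Ico_mem_nhdsLT h] with v hv hv2
    rcases (hR v ⟨hv2.1, by linarith [hv2.2, hr.2]⟩).2 with h1 | h1
    · linarith
    · exact h1.le
  have hup := barrier_pos' (f := fun r => 7 * q r - y r) (a := 0) (b := s) (by fun_prop)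
    (by rw [hq0]; linarith) (fun r hr _ hz => by
      refine ⟨_, ?_, ((ho.dq r (hbox r hr)).const_mul 7).sub (ho.dy r (hbox r hr))⟩
      have hyr : y r = 7 * q r := by linarith
      have h2 : (21/10 - u r) * e ≤ 1 * (1/100000) :=
          mul_le_mul (by linarith [hm.lo, (hul r hr).1]) e1 e0.le (by norm_num)
      have h3 := hqlow r hr
      have h4 := hqup r hr
      have h5 := (hul r hr).2
      have h6 := hm.g1
      have : 7 * y r - FY e (q r) (y r) (u r) μ =
        q r * (49 - 7 * (8 * (u r + μ)) + 2 * q r * (2 - q r) - 2 * ((21/10 - u r) * e)) := by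
        rw [FY, hyr]; ring
      rw [this]
      apply mul_pos (by linarith)
      nlinarith) s ⟨hs0, le_rfl⟩
  have hlow := barrier_pos' (f := fun r => y r + 10 * (2 - q r) + 1/10) (a := 0) (b := s) (by fun_prop)
    (by rw [hq0]; linarith) (fun r hr _ hz => by
      refine ⟨_, ?_, (((ho.dy r (hbox r hr)).add
        (((ho.dq r (hbox r hr)).const_sub 2).const_mul 10))).add_const _⟩
      have h4 := hqup r hr
      have h3 := hneg r hr (by linarith)
      have h5 := (hul r hr).2
      have h6 := hm.g1
      have h7 := (hul r hr).1
      have h8 := hm.g0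
      rw [FY]
      have h2 : 0 ≤ (21/10 - u r) * e := mul_nonneg (by linarith) e0.le
      have h9 : 2 * q r * (q r * (2 - q r) - (21/10 - u r) * e) ≤ 20 * e := by
        have : q r * (2 - q r) ≤ 4 * e := by nlinarith
        nlinarith
      have hy : y r ≤ -(1/10) := by linarith
      nlinarith) s ⟨hs0, le_rfl⟩
  exact ⟨hqs, hqup s ⟨hs0.le, le_rfl⟩, by linarith, hneg s ⟨hs0.le, le_rfl⟩, by linarith, hb⟩

/-- The information available during an undecided upward jump. -/
structure LapI (e ulo q y u : ℝ) : Prop where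
  gu : GU ulo q y u
  q0 : 1/20 ≤ q
  q2 : q ≤ 2
  y7 : y ≤ 7 * q
  band : y < 0 → 2 - 2*e ≤ q
  low : -(10 * (2 - q) + 1/10) ≤ y

/-- Initial data of a lap. -/
structure LapS (ulo q y u : ℝ) : Prop where
  q0 : q = 1/20
  y0 : 0 < y
  y1 : y ≤ 7/20
  u0 : ulo < u
  u1 : u < 401/200

lemma LapS.lapI (hp : Par e η ζ) {q y u : ℝ} (h : LapS ulo q y u) : LapI e ulo q y u := by
  obtain ⟨h1, h2, h3, h4, h5⟩ := h
  have := hp.e1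
  refine ⟨⟨?_, ?_, ?_, ?_, h4, h5⟩, ?_, ?_, ?_, fun h => ?_, ?_⟩ <;> linarith

lemma Orb.lap_inv (ho : Orb e η ζ μ q y u) (hp : Par e η ζ) (hm : MU ulo μ) {t : ℝ}
    (h0 : LapS ulo (q 0) (y 0) (u 0))
    (hℓ : ulo = 119/100 ∨ (ulo = 143/100 ∧
      ∀ s ∈ Icc 0 t, (∀ r ∈ Ico 0 s, GU ulo (q r) (y r) (u r)) → 145/100 ≤ u s))
    (hR : ∀ s ∈ Ico 0 t, SRp e (q s) (y s)) :
    ∀ s ∈ Icc 0 t, LapI e ulo (q s) (y s) (u s) := by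
  have e0 := hp.e0
  have e1 := hp.e1
  have key : ∀ s, 0 < s → s ≤ t → (∀ r ∈ Ico 0 s, GU ulo (q r) (y r) (u r)) →
      LapI e ulo (q s) (y s) (u s) := by
    intro s hs0 hst hU
    obtain ⟨b1, b2, b3, b4, b5, b6⟩ := ho.lap_key hp hm h0.q0 h0.y0 h0.y1 hR hs0 hst hU
    have hB : ∀ r ∈ Ioc 0 s, Box (q r) (y r) (u r) μ ∧ 0 ≤ q r ∧ q r ≤ 21/10 := by
      intro r hr
      rcases hr.2.eq_or_lt with h | h
      · rw [h]; exact ⟨b6, by linarith, by linarith⟩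
      · have := hU r ⟨hr.1.le, h⟩
        exact ⟨this.box hm, this.q0.le, this.q1.le⟩
    refine ⟨⟨by linarith, by linarith, ?_, by linarith, ?_, ?_⟩, b1, b2, b3, b4, b5⟩
    · rcases le_or_gt 0 (y s) with h | h
      · linarith
      · linarith [b4 h]
    · rcases hℓ with rfl | ⟨rfl, hℓ⟩
      · exact ho.lt_u hp (qm := 21/10) h0.u0 (by norm_num) (by norm_num)
          (fun r hr => ⟨(hB r hr).1, (hB r hr).2.2⟩) s ⟨hs0.le, le_rfl⟩
      · linarith [hℓ s ⟨hs0.le, hst⟩ hU]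
    · exact ho.u_lt hp hm h0.u1 (fun r hr => ⟨(hB r hr).1, (hB r hr).2.1⟩) s ⟨hs0.le, le_rfl⟩
  have hI0 := h0.lapI hp
  intro s hs
  rcases hs.1.eq_or_lt with h | h
  · rw [← h]; exact hI0
  rcases first_exit ho.cont3 (continuous_GU_isOpen ulo) (a := 0) hI0.gu s with h1 | ⟨r, hr, hex, hin⟩
  · exact key s h hs.2 fun r hr => h1 r ⟨hr.1, hr.2.le⟩
  · exact absurd (key r hr.1 (hr.2.trans hs.2) hin).gu hex

/-- Once in the upper band, an undecided orbit remains there. -/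
lemma Orb.band_persist (ho : Orb e η ζ μ q y u) (hm : MU ulo μ) {a b : ℝ}
    (h : ∀ s ∈ Icc a b, GU ulo (q s) (y s) (u s) ∧ SRp e (q s) (y s)) (ha : 2 - 2*e ≤ q a) :
    ∀ s ∈ Ioc a b, 2 - 2*e < q s := by
  have cq := ho.cq
  have := barrier_pos' (f := fun s => q s - (2 - 2*e)) (a := a) (b := b) (by fun_prop) (by linarith)
    (fun s hs _ hz => by
      refine ⟨_, ?_, (ho.dq s ((h s hs).1.box hm)).sub_const _⟩
      rcases (h s hs).2.2 with h1 | h1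
      · exact h1
      · linarith)
  intro s hs
  linarith [this s hs]

/-- An undecided orbit enters the upper band in bounded time. -/
lemma Orb.band_time (ho : Orb e η ζ μ q y u) (hp : Par e η ζ) (hm : MU ulo μ) {T : ℝ}
    (hT : 25/e ≤ T)
    (h : ∀ s ∈ Icc 0 T, LapI e ulo (q s) (y s) (u s) ∧ SRp e (q s) (y s)) :
    ∀ s ∈ Ioc (25/e) T, 2 - 2*e < q s := by
  have e0 := hp.e0
  have e1 := hp.e1
  have cq := ho.cq
  have cy := ho.cy
  have h25 : 0 < 25/e := by positivity
  have : ∃ a ∈ Icc 0 (25/e), 2 - 2*e ≤ q a := by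
    by_contra hc
    push Not at hc
    have h1 := ge_of_deriv_le (f := fun s => y s - 5 * q s) (c := -e) h25.le (by fun_prop) fun s hs => by
      have hsI : s ∈ Icc 0 (25/e) := ⟨hs.1.le, hs.2.le⟩
      obtain ⟨hI, hR⟩ := h s ⟨hs.1.le, by linarith [hs.2]⟩
      refine ⟨_, ?_, (ho.dy s (hI.gu.box hm)).sub ((ho.dq s (hI.gu.box hm)).const_mul 5)⟩
      have hq1 := hc s hsI
      have hy : 0 < y s := by
        rcases hR.2 with h1 | h1
        · exact h1
        · linarith
      have hU := hI.gu
      have hq0 := hI.q0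
      rw [FY]
      have hr := reaction_pos e0 e1 (by linarith) hq1.le (hm.lo.trans hU.u0.le)
      have hF : e/2 ≤ q s * (q s * (2 - q s) - (21/10 - u s) * e) := by
        rcases le_total 1 (q s) with hc | hc
        · nlinarith
        · have h2 : (21/10 - u s) * e ≤ 1 * (1/100000) :=
            mul_le_mul (by linarith [hm.lo, hU.u0]) e1 e0.le (by norm_num)
          nlinarith
      have : 8 * (u s + μ) * y s ≤ 5 * y s := by
        have := hU.u1
        have := hm.g1
        nlinarith
      linarith
    have h2 := (h 0 ⟨le_rfl, by linarith⟩).1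
    have h3 := (h (25/e) ⟨h25.le, hT⟩).1
    have h4 : -e * (25/e - 0) = -25 := by field_simp; ring
    rw [h4] at h1
    have h5 := h3.low
    have h6 := h3.q2
    have h7 := h3.q0
    by_cases hy : y (25/e) < 0
    · have := h3.band hy
      have := h2.y7
      have := h2.q2
      linarith
    · have := h2.y7
      have := h2.q2
      linarith
  obtain ⟨a, ha, haq⟩ := this
  intro s hs
  exact ho.band_persist hm (a := a) (b := T)
    (fun r hr => ⟨(h r ⟨ha.1.trans hr.1, hr.2⟩).1.gu, (h r ⟨ha.1.trans hr.1, hr.2⟩).2⟩) haq s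
    ⟨ha.2.trans_lt hs.1, hs.2⟩

lemma isOpen_SRp (e : ℝ) : IsOpen {x : ℝ × ℝ × ℝ | SRp e x.1 x.2.1} := by
  have h1 : IsOpen {x : ℝ × ℝ × ℝ | x.1 < 2} := isOpen_lt (by fun_prop) (by fun_prop)
  have h2 : IsOpen {x : ℝ × ℝ × ℝ | 0 < x.2.1} := isOpen_lt (by fun_prop) (by fun_prop)
  have h3 : IsOpen {x : ℝ × ℝ × ℝ | 2 - 2*e < x.1} := isOpen_lt (by fun_prop) (by fun_prop)
  exact h1.inter (h2.union h3)

/-- The two ways in which an upward jump gets decided. -/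
lemma Orb.lap_exit (ho : Orb e η ζ μ q y u) (hp : Par e η ζ) (hm : MU ulo μ) {t : ℝ} (ht : 0 < t)
    (hI : LapI e ulo (q t) (y t) (u t)) (hR : ∀ s ∈ Ico 0 t, SRp e (q s) (y s))
    (hex : ¬ SRp e (q t) (y t)) :
    (q t = 2 ∧ 0 < y t ∧ ∀ᶠ s in 𝓝[>] t, 2 < q s ∧ ∀ r ∈ Icc 0 s, 0 < y r ∨ 2 - 2*e < q r) ∨
    (q t ≤ 2 - 2*e ∧ y t ≤ 0 ∧ ∀ᶠ s in 𝓝[>] t, (y s < 0 ∧ q s < 2 - 2*e) ∧ ∀ r ∈ Icc 0 s, q r < 2) := by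
  have e0 := hp.e0
  have e1 := hp.e1
  have cq := ho.cq
  have cy := ho.cy
  have hb := hI.gu.box hm
  have hdq := ho.dq t hb
  have hdy := ho.dy t hb
  have nbhd : ∀ {p : ℝ → Prop}, (∀ᶠ s in 𝓝 t, p s) → (∀ r ∈ Ico 0 t, p r) →
      ∀ᶠ s in 𝓝[>] t, ∀ r ∈ Icc 0 s, p r := by
    intro p hp1 hp2
    obtain ⟨d, hd0, hd⟩ := Metric.eventually_nhds_iff.1 hp1
    filter_upwards [Ioo_mem_nhdsGT (show t < t + d by linarith)] with s hs r hr
    rcases lt_or_ge r t with h | h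
    · exact hp2 r ⟨hr.1, h⟩
    · refine hd ?_
      rw [Real.dist_eq, abs_of_nonneg (by linarith)]
      linarith [hr.2, hs.2]
  have hrpos : ∀ {f : ℝ → ℝ} {f' : ℝ}, HasDerivAt f f' t → 0 ≤ f t → 0 < f' →
      ∀ᶠ s in 𝓝[>] t, 0 < f s := by
    intro f f' h1 h2 h3
    obtain ⟨d, hd, h⟩ := pos_right_of_deriv_pos h1 h2 h3
    filter_upwards [Ioo_mem_nhdsGT (show t < t + d by linarith)] with s hs using h s hs
  by_cases hq2 : q t = 2
  · left
    have hy0 : 0 ≤ y t := by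
      have := deriv_nonpos_of_pos_left (f := fun s => 2 - q s) ht (fun s hs => by
        have := (hR s hs).1; linarith) (by linarith) (hdq.const_sub 2)
      linarith
    have hypos : 0 < y t := by
      refine lt_of_le_of_ne hy0 fun hy => ?_
      have hF : 0 < FY e (q t) (y t) (u t) μ := by
        rw [FY, hq2, ← hy]
        have := mul_pos (show 0 < 21/10 - u t by linarith [hI.gu.u1]) e0
        nlinarith
      have hs := (hasDerivAt_iff_tendsto_slope_left_right.1 hdy).1.eventually (lt_mem_nhds hF)
      obtain ⟨c, hc, hc'⟩ := mem_nhdsLT_iff_exists_Ioo_subset.1 hs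
      have evb : ∀ᶠ s in 𝓝[<] t, GU ulo (q s) (y s) (u s) :=
        ((ho.cont3.tendsto t).eventually ((continuous_GU_isOpen ulo).mem_nhds hI.gu)).filter_mono
          nhdsWithin_le_nhds
      obtain ⟨c2, hc2, hc2'⟩ := mem_nhdsLT_iff_exists_Ioo_subset.1 evb
      set a := max (max c c2) 0 with ha
      have hat : a < t := max_lt (max_lt hc hc2) ht
      set b := (a + t)/2 with hbd
      have hab : a < b := by linarith
      have hbt : b < t := by linarith
      have := ge_of_deriv_le (f := q) (c := 0) hbt.le cq.continuousOn fun s hs => by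
        have h1 : c < s := (le_max_left c c2).trans_lt ((le_max_left _ _).trans_lt (hab.trans hs.1))
        have h2 : c2 < s := (le_max_right c c2).trans_lt ((le_max_left _ _).trans_lt (hab.trans hs.1))
        refine ⟨_, ?_, ho.dq s ((hc2' ⟨h2, hs.2⟩ : GU ulo (q s) (y s) (u s)).box hm)⟩
        have h3 : 0 < slope y t s := hc' ⟨h1, hs.2⟩
        rw [slope_def_field, ← hy, div_pos_iff] at h3
        rcases h3 with h3 | h3
        · linarith [hs.2, h3.2]
        · linarith [h3.1]
      have h3 := (hR b ⟨by linarith [le_max_right (max c c2) 0], hbt⟩).1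
      linarith
    refine ⟨hq2, hypos, ?_⟩
    have h1 := hrpos (f := fun s => q s - 2) (hdq.sub_const 2) (by linarith) hypos
    have h2 := nbhd (p := fun r => 0 < y r ∨ 2 - 2*e < q r)
      (((cy.tendsto t).eventually (lt_mem_nhds hypos)).mono fun s hs => Or.inl hs)
      (fun r hr => (hR r hr).2)
    filter_upwards [h1, h2] with s hs1 hs2 using ⟨by linarith, hs2⟩
  · right
    have hqlt : q t < 2 := lt_of_le_of_ne hI.q2 hq2
    have hnot : y t ≤ 0 ∧ q t ≤ 2 - 2*e := by
      unfold SRp at hex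
      push Not at hex
      exact hex hqlt
    refine ⟨hnot.2, hnot.1, ?_⟩
    have h2 := nbhd (p := fun r => q r < 2) ((cq.tendsto t).eventually (gt_mem_nhds hqlt))
      (fun r hr => (hR r hr).1)
    have hF : y t = 0 → 0 < -FY e (q t) (y t) (u t) μ := by
      intro hy
      have hr := reaction_pos e0 e1 (by linarith [hI.q0]) hnot.2 (hm.lo.trans hI.gu.u0.le)
      have := mul_pos hI.gu.q0 (e0.trans_le hr)
      rw [FY, hy]
      nlinarith
    have hyneg : ∀ᶠ s in 𝓝[>] t, y s < 0 := by
      rcases hnot.1.eq_or_lt with h | h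
      · refine (hrpos (f := fun s => - y s) hdy.neg (by linarith) (hF h)).mono fun s hs => ?_
        linarith
      · exact ((cy.tendsto t).eventually (gt_mem_nhds h)).filter_mono nhdsWithin_le_nhds
    have hqneg : ∀ᶠ s in 𝓝[>] t, q s < 2 - 2*e := by
      obtain ⟨c, hc, hc'⟩ := mem_nhdsGT_iff_exists_Ioo_subset.1 hyneg
      have evb : ∀ᶠ s in 𝓝[>] t, GU ulo (q s) (y s) (u s) :=
        ((ho.cont3.tendsto t).eventually ((continuous_GU_isOpen ulo).mem_nhds hI.gu)).filter_mono
          nhdsWithin_le_nhds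
      obtain ⟨c2, hc2, hc2'⟩ := mem_nhdsGT_iff_exists_Ioo_subset.1 evb
      filter_upwards [Ioo_mem_nhdsGT (lt_min hc hc2)] with s hs
      obtain ⟨v, hv, hveq⟩ := exists_hasDerivAt_eq_slope q y hs.1 cq.continuousOn fun v hv =>
        ho.dq v ((hc2' ⟨hv.1, hv.2.trans (hs.2.trans_le (min_le_right _ _))⟩ :
          GU ulo (q v) (y v) (u v)).box hm)
      have h3 : y v < 0 := hc' ⟨hv.1, hv.2.trans (hs.2.trans_le (min_le_left _ _))⟩
      rw [hveq, div_neg_iff] at h3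
      rcases h3 with h3 | h3
      · linarith [h3.2, hs.1]
      · linarith [h3.1]
    filter_upwards [h2, hyneg, hqneg] with s h1 h2 h3 using ⟨⟨h2, h3⟩, h1⟩

end lap

/-- Points of the lap that are still below the level of return or already in the upper band. -/
def RP (e : ℝ) : Set St := {x | 0 < x.2.1 ∨ 2 - 2*e < x.1}
/-- Initial points that overshoot. -/
def SPc (φ : ℝ → St → St) (e : ℝ) : Set St := Reach φ (RP e) {x | 2 < x.1}
/-- Initial points that fall back before `u` gets down to `ℓ`. -/
def SMc (φ : ℝ → St → St) (e ℓ : ℝ) : Set St :=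
  Reach φ {x | x.1 < 2 ∧ ℓ < x.2.2.1} {x | x.2.1 < 0 ∧ x.1 < 2 - 2*e}

section lapclass
variable {e η ζ μ ulo ℓ : ℝ} {q y u : ℝ → ℝ} {φ : ℝ → St → St}

lemma isOpen_SPc (hφ : PFlow e η ζ φ) : IsOpen (SPc φ e) := by
  refine isOpen_Reach hφ.cont ?_ (isOpen_lt (by fun_prop) (by fun_prop))
  have h1 : IsOpen {x : St | 0 < x.2.1} := isOpen_lt (by fun_prop) (by fun_prop)
  have h2 : IsOpen {x : St | 2 - 2*e < x.1} := isOpen_lt (by fun_prop) (by fun_prop)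
  exact h1.union h2

lemma isOpen_SMc (hφ : PFlow e η ζ φ) : IsOpen (SMc φ e ℓ) := by
  have h1 : IsOpen {x : St | x.1 < 2} := isOpen_lt (by fun_prop) (by fun_prop)
  have h2 : IsOpen {x : St | ℓ < x.2.2.1} := isOpen_lt (by fun_prop) (by fun_prop)
  have h3 : IsOpen {x : St | x.2.1 < 0} := isOpen_lt (by fun_prop) (by fun_prop)
  have h4 : IsOpen {x : St | x.1 < 2 - 2*e} := isOpen_lt (by fun_prop) (by fun_prop)
  exact isOpen_Reach hφ.cont (h1.inter h2) (h3.inter h4)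

lemma not_SMc_SPc (x : St) : ¬ (x ∈ SMc φ e ℓ ∧ x ∈ SPc φ e) := by
  rintro ⟨⟨t', ht', hV, hU⟩, ⟨t, ht, hQ, hR⟩⟩
  rcases le_or_gt t t' with h | h
  · have h1 : (φ t x).1 < 2 := (hU t ⟨ht, h⟩).1
    have h2 : 2 < (φ t x).1 := hQ
    linarith
  · have h1 : 0 < (φ t' x).2.1 ∨ 2 - 2*e < (φ t' x).1 := hR t' ⟨ht', h.le⟩
    have h2 : (φ t' x).2.1 < 0 ∧ (φ t' x).1 < 2 - 2*e := hV
    rcases h1 with h1 | h1 <;> linarith [h2.1, h2.2]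

/-- The first return from the upper band of a lap. -/
structure Exit (e ulo : ℝ) (q y u : ℝ → ℝ) (t : ℝ) : Prop where
  pos : 0 < t
  inv : ∀ s ∈ Icc 0 t, LapI e ulo (q s) (y s) (u s)
  srp : ∀ s ∈ Ico 0 t, SRp e (q s) (y s)
  q2 : q t ≤ 2 - 2*e
  y0 : y t ≤ 0

/-- A lap either stays undecided up to `T`, or overshoots, or falls back. -/
lemma lap_cases (hφ : PFlow e η ζ φ) (hp : Par e η ζ) {x : St} (hm : MU ulo x.2.2.2)
    (h0 : LapS ulo x.1 x.2.1 x.2.2.1) {T : ℝ}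
    (hℓ : (ulo = 119/100 ∧ ℓ = 1) ∨ (ulo = 143/100 ∧ ℓ = 145/100 ∧
      ∀ s ∈ Icc 0 T, (∀ r ∈ Ico 0 s, GU ulo (φ r x).1 (φ r x).2.1 (φ r x).2.2.1) → ℓ ≤ (φ s x).2.2.1)) :
    (∀ s ∈ Icc 0 T, SRp e (φ s x).1 (φ s x).2.1 ∧ LapI e ulo (φ s x).1 (φ s x).2.1 (φ s x).2.2.1) ∨
    (x ∈ SPc φ e ∧ ∃ t, 0 ≤ t ∧ t ≤ T ∧ (∀ s ∈ Icc 0 t, LapI e ulo (φ s x).1 (φ s x).2.1 (φ s x).2.2.1) ∧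
      (φ t x).1 = 2) ∨ ∃ t ≤ T, Exit e ulo (fun s => (φ s x).1) (fun s => (φ s x).2.1)
      (fun s => (φ s x).2.2.1) t ∧ ((∀ s ∈ Icc 0 t, ℓ < (φ s x).2.2.1) → x ∈ SMc φ e ℓ) := by
  have ho := hφ.orb x
  have e0 := hp.e0
  have h0' : LapS ulo (φ 0 x).1 (φ 0 x).2.1 (φ 0 x).2.2.1 := by rw [hφ.zero]; exact h0
  have hR0 : SRp e (φ 0 x).1 (φ 0 x).2.1 := ⟨by rw [h0'.q0]; norm_num, Or.inl h0'.y0⟩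
  have hℓ' : ∀ t ≤ T, ulo = 119/100 ∨ (ulo = 143/100 ∧ ∀ s ∈ Icc 0 t,
      (∀ r ∈ Ico 0 s, GU ulo (φ r x).1 (φ r x).2.1 (φ r x).2.2.1) → 145/100 ≤ (φ s x).2.2.1) := by
    intro t ht
    rcases hℓ with h | ⟨h, h1, h2⟩
    · exact Or.inl h.1
    · exact Or.inr ⟨h, fun s hs hU => h1 ▸ h2 s ⟨hs.1, hs.2.trans ht⟩ hU⟩
  rcases first_exit ho.cont3 (isOpen_SRp e) (a := 0) hR0 T with h | ⟨t, ht, hex, hin⟩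
  · left
    intro s hs
    exact ⟨h s hs, ho.lap_inv hp hm h0' (hℓ' T le_rfl) (fun r hr => h r ⟨hr.1, hr.2.le⟩) s hs⟩
  right
  have hI := ho.lap_inv hp hm h0' (hℓ' t ht.2) hin
  rcases ho.lap_exit hp hm ht.1 (hI t ⟨ht.1.le, le_rfl⟩) hin hex with ⟨hq2, _, hev⟩ | ⟨a1, a2, hev⟩
  · left
    obtain ⟨s, hs, hst⟩ := (hev.and self_mem_nhdsWithin).exists
    exact ⟨⟨s, ht.1.le.trans (le_of_lt hst), hs.1, hs.2⟩, t, ht.1.le, ht.2, hI, hq2⟩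
  · right
    refine ⟨t, ht.2, ⟨ht.1, hI, hin, a1, a2⟩, fun hu => ?_⟩
    have hev2 : ∀ᶠ s in 𝓝[>] t, ∀ r ∈ Icc t s, ℓ < (φ r x).2.2.1 := by
      have h1 : ∀ᶠ s in 𝓝 t, ℓ < (φ s x).2.2.1 :=
        ho.cu.continuousAt.eventually (lt_mem_nhds (hu t ⟨ht.1.le, le_rfl⟩))
      obtain ⟨d, hd, h2⟩ := Metric.eventually_nhds_iff.1 h1
      have h3 : ∀ᶠ s in 𝓝[>] t, s < t + d := nhdsWithin_le_nhds (gt_mem_nhds (by linarith))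
      filter_upwards [h3, self_mem_nhdsWithin] with s hs hs' r hr
      apply h2
      rw [Real.dist_eq, abs_of_nonneg (by linarith [hr.1])]
      linarith [hr.2]
    obtain ⟨s, ⟨hs, hs2⟩, hst⟩ := ((hev.and hev2).and self_mem_nhdsWithin).exists
    have hst : t < s := hst
    refine ⟨s, ht.1.le.trans hst.le, hs.1, fun r hr => ⟨hs.2 r hr, ?_⟩⟩
    rcases le_or_gt r t with h | h
    · exact hu r ⟨hr.1, h⟩
    · exact hs2 r ⟨h.le, hr.2⟩

lemma SMc.exit (hφ : PFlow e η ζ φ) (hp : Par e η ζ) {x : St} (hm : MU ulo x.2.2.2)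
    (h0 : LapS ulo x.1 x.2.1 x.2.2.1)
    (hℓ : (ulo = 119/100 ∧ ℓ = 1) ∨ (ulo = 143/100 ∧ ℓ = 145/100)) (hx : x ∈ SMc φ e ℓ) :
    ∃ t, Exit e ulo (fun s => (φ s x).1) (fun s => (φ s x).2.1) (fun s => (φ s x).2.2.1) t ∧
      ∀ s ∈ Icc 0 t, ℓ < (φ s x).2.2.1 := by
  have hx' := hx
  obtain ⟨T, hT, hV, hU⟩ := hx
  rcases lap_cases hφ hp hm h0 (T := T) (ℓ := ℓ) (by
    rcases hℓ with h | h
    · exact Or.inl h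
    · exact Or.inr ⟨h.1, h.2, fun s hs _ => (hU s hs).2.le⟩) with h | h | ⟨t, ht, h, _⟩
  · have h1 := (h T ⟨hT, le_rfl⟩).1.2
    have h2 : (φ T x).2.1 < 0 ∧ (φ T x).1 < 2 - 2*e := hV
    rcases h1 with h1 | h1 <;> linarith [h2.1, h2.2]
  · exact absurd ⟨hx', h.1⟩ (not_SMc_SPc x)
  · exact ⟨t, h, fun s hs => (hU s ⟨hs.1, hs.2.trans ht⟩).2⟩

/-- A lap that neither overshoots nor falls back stays in the undecided region. -/
lemma lap_trapped (hφ : PFlow e η ζ φ) (hp : Par e η ζ) {x : St} (hm : MU (119/100) x.2.2.2)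
    (h0 : LapS (119/100) x.1 x.2.1 x.2.2.1) (h1 : x ∉ SMc φ e 1) (h2 : x ∉ SPc φ e) :
    ∀ s, 0 ≤ s → SRp e (φ s x).1 (φ s x).2.1 ∧ LapI e (119/100) (φ s x).1 (φ s x).2.1 (φ s x).2.2.1 := by
  intro s hs
  rcases lap_cases hφ hp hm h0 (T := s) (ℓ := 1) (Or.inl ⟨rfl, rfl⟩) with h | h | ⟨t, ht, h, h'⟩
  · exact h s ⟨hs, le_rfl⟩
  · exact absurd h.1 h2
  · exact absurd (h' fun r hr => by linarith [(h.inv r hr).gu.u0]) h1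

lemma Orb.barrier_up (ho : Orb e η ζ μ q y u) (hp : Par e η ζ) (hm : MU ulo μ) {a b : ℝ}
    (h0 : q a * (21/10 - q a) ≤ y a)
    (h : ∀ s ∈ Icc a b, GU ulo (q s) (y s) (u s) ∧ 215/100 ≤ 8 * (u s + μ)) :
    ∀ s ∈ Icc a b, q s * (21/10 - q s) ≤ y s := by
  have e0 := hp.e0
  have cq := ho.cq
  have cy := ho.cy
  have := barrier_pos' (f := fun s => y s - q s * (21/10 - q s)) (a := a) (b := b) (by fun_prop)
    (by simpa using h0) (fun s hs _ hz => by
      obtain ⟨hU, hg⟩ := h s hs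
      have hb := hU.box hm
      refine ⟨_, ?_, (ho.dy s hb).sub ((ho.dq s hb).mul ((ho.dq s hb).const_sub _))⟩
      have hy : y s = q s * (21/10 - q s) := by linarith
      have h1 := hU.q0
      have h2 := hU.q1
      have h3 : 0 ≤ (21/10 - u s) * e := mul_nonneg (by linarith [hU.u1]) e0.le
      rw [FY, hy]
      have h4 : 0 ≤ (21/10 - q s) * (8 * (u s + μ) - 215/100) := mul_nonneg (by linarith) (by linarith)
      have h5 : 0 < q s * ((21/10 - q s) * (8 * (u s + μ)) - 441/100 + 23/10 * q s
        + 2 * ((21/10 - u s) * e)) := mul_pos h1 (by linarith)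
      linarith)
  intro s hs
  rcases hs.1.eq_or_lt with h' | h'
  · rw [← h']; exact h0
  · linarith [this s ⟨h', hs.2⟩]

lemma Orb.barrier_dn (ho : Orb e η ζ μ q y u) (hp : Par e η ζ) (hm : MU ulo μ) {a b : ℝ}
    (h0 : y a ≤ q a * (19/10 - q a))
    (h : ∀ t ∈ Icc a b, (∀ s ∈ Icc a t, y s ≤ q s * (19/10 - q s)) →
      GU ulo (q t) (y t) (u t) ∧ q t ≤ 19/10 ∧ 8 * (u t + μ) ≤ 185/100) :
    ∀ s ∈ Icc a b, y s ≤ q s * (19/10 - q s) := by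
  have e0 := hp.e0
  have e1 := hp.e1
  have cq := ho.cq
  have cy := ho.cy
  have := barrier_pos' (f := fun s => q s * (19/10 - q s) - y s) (a := a) (b := b) (by fun_prop)
    (by simpa using h0) (fun s hs hle hz => by
      obtain ⟨hU, h2, hg⟩ := h s hs fun r hr => by linarith [hle r hr]
      have hb := hU.box hm
      refine ⟨_, ?_, ((ho.dq s hb).mul ((ho.dq s hb).const_sub _)).sub (ho.dy s hb)⟩
      have hy : y s = q s * (19/10 - q s) := by linarith
      have h1 := hU.q0
      have h3 : (21/10 - u s) * e ≤ 1 * (1/100000) :=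
        mul_le_mul (by linarith [hU.u0, hm.lo]) e1 e0.le (by norm_num)
      rw [FY, hy]
      have h4 : 0 ≤ (19/10 - q s) * (185/100 - 8 * (u s + μ)) := mul_nonneg (by linarith) (by linarith)
      have h5 : 0 < q s * (361/100 - 17/10 * q s - (19/10 - q s) * (8 * (u s + μ))
        - 2 * ((21/10 - u s) * e)) := mul_pos h1 (by linarith)
      linarith)
  intro s hs
  rcases hs.1.eq_or_lt with h' | h'
  · rw [← h']; exact h0
  · linarith [this s ⟨h', hs.2⟩]

/-- The slow variable barely moves over times of order `1/e`. -/
lemma Orb.u_short (ho : Orb e η ζ μ q y u) (hp : Par e η ζ) (hm : MU ulo μ) {a b : ℝ} (hab : a ≤ b)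
    (hb : b - a ≤ 10^4/e^2) (hU : ∀ t ∈ Ioo a b, GU ulo (q t) (y t) (u t)) : |u b - u a| ≤ 1/10^20 := by
  have e0 := hp.e0
  refine (ho.u_drift hp hm hab hU).trans ?_
  have h1 : 200 * η * (b - a) ≤ 200 * (e^2/10^30) * (10^4/e^2) :=
    mul_le_mul (by linarith [hp.hsmall.2.1]) hb (by linarith) (by positivity)
  have h2 : 200 * (e^2/10^30) * (10^4/e^2) ≤ 1/10^20 := by
    rw [show 200 * (e^2/10^30) * (10^4/e^2) = 200 * 10^4/10^30 by field_simp]; norm_num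
  linarith

lemma Par.e_ratio (hp : Par e η ζ) : 26/e ≤ 10^4/e^2 := by
  have e0 := hp.e0
  have e1 := hp.e1
  rw [div_le_div_iff₀ e0 (by positivity)]
  nlinarith

lemma lap_level (hφ : PFlow e η ζ φ) (hp : Par e η ζ) {x : St} (hm : MU ulo x.2.2.2)
    (hℓ : (ulo = 119/100 ∧ ℓ = 1) ∨ (ulo = 143/100 ∧ ℓ = 145/100 ∧ 146/100 ≤ x.2.2.1)) :
    (ulo = 119/100 ∧ ℓ = 1) ∨ (ulo = 143/100 ∧ ℓ = 145/100 ∧ ∀ s ∈ Icc 0 (26/e),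
      (∀ r ∈ Ico 0 s, GU ulo (φ r x).1 (φ r x).2.1 (φ r x).2.2.1) → ℓ ≤ (φ s x).2.2.1) := by
  rcases hℓ with h | ⟨h1, h2, h3⟩
  · exact Or.inl h
  · refine Or.inr ⟨h1, h2, fun s hs hU => ?_⟩
    have := (abs_le.1 ((hφ.orb x).u_short hp hm hs.1 (by linarith [hp.e_ratio, hs.2]) fun r hr =>
      hU r ⟨hr.1.le, hr.2⟩)).1
    rw [hφ.zero] at this
    linarith

lemma lap_up (hφ : PFlow e η ζ φ) (hp : Par e η ζ) {x : St} (hm : MU ulo x.2.2.2)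
    (h0 : LapS ulo x.1 x.2.1 x.2.2.1) (hy : 205/100 * x.1 ≤ x.2.1)
    (hg : 219/100 ≤ 8 * (x.2.2.1 + x.2.2.2))
    (hℓ : (ulo = 119/100 ∧ ℓ = 1) ∨ (ulo = 143/100 ∧ ℓ = 145/100 ∧ 146/100 ≤ x.2.2.1)) : x ∈ SPc φ e := by
  have e0 := hp.e0
  have ho := hφ.orb x
  have hz := hφ.zero x
  have hq0 : (φ 0 x).1 = 1/20 := by rw [hz]; exact h0.q0
  have bar : ∀ T, 0 ≤ T → T ≤ 26/e → (∀ s ∈ Icc 0 T, GU ulo (φ s x).1 (φ s x).2.1 (φ s x).2.2.1) →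
      ∀ s ∈ Icc 0 T, (φ s x).1 * (21/10 - (φ s x).1) ≤ (φ s x).2.1 := by
    intro T hT hT' hU
    refine ho.barrier_up hp hm (a := 0) ?_ fun s hs => ⟨hU s hs, ?_⟩
    · rw [hz, h0.q0]; rw [h0.q0] at hy; linarith
    · have := (abs_le.1 (ho.u_short hp hm hs.1 (by linarith [hp.e_ratio, hs.2]) fun r hr =>
        hU r ⟨hr.1.le, hr.2.le.trans hs.2⟩)).1
      rw [hz] at this
      linarith
  have h26 : 0 < 26/e := by positivity
  rcases lap_cases hφ hp hm h0 (T := 26/e) (ℓ := ℓ) (lap_level hφ hp hm hℓ) with h | h | ⟨t, ht, h, _⟩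
  · exfalso
    have hb := bar _ h26.le le_rfl fun s hs => (h s hs).2.gu
    have := le_of_deriv_ge (f := fun s => (φ s x).1) (c := 1/10) h26.le ho.cq.continuousOn
      fun s hs => ⟨_, ?_, ho.dq s ((h s ⟨hs.1.le, hs.2.le⟩).2.gu.box hm)⟩
    · have h1 := (h _ ⟨h26.le, le_rfl⟩).2.q2
      have e1 := hp.e1
      have : 100 ≤ 26/e := by rw [le_div_iff₀ e0]; linarith
      linarith
    · have h1 := hb s ⟨hs.1.le, hs.2.le⟩
      obtain ⟨_, hI⟩ := h s ⟨hs.1.le, hs.2.le⟩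
      have h2 := hI.q0
      have h3 := hI.q2
      nlinarith
  · exact h.1
  · exfalso
    have hb := bar t h.pos.le ht (fun s hs => (h.inv s hs).gu) t ⟨h.pos.le, le_rfl⟩
    have h1 := h.y0
    have h2 := (h.inv t ⟨h.pos.le, le_rfl⟩).q0
    have h3 := (h.inv t ⟨h.pos.le, le_rfl⟩).q2
    nlinarith

lemma lap_down (hφ : PFlow e η ζ φ) (hp : Par e η ζ) {x : St} (hm : MU ulo x.2.2.2)
    (h0 : LapS ulo x.1 x.2.1 x.2.2.1) (hy : x.2.1 ≤ 185/100 * x.1)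
    (hg : 8 * (x.2.2.1 + x.2.2.2) ≤ 18/10)
    (hℓ : (ulo = 119/100 ∧ ℓ = 1) ∨ (ulo = 143/100 ∧ ℓ = 145/100 ∧ 146/100 ≤ x.2.2.1)) :
    x ∈ SMc φ e ℓ ∧ ∃ t ≤ 26/e, Exit e ulo (fun s => (φ s x).1) (fun s => (φ s x).2.1)
      (fun s => (φ s x).2.2.1) t := by
  have e0 := hp.e0
  have e1 := hp.e1
  have ho := hφ.orb x
  have hz := hφ.zero x
  have cq := ho.cq
  have hq0 : (φ 0 x).1 = 1/20 := by rw [hz]; exact h0.q0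
  have dich : ∀ T, (∀ s ∈ Icc 0 T, LapI e ulo (φ s x).1 (φ s x).2.1 (φ s x).2.2.1) →
      (∀ s ∈ Icc 0 T, (φ s x).2.1 ≤ (φ s x).1 * (19/10 - (φ s x).1)) →
      ∀ s ∈ Icc 0 T, (φ s x).1 ≤ 19/10 := by
    intro T hI hb
    have key : ∀ s ∈ Icc 0 T, 19/10 < (φ s x).1 → 2 - 2*e ≤ (φ s x).1 := fun s hs h =>
      (hI s hs).band (by
        have := hb s hs
        nlinarith)
    have := barrier_pos (f := fun s => 195/100 - (φ s x).1) (a := 0) (b := T) (by fun_prop)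
      (by simp only [hq0]; norm_num) (fun s hs _ hz' => by
        have := key s ⟨hs.1.le, hs.2⟩ (by linarith)
        linarith)
    intro s hs
    by_contra hc
    push Not at hc
    have h1 := key s hs hc
    have h2 := this s hs
    linarith
  have bar : ∀ T, 0 ≤ T → T ≤ 26/e → (∀ s ∈ Icc 0 T, LapI e ulo (φ s x).1 (φ s x).2.1 (φ s x).2.2.1) →
      ∀ s ∈ Icc 0 T, (φ s x).1 ≤ 19/10 := by
    intro T hT hT' hI
    refine dich T hI (ho.barrier_dn hp hm (a := 0) ?_ fun s hs hle => ⟨(hI s hs).gu, ?_, ?_⟩)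
    · rw [hz, h0.q0]; rw [h0.q0] at hy; linarith
    · exact dich s (fun r hr => hI r ⟨hr.1, hr.2.trans hs.2⟩) hle s ⟨hs.1, le_rfl⟩
    · have := (abs_le.1 (ho.u_short hp hm hs.1 (by linarith [hp.e_ratio, hs.2]) fun r hr =>
        (hI r ⟨hr.1.le, hr.2.le.trans hs.2⟩).gu)).2
      rw [hz] at this
      linarith
  have h26 : 25/e < 26/e := by gcongr; norm_num
  have h25 : 0 < 25/e := by positivity
  rcases lap_cases hφ hp hm h0 (T := 26/e) (ℓ := ℓ) (lap_level hφ hp hm hℓ) with h | h | ⟨t, ht, h, h'⟩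
  · exfalso
    have hb := bar _ (by linarith) le_rfl (fun s hs => (h s hs).2) (26/e) ⟨by linarith, le_rfl⟩
    have := ho.band_time hp hm h26.le (fun s hs => (h s hs).symm) (26/e) ⟨h26, le_rfl⟩
    linarith
  · exfalso
    obtain ⟨_, t, ht0, ht, hI, hq⟩ := h
    linarith [bar t ht0 ht hI t ⟨ht0, le_rfl⟩]
  · refine ⟨h' fun s hs => ?_, t, ht, h⟩
    rcases hℓ with ⟨h1, h2⟩ | h1
    · linarith [(h.inv s hs).gu.u0, hm.lo]
    · have := (abs_le.1 (ho.u_short hp hm hs.1 (by linarith [hp.e_ratio, hs.2]) fun r hr =>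
        (h.inv r ⟨hr.1.le, hr.2.le.trans hs.2⟩).gu)).1
      rw [hz] at this
      linarith [h1.2.1, h1.2.2]

end lapclass

section exits
variable {e η ζ μ ulo ℓ : ℝ} {q y u : ℝ → ℝ} {φ : ℝ → St → St}

lemma Exit.gu_append {t T : ℝ} (h : Exit e ulo q y u t)
    (h2 : ∀ s ∈ Icc 0 T, GU ulo (q (s + t)) (y (s + t)) (u (s + t))) :
    ∀ s ∈ Icc 0 (T + t), GU ulo (q s) (y s) (u s) := by
  intro s hs
  rcases le_or_gt s t with h1 | h1
  · exact (h.inv s ⟨hs.1, h1⟩).gu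
  · have := h2 (s - t) ⟨by linarith, by linarith [hs.2]⟩
    simpa using this

lemma Exit.gf_append {t T : ℝ} (h : Exit e ulo q y u t)
    (h2 : ∀ s ∈ Icc 0 T, GF e ulo (q (s + t)) (y (s + t)) (u (s + t))) :
    ∀ s ∈ Icc 0 (T + t), GF e ulo (q s) (y s) (u s) := by
  intro s hs
  rcases le_or_gt s t with h1 | h1
  · have := h.inv s ⟨hs.1, h1⟩
    exact ⟨this.gu, Or.inl (by linarith [this.q0])⟩
  · have := h2 (s - t) ⟨by linarith, by linarith [hs.2]⟩
    simpa using this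

/-- After the exit, an orbit that avoids the two classes descends forever. -/
lemma Exit.desc (hφ : PFlow e η ζ φ) (hp : Par e η ζ) {x : St} (hm : MU ulo x.2.2.2) {t : ℝ}
    (h : Exit e ulo (fun s => (φ s x).1) (fun s => (φ s x).2.1) (fun s => (φ s x).2.2.1) t)
    (hℓ : ulo = 119/100 ∨ (ulo = 143/100 ∧ 145/100 ≤ (φ t x).2.2.1)) {T : ℝ}
    (hV : ∀ s ∈ Icc 0 T, (∀ r ∈ Icc 0 s, GU ulo (φ (r + t) x).1 (φ (r + t) x).2.1 (φ (r + t) x).2.2.1) →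
      (φ (s + t) x).1 < 1/40 → (φ (s + t) x).2.1 ≤ -(e/100 * (φ (s + t) x).1))
    (hO : ∀ s ∈ Icc 0 T, (∀ r ∈ Icc 0 s, GF e ulo (φ (r + t) x).1 (φ (r + t) x).2.1 (φ (r + t) x).2.2.1) →
      -(7 * (φ (s + t) x).1) ≤ (φ (s + t) x).2.1) :
    Desc e ulo x.2.2.2 (fun s => (φ (s + t) x).1) (fun s => (φ (s + t) x).2.1)
      (fun s => (φ (s + t) x).2.2.1) T := by
  have hI := h.inv t ⟨h.pos.le, le_rfl⟩
  refine ((hφ.orb x).shift t).desc hp hm ?_ ?_ ?_ ?_ ?_ hV hO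
  · simpa using hI.q0
  · simpa using h.q2
  · simpa using hI.gu
  · simpa using h.y0
  · simpa using hℓ

lemma Exit.hV {x : St} {t : ℝ}
    (h : Exit e ulo (fun s => (φ s x).1) (fun s => (φ s x).2.1) (fun s => (φ s x).2.2.1) t)
    (hx : x ∉ VC φ e ulo) {s : ℝ} (hs : 0 ≤ s)
    (hU : ∀ r ∈ Icc 0 s, GU ulo (φ (r + t) x).1 (φ (r + t) x).2.1 (φ (r + t) x).2.2.1)
    (hq : (φ (s + t) x).1 < 1/40) : (φ (s + t) x).2.1 ≤ -(e/100 * (φ (s + t) x).1) := by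
  by_contra hc
  push Not at hc
  exact hx ⟨s + t, by linarith [h.pos], ⟨hq, hc⟩, h.gu_append hU⟩

lemma Exit.hO {x : St} {t : ℝ}
    (h : Exit e ulo (fun s => (φ s x).1) (fun s => (φ s x).2.1) (fun s => (φ s x).2.2.1) t)
    (hx : x ∉ OC φ e ulo) {s : ℝ} (hs : 0 ≤ s)
    (hU : ∀ r ∈ Icc 0 s, GF e ulo (φ (r + t) x).1 (φ (r + t) x).2.1 (φ (r + t) x).2.2.1) :
    -(7 * (φ (s + t) x).1) ≤ (φ (s + t) x).2.1 := by
  by_contra hc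
  push Not at hc
  exact hx ⟨s + t, by linarith [h.pos], hc, h.gf_append hU⟩

lemma Par.two_hundred (hp : Par e η ζ) : 0 < 200/e^2 ∧ 201/e^2 ≤ 10^4/e^2 ∧ 200/e^2 + 1 ≤ 201/e^2 := by
  have e0 := hp.e0
  have e1 := hp.e1
  refine ⟨by positivity, by gcongr; norm_num, ?_⟩
  rw [show 201/e^2 = 200/e^2 + 1/e^2 by ring]
  have : 1 ≤ 1/e^2 := by rw [le_div_iff₀ (by positivity)]; nlinarith
  linarith

/-- After the exit, an orbit that avoids the two classes lands, and the exit speed is constrained. -/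
lemma Exit.lands (hφ : PFlow e η ζ φ) (hp : Par e η ζ) {x : St} (hm : MU ulo x.2.2.2) {t : ℝ}
    (h : Exit e ulo (fun s => (φ s x).1) (fun s => (φ s x).2.1) (fun s => (φ s x).2.2.1) t)
    (hℓ : ulo = 119/100 ∨ (ulo = 143/100 ∧ 145/100 ≤ (φ t x).2.2.1))
    (h1 : x ∉ VC φ e ulo) (h2 : x ∉ OC φ e ulo) :
    (Tendsto (fun s => (φ s x).1) atTop (𝓝 0) ∧ Tendsto (fun s => (φ s x).2.1) atTop (𝓝 0) ∧
      Tendsto (fun s => (φ s x).2.2.1) atTop (𝓝 2)) ∧ (φ t x).2.2.1 + x.2.2.2 < 0 ∧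
    (∀ s, 0 ≤ s → GU ulo (φ s x).1 (φ s x).2.1 (φ s x).2.2.1) := by
  have hd : ∀ T, Desc e ulo x.2.2.2 (fun s => (φ (s + t) x).1) (fun s => (φ (s + t) x).2.1)
      (fun s => (φ (s + t) x).2.2.1) T := fun T =>
    h.desc hφ hp hm hℓ (fun s hs hU hq => h.hV h1 hs.1 hU hq) (fun s hs hU => h.hO h2 hs.1 hU)
  have hos := (hφ.orb x).shift t
  have hlan := hos.desc_lands hp hm (by simpa using h.q2) hd
  have tr : ∀ f : ℝ → ℝ, ∀ c : ℝ, Tendsto (fun s => f (s + t)) atTop (𝓝 c) → Tendsto f atTop (𝓝 c) := by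
    intro f c hf
    have := hf.comp (tendsto_atTop_add_const_right atTop (-t) tendsto_id)
    refine this.congr fun s => ?_
    simp
  refine ⟨⟨tr _ _ hlan.1, tr _ _ hlan.2.1, tr _ _ hlan.2.2⟩, ?_, ?_⟩
  · by_contra hc
    push Not at hc
    obtain ⟨a1, a2, a3⟩ := hp.two_hundred
    have hI := h.inv t ⟨h.pos.le, le_rfl⟩
    refine hos.forced_O hp hm (T := 200/e^2) (κ := 5/100) (g := -(1/100)) le_rfl (by norm_num) ?_
      (by norm_num) (by norm_num) (by simpa using h.q2) fun s hs => ?_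
    · have := hI.q0
      simp only [zero_add]
      linarith
    · have hs' : s ∈ Ico 0 (s + 1) := ⟨hs.1, by linarith⟩
      refine ⟨((hd _).gf s hs').1, (hd _).y0 s hs', (hd _).y7 s hs', ?_⟩
      have := (abs_le.1 (hos.u_short hp hm hs.1 (by linarith [hs.2]) fun r hr =>
        ((hd (r + 1)).gf r ⟨hr.1.le, by linarith⟩).1)).1
      simp only [zero_add] at this
      linarith
  · intro s hs
    have := h.gu_append (T := s) (fun r hr => ((hd (r+1)).gf r ⟨hr.1, by linarith⟩).1)
    exact this s ⟨hs, by linarith [h.pos]⟩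

lemma Orb.barrier_O (ho : Orb e η ζ μ q y u) (hp : Par e η ζ) (hm : MU ulo μ) {a b : ℝ}
    (h0 : y a ≤ -(q a * (1/20 - q a)))
    (h : ∀ s ∈ Icc a b, GU ulo (q s) (y s) (u s) ∧ -(1/100) ≤ 8 * (u s + μ) ∧ 8 * (u s + μ) ≤ 3) :
    ∀ s ∈ Icc a b, y s ≤ -(q s * (1/20 - q s)) := by
  have e0 := hp.e0
  have e1 := hp.e1
  have cq := ho.cq
  have cy := ho.cy
  have := barrier_pos' (f := fun s => -(q s * (1/20 - q s)) - y s) (a := a) (b := b) (by fun_prop)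
    (by simpa using h0) (fun s hs _ hz => by
      obtain ⟨hU, hg, hg3⟩ := h s hs
      have hb := hU.box hm
      refine ⟨_, ?_, (((ho.dq s hb).mul ((ho.dq s hb).const_sub _)).neg).sub (ho.dy s hb)⟩
      have hy : y s = -(q s * (1/20 - q s)) := by linarith
      have h1 := hU.q0
      have h3 : (21/10 - u s) * e ≤ 1 * (1/100000) :=
        mul_le_mul (by linarith [hm.lo, hU.u0]) e1 e0.le (by norm_num)
      rw [FY, hy]
      have h4 : 0 ≤ q s * (3 - 8 * (u s + μ)) := mul_nonneg h1.le (by linarith)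
      have h5 : 0 < q s * (1/20 * (1/20 + 8 * (u s + μ)) + q s * (4 - 3/20 - 8 * (u s + μ))
        - 2 * ((21/10 - u s) * e)) := mul_pos h1 (by linarith)
      linarith)
  intro s hs
  rcases hs.1.eq_or_lt with h' | h'
  · rw [← h']; exact h0
  · linarith [this s ⟨h', hs.2⟩]

lemma Orb.barrier_V (ho : Orb e η ζ μ q y u) (hp : Par e η ζ) (hm : MU ulo μ) {a b : ℝ}
    (h0 : 0 ≤ y a + q a * (21/10 - q a))
    (h : ∀ s ∈ Icc a b, GU ulo (q s) (y s) (u s) ∧ 8 * (u s + μ) ≤ -(215/100)) :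
    ∀ s ∈ Icc a b, 0 ≤ y s + q s * (21/10 - q s) := by
  have e0 := hp.e0
  have e1 := hp.e1
  have cq := ho.cq
  have cy := ho.cy
  have := barrier_pos' (f := fun s => y s + q s * (21/10 - q s)) (a := a) (b := b) (by fun_prop)
    (by simpa using h0) (fun s hs _ hz => by
      obtain ⟨hU, hg⟩ := h s hs
      have hb := hU.box hm
      refine ⟨_, ?_, (ho.dy s hb).add ((ho.dq s hb).mul ((ho.dq s hb).const_sub _))⟩
      have hy : y s = -(q s * (21/10 - q s)) := by linarith
      have h1 := hU.q0
      have h2 := hU.q1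
      have h3 : 0 ≤ (21/10 - u s) * e := mul_nonneg (by linarith [hU.u1]) e0.le
      rw [FY, hy]
      have h4 : 0 ≤ (21/10 - q s) * (-(8 * (u s + μ)) - 215/100) := mul_nonneg (by linarith) (by linarith)
      have h5 : 0 < q s * (-((21/10 - q s) * (8 * (u s + μ))) - 441/100 + 23/10 * q s
        + 2 * ((21/10 - u s) * e)) := mul_pos h1 (by linarith)
      linarith)
  intro s hs
  rcases hs.1.eq_or_lt with h' | h'
  · rw [← h']; exact h0
  · exact (this s ⟨h', hs.2⟩).le

lemma Exit.to_O (hφ : PFlow e η ζ φ) (hp : Par e η ζ) {x : St} (hm : MU ulo x.2.2.2) {t : ℝ}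
    (h : Exit e ulo (fun s => (φ s x).1) (fun s => (φ s x).2.1) (fun s => (φ s x).2.2.1) t)
    (hℓ : ulo = 119/100 ∨ (ulo = 143/100 ∧ 145/100 ≤ (φ t x).2.2.1))
    (hg0 : 0 ≤ (φ t x).2.2.1 + x.2.2.2) (hg1 : 8 * ((φ t x).2.2.1 + x.2.2.2) ≤ 29/10) :
    x ∈ OC φ e ulo := by
  by_contra h2
  have e0 := hp.e0
  have e1 := hp.e1
  obtain ⟨a1, a2, a3⟩ := hp.two_hundred
  have hI := h.inv t ⟨h.pos.le, le_rfl⟩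
  have hos := (hφ.orb x).shift t
  have hu : ∀ s ∈ Icc 0 (201/e^2), (∀ r ∈ Ioo 0 s, GU ulo (φ (r + t) x).1 (φ (r + t) x).2.1
      (φ (r + t) x).2.2.1) → -(1/100) ≤ 8 * ((φ (s + t) x).2.2.1 + x.2.2.2) ∧
        8 * ((φ (s + t) x).2.2.1 + x.2.2.2) ≤ 3 := by
    intro s hs hU
    have := abs_le.1 (hos.u_short hp hm hs.1 (by linarith [hs.2]) hU)
    simp only [zero_add] at this
    constructor <;> linarith [this.1, this.2]
  have hd : Desc e ulo x.2.2.2 (fun s => (φ (s + t) x).1) (fun s => (φ (s + t) x).2.1)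
      (fun s => (φ (s + t) x).2.2.1) (201/e^2) := by
    refine h.desc hφ hp hm hℓ (fun s hs hU hq => ?_) (fun s hs hU => h.hO h2 hs.1 hU)
    have h3 := hos.barrier_O hp hm (a := 0) (b := s) ?_ (fun r hr => ⟨hU r hr, hu r ⟨hr.1, hr.2.trans hs.2⟩
      fun r' hr' => hU r' ⟨hr'.1.le, hr'.2.le.trans hr.2⟩⟩) s ⟨hs.1, le_rfl⟩
    · have h4 := (hU s ⟨hs.1, le_rfl⟩).q0
      nlinarith
    · have h4 := h.y0
      have h5 := hI.q0
      simp only [zero_add]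
      nlinarith
  refine hos.forced_O hp hm (T := 200/e^2) (κ := 5/100) (g := -(1/100)) le_rfl (by norm_num) ?_
    (by norm_num) (by norm_num) (by simpa using h.q2) fun s hs => ?_
  · have := hI.q0
    simp only [zero_add]
    linarith
  · have hs' : s ∈ Ico 0 (201/e^2) := ⟨hs.1, by linarith [hs.2]⟩
    exact ⟨(hd.gf s hs').1, hd.y0 s hs', hd.y7 s hs', (hu s ⟨hs.1, hs'.2.le⟩ fun r hr =>
      (hd.gf r ⟨hr.1.le, hr.2.trans hs'.2⟩).1).1⟩

lemma Exit.to_V (hφ : PFlow e η ζ φ) (hp : Par e η ζ) {x : St} (hm : MU ulo x.2.2.2) {t : ℝ}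
    (h : Exit e ulo (fun s => (φ s x).1) (fun s => (φ s x).2.1) (fun s => (φ s x).2.2.1) t)
    (hℓ : ulo = 119/100 ∨ (ulo = 143/100 ∧ 145/100 ≤ (φ t x).2.2.1))
    (hg1 : 8 * ((φ t x).2.2.1 + x.2.2.2) ≤ -(22/10)) :
    x ∈ VC φ e ulo := by
  by_contra h2
  have e0 := hp.e0
  have e1 := hp.e1
  obtain ⟨a1, a2, a3⟩ := hp.two_hundred
  have hI := h.inv t ⟨h.pos.le, le_rfl⟩
  have hos := (hφ.orb x).shift t
  have hu : ∀ s ∈ Icc 0 (201/e^2), (∀ r ∈ Ioo 0 s, GU ulo (φ (r + t) x).1 (φ (r + t) x).2.1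
      (φ (r + t) x).2.2.1) → 8 * ((φ (s + t) x).2.2.1 + x.2.2.2) ≤ -(215/100) := by
    intro s hs hU
    have := abs_le.1 (hos.u_short hp hm hs.1 (by linarith [hs.2]) hU)
    simp only [zero_add] at this
    linarith [this.1, this.2]
  have h0 : 0 ≤ (φ t x).2.1 + (φ t x).1 * (21/10 - (φ t x).1) := by
    have b1 := hI.q0
    have b2 := hI.q2
    have b3 := hI.low
    have b4 := hI.band
    rcases lt_or_ge (φ t x).2.1 0 with hy | hy
    · have := b4 hy
      nlinarith
    · have : 0 ≤ (φ t x).1 * (21/10 - (φ t x).1) := mul_nonneg (by linarith) (by linarith)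
      linarith
  have hd : Desc e ulo x.2.2.2 (fun s => (φ (s + t) x).1) (fun s => (φ (s + t) x).2.1)
      (fun s => (φ (s + t) x).2.2.1) (201/e^2) := by
    refine h.desc hφ hp hm hℓ (fun s hs hU hq => h.hV h2 hs.1 hU hq) (fun s hs hU => ?_)
    have h3 := hos.barrier_V hp hm (a := 0) (b := s) (by simpa using h0)
      (fun r hr => ⟨(hU r hr).1, hu r ⟨hr.1, hr.2.trans hs.2⟩
      fun r' hr' => (hU r' ⟨hr'.1.le, hr'.2.le.trans hr.2⟩).1⟩) s ⟨hs.1, le_rfl⟩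
    have h4 := (hU s ⟨hs.1, le_rfl⟩).1.q0
    nlinarith
  refine hos.forced_V hp hm (T := 200/e^2) le_rfl (by simpa using hI.q0) (by simpa using h.q2)
    (by simpa using h0) fun s hs => ?_
  have hs' : s ∈ Ico 0 (201/e^2) := ⟨hs.1, by linarith [hs.2]⟩
  exact ⟨(hd.gf s hs').1, hd.y0 s hs', hd.y7 s hs', hu s ⟨hs.1, hs'.2.le⟩ fun r hr =>
    (hd.gf r ⟨hr.1.le, hr.2.trans hs'.2⟩).1, fun hq => h.hV h2 hs.1 (fun r hr =>
      (hd.gf r ⟨hr.1, hr.2.trans_lt hs'.2⟩).1) hq⟩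

/-- A late exit passes close to the turbulent plateau. -/
lemma Exit.mid (ho : Orb e η ζ μ q y u) (hp : Par e η ζ) (hm : MU ulo μ) {t : ℝ}
    (h : Exit e ulo q y u t) (hu : 1/10 ≤ u 0 - u t) :
    ∃ s ∈ Icc 0 t, 2 - 2*e ≤ q s ∧ q s ≤ 2 ∧ |y s| ≤ 2*e/100 ∧ |u t - u s| ≤ 1/10^20 := by
  have e0 := hp.e0
  have e1 := hp.e1
  have h26 : 26/e < t := by
    by_contra hc
    push Not at hc
    have := (abs_le.1 (ho.u_short hp hm h.pos.le (by linarith [hp.e_ratio]) fun s hs =>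
      (h.inv s ⟨hs.1.le, hs.2.le⟩).gu)).1
    linarith
  have h100 : 25/e + 101 ≤ 26/e := by
    rw [show 26/e = 25/e + 1/e by ring]
    have : 101 ≤ 1/e := by rw [le_div_iff₀ e0]; linarith
    linarith
  have h25 : 0 < 25/e := by positivity
  have hband : ∀ s ∈ Icc (t - 100) t, 2 - 2*e ≤ q s := by
    have key : ∀ s ∈ Ioo (25/e) t, 2 - 2*e ≤ q s := by
      intro s hs
      exact (ho.band_time hp hm (T := s) hs.1.le (fun r hr =>
        ⟨h.inv r ⟨hr.1, by linarith [hr.2, hs.2]⟩, h.srp r ⟨hr.1, by linarith [hr.2, hs.2]⟩⟩) s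
        ⟨hs.1, le_rfl⟩).le
    intro s hs
    rcases hs.2.eq_or_lt with h1 | h1
    · rw [h1]
      refine ge_of_tendsto (x := 𝓝[<] t) (ho.cq.continuousAt.mono_left nhdsWithin_le_nhds) ?_
      filter_upwards [Ioo_mem_nhdsLT (show 25/e < t by linarith)] with r hr using key r hr
    · exact key s ⟨by linarith [hs.1], h1⟩
  obtain ⟨s, hs, hd⟩ := exists_hasDerivAt_eq_slope q y (show t - 100 < t by linarith)
    ho.cq.continuousOn fun s hs => ho.dq s ((h.inv s ⟨by linarith [hs.1], hs.2.le⟩).gu.box hm)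
  have hs' : s ∈ Icc 0 t := ⟨by linarith [hs.1], hs.2.le⟩
  refine ⟨s, hs', hband s ⟨hs.1.le, hs.2.le⟩, (h.inv s hs').q2, ?_, ?_⟩
  · have b1 := hband t ⟨by linarith, le_rfl⟩
    have b2 := hband (t - 100) ⟨le_rfl, by linarith⟩
    have b3 := (h.inv t ⟨h.pos.le, le_rfl⟩).q2
    have b4 := (h.inv (t-100) ⟨by linarith, by linarith⟩).q2
    rw [hd, show t - (t - 100) = 100 by ring, abs_le]
    constructor <;> linarith
  · refine ho.u_short hp hm hs.2.le ?_ fun r hr => (h.inv r ⟨by linarith [hr.1, hs'.1], hr.2.le⟩).gu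
    have := hp.e_ratio
    linarith [hs.1]

end exits

/-- Along a curve leading from `A` to `B`, the first point outside `A` belongs to neither. -/
lemma exists_first_neither {A B : Set St} (hA : IsOpen A) (hB : IsOpen B) {c : ℝ → St} {a b : ℝ}
    (hab : a ≤ b) (hc : ContinuousOn c (Icc a b))
    (hdis : ∀ m ∈ Icc a b, ¬ (c m ∈ A ∧ c m ∈ B)) (ha : c a ∈ A) (hb : c b ∈ B) :
    ∃ m ∈ Ioc a b, (∀ m' ∈ Ico a m, c m' ∈ A) ∧ c m ∉ A ∧ c m ∉ B := by
  let X : ℝ → St := fun t => c (projIcc a b hab t)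
  have hX : Continuous X := hc.domRestrict.comp continuous_projIcc
  have hXe : ∀ t ∈ Icc a b, X t = c t := fun t ht => by simp only [X]; rw [projIcc_of_mem hab ht]
  have haI : a ∈ Icc a b := ⟨le_rfl, hab⟩
  have hbI : b ∈ Icc a b := ⟨hab, le_rfl⟩
  rcases first_exit hX hA (a := a) (by rw [hXe a haI]; exact ha) b with h | ⟨t, ht, hex, hin⟩
  · exact absurd ⟨hXe b hbI ▸ h b hbI, hb⟩ (hdis b hbI)
  have htI : t ∈ Icc a b := ⟨ht.1.le, ht.2⟩
  have hin' : ∀ m' ∈ Ico a t, c m' ∈ A := fun m' hm' => by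
    have := hin m' hm'
    rwa [hXe m' ⟨hm'.1, hm'.2.le.trans ht.2⟩] at this
  refine ⟨t, ht, hin', hXe t htI ▸ hex, fun hBt => ?_⟩
  have h1 : ∀ᶠ s in 𝓝[<] t, X s ∈ B :=
    (hX.continuousAt.eventually (hB.mem_nhds (by rw [hXe t htI]; exact hBt))).filter_mono
      nhdsWithin_le_nhds
  obtain ⟨s, hs, hsI⟩ := (h1.and (Ioo_mem_nhdsLT ht.1)).exists
  have hsI' : s ∈ Icc a b := ⟨hsI.1.le, hsI.2.le.trans ht.2⟩
  exact hdis s hsI' ⟨hin' s ⟨hsI.1.le, hsI.2⟩, hXe s hsI' ▸ hs⟩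

section curves
variable {e η ζ μ ulo ℓ : ℝ} {φ : ℝ → St → St} {c : ℝ → St} {a b : ℝ}

/-- A landing lap which passes near the turbulent plateau. -/
structure Land (e ulo : ℝ) (φ : ℝ → St → St) (x : St) : Prop where
  lim : Tendsto (fun s => (φ s x).1) atTop (𝓝 0) ∧ Tendsto (fun s => (φ s x).2.1) atTop (𝓝 0) ∧
      Tendsto (fun s => (φ s x).2.2.1) atTop (𝓝 2)
  gu : ∀ s, 0 ≤ s → GU ulo (φ s x).1 (φ s x).2.1 (φ s x).2.2.1
  mid : ∃ s, 0 < s ∧ 2 - 2*e ≤ (φ s x).1 ∧ (φ s x).1 ≤ 2 ∧ |(φ s x).2.1| ≤ 2*e/100 ∧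
    (φ s x).2.2.1 ≤ 1/10^10 - x.2.2.2

lemma Exit.land (hφ : PFlow e η ζ φ) (hp : Par e η ζ) {x : St} (hm : MU ulo x.2.2.2) {t : ℝ}
    (h : Exit e ulo (fun s => (φ s x).1) (fun s => (φ s x).2.1) (fun s => (φ s x).2.2.1) t)
    (hℓ : ulo = 119/100 ∨ (ulo = 143/100 ∧ 145/100 ≤ (φ t x).2.2.1))
    (h1 : x ∉ VC φ e ulo) (h2 : x ∉ OC φ e ulo) (hu : 1/10 ≤ x.2.2.1 + x.2.2.2)
    (hq : x.1 = 1/20) : Land e ulo φ x := by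
  obtain ⟨a1, a2, a3⟩ := h.lands hφ hp hm hℓ h1 h2
  have e0 := hp.e0
  have e1 := hp.e1
  refine ⟨a1, a3, ?_⟩
  obtain ⟨s, hs, b1, b2, b3, b4⟩ := Exit.mid (hφ.orb x) hp hm h (by rw [hφ.zero]; linarith)
  refine ⟨s, lt_of_le_of_ne hs.1 ?_, b1, b2, b3, ?_⟩
  · rintro rfl
    rw [hφ.zero, hq] at b1
    linarith
  · linarith [(abs_le.1 b4).1]

/-- A curve of lap starts. -/
structure LapCurve (ulo : ℝ) (c : ℝ → St) (a b : ℝ) : Prop where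
  ab : a ≤ b
  cont : ContinuousOn c (Icc a b)
  mu : ∀ m ∈ Icc a b, MU ulo (c m).2.2.2
  st : ∀ m ∈ Icc a b, LapS ulo (c m).1 (c m).2.1 (c m).2.2.1
  left : (c a).2.1 ≤ 185/100 * (c a).1
  leftγ : 8 * ((c a).2.2.1 + (c a).2.2.2) ≤ 18/10
  right : 205/100 * (c b).1 ≤ (c b).2.1
  rightγ : 219/100 ≤ 8 * ((c b).2.2.1 + (c b).2.2.2)
  g : ∀ m ∈ Icc a b, 1/10 ≤ (c m).2.2.1 + (c m).2.2.2

lemma LapCurve.aI (h : LapCurve ulo c a b) : a ∈ Icc a b := ⟨le_rfl, h.ab⟩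
lemma LapCurve.bI (h : LapCurve ulo c a b) : b ∈ Icc a b := ⟨h.ab, le_rfl⟩

lemma LapCurve.left_O (hφ : PFlow e η ζ φ) (hp : Par e η ζ) (h : LapCurve ulo c a b)
    (hℓ : (ulo = 119/100 ∧ ℓ = 1) ∨ (ulo = 143/100 ∧ ℓ = 145/100 ∧ 146/100 ≤ (c a).2.2.1)) :
    c a ∈ SMc φ e ℓ ∧ c a ∈ OC φ e ulo := by
  have hm := h.mu a h.aI
  have hs := h.st a h.aI
  have hg := h.g a h.aI
  obtain ⟨h1, t, ht, hE⟩ := lap_down hφ hp hm hs h.left h.leftγ hℓ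
  refine ⟨h1, ?_⟩
  have := abs_le.1 ((hφ.orb (c a)).u_short hp hm hE.pos.le (by linarith [hp.e_ratio]) fun r hr =>
    (hE.inv r ⟨hr.1.le, hr.2.le⟩).gu)
  rw [hφ.zero] at this
  have hγ := h.leftγ
  refine hE.to_O hφ hp hm ?_ ?_ ?_
  · rcases hℓ with h2 | h2
    · exact Or.inl h2.1
    · exact Or.inr ⟨h2.1, by linarith [h2.2.2, this.1]⟩
  · linarith [this.1]
  · linarith [this.2]

/-- The critical parameter of a curve of laps. -/
lemma LapCurve.crit (hφ : PFlow e η ζ φ) (hp : Par e η ζ) (h : LapCurve (119/100) c a b) :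
    ∃ m₂ ∈ Ioc a b, (∀ m ∈ Ico a m₂, c m ∈ SMc φ e 1) ∧ c m₂ ∉ SMc φ e 1 ∧ c m₂ ∉ SPc φ e :=
  exists_first_neither (isOpen_SMc hφ) (isOpen_SPc hφ) h.ab h.cont (fun m _ => not_SMc_SPc (c m))
    (h.left_O hφ hp (Or.inl ⟨rfl, rfl⟩)).1
    (lap_up hφ hp (h.mu b h.bI) (h.st b h.bI) h.right h.rightγ (ℓ := 1) (Or.inl ⟨rfl, rfl⟩))

lemma VC_of_path (hφ : PFlow e η ζ φ) {x : St} {t : ℝ} (ht : 0 ≤ t)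
    (h : ∀ s ∈ Icc 0 t, φ s x ∈ SU ulo) (hx : φ t x ∈ VC φ e ulo) : x ∈ VC φ e ulo := by
  obtain ⟨T, hT, hV, hU⟩ := hx
  refine ⟨T + t, by linarith, by rw [hφ.add]; exact hV, fun s hs => ?_⟩
  rcases le_total s t with h1 | h1
  · exact h s ⟨hs.1, h1⟩
  · have := hU (s - t) ⟨by linarith, by linarith [hs.2]⟩
    rwa [← hφ.add, sub_add_cancel] at this

/-- Exit points of laps with ever longer exit times accumulate on an orbit that stays in the upper
band in backward time. -/
lemma exit_limit (hφ : PFlow e η ζ φ) (hp : Par e η ζ) {x : ℕ → St} {x₀ : St}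
    (hx : Tendsto x atTop (𝓝 x₀)) (hm : ∀ n, MU ulo (x n).2.2.2) {t : ℕ → ℝ} (ht : ∀ n : ℕ, (n : ℝ) ≤ t n)
    (hE : ∀ n, Exit e ulo (fun s => (φ s (x n)).1) (fun s => (φ s (x n)).2.1)
      (fun s => (φ s (x n)).2.2.1) (t n)) (hV : ∀ n, x n ∉ VC φ e ulo) :
    ∃ Z : St, Z ∉ VC φ e ulo ∧ Z.2.2.2 = x₀.2.2.2 ∧ Z.1 = 2 - 2*e ∧
      ∀ s ≤ 0, (φ s Z).1 ∈ Icc (2 - 2*e) 2 ∧ (φ s Z).2.1 ∈ Icc (-1) 15 ∧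
        (φ s Z).2.2.1 ∈ Icc (119/100) (401/200) := by
  have e0 := hp.e0
  have e1 := hp.e1
  have h25 : 0 < 25/e := by positivity
  have hlow : ∀ n, ∀ s ∈ Ioc (25/e) (t n), 2 - 2*e ≤ (φ s (x n)).1 := by
    intro n s hs
    have hop : ∀ r ∈ Ioo (25/e) (t n), 2 - 2*e ≤ (φ r (x n)).1 := fun r hr =>
      ((hφ.orb (x n)).band_time hp (hm n) hr.1.le (fun r' hr' =>
        ⟨(hE n).inv r' ⟨hr'.1, hr'.2.trans hr.2.le⟩, (hE n).srp r' ⟨hr'.1, hr'.2.trans_lt hr.2⟩⟩) r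
        ⟨hr.1, le_rfl⟩).le
    rcases hs.2.lt_or_eq with h | h
    · exact hop s ⟨hs.1, h⟩
    · have hmid : (25/e + s)/2 < s := by linarith [hs.1]
      refine le_of_le_on_Ico hmid continuous_const (hφ.orb (x n)).cq fun r hr => hop r ⟨?_, ?_⟩
      · linarith [hr.1, hs.1]
      · linarith [hr.2]
  let Z : ℕ → St := fun n => φ (t n) (x n)
  have hbd : ∀ n, ∀ s ∈ Icc 0 (t n), (φ s (x n)).1 ≤ 2 ∧ (φ s (x n)).2.1 ∈ Icc (-21) 15 ∧
      (φ s (x n)).2.2.1 ∈ Icc (119/100) (401/200) := by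
    intro n s hs
    have hI := (hE n).inv s hs
    have h1 := hI.q2
    have h2 := hI.q0
    have h3 := hI.low
    have h4 := hI.y7
    exact ⟨h1, ⟨by linarith, by linarith⟩, by linarith [hI.gu.u0, (hm n).lo], hI.gu.u1.le⟩
  have ht0 : ∀ n, t n ∈ Icc 0 (t n) := fun n => ⟨(hE n).pos.le, le_rfl⟩
  have hK : ∀ n, Z n ∈ Icc ((0, -21, 1, -2) : St) (2, 15, 3, -1) := by
    intro n
    obtain ⟨h1, h2, h3⟩ := hbd n (t n) (ht0 n)
    have h4 := ((hE n).inv (t n) (ht0 n)).q0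
    have h5 : (Z n).2.2.2 = (x n).2.2.2 := hφ.mu _ _
    exact ⟨⟨by linarith, h2.1, by linarith [h3.1], by linarith [(hm n).m0]⟩,
      ⟨h1, h2.2, by linarith [h3.2], by linarith [(hm n).m1]⟩⟩
  obtain ⟨z, -, θ, hθ, hlim⟩ := isCompact_Icc.tendsto_subseq hK
  have hflow : ∀ s, Tendsto (fun n => φ (s + t (θ n)) (x (θ n))) atTop (𝓝 (φ s z)) := by
    intro s
    have : Tendsto (fun n => φ s (Z (θ n))) atTop (𝓝 (φ s z)) :=
      ((hφ.cont.comp (by fun_prop : Continuous fun z : St => (s, z))).tendsto z).comp hlim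
    simpa only [Z, ← hφ.add] using this
  have htt : Tendsto (fun n => t (θ n)) atTop atTop :=
    tendsto_atTop_mono (fun n => ht (θ n))
      (tendsto_natCast_atTop_atTop.comp hθ.tendsto_atTop)
  have hbk : ∀ s ≤ 0, (φ s z).1 ∈ Icc (2 - 2*e) 2 ∧ (φ s z).2.1 ∈ Icc (-1) 15 ∧
        (φ s z).2.2.1 ∈ Icc (119/100) (401/200) := by
    intro s hs
    have hev : ∀ᶠ n in atTop, φ (s + t (θ n)) (x (θ n)) ∈ {p : St | p.1 ∈ Icc (2 - 2*e) 2 ∧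
        p.2.1 ∈ Icc (-1) 15 ∧ p.2.2.1 ∈ Icc (119/100) (401/200)} := by
      filter_upwards [htt.eventually_gt_atTop (25/e - s)] with n hn
      have hI1 : s + t (θ n) ∈ Icc 0 (t (θ n)) := ⟨by linarith, by linarith⟩
      obtain ⟨h1, h2, h3⟩ := hbd (θ n) _ hI1
      have h4 := hlow (θ n) (s + t (θ n)) ⟨by linarith, hI1.2⟩
      have h5 := ((hE (θ n)).inv _ hI1).low
      exact ⟨⟨h4, h1⟩, ⟨by linarith, h2.2⟩, h3⟩
    have hcl : IsClosed {p : St | p.1 ∈ Icc (2 - 2*e) 2 ∧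
        p.2.1 ∈ Icc (-1) 15 ∧ p.2.2.1 ∈ Icc (119/100) (401/200)} :=
      (isClosed_Icc.preimage continuous_fst).inter
        ((isClosed_Icc.preimage (continuous_fst.comp continuous_snd)).inter
        (isClosed_Icc.preimage (continuous_fst.comp (continuous_snd.comp continuous_snd))))
    exact hcl.mem_of_tendsto (hflow s) hev
  have hz0 : (fun n => φ (0 + t (θ n)) (x (θ n))) = Z ∘ θ := by
    funext n
    simp [Z]
  refine ⟨z, fun hzV => ?_, ?_, le_antisymm ?_ ?_, hbk⟩
  · obtain ⟨n, hn⟩ := (hlim.eventually ((isOpen_VC hφ).mem_nhds hzV)).exists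
    exact hV (θ n) (VC_of_path hφ (ht0 (θ n)).1 (fun s hs => ((hE (θ n)).inv s hs).gu) hn)
  · have h1 : Tendsto (fun n => ((Z ∘ θ) n).2.2.2) atTop (𝓝 z.2.2.2) :=
      ((continuous_snd.comp (continuous_snd.comp continuous_snd)).tendsto z).comp hlim
    have h2 : Tendsto (fun n => ((x ∘ θ) n).2.2.2) atTop (𝓝 x₀.2.2.2) :=
      ((continuous_snd.comp (continuous_snd.comp continuous_snd)).tendsto x₀).comp
        (hx.comp hθ.tendsto_atTop)
    refine tendsto_nhds_unique h1 (h2.congr fun n => ?_)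
    exact (hφ.mu _ _).symm
  · have h1 : Tendsto (fun n => ((Z ∘ θ) n).1) atTop (𝓝 z.1) := (continuous_fst.tendsto z).comp hlim
    exact le_of_tendsto h1 (Eventually.of_forall fun n => (hE (θ n)).q2)
  · have := (hbk 0 le_rfl).1.1
    rwa [hφ.zero] at this

/-- Below the critical parameter either some lap lands, or the exit points accumulate on an orbit
that stays in the upper band in backward time. -/
lemma LapCurve.back (hφ : PFlow e η ζ φ) (hp : Par e η ζ) (h : LapCurve (119/100) c a b) {m₂ : ℝ}
    (hm : m₂ ∈ Ioc a b) (h1 : ∀ m ∈ Ico a m₂, c m ∈ SMc φ e 1) (h2 : c m₂ ∉ SMc φ e 1)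
    (h3 : c m₂ ∉ SPc φ e) :
    (∃ m ∈ Icc a b, Land e (119/100) φ (c m)) ∨
    ∃ Z : St, Z ∉ VC φ e (119/100) ∧ Z.2.2.2 = (c m₂).2.2.2 ∧ Z.1 = 2 - 2*e ∧
      ∀ s ≤ 0, (φ s Z).1 ∈ Icc (2 - 2*e) 2 ∧ (φ s Z).2.1 ∈ Icc (-1) 15 ∧
        (φ s Z).2.2.1 ∈ Icc (119/100) (401/200) := by
  have hsub : Ico a m₂ ⊆ Icc a b := fun x hx => ⟨hx.1, hx.2.le.trans hm.2⟩
  have hm₂ : m₂ ∈ Icc a b := ⟨hm.1.le, hm.2⟩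
  have hex : ∀ m ∈ Ico a m₂, ∃ t, Exit e (119/100) (fun s => (φ s (c m)).1)
      (fun s => (φ s (c m)).2.1) (fun s => (φ s (c m)).2.2.1) t := fun m hm' => by
    obtain ⟨t, ht, -⟩ := SMc.exit hφ hp (h.mu m (hsub hm')) (h.st m (hsub hm')) (ℓ := 1)
      (Or.inl ⟨rfl, rfl⟩) (h1 m hm')
    exact ⟨t, ht⟩
  by_cases hV : ∃ m ∈ Ico a m₂, c m ∈ VC φ e (119/100)
  · left
    obtain ⟨m₁, hm₁, hV⟩ := hV
    have hsub1 : Icc a m₁ ⊆ Ico a m₂ := fun x hx => ⟨hx.1, hx.2.trans_lt hm₁.2⟩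
    obtain ⟨m, hm', h4, h5⟩ := exists_neither (isOpen_OC hφ) (isOpen_VC hφ) hm₁.1
      (h.cont.mono (hsub1.trans hsub))
      (fun m hm => fun hh => not_VC_OC hφ hp (h.mu m (hsub (hsub1 hm))) ⟨hh.2, hh.1⟩)
      (h.left_O hφ hp (ℓ := 1) (Or.inl ⟨rfl, rfl⟩)).2 hV
    have hmI := hsub (hsub1 hm')
    obtain ⟨t, hE⟩ := hex m (hsub1 hm')
    exact ⟨m, hmI, hE.land hφ hp (h.mu m hmI) (Or.inl rfl) h5 h4 (h.g m hmI) (h.st m hmI).q0⟩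
  · right
    push Not at hV
    have htr := lap_trapped hφ hp (h.mu m₂ hm₂) (h.st m₂ hm₂) h2 h3
    have hoS : IsOpen {z : St | SRp e z.1 z.2.1} := (isOpen_SRp e).preimage continuous_drop
    have hc : Tendsto c (𝓝[<] m₂) (𝓝 (c m₂)) :=
      (h.cont m₂ hm₂).mono_left (nhdsWithin_le_of_mem
        (Filter.mem_of_superset (Ioo_mem_nhdsLT hm.1) fun x hx => hsub ⟨hx.1.le, hx.2⟩))
    have key : ∀ n : ℕ, ∃ m ∈ Ico a m₂, dist (c m) (c m₂) < 1/((n : ℝ) + 1) ∧ ∃ t, (n : ℝ) ≤ t ∧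
        Exit e (119/100) (fun s => (φ s (c m)).1) (fun s => (φ s (c m)).2.1)
          (fun s => (φ s (c m)).2.2.1) t := by
      intro n
      have h6 : ∀ᶠ z in 𝓝 (c m₂), ∀ s ∈ Icc 0 (n : ℝ), φ s z ∈ {z : St | SRp e z.1 z.2.1} :=
        eventually_forall_Icc hφ.cont hoS fun s hs => (htr s hs.1).1
      have h7 : ∀ᶠ z in 𝓝 (c m₂), dist z (c m₂) < 1/((n : ℝ) + 1) :=
        Metric.ball_mem_nhds _ (by positivity)
      obtain ⟨m, ⟨h8, h9⟩, hm'⟩ := ((hc.eventually (h6.and h7)).and (Ioo_mem_nhdsLT hm.1)).exists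
      have hmI : m ∈ Ico a m₂ := ⟨hm'.1.le, hm'.2⟩
      obtain ⟨t, hE⟩ := hex m hmI
      refine ⟨m, hmI, h9, t, ?_, hE⟩
      by_contra hcon
      push Not at hcon
      have h10 : SRp e (φ t (c m)).1 (φ t (c m)).2.1 := h8 t ⟨hE.pos.le, hcon.le⟩
      have hq2 := hE.q2
      have hy0 := hE.y0
      rcases h10.2 with h11 | h11 <;> linarith
    choose m hmI hd t ht hE using key
    have hx : Tendsto (fun n => c (m n)) atTop (𝓝 (c m₂)) := by
      rw [tendsto_iff_dist_tendsto_zero]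
      exact squeeze_zero (fun _ => dist_nonneg) (fun n => (hd n).le)
        tendsto_one_div_add_atTop_nhds_zero_nat
    exact exit_limit hφ hp hx (fun n => h.mu _ (hsub (hmI n))) ht hE fun n => hV _ (hmI n)

lemma FU_le_of_band {q u μ : ℝ} (hp : Par e η ζ) (hq : 199/100 ≤ q) (hu : 145/100 ≤ u)
    (hg0 : -(36/100) ≤ u + μ) (hg : u + μ ≤ 6/10) : FU η ζ q u μ ≤ -(η / (1 + ζ)) := by
  have hz := hp.z
  have h0 := hp.h0
  have h1 : 2 - u + 2*q*(1-u) ≤ -1 := by nlinarith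
  rw [FU, ← neg_div, div_le_div_iff₀ (by linarith) (by linarith)]
  nlinarith [mul_nonneg (mul_nonneg h0.le (by linarith : 0 ≤ 1 + ζ)) (sub_nonneg.2 h1),
    mul_nonneg h0.le (by linarith : 0 ≤ 1 - (u + μ))]

lemma level_reached (hφ : PFlow e η ζ φ) (hp : Par e η ζ) {x : St} (hm : MU (143/100) x.2.2.2)
    (h0 : LapS (143/100) x.1 x.2.1 x.2.2.1) (hu : 146/100 ≤ x.2.2.1)
    (h1 : x ∉ SMc φ e (145/100)) (h2 : x ∉ SPc φ e) :
    ∃ T > 0, (φ T x).2.2.1 = 145/100 ∧ ∀ s ∈ Ico 0 T, 145/100 < (φ s x).2.2.1 := by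
  have ho := hφ.orb x
  have e0 := hp.e0
  have e1 := hp.e1
  have hz := hp.z
  have hη := hp.h0
  have cu := ho.cu
  have cq := ho.cq
  have hB : 0 < (1 + ζ)/η := by positivity
  have hE : 0 < 25/e := by positivity
  rcases first_exit cu (isOpen_Ioi (a := (145/100 : ℝ))) (a := 0)
    (by rw [mem_Ioi, hφ.zero]; linarith) (25/e + (1 + ζ)/η) with h | ⟨T, hT, hex, hin⟩
  · exfalso
    rcases lap_cases hφ hp hm h0 (T := 25/e + (1 + ζ)/η) (ℓ := 145/100)
      (Or.inr ⟨rfl, rfl, fun s hs _ => (h s hs).le⟩) with h' | h' | ⟨t, ht, h3, h4⟩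
    · have hband := ho.band_time hp hm (T := 25/e + (1 + ζ)/η) (by linarith)
        (fun s hs => (h' s hs).symm)
      have := ge_of_deriv_le (a := 25/e) (b := 25/e + (1 + ζ)/η) (c := -(η/(1+ζ))) (by linarith)
        cu.continuousOn (fun t ht => by
          have hI := (h' t ⟨by linarith [ht.1], ht.2.le⟩).2
          refine ⟨_, ?_, ho.du t (hI.gu.box hm)⟩
          refine FU_le_of_band hp ?_ ?_ ?_ ?_
          · linarith [hband t ⟨ht.1, ht.2.le⟩]
          · exact (h t ⟨by linarith [ht.1], ht.2.le⟩).le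
          · linarith [hI.gu.u0, hm.g0]
          · linarith [hI.gu.u1, hm.g1])
      have h5 := (h' (25/e) ⟨by linarith, by linarith⟩).2.gu.u1
      have h6 : 145/100 < (φ (25/e + (1 + ζ)/η) x).2.2.1 := h _ ⟨by linarith, le_rfl⟩
      have h7 : -(η/(1+ζ)) * (25/e + (1 + ζ)/η - 25/e) = -1 := by
        field_simp
        ring
      rw [h7] at this
      linarith
    · exact h2 h'.1
    · exact h1 (h4 fun s hs => h s ⟨hs.1, hs.2.trans ht⟩)
  · refine ⟨T, hT.1, le_antisymm (not_lt.1 hex) ?_, hin⟩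
    exact le_of_le_on_Ico hT.1 continuous_const cu fun s hs => (hin s hs).le

/-- At the critical parameter of the high cut-off the lap turns back. -/
lemma cutoff_VC (hφ : PFlow e η ζ φ) (hp : Par e η ζ) {c : ℝ → St} {a m : ℝ} (ham : a < m)
    (hc : ContinuousWithinAt c (Iio m) m)
    (hmu : ∀ m' ∈ Icc a m, MU (143/100) (c m').2.2.2)
    (hst : ∀ m' ∈ Icc a m, LapS (143/100) (c m').1 (c m').2.1 (c m').2.2.1)
    (hu : 146/100 ≤ (c m).2.2.1) (hμ : (c m).2.2.2 ≤ -(1725/1000))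
    (hS : ∀ m' ∈ Ico a m, c m' ∈ SMc φ e (145/100)) (h1 : c m ∉ SMc φ e (145/100))
    (h2 : c m ∉ SPc φ e) : c m ∈ VC φ e (143/100) := by
  have hmI : m ∈ Icc a m := ⟨ham.le, le_rfl⟩
  have hm := hmu m hmI
  have h0 := hst m hmI
  have ho := hφ.orb (c m)
  have e0 := hp.e0
  have e1 := hp.e1
  have cu := ho.cu
  have cq := ho.cq
  obtain ⟨T, hT, hTu, hin⟩ := level_reached hφ hp hm h0 hu h1 h2
  have hge : ∀ s ∈ Icc 0 T, 145/100 ≤ (φ s (c m)).2.2.1 := fun s hs => by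
    rcases hs.2.lt_or_eq with h | h
    · exact (hin s ⟨hs.1, h⟩).le
    · rw [h, hTu]
  rcases lap_cases hφ hp hm h0 (T := T) (ℓ := 145/100)
      (Or.inr ⟨rfl, rfl, fun s hs _ => hge s hs⟩) with h' | h' | ⟨t, ht, h3, h4⟩
  · exfalso
    have hTl : 25/e < T := by
      by_contra hcon
      push Not at hcon
      have := (abs_le.1 (ho.u_short hp hm hT.le (by
        have := hp.e_ratio
        have h26 : 25/e ≤ 26/e := by gcongr; norm_num
        linarith) fun r hr => (h' r ⟨hr.1.le, hr.2.le⟩).2.gu)).1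
      rw [hφ.zero, hTu] at this
      linarith
    have hqT := ho.band_time hp hm hTl.le (fun s hs => (h' s hs).symm) T ⟨hTl, le_rfl⟩
    have hI := (h' T ⟨hT.le, le_rfl⟩).2
    have hd := ho.du T (hI.gu.box hm)
    have hneg := FU_le_of_band hp (q := (φ T (c m)).1) (u := (φ T (c m)).2.2.1) (μ := (c m).2.2.2)
      (by linarith) hTu.ge (by linarith [hI.gu.u0, hm.g0]) (by linarith [hI.gu.u1, hm.g1])
    have hpos : 0 < η/(1+ζ) := by have := hp.h0; have := hp.z; positivity
    obtain ⟨d, hd0, hd1⟩ := pos_right_of_deriv_pos (f := fun s => 145/100 - (φ s (c m)).2.2.1)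
      (hd.const_sub (145/100)) (by linarith [hTu.le]) (by linarith)
    have hoS : IsOpen {z : St | SRp e z.1 z.2.1} :=
      (isOpen_SRp e).preimage continuous_drop
    have hcφ : Continuous fun s => φ s (c m) :=
      hφ.cont.comp (by fun_prop : Continuous fun s : ℝ => (s, c m))
    obtain ⟨d', hd'0, hd'⟩ : ∃ d' ∈ Ioo T (T + d), ∀ s ∈ Icc 0 d', φ s (c m) ∈ {z : St | SRp e z.1 z.2.1} := by
      have h5 : ∀ᶠ s in 𝓝 T, φ s (c m) ∈ {z : St | SRp e z.1 z.2.1} :=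
        hcφ.continuousAt.eventually (hoS.mem_nhds (h' T ⟨hT.le, le_rfl⟩).1)
      obtain ⟨ε, hε, hball⟩ := Metric.eventually_nhds_iff.1 h5
      refine ⟨T + min (ε/2) (d/2), ⟨by linarith [show 0 < min (ε/2) (d/2) by positivity],
        by linarith [min_le_right (ε/2) (d/2)]⟩, fun s hs => ?_⟩
      rcases le_total s T with h | h
      · exact (h' s ⟨hs.1, h⟩).1
      · refine hball ?_
        rw [Real.dist_eq, abs_of_nonneg (by linarith)]
        linarith [hs.2, min_le_left (ε/2) (d/2)]
    have h6 : ∀ᶠ z in 𝓝 (c m), ∀ s ∈ Icc 0 d', φ s z ∈ {z : St | SRp e z.1 z.2.1} :=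
      eventually_forall_Icc hφ.cont hoS hd'
    have h7 : ∀ᶠ z in 𝓝 (c m), (φ d' z).2.2.1 < 145/100 := by
      have hcd : Continuous fun z => (φ d' z).2.2.1 :=
        (continuous_fst.comp (continuous_snd.comp continuous_snd)).comp
          (hφ.cont.comp (by fun_prop : Continuous fun z : St => (d', z)))
      refine hcd.continuousAt.eventually_lt continuousAt_const ?_
      linarith [hd1 d' hd'0]
    obtain ⟨m', ⟨h8, h9⟩, hm'⟩ := ((hc.eventually (h6.and h7)).and (Ioo_mem_nhdsLT ham)).exists
    have hm'I : m' ∈ Icc a m := ⟨hm'.1.le, hm'.2.le⟩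
    obtain ⟨t, hE, hut⟩ := SMc.exit hφ hp (hmu m' hm'I) (hst m' hm'I) (Or.inr ⟨rfl, rfl⟩)
      (hS m' ⟨hm'.1.le, hm'.2⟩)
    rcases le_total d' t with h | h
    · linarith [hut d' ⟨by linarith [hd'0.1], h⟩]
    · have h10 : SRp e (φ t (c m')).1 (φ t (c m')).2.1 := h8 t ⟨hE.pos.le, h⟩
      have hq2 := hE.q2
      have hy0 := hE.y0
      rcases h10.2 with h11 | h11 <;> linarith
  · exact absurd h'.1 h2
  · have htT : t = T := by
      rcases ht.lt_or_eq with h | h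
      · exact absurd (h4 fun s hs => hin s ⟨hs.1, hs.2.trans_lt h⟩) h1
      · exact h
    refine h3.to_V hφ hp hm (Or.inr ⟨rfl, ?_⟩) ?_
    · rw [htT, hTu]
    · rw [htT, hTu]; linarith

lemma LapCurve.impulse (hφ : PFlow e η ζ φ) (hp : Par e η ζ) (h : LapCurve (143/100) c a b)
    (hu : ∀ m ∈ Icc a b, 146/100 ≤ (c m).2.2.1) (hmu : ∀ m ∈ Icc a b, (c m).2.2.2 ≤ -(1725/1000)) :
    ∃ m ∈ Icc a b, Land e (143/100) φ (c m) := by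
  have hO := h.left_O hφ hp (ℓ := 145/100) (Or.inr ⟨rfl, rfl, hu a h.aI⟩)
  obtain ⟨m₁, hm₁, hS, h1, h2⟩ := exists_first_neither (isOpen_SMc hφ) (isOpen_SPc hφ) h.ab h.cont
    (fun m _ => not_SMc_SPc (c m)) hO.1
    (lap_up hφ hp (h.mu b h.bI) (h.st b h.bI) h.right h.rightγ (ℓ := 145/100)
      (Or.inr ⟨rfl, rfl, hu b h.bI⟩))
  have hsub : Icc a m₁ ⊆ Icc a b := Icc_subset_Icc_right hm₁.2
  have hm₁I : m₁ ∈ Icc a b := ⟨hm₁.1.le, hm₁.2⟩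
  have hVC := cutoff_VC hφ hp hm₁.1
    (((h.cont.mono hsub) m₁ ⟨hm₁.1.le, le_rfl⟩).mono_of_mem_nhdsWithin
      (Filter.mem_of_superset (Ioo_mem_nhdsLT hm₁.1) fun x hx => ⟨hx.1.le, hx.2.le⟩))
    (fun m hm => h.mu m (hsub hm)) (fun m hm => h.st m (hsub hm)) (hu m₁ hm₁I) (hmu m₁ hm₁I) hS h1 h2
  obtain ⟨m, hm, h3, h4⟩ := exists_neither (isOpen_OC hφ) (isOpen_VC hφ) hm₁.1.le (h.cont.mono hsub)
    (fun m hm => fun hh => not_VC_OC hφ hp (h.mu m (hsub hm)) ⟨hh.2, hh.1⟩) hO.2 hVC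
  have hlt : m < m₁ := lt_of_le_of_ne hm.2 fun hh => h4 (hh ▸ hVC)
  obtain ⟨t, hE, hut⟩ := SMc.exit hφ hp (h.mu m (hsub hm)) (h.st m (hsub hm)) (Or.inr ⟨rfl, rfl⟩)
      (hS m ⟨hm.1, hlt⟩)
  exact ⟨m, hsub hm, hE.land hφ hp (h.mu m (hsub hm)) (Or.inr ⟨rfl, (hut t ⟨hE.pos.le, le_rfl⟩).le⟩)
    h4 h3 (h.g m (hsub hm)) (h.st m (hsub hm)).q0⟩

end curves

/-- `t` is a transversal first time at which `q` reaches the level `h`. -/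
structure Hit (φ : ℝ → St → St) (h : ℝ) (x : St) (t : ℝ) : Prop where
  pos : 0 < t
  before : ∀ s ∈ Ico 0 t, (φ s x).1 < h
  at_eq : (φ t x).1 = h
  after : ∀ d > 0, ∃ s ∈ Ioo t (t + d), h < (φ s x).1

section hit
variable {e η ζ μ ulo h : ℝ} {φ : ℝ → St → St}

lemma Hit.continuousOn (hφ : PFlow e η ζ φ) {c : ℝ → St} {I : Set ℝ} (hc : ContinuousOn c I)
    {τ : ℝ → ℝ} (hτ : ∀ m ∈ I, Hit φ h (c m) (τ m)) : ContinuousOn τ I := by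
  intro m hm
  have ht := hτ m hm
  have hop : IsOpen {z : St | z.1 < h} := isOpen_lt continuous_fst continuous_const
  refine Metric.tendsto_nhds.2 fun d hd => ?_
  obtain ⟨s, hs, hsh⟩ := ht.after d hd
  have hcm : Tendsto c (𝓝[I] m) (𝓝 (c m)) := hc m hm
  have h1 : ∀ᶠ z in 𝓝 (c m), h < (φ s z).1 :=
    continuousAt_const.eventually_lt
      ((continuous_fst.comp (hφ.cont.comp (by fun_prop : Continuous fun z : St => (s, z)))).continuousAt)
      hsh
  have h2 : ∀ᶠ z in 𝓝 (c m), ∀ r ∈ Icc 0 (τ m - d/2), φ r z ∈ {z : St | z.1 < h} :=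
    eventually_forall_Icc hφ.cont hop fun r hr => ht.before r ⟨hr.1, by linarith [hr.2]⟩
  filter_upwards [hcm.eventually (h1.and h2), self_mem_nhdsWithin] with m' hm' hI
  have ht' := hτ m' hI
  have h3 : τ m' < s := by
    by_contra hcon
    push Not at hcon
    have hs0 : 0 ≤ s := by linarith [ht.pos, hs.1]
    rcases hcon.lt_or_eq with h4 | h4
    · linarith [ht'.before s ⟨hs0, h4⟩, hm'.1]
    · have := ht'.at_eq
      rw [← h4] at this
      linarith [hm'.1]
  have h4 : τ m - d/2 < τ m' := by
    by_contra hcon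
    push Not at hcon
    have h5 : (φ (τ m') (c m')).1 < h := hm'.2 (τ m') ⟨ht'.pos.le, hcon⟩
    linarith [ht'.at_eq]
  rw [Real.dist_eq, abs_lt]
  constructor <;> linarith [hs.2]

lemma Hit.map_continuousOn (hφ : PFlow e η ζ φ) {c : ℝ → St} {I : Set ℝ} (hc : ContinuousOn c I)
    {τ : ℝ → ℝ} (hτ : ∀ m ∈ I, Hit φ h (c m) (τ m)) :
    ContinuousOn (fun m => φ (τ m) (c m)) I :=
  hφ.cont.comp_continuousOn ((Hit.continuousOn hφ hc hτ).prodMk hc)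

lemma Hit.of_pos (hφ : PFlow e η ζ φ) {x : St} {t : ℝ} (h0 : 0 < t)
    (h1 : ∀ s ∈ Ico 0 t, (φ s x).1 < h) (h2 : (φ t x).1 = h) (h3 : 0 < (φ t x).2.1)
    (hb : Box (φ t x).1 (φ t x).2.1 (φ t x).2.2.1 x.2.2.2) : Hit φ h x t := by
  refine ⟨h0, h1, h2, fun d hd => ?_⟩
  obtain ⟨d', hd', hpos⟩ := pos_right_of_deriv_pos (f := fun s => (φ s x).1 - h)
    ((hφ.dq t x hb).sub_const h) (by simp [h2]) h3
  have hmin : 0 < min d d' := lt_min hd hd'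
  refine ⟨t + min d d' / 2, ⟨by linarith, by linarith [min_le_left d d']⟩, ?_⟩
  have := hpos (t + min d d'/2) ⟨by linarith, by linarith [min_le_right d d']⟩
  linarith

/-- Start of a rise. -/
structure RiseS (e ulo q y u μ : ℝ) : Prop where
  q0 : q = e/1000
  y0 : 105/100 * q ≤ y
  y1 : y ≤ 6 * q
  u0 : ulo + 1/1000 ≤ u
  u1 : u ≤ 2004/1000
  g : 115/100 ≤ 8 * (u + μ)

/-- A short rise from the laminar state to the level `1/20`. -/
structure Rise (e ulo : ℝ) (φ : ℝ → St → St) (x : St) (t : ℝ) : Prop where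
  hit : Hit φ (1/20) x t
  gu : ∀ s ∈ Icc 0 t, GU ulo (φ s x).1 (φ s x).2.1 (φ s x).2.2.1
  st : LapS ulo (φ t x).1 (φ t x).2.1 (φ t x).2.2.1
  near : ∀ s ∈ Icc 0 t, |(φ s x).2.2.1 - x.2.2.1| ≤ 1/10^20

def SRise (ulo : ℝ) : Set St :=
  {z | (-1 < z.1 ∧ z.1 < 1/20 ∧ ulo < z.2.2.1 ∧ z.2.2.1 < 401/200) ∧ (1/2 - 5*z.1) * z.1 < z.2.1 ∧ z.2.1 < 7*z.1}

lemma isOpen_SRise (ulo : ℝ) : IsOpen (SRise ulo) := by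
  have h0 : IsOpen {z : St | -1 < z.1} := isOpen_lt (by fun_prop) (by fun_prop)
  have h1 : IsOpen {z : St | z.1 < 1/20} := isOpen_lt (by fun_prop) (by fun_prop)
  have h2 : IsOpen {z : St | ulo < z.2.2.1} := isOpen_lt (by fun_prop) (by fun_prop)
  have h3 : IsOpen {z : St | z.2.2.1 < 401/200} := isOpen_lt (by fun_prop) (by fun_prop)
  have h4 : IsOpen {z : St | (1/2 - 5*z.1) * z.1 < z.2.1} := isOpen_lt (by fun_prop) (by fun_prop)
  have h5 : IsOpen {z : St | z.2.1 < 7*z.1} := isOpen_lt (by fun_prop) (by fun_prop)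
  exact (h0.inter (h1.inter (h2.inter h3))).inter (h4.inter h5)

lemma SRise.gu {ulo : ℝ} {z : St} (hz : z ∈ SRise ulo) : GU ulo z.1 z.2.1 z.2.2.1 := by
  obtain ⟨⟨h0, h1, h2, h3⟩, h4, h5⟩ := hz
  have hq : 0 < z.1 := by
    by_contra hcon
    push Not at hcon
    nlinarith
  exact ⟨hq, by linarith, by nlinarith, by linarith, h2, h3⟩

lemma exists_rise (hφ : PFlow e η ζ φ) (hp : Par e η ζ) {x : St} (hm : MU ulo x.2.2.2)
    (h0 : RiseS e ulo x.1 x.2.1 x.2.2.1 x.2.2.2) : ∃ t, Rise e ulo φ x t := by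
  have ho := hφ.orb x
  have hz := hφ.zero x
  have e0 := hp.e0
  have e1 := hp.e1
  have cq := ho.cq
  have cy := ho.cy
  have cu := ho.cu
  obtain ⟨k0, k1, k2, k3, k4, k5⟩ := h0
  have hcφ : Continuous fun s => φ s x := hφ.cont.comp (by fun_prop : Continuous fun s : ℝ => (s, x))
  have hx : φ 0 x ∈ SRise ulo := by
    rw [hz]
    refine ⟨⟨by rw [k0]; linarith, by rw [k0]; linarith, by linarith, by linarith⟩, ?_, ?_⟩
    · nlinarith
    · nlinarith
  have hT0 : 0 < 200/e^2 := by positivity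
  have shrt : ∀ t, 0 ≤ t → t ≤ 200/e^2 → (∀ s ∈ Ico 0 t, GU ulo (φ s x).1 (φ s x).2.1 (φ s x).2.2.1) →
      |(φ t x).2.2.1 - x.2.2.1| ≤ 1/10^20 := fun t h1 h2 h3 => by
    have := ho.u_short hp hm h1 (by linarith [hp.two_hundred.2.1, hp.two_hundred.2.2]) fun s hs =>
      h3 s ⟨hs.1.le, hs.2⟩
    rwa [hz] at this
  rcases first_exit hcφ (isOpen_SRise ulo) hx (200/e^2) with h | ⟨t, ht, hex, hin⟩
  · exfalso
    have h1 := exp_le_of_deriv_ge (a := 0) (b := 200/e^2) (c := 1/4) hT0.le cq.continuousOn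
      (fun t ht => by
        have h2 := h t ⟨ht.1.le, ht.2.le⟩
        have h3 := (SRise.gu h2).q0
        refine ⟨_, ?_, ho.dq t ((SRise.gu h2).box hm)⟩
        obtain ⟨⟨_, h4, _⟩, h5, _⟩ := h2
        nlinarith)
    have h2 := (h _ ⟨hT0.le, le_rfl⟩).1.2.1
    have h3 := Real.add_one_le_exp (1/4 * (200/e^2 - 0))
    simp only [hz, k0] at h1
    have h4 : e/1000 * (1/4 * (200/e^2 - 0) + 1) ≤ e/1000 * Real.exp (1/4 * (200/e^2 - 0)) := by gcongr
    have h5 : e/1000 * (1/4 * (200/e^2 - 0) + 1) = 1/(20*e) + e/1000 := by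
      field_simp
      ring
    have h6 : (1:ℝ) ≤ 1/(20*e) := by
      rw [le_div_iff₀ (by positivity)]
      linarith
    linarith
  · have hGU : ∀ s ∈ Ico 0 t, GU ulo (φ s x).1 (φ s x).2.1 (φ s x).2.2.1 := fun s hs =>
      SRise.gu (hin s hs)
    have hqt := ho.q_pos hm ht.1 hGU
    have hb := (GU.closure ho hm ht.1 hGU).2.2.2.2.2.2
    have hut := abs_le.1 (shrt t ht.1.le ht.2 hGU)
    have hq1 : (φ t x).1 ≤ 1/20 := le_of_le_on_Ico ht.1 cq continuous_const fun s hs => (hin s hs).1.2.1.le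
    have hlow := le_of_le_on_Ico ht.1 (f := fun s => (1/2 - 5*(φ s x).1) * (φ s x).1)
      (by fun_prop) cy fun s hs => (hin s hs).2.1.le
    have hupp := le_of_le_on_Ico ht.1 (g := fun s => 7*(φ s x).1) cy (by fun_prop)
      fun s hs => (hin s hs).2.2.le
    have hγ0 : 114/100 ≤ 8 * ((φ t x).2.2.1 + x.2.2.2) := by linarith [hut.1]
    have hγ1 : 8 * ((φ t x).2.2.1 + x.2.2.2) ≤ 49/10 := by linarith [hut.2, hm.g1]
    have hlow' : (1/2 - 5*(φ t x).1) * (φ t x).1 < (φ t x).2.1 := by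
      refine lt_of_le_of_ne hlow fun heq => ?_
      have hd : HasDerivAt (fun s => (φ s x).2.1 - (1/2 - 5*(φ s x).1) * (φ s x).1)
          (FY e (φ t x).1 (φ t x).2.1 (φ t x).2.2.1 x.2.2.2
            - (-(5*(φ t x).2.1) * (φ t x).1 + (1/2 - 5*(φ t x).1) * (φ t x).2.1)) t := by
        refine (ho.dy t hb).sub ?_
        exact (((ho.dq t hb).const_mul 5).const_sub (1/2)).mul (ho.dq t hb)
      have := deriv_nonpos_of_pos_left ht.1 (fun s hs => by linarith [(hin s hs).2.1])
        (by linarith) hd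
      rw [← heq] at this
      set q := (φ t x).1
      set g := 8 * ((φ t x).2.2.1 + x.2.2.2) with hg
      have h1 : FY e q ((1/2 - 5*q)*q) (φ t x).2.2.1 x.2.2.2 =
        g * ((1/2 - 5*q)*q) - 2*q*(q*(2-q) - (21/10 - (φ t x).2.2.1)*e) := rfl
      have h2 : 0 ≤ (21/10 - (φ t x).2.2.1)*e := mul_nonneg (by linarith [hut.2]) e0.le
      rw [h1] at this
      have h3 : 0 < q * ((1/2 - 5*q) * (g - 1/2 + 10*q) - 2*q*(2-q) + 2*((21/10 - (φ t x).2.2.1)*e)) := by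
        refine mul_pos hqt ?_
        have h4 : (1/2 - 5*q) * (64/100 + 10*q) ≤ (1/2 - 5*q) * (g - 1/2 + 10*q) :=
          mul_le_mul_of_nonneg_left (by linarith) (by linarith)
        nlinarith
      nlinarith
    have hupp' : (φ t x).2.1 < 7*(φ t x).1 := by
      refine lt_of_le_of_ne hupp fun heq => ?_
      have hd : HasDerivAt (fun s => 7*(φ s x).1 - (φ s x).2.1)
          (7*(φ t x).2.1 - FY e (φ t x).1 (φ t x).2.1 (φ t x).2.2.1 x.2.2.2) t :=
        ((ho.dq t hb).const_mul 7).sub (ho.dy t hb)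
      have := deriv_nonpos_of_pos_left ht.1 (fun s hs => by linarith [(hin s hs).2.2])
        (by linarith) hd
      rw [heq] at this
      set q := (φ t x).1
      set g := 8 * ((φ t x).2.2.1 + x.2.2.2) with hg
      have h1 : FY e q (7*q) (φ t x).2.2.1 x.2.2.2 =
        g * (7*q) - 2*q*(q*(2-q) - (21/10 - (φ t x).2.2.1)*e) := rfl
      have h2 : (21/10 - (φ t x).2.2.1)*e ≤ 1 := by nlinarith [hut.1, hm.lo]
      rw [h1] at this
      have h3 : 0 < q * (49 - 7*g + 2*(q*(2-q)) - 2*((21/10 - (φ t x).2.2.1)*e)) := by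
        refine mul_pos hqt ?_
        nlinarith
      nlinarith
    have hq : (φ t x).1 = 1/20 := by
      by_contra hne
      exact hex ⟨⟨by linarith, lt_of_le_of_ne hq1 hne, by linarith [hut.1], by linarith [hut.2]⟩, hlow', hupp'⟩
    have hy : 0 < (φ t x).2.1 := by rw [hq] at hlow'; linarith
    have hgt : GU ulo (φ t x).1 (φ t x).2.1 (φ t x).2.2.1 :=
      ⟨hqt, by linarith, by linarith, by linarith, by linarith [hut.1], by linarith [hut.2]⟩
    refine ⟨t, Hit.of_pos hφ ht.1 (fun s hs => (hin s hs).1.2.1) hq hy hb, fun s hs => ?_,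
      ⟨hq, hy, by linarith, hgt.u0, hgt.u1⟩, fun s hs => ?_⟩
    · rcases hs.2.lt_or_eq with h | h
      · exact hGU s ⟨hs.1, h⟩
      · rw [h]; exact hgt
    · exact shrt s hs.1 (hs.2.trans ht.2) fun r hr => hGU r ⟨hr.1, hr.2.trans_le hs.2⟩

lemma Rise.up (hφ : PFlow e η ζ φ) (hp : Par e η ζ) {x : St} (hm : MU ulo x.2.2.2) {t : ℝ}
    (h : Rise e ulo φ x t) (hq : 0 ≤ x.1) (hy : 21/10 * x.1 ≤ x.2.1)
    (hg : 2195/1000 ≤ 8 * (x.2.2.1 + x.2.2.2)) :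
    205/100 * (φ t x).1 ≤ (φ t x).2.1 ∧ 219/100 ≤ 8 * ((φ t x).2.2.1 + x.2.2.2) := by
  have hu : ∀ s ∈ Icc 0 t, 219/100 ≤ 8 * ((φ s x).2.2.1 + x.2.2.2) := fun s hs => by
    linarith [(abs_le.1 (h.near s hs)).1]
  have htI : t ∈ Icc 0 t := ⟨h.hit.pos.le, le_rfl⟩
  have := (hφ.orb x).barrier_up hp hm (a := 0) (b := t) (by rw [hφ.zero]; nlinarith)
    (fun s hs => ⟨h.gu s hs, by linarith [hu s hs]⟩) t htI
  refine ⟨?_, hu t htI⟩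
  rw [h.hit.at_eq] at this ⊢
  linarith

lemma Rise.down (hφ : PFlow e η ζ φ) (hp : Par e η ζ) {x : St} (hm : MU ulo x.2.2.2) {t : ℝ}
    (h : Rise e ulo φ x t) (hq : 0 ≤ x.1) (hq1 : x.1 ≤ 1/10) (hy : x.2.1 ≤ 179/100 * x.1)
    (hg : 8 * (x.2.2.1 + x.2.2.2) ≤ 179/100) :
    (φ t x).2.1 ≤ 185/100 * (φ t x).1 ∧ 8 * ((φ t x).2.2.1 + x.2.2.2) ≤ 18/10 := by
  have hu : ∀ s ∈ Icc 0 t, 8 * ((φ s x).2.2.1 + x.2.2.2) ≤ 18/10 := fun s hs => by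
    linarith [(abs_le.1 (h.near s hs)).2]
  have htI : t ∈ Icc 0 t := ⟨h.hit.pos.le, le_rfl⟩
  have := (hφ.orb x).barrier_dn hp hm (a := 0) (b := t) (by rw [hφ.zero]; nlinarith)
    (fun s hs _ => ⟨h.gu s hs, ?_, by linarith [hu s hs]⟩) t htI
  · refine ⟨?_, hu t htI⟩
    rw [h.hit.at_eq] at this ⊢
    linarith
  · rcases hs.2.lt_or_eq with h1 | h1
    · linarith [h.hit.before s ⟨hs.1, h1⟩]
    · rw [h1, h.hit.at_eq]; norm_num

end hit

lemma backward_uniq {L N : ℝ → ℝ} {c C B : ℝ} (hc : 0 < c) (hC : 0 < C) (cN : Continuous N)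
    (hL : ∀ s ≤ 0, ∃ L', c * N s ≤ L' ∧ HasDerivAt L L' s) (hLN : ∀ s ≤ 0, |L s| ≤ C * N s)
    (hB : ∀ s ≤ 0, N s ≤ B) (h0 : L 0 ≤ 0) : ∀ s ≤ 0, N s = 0 := by
  have hN0 : ∀ s ≤ 0, 0 ≤ N s := fun s hs => by
    have := (abs_nonneg _).trans (hLN s hs)
    exact nonneg_of_mul_nonneg_right this hC
  have cL : ∀ s ≤ 0, ContinuousAt L s := fun s hs => by
    obtain ⟨_, _, h⟩ := hL s hs
    exact h.continuousAt
  have hLle : ∀ s ≤ 0, L s ≤ 0 := fun s hs => by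
    have := le_of_deriv_ge (f := L) (a := s) (b := 0) (c := 0) hs
      (fun r hr => (cL r hr.2).continuousWithinAt) (fun t ht => by
        obtain ⟨L', h1, h2⟩ := hL t ht.2.le
        exact ⟨L', (mul_nonneg hc.le (hN0 t ht.2.le)).trans h1, h2⟩)
    linarith
  have hLge : ∀ s ≤ 0, 0 ≤ L s := by
    intro s hs
    have hk : 0 < c / C := by positivity
    have h1 : ∀ t ≤ s, -(C * B) * Real.exp (-(c/C) * (s - t)) ≤ L s := by
      intro t ht
      have h2 := exp_le_of_deriv_ge (f := L) (a := t) (b := s) (c := -(c/C)) ht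
        (fun r hr => (cL r (hr.2.trans hs)).continuousWithinAt) (fun r hr => by
          have hr0 : r ≤ 0 := hr.2.le.trans hs
          obtain ⟨L', h1, h2⟩ := hL r hr0
          refine ⟨L', le_trans ?_ h1, h2⟩
          have h3 := (neg_abs_le (L r)).trans' (neg_le_neg (hLN r hr0))
          have : -(c/C) * L r ≤ (c/C) * (C * N r) := by nlinarith
          calc _ ≤ (c/C) * (C * N r) := this
            _ = c * N r := by field_simp)
      refine le_trans ?_ h2
      refine mul_le_mul_of_nonneg_right ?_ (Real.exp_pos _).le
      have h3 := (abs_le.1 (hLN t (ht.trans hs))).1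
      nlinarith [hB t (ht.trans hs)]
    have hlim : Tendsto (fun t => -(C * B) * Real.exp (-(c/C) * (s - t))) atBot (𝓝 (-(C * B) * 0)) := by
      refine (Real.tendsto_exp_atBot.comp ?_).const_mul _
      refine Tendsto.const_mul_atTop_of_neg (by linarith) ?_
      exact tendsto_atTop_add_const_left _ s tendsto_neg_atBot_atTop
    rw [mul_zero] at hlim
    exact le_of_tendsto hlim ((eventually_le_atBot s).mono h1)
  have hneg : ∀ s < 0, N s ≤ 0 := by
    intro s hs
    obtain ⟨L', h1, h2⟩ := hL s hs.le
    have h3 : L =ᶠ[𝓝 s] fun _ => 0 := by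
      filter_upwards [Iio_mem_nhds hs] with r hr
      exact le_antisymm (hLle r (le_of_lt hr)) (hLge r (le_of_lt hr))
    have h4 := h2.unique ((hasDerivAt_const s (0:ℝ)).congr_of_eventuallyEq h3)
    rw [h4] at h1
    nlinarith
  intro s hs
  refine le_antisymm ?_ (hN0 s hs)
  rcases hs.lt_or_eq with h | h
  · exact hneg s h
  · rw [h]
    exact le_of_le_on_Ico (a := -1) (by norm_num) cN continuous_const fun r hr => hneg r hr.2

lemma forward_conv {L N : ℝ → ℝ} {T c K B : ℝ} (hc : 0 < c) (hK : 0 < K)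
    (hL : ∀ s, T ≤ s → ∃ L', c * N s ≤ L' ∧ HasDerivAt L L' s) (hB : ∀ s, T ≤ s → |L s| ≤ B)
    (hN0 : ∀ s, 0 ≤ N s) (hN : ∀ s, T ≤ s → ∃ N', |N'| ≤ K ∧ HasDerivAt N N' s) :
    Tendsto N atTop (𝓝 0) := by
  have cL : ∀ s, T ≤ s → ContinuousAt L s := fun s hs => by
    obtain ⟨_, _, h⟩ := hL s hs
    exact h.continuousAt
  have cN : ∀ s, T ≤ s → ContinuousAt N s := fun s hs => by
    obtain ⟨_, _, h⟩ := hN s hs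
    exact h.continuousAt
  have hstep : ∀ a b d, T ≤ a → a ≤ b → (∀ s ∈ Icc a b, d ≤ N s) → L a + c * d * (b - a) ≤ L b := by
    intro a b d hTa hab hd
    refine le_of_deriv_ge hab (fun r hr => (cL r (hTa.trans hr.1)).continuousWithinAt) fun t ht => ?_
    obtain ⟨L', h1, h2⟩ := hL t (hTa.trans ht.1.le)
    exact ⟨L', (mul_le_mul_of_nonneg_left (hd t ⟨ht.1.le, ht.2.le⟩) hc.le).trans h1, h2⟩
  have hmono : Monotone fun t => L (max t T) := by
    intro a b hab
    have := hstep (max a T) (max b T) 0 (le_max_right _ _) (max_le_max_right T hab)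
      (fun s _ => hN0 s)
    simpa using this
  have hbdd : BddAbove (range fun t => L (max t T)) := by
    refine ⟨B, ?_⟩
    rintro _ ⟨t, rfl⟩
    exact (abs_le.1 (hB _ (le_max_right _ _))).2
  have hlim := tendsto_atTop_ciSup hmono hbdd
  refine Metric.tendsto_nhds.2 fun δ hδ => ?_
  set τ := δ / (2 * K) with hτ
  have hτ0 : 0 < τ := by positivity
  have hlim2 := hlim.comp (tendsto_atTop_add_const_right atTop τ tendsto_id)
  have hd := hlim2.sub hlim
  rw [sub_self] at hd
  have hε : 0 < c * (δ/2) * τ := by positivity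
  filter_upwards [hd.eventually (gt_mem_nhds hε), eventually_ge_atTop T] with t h1 hTt
  rw [Real.dist_eq, sub_zero, abs_of_nonneg (hN0 t)]
  by_contra hcon
  push Not at hcon
  have h2 : ∀ s ∈ Icc t (t + τ), δ/2 ≤ N s := by
    intro s hs
    have := le_of_deriv_ge (f := N) (c := -K) hs.1
      (fun r hr => (cN r (hTt.trans hr.1)).continuousWithinAt) (fun r hr => by
        obtain ⟨N', h3, h4⟩ := hN r (hTt.trans hr.1.le)
        exact ⟨N', (abs_le.1 h3).1, h4⟩)
    have h5 : K * (s - t) ≤ K * τ := mul_le_mul_of_nonneg_left (by linarith [hs.2]) hK.le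
    have h6 : K * τ = δ/2 := by rw [hτ]; field_simp
    linarith
  have h3 := hstep t (t + τ) (δ/2) hTt (by linarith) h2
  have h4 : L (max (t + τ) T) - L (max t T) < c * (δ/2) * τ := h1
  rw [max_eq_left hTt, max_eq_left (by linarith)] at h4
  linarith

/-- A continuous branch of points whose backward orbits stay in a compact set. -/
lemma exists_branch {e η ζ : ℝ} {φ : ℝ → St → St} (hφ : PFlow e η ζ φ) {C : Set St}
    (hC : IsCompact C) {h m₀ m₁ : ℝ}
    (seed : ∀ m ∈ Icc m₀ m₁, ∀ n : ℕ, ∃ z : St, z.2.2.2 = m ∧ z.1 = h ∧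
      ∀ s ∈ Icc (-(n : ℝ)) 0, φ s z ∈ C)
    (uniq : ∀ z z' : St, z.2.2.2 ∈ Icc m₀ m₁ → z.2.2.2 = z'.2.2.2 → z.1 = h → z'.1 = h →
      (∀ s ≤ 0, φ s z ∈ C) → (∀ s ≤ 0, φ s z' ∈ C) → z = z') :
    ∃ w : ℝ → St, ContinuousOn w (Icc m₀ m₁) ∧ ∀ m ∈ Icc m₀ m₁, (w m).2.2.2 = m ∧ (w m).1 = h ∧
      ∀ s ≤ 0, φ s (w m) ∈ C := by
  have hs : ∀ s, Continuous fun z : St => φ s z := fun s =>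
    hφ.cont.comp (by fun_prop : Continuous fun z : St => (s, z))
  have cμ : Continuous fun z : St => z.2.2.2 := by fun_prop
  let G : Set St := {z | z.2.2.2 ∈ Icc m₀ m₁ ∧ z.1 = h ∧ ∀ s ≤ 0, φ s z ∈ C}
  have hGc : IsClosed G := by
    have : G = {z : St | z.2.2.2 ∈ Icc m₀ m₁} ∩ ({z : St | z.1 = h} ∩ ⋂ s ∈ Iic (0:ℝ), {z | φ s z ∈ C}) := by
      ext z
      simp [G]
    rw [this]
    refine (isClosed_Icc.preimage cμ).inter ((isClosed_eq (by fun_prop) (by fun_prop)).inter ?_)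
    exact isClosed_biInter fun s _ => hC.isClosed.preimage (hs s)
  have hG : IsCompact G := hC.of_isClosed_subset hGc fun z hz => by
    have := hz.2.2 0 le_rfl
    rwa [hφ.zero] at this
  have ex : ∀ m ∈ Icc m₀ m₁, ∃ z ∈ G, z.2.2.2 = m := by
    intro m hm
    choose z hz1 hz2 hz3 using seed m hm
    have hz0 : ∀ n, z n ∈ C := fun n => by
      have := hz3 n 0 ⟨by simp, le_rfl⟩
      rwa [hφ.zero] at this
    obtain ⟨w, -, θ, hθ, hlim⟩ := hC.tendsto_subseq hz0
    have h1 : w.2.2.2 = m := by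
      refine tendsto_nhds_unique ((cμ.tendsto w).comp hlim) ?_
      exact tendsto_const_nhds.congr fun n => (hz1 _).symm
    have h2 : w.1 = h := by
      refine tendsto_nhds_unique ((continuous_fst.tendsto w).comp hlim) ?_
      exact tendsto_const_nhds.congr fun n => (hz2 _).symm
    refine ⟨w, ⟨by rwa [h1], h2, fun s hs0 => ?_⟩, h1⟩
    refine hC.isClosed.mem_of_tendsto (((hs s).tendsto w).comp hlim) ?_
    filter_upwards [(tendsto_natCast_atTop_atTop.comp hθ.tendsto_atTop).eventually_ge_atTop (-s)]
      with n hn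
    exact hz3 (θ n) s ⟨by simp only [Function.comp] at hn; linarith, hs0⟩
  have huniq : ∀ z ∈ G, ∀ z' ∈ G, z.2.2.2 = z'.2.2.2 → z = z' := fun z hz z' hz' he =>
    uniq z z' hz.1 he hz.2.1 hz'.2.1 hz.2.2 hz'.2.2
  choose! w hwG hwμ using ex
  refine ⟨w, ?_, fun m hm => ⟨hwμ m hm, (hwG m hm).2⟩⟩
  rw [continuousOn_iff_isClosed]
  intro F hF
  refine ⟨(fun z : St => z.2.2.2) '' (G ∩ F), ((hG.inter_right hF).image cμ).isClosed, ?_⟩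
  ext m
  constructor
  · rintro ⟨h1, h2⟩
    exact ⟨⟨w m, ⟨hwG m h2, h1⟩, hwμ m h2⟩, h2⟩
  · rintro ⟨⟨z, ⟨hzG, hzF⟩, rfl⟩, h2⟩
    refine ⟨?_, h2⟩
    have := huniq (w z.2.2.2) (hwG _ h2) z hzG (hwμ _ h2)
    rw [mem_preimage, this]
    exact hzF

lemma quad_deriv {A B C : ℝ → ℝ} {a b c t : ℝ} (k M : ℝ) (da : HasDerivAt A a t)
    (db : HasDerivAt B b t) (dc : HasDerivAt C c t) :
    HasDerivAt (fun s => A s * B s - k/2 * A s ^ 2 - M/2 * C s ^ 2)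
      (a * B t + A t * b - k * A t * a - M * C t * c) t := by
  refine (((da.fun_mul db).fun_sub ((da.fun_pow 2).const_mul (k/2))).fun_sub
    ((dc.fun_pow 2).const_mul (M/2))).congr_deriv ?_
  ring

section pair
variable {e η ζ μ : ℝ} {q₁ y₁ u₁ q₂ y₂ u₂ : ℝ → ℝ}

/-- Squared distance between two orbits. -/
noncomputable def pairN (q₁ y₁ u₁ q₂ y₂ u₂ : ℝ → ℝ) (s : ℝ) : ℝ :=
  (q₁ s - q₂ s)^2 + (y₁ s - y₂ s)^2 + (u₁ s - u₂ s)^2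

/-- Quadratic form used to separate two orbits. -/
noncomputable def pairL (k M : ℝ) (q₁ y₁ u₁ q₂ y₂ u₂ : ℝ → ℝ) (s : ℝ) : ℝ :=
  (q₁ s - q₂ s) * (y₁ s - y₂ s) - k/2 * (q₁ s - q₂ s)^2 - M/2 * (u₁ s - u₂ s)^2

lemma Orb.pair_deriv (ho₁ : Orb e η ζ μ q₁ y₁ u₁) (ho₂ : Orb e η ζ μ q₂ y₂ u₂) (hη : η ≠ 0)
    (k m : ℝ) {t : ℝ} (hb₁ : Box (q₁ t) (y₁ t) (u₁ t) μ) (hb₂ : Box (q₂ t) (y₂ t) (u₂ t) μ)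
    (h₁ : u₁ t + μ + ζ ≠ 0) (h₂ : u₂ t + μ + ζ ≠ 0) {a b c : ℝ} (ha : q₁ t - q₂ t = a)
    (hb : y₁ t - y₂ t = b) (hc : u₁ t - u₂ t = c) :
    HasDerivAt (pairL k (m/η) q₁ y₁ u₁ q₂ y₂ u₂)
      (b^2 + (8 * (u₁ t + μ) - k) * (a * b) + (8 * y₂ t - 2 * e * q₂ t) * (a * c)
        - (4 * (q₁ t + q₂ t) - 2 * (q₁ t ^ 2 + q₁ t * q₂ t + q₂ t ^ 2)
            - 2 * e * (21/10 - u₁ t)) * a^2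
        + m / (u₁ t + μ + ζ) * ((1 + 2 * q₁ t) * c^2 - 2 * (1 - u₂ t) * (a * c)
          + (2 - u₂ t + 2 * q₂ t * (1 - u₂ t)) / (u₂ t + μ + ζ) * c^2)) t := by
  have da : HasDerivAt (fun s => q₁ s - q₂ s) _ t := (ho₁.dq t hb₁).fun_sub (ho₂.dq t hb₂)
  have db : HasDerivAt (fun s => y₁ s - y₂ s) _ t := (ho₁.dy t hb₁).fun_sub (ho₂.dy t hb₂)
  have dc : HasDerivAt (fun s => u₁ s - u₂ s) _ t := (ho₁.du t hb₁).fun_sub (ho₂.du t hb₂)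
  refine (quad_deriv k (m/η) da db dc).congr_deriv ?_
  subst ha hb hc
  simp only [FY, FU]
  field_simp
  ring

lemma pair_cont (ho₁ : Orb e η ζ μ q₁ y₁ u₁) (ho₂ : Orb e η ζ μ q₂ y₂ u₂) :
    Continuous (pairN q₁ y₁ u₁ q₂ y₂ u₂) := by
  have := ho₁.cq; have := ho₁.cy; have := ho₁.cu
  have := ho₂.cq; have := ho₂.cy; have := ho₂.cu
  unfold pairN
  fun_prop

lemma abs_pairL_le {k M : ℝ} (hk : 0 ≤ k) (hM : 0 ≤ M) (s : ℝ) :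
    |pairL k M q₁ y₁ u₁ q₂ y₂ u₂ s| ≤ (1 + k + M) * pairN q₁ y₁ u₁ q₂ y₂ u₂ s := by
  unfold pairL pairN
  set a := q₁ s - q₂ s
  set b := y₁ s - y₂ s
  set c := u₁ s - u₂ s
  have ka := mul_nonneg hk (sq_nonneg a)
  have kb := mul_nonneg hk (sq_nonneg b)
  have kc := mul_nonneg hk (sq_nonneg c)
  have ma := mul_nonneg hM (sq_nonneg a)
  have mb := mul_nonneg hM (sq_nonneg b)
  have mc := mul_nonneg hM (sq_nonneg c)
  rw [abs_le]
  constructor <;> nlinarith [sq_nonneg (a - b), sq_nonneg (a + b), sq_nonneg c]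

lemma abs_mul_mul_le {x K : ℝ} (hx : |x| ≤ K) (a c : ℝ) :
    |x * (a * c)| ≤ K * ((a^2 + c^2)/2) := by
  rw [abs_mul]
  refine mul_le_mul hx ?_ (abs_nonneg _) ((abs_nonneg _).trans hx)
  rw [abs_le]
  constructor <;> linarith [sq_nonneg (a - c), sq_nonneg (a + c)]

/-- Separation inequality near the turbulent state: algebraic core. -/
lemma sep_turb {g k x E₂ D R a b c : ℝ} (hg0 : -(29/10) ≤ g) (hg1 : g ≤ 48/10)
    (hk0 : 1/20 ≤ k) (hk1 : k ≤ 4/3) (hx : |x| ≤ 1/1000) (hD : D ≤ -(799/100))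
    (hR : 49/10 ≤ R) (hE0 : -(6/10) ≤ E₂) (hE1 : E₂ ≤ -(3/10)) :
    1/10 * (a^2 + b^2 + c^2) ≤ b^2 + g * (a * b) + x * (a * c) - D * a^2
      + k * (R * c^2 - E₂ * (a * c)) := by
  obtain ⟨hx0, hx1⟩ := abs_le.mp hx
  have hg : 0 ≤ 576/100 - g^2/4 := by
    linarith [mul_nonneg (sub_nonneg.2 hg1) (sub_nonneg.2 hg0)]
  have h1 : 0 ≤ 9/10 * b^2 + g * (a * b) + 64/10 * a^2 := by
    have : 0 ≤ (9/10 * b + g/2 * a)^2 := sq_nonneg _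
    have h2 : 0 ≤ (576/100 - g^2/4) * a^2 := mul_nonneg hg (sq_nonneg a)
    linarith
  have h2 := (abs_le.mp (abs_mul_mul_le hx a c)).1
  have h3 : 799/100 * a^2 ≤ -D * a^2 := mul_le_mul_of_nonneg_right (by linarith) (sq_nonneg a)
  have h4 : -(3/10) * a^2 + 46/10 * c^2 ≤ R * c^2 - E₂ * (a * c) := by
    have hh := abs_mul_mul_le (abs_le.mpr ⟨hE0, by linarith⟩ : |E₂| ≤ 6/10) a c
    have := mul_le_mul_of_nonneg_right hR (sq_nonneg c)
    linarith [(abs_le.mp hh).2]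
  have h5 : k * (-(3/10) * a^2 + 46/10 * c^2) ≤ k * (R * c^2 - E₂ * (a * c)) :=
    mul_le_mul_of_nonneg_left h4 (by linarith)
  have h6 : k * a^2 ≤ 4/3 * a^2 := mul_le_mul_of_nonneg_right hk1 (sq_nonneg a)
  have h7 : 1/20 * c^2 ≤ k * c^2 := mul_le_mul_of_nonneg_right hk0 (sq_nonneg c)
  linarith [sq_nonneg a, sq_nonneg c, sq_nonneg b]

/-- Region around the turbulent branch, used for the first orbit. -/
structure NearT (e q y u μ : ℝ) : Prop where
  q0 : 2 - 2*e ≤ q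
  q1 : q ≤ 2
  y0 : -1 ≤ y
  y1 : y ≤ 15
  u0 : 119/100 ≤ u
  u1 : u ≤ 401/200
  g0 : -(3625/10000) ≤ u + μ
  g1 : u + μ ≤ 6/10

/-- Small region around the turbulent state, used for the reference orbit. -/
structure AtT (e q y u μ : ℝ) : Prop where
  q0 : 2 - 2*e ≤ q
  q1 : q ≤ 2
  y0 : |y| ≤ 8*e
  u0 : 119/100 ≤ u
  u1 : u ≤ 121/100
  g0 : -(28/100) ≤ u + μ
  g1 : u + μ ≤ -(22/100)
  g : |2 - u + 2 * q * (1 - u)| ≤ 20*e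

lemma NearT.box {q y u : ℝ} (h : NearT e q y u μ) (hp : Par e η ζ) (hm : -2 ≤ μ ∧ μ ≤ -1) :
    Box q y u μ := by
  have := hp.e1
  exact ⟨by linarith [h.q0], by linarith [h.q1], by linarith [h.y0], by linarith [h.y1],
    by linarith [h.u0], by linarith [h.u1], by linarith, by linarith, by linarith [h.g0]⟩

lemma AtT.near {q y u : ℝ} (h : AtT e q y u μ) (hp : Par e η ζ) : NearT e q y u μ := by
  have := hp.e1
  have := abs_le.mp h.y0
  exact ⟨h.q0, h.q1, by linarith, by linarith, h.u0, by linarith [h.u1], by linarith [h.g0],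
    by linarith [h.g1]⟩

lemma Orb.pair_turb (hp : Par e η ζ) (hm : -2 ≤ μ ∧ μ ≤ -1) (ho₁ : Orb e η ζ μ q₁ y₁ u₁)
    (ho₂ : Orb e η ζ μ q₂ y₂ u₂) {t : ℝ} (h₁ : NearT e (q₁ t) (y₁ t) (u₁ t) μ)
    (h₂ : AtT e (q₂ t) (y₂ t) (u₂ t) μ) :
    ∃ L', 1/10 * pairN q₁ y₁ u₁ q₂ y₂ u₂ t ≤ L' ∧
      HasDerivAt (pairL 0 ((ζ - 35/100)/η) q₁ y₁ u₁ q₂ y₂ u₂) L' t := by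
  have hz := hp.z
  have he := hp.e0
  have he1 := hp.e1
  obtain ⟨hg20, hg21⟩ := abs_le.mp h₂.g
  obtain ⟨hy20, hy21⟩ := abs_le.mp h₂.y0
  have p1 : 0 < u₁ t + μ + ζ := by linarith [h₁.g0]
  have p2 : 0 < u₂ t + μ + ζ := by linarith [h₂.g0]
  refine ⟨_, ?_, ho₁.pair_deriv ho₂ hp.h0.ne' 0 (ζ - 35/100) (h₁.box hp hm) ((h₂.near hp).box hp hm)
    p1.ne' p2.ne' rfl rfl rfl⟩
  have hS : |(2 - u₂ t + 2 * q₂ t * (1 - u₂ t)) / (u₂ t + μ + ζ)| ≤ 1/100 := by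
    rw [abs_div, abs_of_pos p2, div_le_iff₀ p2]
    nlinarith [h₂.g, h₂.g0]
  obtain ⟨hS0, hS1⟩ := abs_le.mp hS
  have key := sep_turb (g := 8 * (u₁ t + μ) - 0) (k := (ζ - 35/100) / (u₁ t + μ + ζ))
    (x := 8 * y₂ t - 2 * e * q₂ t) (E₂ := 2 * (1 - u₂ t))
    (D := 4 * (q₁ t + q₂ t) - 2 * (q₁ t ^ 2 + q₁ t * q₂ t + q₂ t ^ 2) - 2 * e * (21/10 - u₁ t))
    (R := 1 + 2 * q₁ t + (2 - u₂ t + 2 * q₂ t * (1 - u₂ t)) / (u₂ t + μ + ζ))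
    (a := q₁ t - q₂ t) (b := y₁ t - y₂ t) (c := u₁ t - u₂ t)
    (by linarith [h₁.g0]) (by linarith [h₁.g1])
    (by rw [le_div_iff₀ p1]; linarith [h₁.g1]) (by rw [div_le_iff₀ p1]; linarith [h₁.g0])
    (abs_le.mpr ⟨by nlinarith [h₂.q1, h₂.q0], by nlinarith [h₂.q0, h₂.q1]⟩)
    (by nlinarith [h₁.q0, h₁.q1, h₂.q0, h₂.q1, h₁.u0, h₁.u1,
      mul_nonneg (sub_nonneg.2 h₁.q1) (sub_nonneg.2 h₂.q1), sq_nonneg (q₁ t - 2), sq_nonneg (q₂ t - 2)])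
    (by linarith [h₁.q0]) (by linarith [h₂.u1]) (by linarith [h₂.u0])
  unfold pairN
  refine key.trans (le_of_eq ?_)
  ring

/-- Backward uniqueness along the turbulent branch. -/
lemma Orb.turb_uniq (hp : Par e η ζ) (hm : -2 ≤ μ ∧ μ ≤ -1) (ho₁ : Orb e η ζ μ q₁ y₁ u₁)
    (ho₂ : Orb e η ζ μ q₂ y₂ u₂) (h₁ : ∀ s ≤ 0, NearT e (q₁ s) (y₁ s) (u₁ s) μ)
    (h₂ : ∀ s ≤ 0, AtT e (q₂ s) (y₂ s) (u₂ s) μ) (h0 : q₁ 0 = q₂ 0) :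
    y₁ 0 = y₂ 0 ∧ u₁ 0 = u₂ 0 := by
  have hM : 0 ≤ (ζ - 35/100)/η := div_nonneg (by linarith [hp.z]) hp.h0.le
  have := backward_uniq (L := pairL 0 ((ζ - 35/100)/η) q₁ y₁ u₁ q₂ y₂ u₂)
    (N := pairN q₁ y₁ u₁ q₂ y₂ u₂) (c := 1/10) (C := 1 + 0 + (ζ - 35/100)/η) (B := 1000)
    (by norm_num) (by linarith) (pair_cont ho₁ ho₂)
    (fun s hs => Orb.pair_turb hp hm ho₁ ho₂ (h₁ s hs) (h₂ s hs))
    (fun s _ => abs_pairL_le le_rfl hM s) (fun s hs => by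
      obtain ⟨a0, a1, b0, b1, c0, c1, -, -⟩ := h₁ s hs
      obtain ⟨a0', a1', b0', b1', c0', c1', -, -⟩ := (h₂ s hs).near hp
      have := hp.e1
      unfold pairN
      nlinarith) (by
      unfold pairL
      rw [h0]
      have := mul_nonneg hM (sq_nonneg (u₁ 0 - u₂ 0))
      linarith) 0 le_rfl
  unfold pairN at this
  have h1 := sq_nonneg (q₁ 0 - q₂ 0)
  have h2 := sq_nonneg (y₁ 0 - y₂ 0)
  have h3 := sq_nonneg (u₁ 0 - u₂ 0)
  constructor
  · have : (y₁ 0 - y₂ 0)^2 = 0 := by linarith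
    exact sub_eq_zero.mp (pow_eq_zero_iff (two_ne_zero) |>.mp this)
  · have : (u₁ 0 - u₂ 0)^2 = 0 := by linarith
    exact sub_eq_zero.mp (pow_eq_zero_iff (two_ne_zero) |>.mp this)

end pair

/-- The turbulent state `(qb, 0, ub)`. -/
structure Eqm (e ub qb : ℝ) : Prop where
  eq1 : qb * (2 - qb) = (21/10 - ub) * e
  eq2 : 2 - ub + 2 * qb * (1 - ub) = 0
  q0 : 2 - e ≤ qb
  q1 : qb < 2
  u0 : 6/5 < ub
  u1 : ub ≤ 12001/10000

/-- Closed wedge containing the unstable branch of the turbulent state. -/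
structure WedgeT (e ub qb q y u : ℝ) : Prop where
  x0 : 0 ≤ qb - q
  x1 : 2 - 2*e ≤ q
  y0 : qb - q ≤ -y
  y1 : -y ≤ 4 * (qb - q)
  u0 : |u - ub| ≤ (qb - q)/1000

/-- Open wedge containing the unstable branch of the turbulent state. -/
structure OWedgeT (e ub qb q y u : ℝ) : Prop where
  x1 : 2 - 2*e < q
  y0 : qb - q < -y
  y1 : -y < 4 * (qb - q)
  u0 : u - ub < (qb - q)/1000
  u1 : ub - u < (qb - q)/1000

lemma isOpen_OWedgeT (e ub qb : ℝ) :
    IsOpen {x : ℝ × ℝ × ℝ | OWedgeT e ub qb x.1 x.2.1 x.2.2} := by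
  have h0 : IsOpen {x : ℝ × ℝ × ℝ | 2 - 2*e < x.1} := isOpen_lt (by fun_prop) (by fun_prop)
  have h1 : IsOpen {x : ℝ × ℝ × ℝ | qb - x.1 < -x.2.1} := isOpen_lt (by fun_prop) (by fun_prop)
  have h2 : IsOpen {x : ℝ × ℝ × ℝ | -x.2.1 < 4 * (qb - x.1)} :=
    isOpen_lt (by fun_prop) (by fun_prop)
  have h3 : IsOpen {x : ℝ × ℝ × ℝ | x.2.2 - ub < (qb - x.1)/1000} :=
    isOpen_lt (by fun_prop) (by fun_prop)
  have h4 : IsOpen {x : ℝ × ℝ × ℝ | ub - x.2.2 < (qb - x.1)/1000} :=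
    isOpen_lt (by fun_prop) (by fun_prop)
  convert h0.inter (h1.inter (h2.inter (h3.inter h4))) using 1
  ext x
  exact ⟨fun ⟨a, b, c, d, f⟩ => ⟨a, b, c, d, f⟩, fun ⟨a, b, c, d, f⟩ => ⟨a, b, c, d, f⟩⟩

section turb
variable {e η ζ ub qb μ : ℝ} {q y u : ℝ → ℝ} {φ : ℝ → St → St}

/-- Admissible wave speeds near the turbulent state. -/
def MT (ub μ : ℝ) : Prop := -ub - 275/1000 ≤ μ ∧ μ ≤ -ub - 225/1000

lemma OWedgeT.closed {q y u : ℝ} (h : OWedgeT e ub qb q y u) : WedgeT e ub qb q y u :=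
  ⟨by linarith [h.y0, h.y1], h.x1.le, h.y0.le, h.y1.le,
    abs_le.mpr ⟨by linarith [h.u1], by linarith [h.u0]⟩⟩

lemma Eqm.g_eq (hE : Eqm e ub qb) (q u : ℝ) :
    2 - u + 2 * q * (1 - u) = -(1 + 2*q) * (u - ub) - 2 * (qb - q) * (1 - ub) := by
  linear_combination hE.eq2

lemma Eqm.f_eq (hE : Eqm e ub qb) (q u : ℝ) :
    q * (2 - q) - (21/10 - u) * e = (qb - q) * (q + qb - 2) + e * (u - ub) := by
  linear_combination hE.eq1

lemma WedgeT.g_le (hE : Eqm e ub qb) {q y u : ℝ} (h : WedgeT e ub qb q y u) (hq : 0 ≤ q) :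
    |2 - u + 2 * q * (1 - u)| ≤ 6/10 * (qb - q) := by
  rw [hE.g_eq]
  obtain ⟨h1, h2⟩ := abs_le.mp h.u0
  have hx := h.x0
  have hq2 : q ≤ 2 := by linarith [hE.q1]
  have h3 : |(1 + 2*q) * (u - ub)| ≤ 5 * ((qb - q)/1000) := by
    rw [abs_mul, abs_of_nonneg (by linarith)]
    exact mul_le_mul (by linarith) h.u0 (abs_nonneg _) (by norm_num)
  obtain ⟨h4, h5⟩ := abs_le.mp h3
  have h6 := mul_nonneg hx (sub_nonneg.2 hE.u1)
  have h7 := mul_nonneg hx (sub_nonneg.2 hE.u0.le)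
  rw [abs_le]
  constructor <;> linarith

lemma WedgeT.atT (hE : Eqm e ub qb) (hp : Par e η ζ) (hm : MT ub μ) {q y u : ℝ}
    (h : WedgeT e ub qb q y u) : AtT e q y u μ := by
  have h1 := hp.e1
  have hx0 := h.x0
  have hx1 := h.x1
  obtain ⟨u0, u1⟩ := abs_le.mp h.u0
  have := hE.q1
  have := hE.u0
  have := hE.u1
  refine ⟨h.x1, by linarith, abs_le.mpr ⟨by linarith [h.y1], by linarith [h.y0]⟩, by linarith,
    by linarith, by linarith [hm.1], by linarith [hm.2], (h.g_le hE (by linarith)).trans (by linarith)⟩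

lemma MT.bounds (hE : Eqm e ub qb) (hm : MT ub μ) : -2 ≤ μ ∧ μ ≤ -1 := by
  have := hE.u0
  have := hE.u1
  exact ⟨by linarith [hm.1], by linarith [hm.2]⟩

lemma WedgeT.box (hE : Eqm e ub qb) (hp : Par e η ζ) (hm : MT ub μ) {q y u : ℝ}
    (h : WedgeT e ub qb q y u) : Box q y u μ :=
  ((h.atT hE hp hm).near hp).box hp (hm.bounds hE)

lemma WedgeT.du_le (hE : Eqm e ub qb) (hp : Par e η ζ) (hm : MT ub μ) {q y u : ℝ}
    (h : WedgeT e ub qb q y u) : |FU η ζ q u μ| ≤ (qb - q)/2000 := by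
  have hA := h.atT hE hp hm
  have hz := hp.z
  have p : 12/100 ≤ u + μ + ζ := by linarith [hA.g0]
  have p0 : 0 < u + μ + ζ := by linarith
  have := hp.e1
  have hg := h.g_le hE (by linarith [hA.q0])
  have hη : η ≤ 1/100000 := hp.hsmall.1.trans (by linarith)
  unfold FU
  rw [abs_div, abs_mul, abs_of_pos p0, abs_of_pos hp.h0, div_le_iff₀ p0]
  calc η * |2 - u + 2 * q * (1 - u)| ≤ 1/100000 * (6/10 * (qb - q)) :=
        mul_le_mul hη hg (abs_nonneg _) (by norm_num)
    _ ≤ (qb - q)/2000 * (12/100) := by linarith [h.x0]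
    _ ≤ _ := mul_le_mul_of_nonneg_left p (by linarith [h.x0])

/-- An orbit of the open wedge can leave only through the section `q = 2 - 2e`. -/
lemma Orb.wedgeT_exit (ho : Orb e η ζ μ q y u) (hp : Par e η ζ) (hE : Eqm e ub qb) (hm : MT ub μ)
    {t : ℝ} (ht : 0 < t) (h : ∀ s ∈ Ico 0 t, OWedgeT e ub qb (q s) (y s) (u s))
    (hx : ¬ OWedgeT e ub qb (q t) (y t) (u t)) :
    q t = 2 - 2*e ∧ WedgeT e ub qb (q t) (y t) (u t) := by
  have cq := ho.cq
  have cy := ho.cy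
  have cu := ho.cu
  have he1 := hp.e1
  have he0 := hp.e0
  have c1 : 2 - 2*e ≤ q t :=
    le_of_le_on_Ico ht continuous_const cq fun s hs => (h s hs).x1.le
  have c2 : qb - q t ≤ -y t :=
    le_of_le_on_Ico ht (by fun_prop) (by fun_prop) fun s hs => (h s hs).y0.le
  have c3 : -y t ≤ 4 * (qb - q t) :=
    le_of_le_on_Ico ht (by fun_prop) (by fun_prop) fun s hs => (h s hs).y1.le
  have c4 : u t - ub ≤ (qb - q t)/1000 :=
    le_of_le_on_Ico ht (by fun_prop) (by fun_prop) fun s hs => (h s hs).u0.le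
  have c5 : ub - u t ≤ (qb - q t)/1000 :=
    le_of_le_on_Ico ht (by fun_prop) (by fun_prop) fun s hs => (h s hs).u1.le
  have hW : WedgeT e ub qb (q t) (y t) (u t) :=
    ⟨by linarith, c1, c2, c3, abs_le.mpr ⟨by linarith, by linarith⟩⟩
  have hb := hW.box hE hp hm
  have dq := ho.dq t hb
  have dy := ho.dy t hb
  have du := ho.du t hb
  have hanti : q t ≤ q 0 := by
    have := ge_of_deriv_le (c := 0) ht.le cq.continuousOn fun s hs =>
      ⟨y s, by have := h s ⟨hs.1.le, hs.2⟩; linarith [this.y0, this.y1],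
        ho.dq s ((h s ⟨hs.1.le, hs.2⟩).closed.box hE hp hm)⟩
    linarith
  have hpos : 0 < qb - q t := by
    have := h 0 ⟨le_rfl, ht⟩
    linarith [this.y0, this.y1]
  have hA := hW.atT hE hp hm
  have hF : FY e (q t) (y t) (u t) μ = 8 * (u t + μ) * y t
      - 2 * q t * ((qb - q t) * (q t + qb - 2) + e * (u t - ub)) := by
    rw [← hE.f_eq]; rfl
  have hR0 : 79/10 * (qb - q t) ≤ 2 * q t * ((qb - q t) * (q t + qb - 2) + e * (u t - ub)) := by
    have h1 : 199/100 * (qb - q t) ≤ (qb - q t) * (q t + qb - 2) := by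
      have := mul_le_mul_of_nonneg_left (show 199/100 ≤ q t + qb - 2 by linarith [hE.q0]) hpos.le
      linarith
    have h2 : -(1/100000 * (qb - q t)) ≤ e * (u t - ub) := by
      have := mul_le_mul hp.e1 hW.u0 (abs_nonneg _) (by norm_num)
      have h3 := neg_abs_le (e * (u t - ub))
      rw [abs_mul, abs_of_pos he0] at h3
      linarith
    have h3 := mul_le_mul (show 399/100 ≤ 2 * q t by linarith)
      (show 198999/100000 * (qb - q t) ≤ (qb - q t) * (q t + qb - 2) + e * (u t - ub) by linarith)
      (by linarith) (by linarith)
    linarith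
  have hR1 : 2 * q t * ((qb - q t) * (q t + qb - 2) + e * (u t - ub)) ≤ 81/10 * (qb - q t) := by
    have h1 : (qb - q t) * (q t + qb - 2) ≤ 2 * (qb - q t) := by
      have := mul_le_mul_of_nonneg_left (show q t + qb - 2 ≤ 2 by linarith [hE.q1]) hpos.le
      linarith
    have h2 : e * (u t - ub) ≤ 1/100000 * (qb - q t) := by
      have := mul_le_mul hp.e1 hW.u0 (abs_nonneg _) (by norm_num)
      have h3 := le_abs_self (e * (u t - ub))
      rw [abs_mul, abs_of_pos he0] at h3
      linarith
    have h3 := mul_le_mul (show 2 * q t ≤ 4 by linarith [hE.q1])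
      (show (qb - q t) * (q t + qb - 2) + e * (u t - ub) ≤ 200001/100000 * (qb - q t) by linarith)
      (by
        have := mul_nonneg hpos.le (show 0 ≤ q t + qb - 2 - 1/100 by linarith [hE.q0])
        have h3 := neg_abs_le (e * (u t - ub))
        rw [abs_mul, abs_of_pos he0] at h3
        have := mul_le_mul hp.e1 hW.u0 (abs_nonneg _) (by norm_num)
        linarith) (by norm_num)
    linarith
  obtain ⟨du0, du1⟩ := abs_le.mp (hW.du_le hE hp hm)
  by_cases b1 : 2 - 2*e < q t
  swap
  · exact ⟨le_antisymm (not_lt.mp b1) c1, hW⟩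
  exfalso
  refine hx ⟨b1, lt_of_le_of_ne c2 fun hc => ?_, lt_of_le_of_ne c3 fun hc => ?_,
    lt_of_le_of_ne c4 fun hc => ?_, lt_of_le_of_ne c5 fun hc => ?_⟩
  · have := deriv_nonpos_of_pos_left (f := fun s => q s - qb - y s) ht
      (fun s hs => by have := (h s hs).y0; linarith) (by linarith)
      ((dq.sub_const qb).sub dy)
    rw [hF, show y t = -(qb - q t) by linarith] at this
    have := mul_nonneg (show 0 ≤ u t + μ + 28/100 by linarith [hA.g0]) hpos.le
    linarith
  · have := deriv_nonpos_of_pos_left (f := fun s => 4 * (qb - q s) + y s) ht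
      (fun s hs => by have := (h s hs).y1; linarith) (by linarith)
      (((dq.const_sub qb).const_mul 4).add dy)
    rw [hF, show y t = -4 * (qb - q t) by linarith] at this
    have := mul_nonneg (show 0 ≤ -(22/100) - (u t + μ) by linarith [hA.g1]) hpos.le
    linarith
  · have := deriv_nonpos_of_pos_left (f := fun s => (qb - q s)/1000 - (u s - ub)) ht
      (fun s hs => by have := (h s hs).u0; linarith) (by linarith)
      (((dq.const_sub qb).div_const 1000).sub (du.sub_const ub))
    linarith
  · have := deriv_nonpos_of_pos_left (f := fun s => (qb - q s)/1000 - (ub - u s)) ht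
      (fun s hs => by have := (h s hs).u1; linarith) (by linarith)
      (((dq.const_sub qb).div_const 1000).sub (du.const_sub ub))
    linarith

lemma Orb.wedgeT_growth (ho : Orb e η ζ μ q y u) (hp : Par e η ζ) (hE : Eqm e ub qb) (hm : MT ub μ)
    {a b : ℝ} (hab : a ≤ b) (h : ∀ s ∈ Ioo a b, WedgeT e ub qb (q s) (y s) (u s)) :
    (qb - q a) * Real.exp (1 * (b - a)) ≤ qb - q b ∧
      qb - q b ≤ (qb - q a) * Real.exp (4 * (b - a)) := by
  have cq := ho.cq
  constructor
  · exact exp_le_of_deriv_ge (f := fun s => qb - q s) hab (by fun_prop) fun s hs =>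
      ⟨-y s, by linarith [(h s hs).y0], (ho.dq s ((h s hs).box hE hp hm)).const_sub qb⟩
  · exact le_exp_of_deriv_le (f := fun s => qb - q s) hab (by fun_prop) fun s hs =>
      ⟨-y s, by linarith [(h s hs).y1], (ho.dq s ((h s hs).box hE hp hm)).const_sub qb⟩

lemma turb_seed (hφ : PFlow e η ζ φ) (hp : Par e η ζ) (hE : Eqm e ub qb) {m : ℝ} (hm : MT ub m)
    (n : ℕ) : ∃ z : St, z.2.2.2 = m ∧ z.1 = 2 - 2*e ∧
      ∀ s ∈ Icc (-(n : ℝ)) 0, WedgeT e ub qb (φ s z).1 (φ s z).2.1 (φ s z).2.2.1 := by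
  have he0 := hp.e0
  have hρ : 0 < qb - (2 - 2*e) := by linarith [hE.q0]
  set ρ := qb - (2 - 2*e) with hρd
  set x := ρ * Real.exp (-(4 * (n : ℝ) + 4)) with hx
  have hx0 : 0 < x := mul_pos hρ (Real.exp_pos _)
  have hn : (0:ℝ) ≤ n := Nat.cast_nonneg n
  have hx1 : x < ρ := by
    have : Real.exp (-(4 * (n : ℝ) + 4)) < 1 := by
      rw [← Real.exp_zero]
      exact Real.exp_lt_exp.mpr (by linarith)
    nlinarith
  set σ : St := (qb - x, -(2*x), ub, m) with hσ
  have ho : Orb e η ζ m (fun t => (φ t σ).1) (fun t => (φ t σ).2.1) (fun t => (φ t σ).2.2.1) :=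
    hφ.orb σ
  have h0 : OWedgeT e ub qb (φ 0 σ).1 (φ 0 σ).2.1 (φ 0 σ).2.2.1 := by
    rw [hφ.zero]
    constructor <;> simp only [hσ] <;> linarith
  have hq0 : qb - (φ 0 σ).1 = x := by rw [hφ.zero]; simp only [hσ]; ring
  rcases first_exit ho.cont3 (isOpen_OWedgeT e ub qb) (a := 0) h0 (4 * (n:ℝ) + 4) with h | ⟨t, ht, hx', h⟩
  · exfalso
    have h1 := (ho.wedgeT_growth hp hE hm (show (0:ℝ) ≤ 4 * n + 4 by linarith) fun s hs =>
      (h s ⟨hs.1.le, hs.2.le⟩).closed).1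
    have h2 := (h (4 * n + 4) ⟨by linarith, le_rfl⟩).x1
    dsimp only at h2
    rw [hq0, hx, mul_assoc, ← Real.exp_add, show -(4 * (n:ℝ) + 4) + 1 * (4 * n + 4 - 0) = 0 by ring,
      Real.exp_zero] at h1
    linarith
  · obtain ⟨h1, h2⟩ := ho.wedgeT_exit hp hE hm ht.1 h hx'
    have h3 := (ho.wedgeT_growth hp hE hm ht.1.le fun s hs => (h s ⟨hs.1.le, hs.2⟩).closed).2
    have hnt : (n:ℝ) ≤ t := by
      rw [hq0, h1, hx, mul_assoc, ← Real.exp_add] at h3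
      have : 1 ≤ Real.exp (-(4 * (n : ℝ) + 4) + 4 * (t - 0)) := by
        by_contra! hc
        nlinarith
      have := Real.one_le_exp_iff.mp this
      linarith
    refine ⟨φ t σ, hφ.mu t σ, h1, fun s hs => ?_⟩
    rw [← hφ.add]
    rcases hs.2.eq_or_lt with h5 | h5
    · rw [h5, zero_add]; exact h2
    · exact (h (s + t) ⟨by linarith [hs.1], by linarith⟩).closed

lemma isCompact_wedgeT (hp : Par e η ζ) (hE : Eqm e ub qb) : IsCompact {z : St |
    WedgeT e ub qb z.1 z.2.1 z.2.2.1 ∧ MT ub z.2.2.2} := by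
  have he := hp.e1
  have hq := hE.q1
  refine (isCompact_Icc (a := ((0, -1, 0, -2) : St)) (b := (2, 1, 2, 0))).of_isClosed_subset ?_ ?_
  · have h0 : IsClosed {x : St | 0 ≤ qb - x.1} := isClosed_le (by fun_prop) (by fun_prop)
    have h1 : IsClosed {x : St | 2 - 2*e ≤ x.1} := isClosed_le (by fun_prop) (by fun_prop)
    have h2 : IsClosed {x : St | qb - x.1 ≤ -x.2.1} := isClosed_le (by fun_prop) (by fun_prop)
    have h3 : IsClosed {x : St | -x.2.1 ≤ 4 * (qb - x.1)} := isClosed_le (by fun_prop) (by fun_prop)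
    have h4 : IsClosed {x : St | |x.2.2.1 - ub| ≤ (qb - x.1)/1000} :=
      isClosed_le (by fun_prop) (by fun_prop)
    have h5 : IsClosed {x : St | -ub - 275/1000 ≤ x.2.2.2} := isClosed_le (by fun_prop) (by fun_prop)
    have h6 : IsClosed {x : St | x.2.2.2 ≤ -ub - 225/1000} := isClosed_le (by fun_prop) (by fun_prop)
    convert h0.inter (h1.inter (h2.inter (h3.inter (h4.inter (h5.inter h6))))) using 1
    ext x
    exact ⟨fun ⟨⟨a, b, c, d, f⟩, g, k⟩ => ⟨a, b, c, d, f, g, k⟩,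
      fun ⟨a, b, c, d, f, g, k⟩ => ⟨⟨a, b, c, d, f⟩, g, k⟩⟩
  · rintro z ⟨h, hm⟩
    have hA := h.atT hE hp hm
    obtain ⟨y0, y1⟩ := abs_le.mp hA.y0
    obtain ⟨m0, m1⟩ := hm.bounds hE
    exact ⟨⟨by show (0:ℝ) ≤ z.1; linarith [hA.q0], by show (-1:ℝ) ≤ z.2.1; linarith,
        by show (0:ℝ) ≤ z.2.2.1; linarith [hA.u0], m0⟩,
      ⟨hA.q1, by show z.2.1 ≤ (1:ℝ); linarith, by show z.2.2.1 ≤ (2:ℝ); linarith [hA.u1],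
        by show z.2.2.2 ≤ (0:ℝ); linarith⟩⟩

/-- A backward orbit near the turbulent state that meets a backward orbit of the wedge on the
section agrees with it. -/
lemma turb_unique (hφ : PFlow e η ζ φ) (hp : Par e η ζ) (hE : Eqm e ub qb) {z z' : St}
    (hm : MT ub z'.2.2.2) (hz : z.2.2.2 = z'.2.2.2) (hq : z.1 = z'.1)
    (h : ∀ s ≤ 0, NearT e (φ s z).1 (φ s z).2.1 (φ s z).2.2.1 z'.2.2.2)
    (h' : ∀ s ≤ 0, WedgeT e ub qb (φ s z').1 (φ s z').2.1 (φ s z').2.2.1) : z = z' := by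
  have ho := hφ.orb z
  rw [hz] at ho
  obtain ⟨h1, h2⟩ := Orb.turb_uniq hp (hm.bounds hE) ho (hφ.orb z') h
    (fun s hs => (h' s hs).atT hE hp hm) (by rw [hφ.zero, hφ.zero, hq])
  rw [hφ.zero, hφ.zero] at h1 h2
  exact Prod.ext hq (Prod.ext h1 (Prod.ext h2 hz))

/-- The branch of the unstable manifold of the turbulent state, parametrized by wave speed. -/
lemma exists_turb_branch (hφ : PFlow e η ζ φ) (hp : Par e η ζ) (hE : Eqm e ub qb) :
    ∃ w : ℝ → St, ContinuousOn w (Icc (-ub - 275/1000) (-ub - 225/1000)) ∧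
      ∀ m ∈ Icc (-ub - 275/1000) (-ub - 225/1000), (w m).2.2.2 = m ∧ (w m).1 = 2 - 2*e ∧
        ∀ s ≤ 0, WedgeT e ub qb (φ s (w m)).1 (φ s (w m)).2.1 (φ s (w m)).2.2.1 := by
  obtain ⟨w, hw, h⟩ := exists_branch hφ (isCompact_wedgeT hp hE) (h := 2 - 2*e)
    (m₀ := -ub - 275/1000) (m₁ := -ub - 225/1000)
    (fun m hm n => by
      obtain ⟨z, h1, h2, h3⟩ := turb_seed hφ hp hE hm n
      exact ⟨z, h1, h2, fun s hs => ⟨h3 s hs, by rw [hφ.mu, h1]; exact hm⟩⟩)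
    (fun z z' hm hz hq hq' h h' => by
      have hm' : MT ub z'.2.2.2 := by rw [← hz]; exact hm
      exact turb_unique hφ hp hE hm' hz (hq.trans hq'.symm)
        (fun s hs => ((h s hs).1.atT hE hp hm').near hp) fun s hs => (h' s hs).1)
  exact ⟨w, hw, fun m hm => ⟨(h m hm).1, (h m hm).2.1, fun s hs => ((h m hm).2.2 s hs).1⟩⟩

/-- Backward orbits of the wedge emanate from the turbulent state. -/
lemma Orb.wedgeT_backward (ho : Orb e η ζ μ q y u) (hp : Par e η ζ) (hE : Eqm e ub qb)
    (hm : MT ub μ) (h : ∀ s ≤ 0, WedgeT e ub qb (q s) (y s) (u s)) :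
    Tendsto q atBot (𝓝 qb) ∧ Tendsto y atBot (𝓝 0) ∧ Tendsto u atBot (𝓝 ub) := by
  have hx : ∀ s ≤ 0, qb - q s ≤ (qb - q 0) * Real.exp s := fun s hs => by
    have h1 := (ho.wedgeT_growth hp hE hm hs fun r hr => h r hr.2.le).1
    have h2 := Real.exp_pos s
    have h3 : Real.exp (1 * (0 - s)) * Real.exp s = 1 := by
      rw [← Real.exp_add]; simp
    calc qb - q s = (qb - q s) * Real.exp (1 * (0 - s)) * Real.exp s := by rw [mul_assoc, h3, mul_one]
      _ ≤ _ := mul_le_mul_of_nonneg_right h1 h2.le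
  have l0 : Tendsto (fun s => (qb - q 0) * Real.exp s) atBot (𝓝 0) := by
    simpa using Real.tendsto_exp_atBot.const_mul (qb - q 0)
  have l1 : Tendsto (fun s => qb - q s) atBot (𝓝 0) :=
    tendsto_of_tendsto_of_tendsto_of_le_of_le' tendsto_const_nhds l0
      ((eventually_le_atBot 0).mono fun s hs => (h s hs).x0)
      ((eventually_le_atBot 0).mono hx)
  refine ⟨by simpa using l1.const_sub qb, ?_, ?_⟩
  · have : Tendsto (fun s => -y s) atBot (𝓝 0) :=
      tendsto_of_tendsto_of_tendsto_of_le_of_le' l1 (by simpa using l1.const_mul 4)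
        ((eventually_le_atBot 0).mono fun s hs => (h s hs).y0)
        ((eventually_le_atBot 0).mono fun s hs => (h s hs).y1)
    simpa using this.neg
  · refine tendsto_iff_dist_tendsto_zero.mpr ?_
    exact tendsto_of_tendsto_of_tendsto_of_le_of_le' tendsto_const_nhds l1
      (Eventually.of_forall fun s => dist_nonneg)
      ((eventually_le_atBot 0).mono fun s hs => by
        rw [Real.dist_eq]
        linarith [(h s hs).u0, (h s hs).x0])

lemma Eqm.wedge (hE : Eqm e ub qb) (hp : Par e η ζ) : WedgeT e ub qb qb 0 ub := by
  have := hp.e0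
  exact ⟨by linarith, by linarith [hE.q0], by linarith, by linarith, by simp⟩

lemma Eqm.orb (hE : Eqm e ub qb) (η ζ μ : ℝ) :
    Orb e η ζ μ (fun _ => qb) (fun _ => 0) (fun _ => ub) where
  cq := continuous_const
  cy := continuous_const
  cu := continuous_const
  dq t _ := hasDerivAt_const t qb
  dy t _ := (hasDerivAt_const t (0:ℝ)).congr_deriv (by
    unfold FY
    linear_combination 2 * qb * hE.eq1)
  du t _ := (hasDerivAt_const t ub).congr_deriv (by
    unfold FU
    rw [hE.eq2]
    simp)

/-- Orbits trapped near the turbulent branch converge to the turbulent state. -/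
lemma Orb.turb_forward (ho : Orb e η ζ μ q y u) (hp : Par e η ζ) (hE : Eqm e ub qb)
    (hm : MT ub μ) {T : ℝ} (h : ∀ s, T ≤ s → NearT e (q s) (y s) (u s) μ) :
    Tendsto q atTop (𝓝 qb) ∧ Tendsto y atTop (𝓝 0) ∧ Tendsto u atTop (𝓝 ub) := by
  have hA := (hE.wedge hp).atT hE hp hm
  have ho₂ := hE.orb η ζ μ
  have hM : 0 ≤ (ζ - 35/100)/η := div_nonneg (by linarith [hp.z]) hp.h0.le
  have he1 := hp.e1
  have he0 := hp.e0
  have hb := hm.bounds hE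
  have bnd : ∀ s, T ≤ s → |q s - qb| ≤ 1 ∧ |y s - 0| ≤ 15 ∧ |u s - ub| ≤ 1 := fun s hs => by
    obtain ⟨a0, a1, b0, b1, c0, c1, -, -⟩ := h s hs
    have := hE.q1
    have := hE.q0
    have := hE.u0
    have := hE.u1
    exact ⟨abs_le.mpr ⟨by linarith, by linarith⟩, abs_le.mpr ⟨by linarith, by linarith⟩,
      abs_le.mpr ⟨by linarith, by linarith⟩⟩
  have sq : ∀ x K : ℝ, 0 ≤ K → |x| ≤ K → x^2 ≤ K^2 := fun x K hK h => sq_le_sq.mpr (by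
    rwa [abs_of_nonneg hK])
  have hN : Tendsto (pairN q y u (fun _ => qb) (fun _ => 0) (fun _ => ub)) atTop (𝓝 0) := by
    refine forward_conv (L := pairL 0 ((ζ - 35/100)/η) q y u (fun _ => qb) (fun _ => 0) (fun _ => ub))
      (T := T) (c := 1/10) (K := 10000)
      (B := (1 + 0 + (ζ - 35/100)/η) * (1^2 + 15^2 + 1^2)) (by norm_num) (by norm_num)
      (fun s hs => Orb.pair_turb hp hb ho ho₂ (h s hs) hA) (fun s hs => ?_) (fun s => ?_)
      (fun s hs => ?_)
    · refine (abs_pairL_le le_rfl hM s).trans (mul_le_mul_of_nonneg_left ?_ (by linarith))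
      obtain ⟨h1, h2, h3⟩ := bnd s hs
      exact add_le_add (add_le_add (sq _ _ (by norm_num) h1) (sq _ _ (by norm_num) h2))
        (sq _ _ (by norm_num) h3)
    · unfold pairN; positivity
    · have hbx := (h s hs).box hp hb
      obtain ⟨h1, h2, h3⟩ := bnd s hs
      have hN := h s hs
      refine ⟨_, ?_, ((((ho.dq s hbx).sub_const qb).fun_pow 2).fun_add
        (((ho.dy s hbx).sub_const 0).fun_pow 2)).fun_add (((ho.du s hbx).sub_const ub).fun_pow 2)⟩
      have hFY : |FY e (q s) (y s) (u s) μ| ≤ 200 := by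
        unfold FY
        have e1 : |8 * (u s + μ) * y s| ≤ 8 * 1 * 15 := by
          rw [abs_mul, abs_mul]
          refine mul_le_mul (mul_le_mul (by norm_num) ?_ (abs_nonneg _) (by norm_num)) ?_
            (abs_nonneg _) (by norm_num)
          · exact abs_le.mpr ⟨by linarith [hN.g0], by linarith [hN.g1]⟩
          · simpa using h2
        have e2 : |2 * q s * (q s * (2 - q s) - (21/10 - u s) * e)| ≤ 4 * 10 := by
          rw [abs_mul]
          refine mul_le_mul (abs_le.mpr ⟨by linarith [hN.q0], by linarith [hN.q1]⟩) ?_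
            (abs_nonneg _) (by norm_num)
          have i1 := mul_nonneg (show 0 ≤ q s by linarith [hN.q0]) (sub_nonneg.2 hN.q1)
          have i2 := mul_nonneg (show 0 ≤ 21/10 - u s by linarith [hN.u1]) he0.le
          have i3 := mul_le_mul (hN.q1) (show 2 - q s ≤ 1 by linarith [hN.q0])
            (by linarith [hN.q1]) (by norm_num)
          have i4 := mul_le_mul (show 21/10 - u s ≤ 1 by linarith [hN.u0]) he1 he0.le (by norm_num)
          exact abs_le.mpr ⟨by linarith, by linarith⟩
        obtain ⟨a1, a2⟩ := abs_le.mp e1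
        obtain ⟨b1, b2⟩ := abs_le.mp e2
        exact abs_le.mpr ⟨by linarith, by linarith⟩
      have hFU : |FU η ζ (q s) (u s) μ| ≤ 1 := by
        have hz := hp.z
        have p : 1/100 ≤ u s + μ + ζ := by linarith [hN.g0]
        have p0 : 0 < u s + μ + ζ := by linarith
        unfold FU
        have hη : η ≤ 1/100000 := hp.hsmall.1.trans (by linarith)
        rw [abs_div, abs_of_pos p0, div_le_one p0, abs_mul, abs_of_pos hp.h0]
        refine (mul_le_mul hη (?_ : _ ≤ (10:ℝ)) (abs_nonneg _) (by norm_num)).trans (by linarith)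
        have i1 := mul_nonneg (show 0 ≤ q s by linarith [hN.q0]) (show 0 ≤ u s - 1 by linarith [hN.u0])
        have i2 := mul_le_mul hN.q1 (show u s - 1 ≤ 2 by linarith [hN.u1]) (by linarith [hN.u0])
          (by norm_num)
        exact abs_le.mpr ⟨by linarith [hN.u1], by linarith [hN.u0]⟩
      have t1 : |(q s - qb) * y s| ≤ 1 * 15 := by
        rw [abs_mul]
        exact mul_le_mul h1 (by simpa using h2) (abs_nonneg _) (by norm_num)
      have t2 : |(y s - 0) * FY e (q s) (y s) (u s) μ| ≤ 15 * 200 := by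
        rw [abs_mul]
        exact mul_le_mul h2 hFY (abs_nonneg _) (by norm_num)
      have t3 : |(u s - ub) * FU η ζ (q s) (u s) μ| ≤ 1 * 1 := by
        rw [abs_mul]
        exact mul_le_mul h3 hFU (abs_nonneg _) (by norm_num)
      have a1 := abs_le.mp t1
      have a2 := abs_le.mp t2
      have a3 := abs_le.mp t3
      simp only [Nat.cast_ofNat, Nat.add_one_sub_one, pow_one]
      exact abs_le.mpr ⟨by linarith [a1.1, a2.1, a3.1], by linarith [a1.2, a2.2, a3.2]⟩
  have aux : ∀ (f : ℝ → ℝ) (L : ℝ), (∀ s, (f s - L)^2 ≤ pairN q y u (fun _ => qb) (fun _ => 0) (fun _ => ub) s) →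
      Tendsto f atTop (𝓝 L) := fun f L hf => by
    have h1 : Tendsto (fun s => (f s - L)^2) atTop (𝓝 0) :=
      squeeze_zero (fun s => sq_nonneg _) hf hN
    have h2 := h1.sqrt
    rw [Real.sqrt_zero] at h2
    refine tendsto_iff_dist_tendsto_zero.mpr (h2.congr fun s => ?_)
    rw [Real.sqrt_sq_eq_abs, Real.dist_eq]
  unfold pairN at aux
  refine ⟨aux q qb fun s => ?_, aux y 0 fun s => ?_, aux u ub fun s => ?_⟩ <;>
    nlinarith [sq_nonneg (q s - qb), sq_nonneg (y s - 0), sq_nonneg (u s - ub)]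

end turb

/-- Separation inequality near the laminar state: algebraic core. -/
lemma sep_lam {e g k x E₂ D R a b c : ℝ} (he0 : 0 < e) (he1 : e ≤ 1/100000) (hg : |g| ≤ 8/1000 * e)
    (hk0 : 9/1000 * e ≤ k) (hk1 : k ≤ 11/1000 * e) (hx : |x| ≤ 2/100 * e) (hD : D ≤ -(19/100) * e)
    (hR : 99/100 ≤ R) (hE : |E₂| ≤ 21/10) :
    e/1000 * (a^2 + b^2 + c^2) ≤ b^2 + g * (a * b) + x * (a * c) - D * a^2
      + k * (R * c^2 - E₂ * (a * c)) := by
  have h1 := (abs_le.mp (abs_mul_mul_le hg a b)).1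
  have h2 := (abs_le.mp (abs_mul_mul_le hx (2*a) (c/2))).1
  have hkE : |k * E₂| ≤ 11/1000 * e * (21/10) := by
    rw [abs_mul, abs_of_nonneg (show 0 ≤ k by linarith)]
    exact mul_le_mul hk1 hE (abs_nonneg _) (by linarith)
  have h3 := (abs_le.mp (abs_mul_mul_le hkE (2*a) (c/2))).2
  have h4 := mul_le_mul_of_nonneg_right hD (sq_nonneg a)
  have h5 := mul_le_mul_of_nonneg_right (mul_le_mul hk0 hR (by norm_num) (by linarith)) (sq_nonneg c)
  have h6 := mul_le_mul_of_nonneg_right he1 (sq_nonneg b)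
  have h7 := mul_nonneg he0.le (sq_nonneg a)
  have h8 := mul_nonneg he0.le (sq_nonneg c)
  linarith [sq_nonneg b]

/-- Closed wedge containing the unstable branch of the laminar state. -/
structure WedgeL (e m q y u : ℝ) : Prop where
  q0 : 0 ≤ q
  q1 : q ≤ e/1000
  y0 : (8 * (2 + m) - 2/100) * q ≤ y
  y1 : y ≤ (8 * (2 + m) + 2/100) * q
  u0 : |u - 2| ≤ q

/-- Open wedge containing the unstable branch of the laminar state. -/
structure OWedgeL (e m q y u : ℝ) : Prop where
  q1 : q < e/1000
  y0 : (8 * (2 + m) - 2/100) * q < y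
  y1 : y < (8 * (2 + m) + 2/100) * q
  u0 : u - 2 < q
  u1 : 2 - u < q

lemma isOpen_OWedgeL (e m : ℝ) :
    IsOpen {x : ℝ × ℝ × ℝ | OWedgeL e m x.1 x.2.1 x.2.2} := by
  have h0 : IsOpen {x : ℝ × ℝ × ℝ | x.1 < e/1000} := isOpen_lt (by fun_prop) (by fun_prop)
  have h1 : IsOpen {x : ℝ × ℝ × ℝ | (8 * (2 + m) - 2/100) * x.1 < x.2.1} :=
    isOpen_lt (by fun_prop) (by fun_prop)
  have h2 : IsOpen {x : ℝ × ℝ × ℝ | x.2.1 < (8 * (2 + m) + 2/100) * x.1} :=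
    isOpen_lt (by fun_prop) (by fun_prop)
  have h3 : IsOpen {x : ℝ × ℝ × ℝ | x.2.2 - 2 < x.1} := isOpen_lt (by fun_prop) (by fun_prop)
  have h4 : IsOpen {x : ℝ × ℝ × ℝ | 2 - x.2.2 < x.1} := isOpen_lt (by fun_prop) (by fun_prop)
  convert h0.inter (h1.inter (h2.inter (h3.inter h4))) using 1
  ext x
  exact ⟨fun ⟨a, b, c, d, f⟩ => ⟨a, b, c, d, f⟩, fun ⟨a, b, c, d, f⟩ => ⟨a, b, c, d, f⟩⟩

section lam
variable {e η ζ μ : ℝ} {q y u q₁ y₁ u₁ q₂ y₂ u₂ : ℝ → ℝ} {φ : ℝ → St → St}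

/-- Admissible wave speeds near the laminar state. -/
def ML (μ : ℝ) : Prop := -(1780/1000) ≤ μ ∧ μ ≤ -(1725/1000)

lemma OWedgeL.closed {q y u : ℝ} (h : OWedgeL e μ q y u) : WedgeL e μ q y u :=
  ⟨by linarith [h.u0, h.u1], h.q1.le, h.y0.le, h.y1.le,
    abs_le.mpr ⟨by linarith [h.u1], by linarith [h.u0]⟩⟩

lemma WedgeL.y_bounds (hm : ML μ) {q y u : ℝ} (h : WedgeL e μ q y u) :
    174/100 * q ≤ y ∧ y ≤ 222/100 * q := by
  have h1 := mul_nonneg h.q0 (show 0 ≤ μ + 1780/1000 by linarith [hm.1])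
  have h2 := mul_nonneg h.q0 (show 0 ≤ -(1725/1000) - μ by linarith [hm.2])
  constructor <;> linarith [h.y0, h.y1]

lemma WedgeL.box (hp : Par e η ζ) (hm : ML μ) {q y u : ℝ} (h : WedgeL e μ q y u) :
    Box q y u μ := by
  have he := hp.e1
  obtain ⟨h1, h2⟩ := h.y_bounds hm
  have h3 := h.q0
  have h4 := h.q1
  obtain ⟨h5, h6⟩ := abs_le.mp h.u0
  exact ⟨by linarith, by linarith, by linarith, by linarith, by linarith, by linarith,
    by linarith [hm.1], by linarith [hm.2], by linarith [hm.1]⟩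

lemma WedgeL.g_le (hp : Par e η ζ) {q y u : ℝ} (h : WedgeL e μ q y u) :
    |2 - u + 2 * q * (1 - u)| ≤ 4 * q := by
  have he := hp.e1
  have h3 := h.q0
  have h4 := h.q1
  obtain ⟨h5, h6⟩ := abs_le.mp h.u0
  have h7 := mul_nonneg h3 (show 0 ≤ u - 1 by linarith)
  have h8 := mul_nonneg h3 (show 0 ≤ 5/2 - u by linarith)
  exact abs_le.mpr ⟨by linarith, by linarith⟩

lemma WedgeL.du_le (hp : Par e η ζ) (hm : ML μ) {q y u : ℝ} (h : WedgeL e μ q y u) :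
    |FU η ζ q u μ| ≤ q/1000 := by
  have hz := hp.z
  have he := hp.e1
  have h3 := h.q0
  have h4 := h.q1
  obtain ⟨h5, h6⟩ := abs_le.mp h.u0
  have p : 1/2 ≤ u + μ + ζ := by linarith [hm.1]
  have p0 : 0 < u + μ + ζ := by linarith
  have hη : η ≤ 1/100000 := hp.hsmall.1.trans (by linarith [hp.e0])
  unfold FU
  rw [abs_div, abs_mul, abs_of_pos p0, abs_of_pos hp.h0, div_le_iff₀ p0]
  calc η * |2 - u + 2 * q * (1 - u)| ≤ 1/100000 * (4 * q) :=
        mul_le_mul hη (h.g_le hp) (abs_nonneg _) (by norm_num)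
    _ ≤ q/1000 * (1/2) := by linarith
    _ ≤ _ := mul_le_mul_of_nonneg_left p (by linarith)

/-- The reaction term is tiny inside the wedge. -/
lemma WedgeL.reaction (hp : Par e η ζ) {q y u : ℝ} (h : WedgeL e μ q y u) :
    |q * (2 - q) - (21/10 - u) * e| ≤ 1/100000 := by
  have he := hp.e1
  have he0 := hp.e0
  have h3 := h.q0
  have h4 := h.q1
  obtain ⟨h5, h6⟩ := abs_le.mp h.u0
  have i1 := mul_nonneg he0.le (show 0 ≤ 21/10 - u by linarith)
  have i2 := mul_nonneg he0.le (show 0 ≤ u - 19/10 by linarith)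
  have i3 := mul_nonneg h3 (show 0 ≤ 2 - q by linarith)
  have i4 := mul_nonneg h3 h3
  exact abs_le.mpr ⟨by linarith, by linarith⟩

lemma Orb.pair_lam (hp : Par e η ζ) (hm : ML μ) (ho₁ : Orb e η ζ μ q₁ y₁ u₁)
    (ho₂ : Orb e η ζ μ q₂ y₂ u₂) {t : ℝ} (h₁ : WedgeL e μ (q₁ t) (y₁ t) (u₁ t))
    (h₂ : WedgeL e μ (q₂ t) (y₂ t) (u₂ t)) :
    ∃ L', e/1000 * pairN q₁ y₁ u₁ q₂ y₂ u₂ t ≤ L' ∧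
      HasDerivAt (pairL (8 * (2 + μ)) (e/100 * (2 + μ + ζ)/η) q₁ y₁ u₁ q₂ y₂ u₂) L' t := by
  have hz := hp.z
  have he := hp.e0
  have he1 := hp.e1
  obtain ⟨m0, m1⟩ := hm
  obtain ⟨u10, u11⟩ := abs_le.mp h₁.u0
  obtain ⟨u20, u21⟩ := abs_le.mp h₂.u0
  have q10 := h₁.q0
  have q11 := h₁.q1
  have q20 := h₂.q0
  have q21 := h₂.q1
  obtain ⟨y20, y21⟩ := h₂.y_bounds ⟨m0, m1⟩
  have p1 : 6/10 < u₁ t + μ + ζ := by linarith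
  have p2 : 6/10 < u₂ t + μ + ζ := by linarith
  refine ⟨_, ?_, ho₁.pair_deriv ho₂ hp.h0.ne' (8 * (2 + μ)) (e/100 * (2 + μ + ζ)) (h₁.box hp ⟨m0, m1⟩)
    (h₂.box hp ⟨m0, m1⟩) (by linarith) (by linarith) rfl rfl rfl⟩
  have hS : |(2 - u₂ t + 2 * q₂ t * (1 - u₂ t)) / (u₂ t + μ + ζ)| ≤ 1/100 := by
    rw [abs_div, abs_of_pos (show 0 < u₂ t + μ + ζ by linarith), div_le_iff₀ (by linarith)]
    linarith [h₂.g_le hp]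
  obtain ⟨hS0, hS1⟩ := abs_le.mp hS
  have s1 := mul_nonneg q10 he.le
  have s2 := mul_nonneg q20 he.le
  have hD : 4 * (q₁ t + q₂ t) - 2 * (q₁ t ^ 2 + q₁ t * q₂ t + q₂ t ^ 2)
      - 2 * e * (21/10 - u₁ t) ≤ -(19/100) * e := by
    have i1 := mul_nonneg he.le (show 0 ≤ 2 + 1/1000 - u₁ t by linarith)
    have i2 := mul_nonneg q10 q20
    linarith [sq_nonneg (q₁ t), sq_nonneg (q₂ t)]
  have key := sep_lam (g := 8 * (u₁ t + μ) - 8 * (2 + μ)) (k := e/100 * (2 + μ + ζ) / (u₁ t + μ + ζ))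
    (x := 8 * y₂ t - 2 * e * q₂ t) (E₂ := 2 * (1 - u₂ t))
    (D := 4 * (q₁ t + q₂ t) - 2 * (q₁ t ^ 2 + q₁ t * q₂ t + q₂ t ^ 2) - 2 * e * (21/10 - u₁ t))
    (R := 1 + 2 * q₁ t + (2 - u₂ t + 2 * q₂ t * (1 - u₂ t)) / (u₂ t + μ + ζ))
    (a := q₁ t - q₂ t) (b := y₁ t - y₂ t) (c := u₁ t - u₂ t) he he1
    (abs_le.mpr ⟨by linarith, by linarith⟩)
    (by
      rw [le_div_iff₀ (by linarith)]
      have := mul_nonneg he.le (show 0 ≤ 10 * (2 + μ + ζ) - 9 * (u₁ t + μ + ζ) by linarith)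
      linarith)
    (by
      rw [div_le_iff₀ (by linarith)]
      have := mul_nonneg he.le (show 0 ≤ 11 * (u₁ t + μ + ζ) - 10 * (2 + μ + ζ) by linarith)
      linarith)
    (abs_le.mpr ⟨by
      have := mul_nonneg s2 he.le
      have := mul_nonneg q20 (show 0 ≤ 1 - e by linarith)
      linarith, by linarith⟩) hD (by linarith) (abs_le.mpr ⟨by linarith, by linarith⟩)
  unfold pairN
  refine key.trans (le_of_eq ?_)
  ring

/-- Uniqueness of backward orbits in the laminar wedge. -/
lemma lam_unique (hφ : PFlow e η ζ φ) (hp : Par e η ζ) {z z' : St}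
    (hm : ML z'.2.2.2) (hz : z.2.2.2 = z'.2.2.2) (hq : z.1 = z'.1)
    (h : ∀ s ≤ 0, WedgeL e z'.2.2.2 (φ s z).1 (φ s z).2.1 (φ s z).2.2.1)
    (h' : ∀ s ≤ 0, WedgeL e z'.2.2.2 (φ s z').1 (φ s z').2.1 (φ s z').2.2.1) : z = z' := by
  have ho := hφ.orb z
  rw [hz] at ho
  have ho' := hφ.orb z'
  set M := e/100 * (2 + z'.2.2.2 + ζ)/η with hMd
  obtain ⟨m0, m1⟩ := hm
  have hM : 0 ≤ M := div_nonneg (mul_nonneg (by linarith [hp.e0]) (by linarith [hp.z])) hp.h0.le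
  have he1 := hp.e1
  have he0 := hp.e0
  have sq : ∀ x : ℝ, |x| ≤ 1 → x^2 ≤ 1 := fun x h => by
    have := sq_le_sq.mpr (show |x| ≤ |(1:ℝ)| by simpa using h)
    linarith
  have := backward_uniq (L := pairL (8 * (2 + z'.2.2.2)) M (fun s => (φ s z).1) (fun s => (φ s z).2.1)
      (fun s => (φ s z).2.2.1) (fun s => (φ s z').1) (fun s => (φ s z').2.1) (fun s => (φ s z').2.2.1))
    (c := e/1000) (C := 1 + 8 * (2 + z'.2.2.2) + M) (B := 3)
    (by linarith) (by linarith) (pair_cont ho ho')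
    (fun s hs => Orb.pair_lam hp ⟨m0, m1⟩ ho ho' (h s hs) (h' s hs))
    (fun s _ => abs_pairL_le (by linarith) hM s) (fun s hs => by
      obtain ⟨a0, a1, -, -, c0⟩ := h s hs
      obtain ⟨a0', a1', -, -, c0'⟩ := h' s hs
      obtain ⟨b0, b1⟩ := (h s hs).y_bounds ⟨m0, m1⟩
      obtain ⟨b0', b1'⟩ := (h' s hs).y_bounds ⟨m0, m1⟩
      obtain ⟨c1, c2⟩ := abs_le.mp c0
      obtain ⟨c1', c2'⟩ := abs_le.mp c0'
      have i1 := sq ((φ s z).1 - (φ s z').1) (abs_le.mpr ⟨by linarith, by linarith⟩)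
      have i2 := sq ((φ s z).2.1 - (φ s z').2.1) (abs_le.mpr ⟨by linarith, by linarith⟩)
      have i3 := sq ((φ s z).2.2.1 - (φ s z').2.2.1) (abs_le.mpr ⟨by linarith, by linarith⟩)
      unfold pairN
      linarith) (by
      unfold pairL
      simp only [hφ.zero, hq]
      have := mul_nonneg hM (sq_nonneg (z.2.2.1 - z'.2.2.1))
      linarith) 0 le_rfl
  unfold pairN at this
  simp only [hφ.zero] at this
  have h1 := sq_nonneg (z.1 - z'.1)
  have h2 := sq_nonneg (z.2.1 - z'.2.1)
  have h3 := sq_nonneg (z.2.2.1 - z'.2.2.1)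
  have e1 : (z.2.1 - z'.2.1)^2 = 0 := by linarith
  have e2 : (z.2.2.1 - z'.2.2.1)^2 = 0 := by linarith
  exact Prod.ext hq (Prod.ext (sub_eq_zero.mp (pow_eq_zero_iff two_ne_zero |>.mp e1))
    (Prod.ext (sub_eq_zero.mp (pow_eq_zero_iff two_ne_zero |>.mp e2)) hz))

lemma Orb.wedgeL_growth (ho : Orb e η ζ μ q y u) (hp : Par e η ζ) (hm : ML μ)
    {a b : ℝ} (hab : a ≤ b) (h : ∀ s ∈ Ioo a b, WedgeL e μ (q s) (y s) (u s)) :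
    q a * Real.exp (1 * (b - a)) ≤ q b ∧ q b ≤ q a * Real.exp (3 * (b - a)) := by
  constructor
  · exact exp_le_of_deriv_ge hab ho.cq.continuousOn fun s hs =>
      ⟨y s, by linarith [((h s hs).y_bounds hm).1, (h s hs).q0], ho.dq s ((h s hs).box hp hm)⟩
  · exact le_exp_of_deriv_le hab ho.cq.continuousOn fun s hs =>
      ⟨y s, by linarith [((h s hs).y_bounds hm).2, (h s hs).q0], ho.dq s ((h s hs).box hp hm)⟩

/-- An orbit of the open wedge can leave only through the section `q = e/1000`. -/
lemma Orb.wedgeL_exit (ho : Orb e η ζ μ q y u) (hp : Par e η ζ) (hm : ML μ)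
    {t : ℝ} (ht : 0 < t) (h : ∀ s ∈ Ico 0 t, OWedgeL e μ (q s) (y s) (u s))
    (hx : ¬ OWedgeL e μ (q t) (y t) (u t)) :
    q t = e/1000 ∧ WedgeL e μ (q t) (y t) (u t) := by
  have cq := ho.cq
  have cy := ho.cy
  have cu := ho.cu
  have he1 := hp.e1
  have he0 := hp.e0
  have c1 : q t ≤ e/1000 :=
    le_of_le_on_Ico ht cq continuous_const fun s hs => (h s hs).q1.le
  have c2 : (8 * (2 + μ) - 2/100) * q t ≤ y t :=
    le_of_le_on_Ico ht (by fun_prop) (by fun_prop) fun s hs => (h s hs).y0.le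
  have c3 : y t ≤ (8 * (2 + μ) + 2/100) * q t :=
    le_of_le_on_Ico ht (by fun_prop) (by fun_prop) fun s hs => (h s hs).y1.le
  have c4 : u t - 2 ≤ q t :=
    le_of_le_on_Ico ht (by fun_prop) (by fun_prop) fun s hs => (h s hs).u0.le
  have c5 : 2 - u t ≤ q t :=
    le_of_le_on_Ico ht (by fun_prop) (by fun_prop) fun s hs => (h s hs).u1.le
  have hW : WedgeL e μ (q t) (y t) (u t) :=
    ⟨by linarith, c1, c2, c3, abs_le.mpr ⟨by linarith, by linarith⟩⟩
  have hb := hW.box hp hm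
  have dq := ho.dq t hb
  have dy := ho.dy t hb
  have du := ho.du t hb
  have hpos : 0 < q t := by
    have h0 := h 0 ⟨le_rfl, ht⟩
    have h1 := (ho.wedgeL_growth hp hm ht.le fun s hs => (h s ⟨hs.1.le, hs.2⟩).closed).1
    exact (mul_pos (show 0 < q 0 by linarith [h0.u0, h0.u1]) (Real.exp_pos _)).trans_le h1
  obtain ⟨m0, m1⟩ := hm
  obtain ⟨du0, du1⟩ := abs_le.mp (hW.du_le hp ⟨m0, m1⟩)
  obtain ⟨r0, r1⟩ := abs_le.mp (hW.reaction hp)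
  obtain ⟨y0, y1⟩ := hW.y_bounds ⟨m0, m1⟩
  by_cases b1 : q t < e/1000
  swap
  · exact ⟨le_antisymm c1 (not_lt.mp b1), hW⟩
  exfalso
  refine hx ⟨b1, lt_of_le_of_ne c2 fun hc => ?_, lt_of_le_of_ne c3 fun hc => ?_,
    lt_of_le_of_ne c4 fun hc => ?_, lt_of_le_of_ne c5 fun hc => ?_⟩
  · have := deriv_nonpos_of_pos_left (f := fun s => y s - (8 * (2 + μ) - 2/100) * q s) ht
      (fun s hs => by have := (h s hs).y0; linarith) (by linarith)
      (dy.sub (dq.const_mul _))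
    have i1 : FY e (q t) (y t) (u t) μ - (8 * (2 + μ) - 2/100) * y t = q t *
        ((8 * (2 + μ) - 2/100) * (2/100 + 8 * (u t - 2))
          - 2 * (q t * (2 - q t) - (21/10 - u t) * e)) := by
      unfold FY
      rw [← hc]
      ring
    rw [i1] at this
    have i2 := mul_le_mul (show 1 ≤ 8 * (2 + μ) - 2/100 by linarith)
      (show 1/100 ≤ 2/100 + 8 * (u t - 2) by linarith) (by norm_num) (by linarith)
    have := mul_pos hpos (show 0 < (8 * (2 + μ) - 2/100) * (2/100 + 8 * (u t - 2))
          - 2 * (q t * (2 - q t) - (21/10 - u t) * e) by linarith)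
    linarith
  · have := deriv_nonpos_of_pos_left (f := fun s => (8 * (2 + μ) + 2/100) * q s - y s) ht
      (fun s hs => by have := (h s hs).y1; linarith) (by linarith)
      ((dq.const_mul _).sub dy)
    have i1 : (8 * (2 + μ) + 2/100) * y t - FY e (q t) (y t) (u t) μ = q t *
        ((8 * (2 + μ) + 2/100) * (2/100 - 8 * (u t - 2))
          + 2 * (q t * (2 - q t) - (21/10 - u t) * e)) := by
      unfold FY
      rw [hc]
      ring
    rw [i1] at this
    have i2 := mul_le_mul (show 1 ≤ 8 * (2 + μ) + 2/100 by linarith)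
      (show 1/100 ≤ 2/100 - 8 * (u t - 2) by linarith) (by norm_num) (by linarith)
    have := mul_pos hpos (show 0 < (8 * (2 + μ) + 2/100) * (2/100 - 8 * (u t - 2))
          + 2 * (q t * (2 - q t) - (21/10 - u t) * e) by linarith)
    linarith
  · have := deriv_nonpos_of_pos_left (f := fun s => q s - (u s - 2)) ht
      (fun s hs => by have := (h s hs).u0; linarith) (by linarith)
      (dq.sub (du.sub_const 2))
    linarith
  · have := deriv_nonpos_of_pos_left (f := fun s => q s - (2 - u s)) ht
      (fun s hs => by have := (h s hs).u1; linarith) (by linarith)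
      (dq.sub (du.const_sub 2))
    linarith

lemma lam_seed (hφ : PFlow e η ζ φ) (hp : Par e η ζ) {m : ℝ} (hm : ML m)
    (n : ℕ) : ∃ z : St, z.2.2.2 = m ∧ z.1 = e/1000 ∧
      ∀ s ∈ Icc (-(n : ℝ)) 0, WedgeL e m (φ s z).1 (φ s z).2.1 (φ s z).2.2.1 := by
  have hρ : 0 < e/1000 := by linarith [hp.e0]
  set ρ := e/1000 with hρd
  set x := ρ * Real.exp (-(4 * (n : ℝ) + 4)) with hx
  have hx0 : 0 < x := mul_pos hρ (Real.exp_pos _)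
  have hn : (0:ℝ) ≤ n := Nat.cast_nonneg n
  have hx1 : x < ρ := by
    have : Real.exp (-(4 * (n : ℝ) + 4)) < 1 := by
      rw [← Real.exp_zero]
      exact Real.exp_lt_exp.mpr (by linarith)
    nlinarith
  set σ : St := (x, 8 * (2 + m) * x, 2, m) with hσ
  have ho : Orb e η ζ m (fun t => (φ t σ).1) (fun t => (φ t σ).2.1) (fun t => (φ t σ).2.2.1) :=
    hφ.orb σ
  have h0 : OWedgeL e m (φ 0 σ).1 (φ 0 σ).2.1 (φ 0 σ).2.2.1 := by
    rw [hφ.zero]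
    constructor <;> simp only [hσ] <;> linarith
  have hq0 : (φ 0 σ).1 = x := by rw [hφ.zero]
  rcases first_exit ho.cont3 (isOpen_OWedgeL e m) (a := 0) h0 (4 * (n:ℝ) + 4) with h | ⟨t, ht, hx', h⟩
  · exfalso
    have h1 := (ho.wedgeL_growth hp hm (show (0:ℝ) ≤ 4 * n + 4 by linarith) fun s hs =>
      (h s ⟨hs.1.le, hs.2.le⟩).closed).1
    have h2 := (h (4 * n + 4) ⟨by linarith, le_rfl⟩).q1
    dsimp only at h2
    rw [hq0, hx, mul_assoc, ← Real.exp_add, show -(4 * (n:ℝ) + 4) + 1 * (4 * n + 4 - 0) = 0 by ring,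
      Real.exp_zero] at h1
    linarith
  · obtain ⟨h1, h2⟩ := ho.wedgeL_exit hp hm ht.1 h hx'
    have h3 := (ho.wedgeL_growth hp hm ht.1.le fun s hs => (h s ⟨hs.1.le, hs.2⟩).closed).2
    have hnt : (n:ℝ) ≤ t := by
      rw [hq0, h1, hx, mul_assoc, ← Real.exp_add] at h3
      have : 1 ≤ Real.exp (-(4 * (n : ℝ) + 4) + 3 * (t - 0)) := by
        by_contra! hc
        nlinarith
      have := Real.one_le_exp_iff.mp this
      linarith
    refine ⟨φ t σ, hφ.mu t σ, h1, fun s hs => ?_⟩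
    rw [← hφ.add]
    rcases hs.2.eq_or_lt with h5 | h5
    · rw [h5, zero_add]; exact h2
    · exact (h (s + t) ⟨by linarith [hs.1], by linarith⟩).closed

lemma isCompact_wedgeL (hp : Par e η ζ) : IsCompact {z : St |
    WedgeL e z.2.2.2 z.1 z.2.1 z.2.2.1 ∧ ML z.2.2.2} := by
  have he := hp.e1
  have he0 := hp.e0
  refine (isCompact_Icc (a := ((0, -1, 0, -2) : St)) (b := (2, 1, 3, 0))).of_isClosed_subset ?_ ?_
  · have h0 : IsClosed {x : St | 0 ≤ x.1} := isClosed_le (by fun_prop) (by fun_prop)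
    have h1 : IsClosed {x : St | x.1 ≤ e/1000} := isClosed_le (by fun_prop) (by fun_prop)
    have h2 : IsClosed {x : St | (8 * (2 + x.2.2.2) - 2/100) * x.1 ≤ x.2.1} :=
      isClosed_le (by fun_prop) (by fun_prop)
    have h3 : IsClosed {x : St | x.2.1 ≤ (8 * (2 + x.2.2.2) + 2/100) * x.1} :=
      isClosed_le (by fun_prop) (by fun_prop)
    have h4 : IsClosed {x : St | |x.2.2.1 - 2| ≤ x.1} := isClosed_le (by fun_prop) (by fun_prop)
    have h5 : IsClosed {x : St | -(1780/1000) ≤ x.2.2.2} := isClosed_le (by fun_prop) (by fun_prop)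
    have h6 : IsClosed {x : St | x.2.2.2 ≤ -(1725/1000)} := isClosed_le (by fun_prop) (by fun_prop)
    convert h0.inter (h1.inter (h2.inter (h3.inter (h4.inter (h5.inter h6))))) using 1
    ext x
    exact ⟨fun ⟨⟨a, b, c, d, f⟩, g, k⟩ => ⟨a, b, c, d, f, g, k⟩,
      fun ⟨a, b, c, d, f, g, k⟩ => ⟨⟨a, b, c, d, f⟩, g, k⟩⟩
  · rintro z ⟨h, hm⟩
    obtain ⟨y0, y1⟩ := h.y_bounds hm
    obtain ⟨u0, u1⟩ := abs_le.mp h.u0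
    have h0 := h.q0
    have h1 := h.q1
    obtain ⟨m0, m1⟩ := hm
    exact ⟨⟨h0, by show (-1:ℝ) ≤ z.2.1; linarith, by show (0:ℝ) ≤ z.2.2.1; linarith,
        by show (-2:ℝ) ≤ z.2.2.2; linarith⟩,
      ⟨by show z.1 ≤ (2:ℝ); linarith, by show z.2.1 ≤ (1:ℝ); linarith,
        by show z.2.2.1 ≤ (3:ℝ); linarith, by show z.2.2.2 ≤ (0:ℝ); linarith⟩⟩

/-- The branch of the unstable manifold of the laminar state, parametrized by wave speed. -/
lemma exists_lam_branch (hφ : PFlow e η ζ φ) (hp : Par e η ζ) :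
    ∃ w : ℝ → St, ContinuousOn w (Icc (-(1780/1000)) (-(1725/1000))) ∧
      ∀ m ∈ Icc (-(1780/1000) : ℝ) (-(1725/1000)), (w m).2.2.2 = m ∧ (w m).1 = e/1000 ∧
        ∀ s ≤ 0, WedgeL e m (φ s (w m)).1 (φ s (w m)).2.1 (φ s (w m)).2.2.1 := by
  obtain ⟨w, hw, h⟩ := exists_branch hφ (isCompact_wedgeL hp) (h := e/1000)
    (m₀ := -(1780/1000)) (m₁ := -(1725/1000))
    (fun m hm n => by
      obtain ⟨z, h1, h2, h3⟩ := lam_seed hφ hp hm n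
      refine ⟨z, h1, h2, fun s hs => ?_⟩
      have := hφ.mu s z
      rw [h1] at this
      simp only [Set.mem_ofPred_eq, this]
      exact ⟨h3 s hs, hm⟩)
    (fun z z' hm hz hq hq' h h' => by
      have hm' : ML z'.2.2.2 := by rw [← hz]; exact hm
      refine lam_unique hφ hp hm' hz (hq.trans hq'.symm) (fun s hs => ?_) fun s hs => ?_
      · have := (h s hs).1
        rwa [hφ.mu, hz] at this
      · have := (h' s hs).1
        rwa [hφ.mu] at this)
  refine ⟨w, hw, fun m hm => ⟨(h m hm).1, (h m hm).2.1, fun s hs => ?_⟩⟩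
  have := ((h m hm).2.2 s hs).1
  rwa [hφ.mu, (h m hm).1] at this

/-- Backward orbits of the wedge emanate from the laminar state. -/
lemma Orb.wedgeL_backward (ho : Orb e η ζ μ q y u) (hp : Par e η ζ)
    (hm : ML μ) (h : ∀ s ≤ 0, WedgeL e μ (q s) (y s) (u s)) :
    Tendsto q atBot (𝓝 0) ∧ Tendsto y atBot (𝓝 0) ∧ Tendsto u atBot (𝓝 2) := by
  have hx : ∀ s ≤ 0, q s ≤ q 0 * Real.exp s := fun s hs => by
    have h1 := (ho.wedgeL_growth hp hm hs fun r hr => h r hr.2.le).1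
    have h2 := Real.exp_pos s
    have h3 : Real.exp (1 * (0 - s)) * Real.exp s = 1 := by
      rw [← Real.exp_add]; simp
    calc q s = q s * Real.exp (1 * (0 - s)) * Real.exp s := by rw [mul_assoc, h3, mul_one]
      _ ≤ _ := mul_le_mul_of_nonneg_right h1 h2.le
  have l0 : Tendsto (fun s => q 0 * Real.exp s) atBot (𝓝 0) := by
    simpa using Real.tendsto_exp_atBot.const_mul (q 0)
  have l1 : Tendsto q atBot (𝓝 0) :=
    tendsto_of_tendsto_of_tendsto_of_le_of_le' tendsto_const_nhds l0
      ((eventually_le_atBot 0).mono fun s hs => (h s hs).q0)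
      ((eventually_le_atBot 0).mono hx)
  refine ⟨l1, ?_, ?_⟩
  · exact tendsto_of_tendsto_of_tendsto_of_le_of_le' tendsto_const_nhds
      (by simpa using l1.const_mul 3)
      ((eventually_le_atBot 0).mono fun s hs => by
        linarith [((h s hs).y_bounds hm).1, (h s hs).q0])
      ((eventually_le_atBot 0).mono fun s hs => by
        linarith [((h s hs).y_bounds hm).2, (h s hs).q0])
  · refine tendsto_iff_dist_tendsto_zero.mpr ?_
    exact tendsto_of_tendsto_of_tendsto_of_le_of_le' tendsto_const_nhds l1
      (Eventually.of_forall fun s => dist_nonneg)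
      ((eventually_le_atBot 0).mono fun s hs => by
        rw [Real.dist_eq]
        exact (h s hs).u0)

end lam

/-- An orbit inside the box from the state `(q₀, 0, u₀)` to the state `(q₁, 0, u₁)`. -/
structure Conn (φ : ℝ → St → St) (x : St) (q₀ u₀ q₁ u₁ : ℝ) : Prop where
  box : ∀ s, Box (φ s x).1 (φ s x).2.1 (φ s x).2.2.1 x.2.2.2
  bot : Tendsto (fun s => (φ s x).1) atBot (𝓝 q₀) ∧ Tendsto (fun s => (φ s x).2.1) atBot (𝓝 0) ∧
    Tendsto (fun s => (φ s x).2.2.1) atBot (𝓝 u₀)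
  top : Tendsto (fun s => (φ s x).1) atTop (𝓝 q₁) ∧ Tendsto (fun s => (φ s x).2.1) atTop (𝓝 0) ∧
    Tendsto (fun s => (φ s x).2.2.1) atTop (𝓝 u₁)

section impulse
variable {e η ζ ulo : ℝ} {φ : ℝ → St → St}

lemma PFlow.tendsto_shift (hφ : PFlow e η ζ φ) {x : St} {t a b c : ℝ}
    (h : Tendsto (fun s => (φ s (φ t x)).1) atTop (𝓝 a) ∧
      Tendsto (fun s => (φ s (φ t x)).2.1) atTop (𝓝 b) ∧
      Tendsto (fun s => (φ s (φ t x)).2.2.1) atTop (𝓝 c)) :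
    Tendsto (fun s => (φ s x).1) atTop (𝓝 a) ∧ Tendsto (fun s => (φ s x).2.1) atTop (𝓝 b) ∧
      Tendsto (fun s => (φ s x).2.2.1) atTop (𝓝 c) := by
  have hs : Tendsto (fun s : ℝ => s - t) atTop atTop := tendsto_atTop_add_const_right _ _ tendsto_id
  have he : ∀ s, φ (s - t) (φ t x) = φ s x := fun s => by rw [← hφ.add, sub_add_cancel]
  refine ⟨?_, ?_, ?_⟩
  · simpa only [Function.comp_def, he] using h.1.comp hs
  · simpa only [Function.comp_def, he] using h.2.1.comp hs
  · simpa only [Function.comp_def, he] using h.2.2.comp hs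

/-- The lap curve obtained by following a curve of rising points up to the section `q = 1/20`. -/
lemma exists_lap_curve (hφ : PFlow e η ζ φ) (hp : Par e η ζ) {w : ℝ → St} {a b : ℝ} (hab : a ≤ b)
    (hw : ContinuousOn w (Icc a b)) (hm : ∀ m ∈ Icc a b, MU ulo (w m).2.2.2)
    (hr : ∀ m ∈ Icc a b, RiseS e ulo (w m).1 (w m).2.1 (w m).2.2.1 (w m).2.2.2)
    (ha : (w a).2.1 ≤ 179/100 * (w a).1 ∧ 8 * ((w a).2.2.1 + (w a).2.2.2) ≤ 179/100)
    (hb : 21/10 * (w b).1 ≤ (w b).2.1 ∧ 2195/1000 ≤ 8 * ((w b).2.2.1 + (w b).2.2.2)) :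
    ∃ τ : ℝ → ℝ, (∀ m ∈ Icc a b, Rise e ulo φ (w m) (τ m)) ∧
      LapCurve ulo (fun m => φ (τ m) (w m)) a b := by
  have hex : ∀ m, ∃ t, m ∈ Icc a b → Rise e ulo φ (w m) t := fun m => by
    by_cases h : m ∈ Icc a b
    · obtain ⟨t, ht⟩ := exists_rise hφ hp (hm m h) (hr m h)
      exact ⟨t, fun _ => ht⟩
    · exact ⟨0, fun h' => absurd h' h⟩
  choose τ hτ using hex
  have haI : a ∈ Icc a b := ⟨le_rfl, hab⟩
  have hbI : b ∈ Icc a b := ⟨hab, le_rfl⟩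
  have he := hp.e0
  have he1 := hp.e1
  have hd := (hτ a haI).down hφ hp (hm a haI) (by rw [(hr a haI).q0]; positivity)
    (by rw [(hr a haI).q0]; linarith) ha.1 ha.2
  have hu := (hτ b hbI).up hφ hp (hm b hbI) (by rw [(hr b hbI).q0]; positivity) hb.1 hb.2
  refine ⟨τ, hτ, hab, Hit.map_continuousOn hφ hw fun m h => (hτ m h).hit, fun m h => ?_,
    fun m h => (hτ m h).st, hd.1, ?_, hu.1, ?_, fun m h => ?_⟩
  · rw [hφ.mu]; exact hm m h
  · rw [hφ.mu]; exact hd.2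
  · rw [hφ.mu]; exact hu.2
  · rw [hφ.mu]
    have h1 := (abs_le.1 ((hτ m h).near (τ m) ⟨(hτ m h).hit.pos.le, le_rfl⟩)).1
    have h2 := (hr m h).g
    linarith

lemma Rise.land (hφ : PFlow e η ζ φ) {x : St} {t : ℝ} (h : Rise e ulo φ x t)
    (hl : Land e ulo φ (φ t x)) :
    (∀ s, 0 ≤ s → GU ulo (φ s x).1 (φ s x).2.1 (φ s x).2.2.1) ∧
    (Tendsto (fun s => (φ s x).1) atTop (𝓝 0) ∧ Tendsto (fun s => (φ s x).2.1) atTop (𝓝 0) ∧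
      Tendsto (fun s => (φ s x).2.2.1) atTop (𝓝 2)) ∧
    ∃ s, 0 < s ∧ 2 - 2*e ≤ (φ s x).1 ∧ (φ s x).1 ≤ 2 ∧ |(φ s x).2.1| ≤ 2*e/100 ∧
      (φ s x).2.2.1 ≤ 1/10^10 - x.2.2.2 ∧ ulo < (φ s x).2.2.1 := by
  refine ⟨fun s hs => ?_, hφ.tendsto_shift hl.lim, ?_⟩
  · rcases le_total s t with h1 | h1
    · exact h.gu s ⟨hs, h1⟩
    · have := hl.gu (s - t) (by linarith)
      rwa [← hφ.add, sub_add_cancel] at this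
  · obtain ⟨s, hs0, h1⟩ := hl.mid
    have h2 := hl.gu s hs0.le
    rw [← hφ.add, hφ.mu] at h1
    rw [← hφ.add] at h2
    exact ⟨s + t, by linarith [h.hit.pos], h1.1, h1.2.1, h1.2.2.1, h1.2.2.2, h2.u0⟩

/-- A simple impulse of the laminar state. -/
lemma exists_lam_impulse (hφ : PFlow e η ζ φ) (hp : Par e η ζ) :
    ∃ x : St, Conn φ x 0 2 0 2 ∧ ∃ s, 2 - 2*e ≤ (φ s x).1 ∧ (φ s x).1 ≤ 2 ∧
      |(φ s x).2.1| ≤ 2*e/100 ∧ 143/100 ≤ (φ s x).2.2.1 ∧ (φ s x).2.2.1 ≤ 179/100 := by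
  obtain ⟨w, hw, h⟩ := exists_lam_branch hφ hp
  have he := hp.e0
  have he1 := hp.e1
  have hW : ∀ m ∈ Icc (-(1780/1000) : ℝ) (-(1725/1000)),
      WedgeL e m (w m).1 (w m).2.1 (w m).2.2.1 := fun m hm => by
    simpa only [hφ.zero] using (h m hm).2.2 0 le_rfl
  have hu : ∀ m ∈ Icc (-(1780/1000) : ℝ) (-(1725/1000)), |(w m).2.2.1 - 2| ≤ 1/10^7 :=
    fun m hm => by linarith [(hW m hm).u0, (h m hm).2.1]
  have hMU : ∀ m ∈ Icc (-(1780/1000) : ℝ) (-(1725/1000)), MU (143/100) m := fun m hm =>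
    ⟨by norm_num, by linarith [hm.1], by linarith [hm.2], by linarith [hm.1], by linarith [hm.2]⟩
  have haI : -(1780/1000) ∈ Icc (-(1780/1000) : ℝ) (-(1725/1000)) := ⟨le_rfl, by norm_num⟩
  have hbI : -(1725/1000) ∈ Icc (-(1780/1000) : ℝ) (-(1725/1000)) := ⟨by norm_num, le_rfl⟩
  obtain ⟨τ, hτ, hL⟩ := exists_lap_curve hφ hp (ulo := 143/100) (by norm_num) hw
    (fun m hm => by rw [(h m hm).1]; exact hMU m hm)
    (fun m hm => by
      have h1 := (hW m hm).y_bounds hm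
      have h2 := abs_le.1 (hu m hm)
      have h3 := (hW m hm).q0
      exact ⟨(h m hm).2.1, by linarith, by linarith, by linarith, by linarith,
        by rw [(h m hm).1]; linarith [hm.1]⟩)
    ⟨by linarith [(hW _ haI).y1, (hW _ haI).q0], by
      rw [(h _ haI).1]; linarith [(abs_le.1 (hu _ haI)).2]⟩
    ⟨by linarith [(hW _ hbI).y0, (hW _ hbI).q0], by
      rw [(h _ hbI).1]; linarith [(abs_le.1 (hu _ hbI)).1]⟩
  have hlu : ∀ m ∈ Icc (-(1780/1000) : ℝ) (-(1725/1000)), 146/100 ≤ (φ (τ m) (w m)).2.2.1 :=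
    fun m hm => by
      linarith [(abs_le.1 ((hτ m hm).near (τ m) ⟨(hτ m hm).hit.pos.le, le_rfl⟩)).1,
        (abs_le.1 (hu m hm)).1]
  obtain ⟨m, hm, hl⟩ := hL.impulse hφ hp hlu
    fun m hm => by rw [hφ.mu, (h m hm).1]; exact hm.2
  obtain ⟨hg, ht, s, -, h1, h2, h3, h4, h5⟩ := (hτ m hm).land hφ hl
  rw [(h m hm).1] at h4
  have hb := (hφ.orb (w m)).wedgeL_backward hp (by rw [(h m hm).1]; exact hm)
    (by rw [(h m hm).1]; exact (h m hm).2.2)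
  refine ⟨w m, ⟨fun s => ?_, hb, ht⟩, s, h1, h2, h3, h5.le, by linarith [hm.1]⟩
  rw [(h m hm).1]
  rcases le_total s 0 with hs | hs
  · exact ((h m hm).2.2 s hs).box hp hm
  · exact (hg s hs).box (hMU m hm)

end impulse

/-- A quantity that grows at rate at least `ρ` whenever it is at most `κ` ends up above `κ`. -/
lemma reach_ge {f : ℝ → ℝ} {a b κ ρ L : ℝ} (hc : ContinuousOn f (Icc a b)) (hρ : 0 ≤ ρ)
    (h : ∀ s ∈ Ioo a b, f s ≤ κ → ∃ f', ρ ≤ f' ∧ HasDerivAt f f' s) (hL0 : 0 ≤ L)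
    (hL : κ ≤ f a + ρ * L) : ∀ s ∈ Icc (a + L) b, κ ≤ f s := by
  intro s hs
  by_contra! hlt
  have has : a ≤ s := by linarith [hs.1]
  by_cases hex : ∃ r ∈ Icc a s, κ ≤ f r
  · have hc' : ContinuousOn f (Icc a s) := hc.mono (Icc_subset_Icc le_rfl hs.2)
    have hcl : IsCompact (Icc a s ∩ f ⁻¹' Ici κ) :=
      isCompact_Icc.of_isClosed_subset (hc'.preimage_isClosed_of_isClosed isClosed_Icc isClosed_Ici)
        inter_subset_left
    obtain ⟨r, hr, hmax⟩ := hcl.exists_isGreatest (by obtain ⟨r, hr, h⟩ := hex; exact ⟨r, hr, h⟩)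
    have := le_of_deriv_ge (f := f) (c := 0) hr.1.2
      (hc'.mono (Icc_subset_Icc hr.1.1 le_rfl)) fun t ht => by
        have htκ : f t ≤ κ := by
          by_contra! hcon
          exact absurd (hmax ⟨⟨hr.1.1.trans ht.1.le, ht.2.le⟩, hcon.le⟩) (not_le.2 ht.1)
        obtain ⟨f', h1, h2⟩ := h t ⟨hr.1.1.trans_lt ht.1, ht.2.trans_le hs.2⟩ htκ
        exact ⟨f', hρ.trans h1, h2⟩
    have hrκ : κ ≤ f r := hr.2
    linarith
  · push Not at hex
    have := le_of_deriv_ge (f := f) (c := ρ) has (hc.mono (Icc_subset_Icc le_rfl hs.2))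
      fun t ht => h t ⟨ht.1, ht.2.trans_le hs.2⟩ (hex t ⟨ht.1.le, ht.2.le⟩).le
    have h3 : ρ * L ≤ ρ * (s - a) := mul_le_mul_of_nonneg_left (by linarith [hs.1]) hρ
    linarith

/-- A subinterval on which a continuous function runs through exactly a given range of values. -/
lemma exists_subinterval {f : ℝ → ℝ} {p q lo hi : ℝ} (hpq : p ≤ q) (hc : ContinuousOn f (Icc p q))
    (hp : f p ≤ lo) (hlh : lo < hi) (hq : hi ≤ f q) :
    ∃ a b, p ≤ a ∧ a ≤ b ∧ b ≤ q ∧ f a = lo ∧ f b = hi ∧ ∀ m ∈ Icc a b, f m ∈ Icc lo hi := by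
  have hcl : IsCompact (Icc p q ∩ f ⁻¹' Ici hi) :=
    isCompact_Icc.of_isClosed_subset (hc.preimage_isClosed_of_isClosed isClosed_Icc isClosed_Ici)
      inter_subset_left
  obtain ⟨b, hb, hmin⟩ := hcl.exists_isLeast ⟨q, ⟨hpq, le_rfl⟩, hq⟩
  have hc' : ContinuousOn f (Icc p b) := hc.mono (Icc_subset_Icc le_rfl hb.1.2)
  have hcl' : IsCompact (Icc p b ∩ f ⁻¹' Iic lo) :=
    isCompact_Icc.of_isClosed_subset (hc'.preimage_isClosed_of_isClosed isClosed_Icc isClosed_Iic)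
      inter_subset_left
  obtain ⟨a, ha, hmax⟩ := hcl'.exists_isGreatest ⟨p, ⟨le_rfl, hb.1.1⟩, hp⟩
  have hb' : hi ≤ f b := hb.2
  have ha' : f a ≤ lo := ha.2
  have hcab : ContinuousOn f (Icc a b) := hc'.mono (Icc_subset_Icc ha.1.1 le_rfl)
  obtain ⟨t, ht, hft⟩ := intermediate_value_Icc ha.1.2 hcab
    (show hi ∈ Icc (f a) (f b) from ⟨by linarith, hb'⟩)
  have htb : t = b := le_antisymm ht.2 (hmin ⟨⟨ha.1.1.trans ht.1, ht.2.trans hb.1.2⟩, hft.ge⟩)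
  obtain ⟨t', ht', hft'⟩ := intermediate_value_Icc ha.1.2 hcab
    (show lo ∈ Icc (f a) (f b) from ⟨ha', by linarith⟩)
  have hta : t' = a := le_antisymm (hmax ⟨⟨ha.1.1.trans ht'.1, ht'.2⟩, hft'.le⟩) ht'.1
  rw [htb] at hft
  rw [hta] at hft'
  refine ⟨a, b, ha.1.1, ha.1.2, hb.1.2, hft', hft, fun m hm => ⟨?_, ?_⟩⟩
  · by_contra! hlt
    have h1 : m ≤ a := hmax ⟨⟨ha.1.1.trans hm.1, hm.2⟩, hlt.le⟩
    rw [le_antisymm h1 hm.1] at hlt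
    linarith
  · by_contra! hlt
    have h1 : b ≤ m := hmin ⟨⟨ha.1.1.trans hm.1, hm.2.trans hb.1.2⟩, hlt.le⟩
    rw [le_antisymm hm.2 h1] at hlt
    linarith

/-- Points close to the laminar plane with moderate logarithmic slope. -/
structure Thin (e ulo q y u : ℝ) : Prop where
  q0 : 0 < q
  q1 : q < e/1000
  y0 : -(e/50 * q) < y
  y1 : y < 6 * q
  u0 : ulo < u
  u1 : u < 401/200

lemma isOpen_Thin (e ulo : ℝ) : IsOpen {x : ℝ × ℝ × ℝ | Thin e ulo x.1 x.2.1 x.2.2} := by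
  have h1 : IsOpen {x : ℝ × ℝ × ℝ | 0 < x.1} := isOpen_lt (by fun_prop) (by fun_prop)
  have h2 : IsOpen {x : ℝ × ℝ × ℝ | x.1 < e/1000} := isOpen_lt (by fun_prop) (by fun_prop)
  have h3 : IsOpen {x : ℝ × ℝ × ℝ | -(e/50 * x.1) < x.2.1} := isOpen_lt (by fun_prop) (by fun_prop)
  have h4 : IsOpen {x : ℝ × ℝ × ℝ | x.2.1 < 6 * x.1} := isOpen_lt (by fun_prop) (by fun_prop)
  have h5 : IsOpen {x : ℝ × ℝ × ℝ | ulo < x.2.2} := isOpen_lt (by fun_prop) (by fun_prop)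
  have h6 : IsOpen {x : ℝ × ℝ × ℝ | x.2.2 < 401/200} := isOpen_lt (by fun_prop) (by fun_prop)
  convert ((((h1.inter h2).inter h3).inter h4).inter h5).inter h6 using 1
  ext x
  exact ⟨fun h => ⟨⟨⟨⟨⟨h.q0, h.q1⟩, h.y0⟩, h.y1⟩, h.u0⟩, h.u1⟩,
    fun h => ⟨h.1.1.1.1.1, h.1.1.1.1.2, h.1.1.1.2, h.1.1.2, h.1.2, h.2⟩⟩

section regrow
variable {e η ζ μ ulo : ℝ} {q y u : ℝ → ℝ}

lemma Thin.gu (hp : Par e η ζ) {q y u : ℝ} (h : Thin e ulo q y u) : GU ulo q y u := by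
  have h1 := mul_le_mul_of_nonneg_right hp.e1 h.q0.le
  have := h.q0
  exact ⟨h.q0, by linarith [h.q1, hp.e1], by linarith [h.y0], by linarith [h.y1], h.u0, h.u1⟩

lemma gamma_bounds (hm : MU ulo μ) {u : ℝ} (h0 : ulo ≤ u) (h1 : u ≤ 401/200) :
    -(288/100) ≤ 8 * (u + μ) ∧ 8 * (u + μ) ≤ 48/10 := by
  constructor <;> linarith [hm.g0, hm.g1]

/-- Where an orbit leaves the thin region. -/
lemma Orb.thin_exit (ho : Orb e η ζ μ q y u) (hp : Par e η ζ) (hm : MU ulo μ) (hl : ulo ≤ 19/10)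
    {t : ℝ} (ht : 0 < t) (h : ∀ s ∈ Ico 0 t, Thin e ulo (q s) (y s) (u s)) :
    0 < q t ∧ q t ≤ e/1000 ∧ -(e/50 * q t) < y t ∧ y t < 6 * q t ∧ ulo < u t ∧ u t < 401/200 := by
  have hgu : ∀ s ∈ Ico 0 t, GU ulo (q s) (y s) (u s) := fun s hs => (h s hs).gu hp
  have hqp := ho.q_pos hm ht hgu
  obtain ⟨-, -, -, -, hu0, hu1, hb⟩ := GU.closure ho hm ht hgu
  have hγ := gamma_bounds hm hu0 hu1
  have he := hp.e0
  have he1 := hp.e1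
  have hq1 : q t ≤ e/1000 :=
    le_of_le_on_Ico ht ho.cq continuous_const fun s hs => (h s hs).q1.le
  have hy0 : -(e/50 * q t) ≤ y t :=
    le_of_le_on_Ico ht (continuous_const.mul ho.cq).neg ho.cy fun s hs => (h s hs).y0.le
  have hy1 : y t ≤ 6 * q t :=
    le_of_le_on_Ico ht ho.cy (continuous_const.mul ho.cq) fun s hs => (h s hs).y1.le
  have h00 := h 0 ⟨le_rfl, ht⟩
  have hbox : ∀ r ∈ Ioc 0 t, Box (q r) (y r) (u r) μ ∧ 0 ≤ q r ∧ q r ≤ e/1000 := fun r hr => by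
    rcases hr.2.lt_or_eq with h1 | h1
    · have := h r ⟨hr.1.le, h1⟩
      exact ⟨(this.gu hp).box hm, this.q0.le, this.q1.le⟩
    · rw [h1]; exact ⟨hb, hqp.le, hq1⟩
  have hu0' : ulo < u t := by
    have h6 := mul_le_mul_of_nonneg_left (show ulo - 1 ≤ 9/10 by linarith) he.le
    exact ho.lt_u hp h00.u0 (by linarith [hm.lo]) (qm := e/1000) (by linarith)
      (fun r hr => ⟨(hbox r hr).1, (hbox r hr).2.2⟩) t ⟨ht.le, le_rfl⟩
  have hu1' : u t < 401/200 := ho.u_lt hp hm h00.u1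
    (fun r hr => ⟨(hbox r hr).1, (hbox r hr).2.1⟩) t ⟨ht.le, le_rfl⟩
  have hq2 : q t * (2 - q t) ≤ e/500 := by
    have := mul_nonneg hqp.le hqp.le
    linarith
  have hq3 : 0 ≤ q t * (2 - q t) := mul_nonneg hqp.le (by linarith)
  have heu : 19/200 * e ≤ (21/10 - u t) * e := by
    have := mul_nonneg (show 0 ≤ 401/200 - u t by linarith) he.le
    linarith
  have heu' : (21/10 - u t) * e ≤ e := by
    have := mul_nonneg (show 0 ≤ u t - 11/10 by linarith [hm.lo]) he.le
    linarith
  refine ⟨hqp, hq1, lt_of_le_of_ne hy0 fun heq => ?_, lt_of_le_of_ne hy1 fun heq => ?_, hu0', hu1'⟩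
  · have hd := (ho.dy t hb).fun_add ((ho.dq t hb).const_mul (e/50))
    have := deriv_nonpos_of_pos_left ht (fun s hs => by linarith [(h s hs).y0]) (by linarith) hd
    unfold FY at this
    have h1 : 0 < q t * (-(8 * (u t + μ) * (e/50)) - 2 * (q t * (2 - q t))
        + 2 * ((21/10 - u t) * e) - e/50 * (e/50)) := by
      refine mul_pos hqp ?_
      have h2 := mul_le_mul_of_nonneg_right hγ.2 (show 0 ≤ e/50 by linarith)
      have h3 := mul_le_mul_of_nonneg_left he1 he.le
      linarith
    rw [← heq] at this
    linarith
  · have hd := ((ho.dq t hb).const_mul 6).fun_sub (ho.dy t hb)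
    have := deriv_nonpos_of_pos_left ht (fun s hs => by linarith [(h s hs).y1]) (by linarith) hd
    unfold FY at this
    have h1 : 0 < q t * (36 - 8 * (u t + μ) * 6 + 2 * (q t * (2 - q t))
        - 2 * ((21/10 - u t) * e)) := by
      refine mul_pos hqp ?_
      linarith
    rw [heq] at this
    linarith

/-- The slope equation in the thin region. -/
lemma thin_slope (hp : Par e η ζ) {q u : ℝ} (hq0 : 0 ≤ q) (hq1 : q ≤ e/1000) (hu0 : 119/100 ≤ u)
    (hu1 : u ≤ 401/200) :
    2 * ((21/10 - u) * e) - 4/1000 * e ≤ 2 * ((21/10 - u) * e) - 2 * q * (2 - q) ∧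
    2 * ((21/10 - u) * e) - 2 * q * (2 - q) ≤ 2 * e ∧
    186/1000 * e ≤ 2 * ((21/10 - u) * e) - 2 * q * (2 - q) := by
  have he := hp.e0
  have h1 := mul_nonneg hq0 hq0
  have h2 := mul_nonneg hq0 (show 0 ≤ 2 - q by linarith [hp.e1])
  have h3 := mul_nonneg (show 0 ≤ 401/200 - u by linarith) he.le
  have h4 := mul_nonneg (show 0 ≤ u - 119/100 by linarith) he.le
  refine ⟨by linarith, by linarith, by linarith⟩

structure ThinC (e q y u : ℝ) : Prop where
  q0 : 0 < q
  q1 : q ≤ e/1000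
  y0 : -(e/50 * q) ≤ y
  y1 : y ≤ 6 * q
  u0 : 119/100 ≤ u
  u1 : u ≤ 401/200

lemma ThinC.box (hp : Par e η ζ) (hm : MU (119/100) μ) {q y u : ℝ} (h : ThinC e q y u) :
    Box q y u μ := by
  have h1 := mul_le_mul_of_nonneg_right hp.e1 h.q0.le
  have := h.q0
  have := hp.e1
  unfold Box
  refine ⟨by linarith, by linarith [h.q1], by linarith [h.y0, h.q1], by linarith [h.y1, h.q1],
    by linarith [h.u0], by linarith [h.u1], by linarith [hm.m0], by linarith [hm.m1],
    by linarith [hm.g0, h.u0]⟩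

lemma Orb.thin_w_cont (ho : Orb e η ζ μ q y u) {a b : ℝ}
    (h : ∀ s ∈ Icc a b, ThinC e (q s) (y s) (u s)) :
    ContinuousOn (fun s => y s / q s) (Icc a b) :=
  ho.cy.continuousOn.div ho.cq.continuousOn fun s hs => (h s hs).q0.ne'

lemma ThinC.w_bounds {q y u : ℝ} (h : ThinC e q y u) : -(e/50) ≤ y / q ∧ y / q ≤ 6 := by
  rw [le_div_iff₀ h.q0, div_le_iff₀ h.q0]
  exact ⟨by linarith [h.y0], h.y1⟩

/-- In the thin region the slope soon becomes positive. -/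
lemma Orb.thin_pos (ho : Orb e η ζ μ q y u) (hp : Par e η ζ) (hm : MU (119/100) μ) {a b : ℝ}
    (h : ∀ s ∈ Icc a b, ThinC e (q s) (y s) (u s)) (hab : a ≤ b) :
    ∀ s ∈ Icc (a + 1) b, 3/100 * e * q s ≤ y s := by
  have he := hp.e0
  have he1 := hp.e1
  intro s hs
  have := reach_ge (ho.thin_w_cont h) (ρ := 5/100 * e) (κ := 3/100 * e) (L := 1) (by linarith)
    (fun s hs hw => by
      have hC := h s ⟨hs.1.le, hs.2.le⟩
      refine ⟨_, ?_, ho.dw (hC.box hp hm) hC.q0⟩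
      have h1 := hC.w_bounds
      have hγ := gamma_bounds hm hC.u0 hC.u1
      have h2 := (thin_slope hp hC.q0.le hC.q1 hC.u0 hC.u1).2.2
      set W := y s / q s
      set g := 8 * (u s + μ)
      have h3 : W^2 ≤ 1/1000 * e := by
        have h4 : |W| ≤ 3/100 * e := abs_le.2 ⟨by linarith, hw⟩
        have h5 := mul_le_mul h4 h4 (abs_nonneg _) (by linarith)
        have h6 := mul_le_mul_of_nonneg_left he1 he.le
        rw [← sq_abs, sq]
        linarith
      have h4 : -(1/10 * e) ≤ g * W := by
        rcases le_total 0 W with hW | hW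
        · have h5 := mul_le_mul_of_nonneg_right hγ.1 hW
          linarith
        · have h5 := mul_le_mul_of_nonpos_right hγ.2 hW
          linarith
      linarith) zero_le_one
    (by linarith [(h a ⟨le_rfl, hab⟩).w_bounds.1]) s hs
  rwa [le_div_iff₀ (h s ⟨by linarith [hs.1], hs.2⟩).q0] at this

/-- Lower tracking of the slope by the instantaneous growth rate. -/
lemma Orb.track_lo (ho : Orb e η ζ μ q y u) (hp : Par e η ζ) (hm : MU (119/100) μ) {a b κ : ℝ}
    (h : ∀ s ∈ Icc a b, ThinC e (q s) (y s) (u s)) (hab : a ≤ b) (hκ1 : κ ≤ 3)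
    (hu : ∀ s ∈ Icc a b, u s ≤ 18/10) (hg : ∀ s ∈ Icc a b, κ + 5/100 ≤ 8 * (u s + μ)) :
    ∀ s ∈ Icc (a + 60/e) b, κ * q s ≤ y s := by
  have he := hp.e0
  have he1 := hp.e1
  have h60 : 0 ≤ 60/e := by positivity
  intro s hs
  have := reach_ge (ho.thin_w_cont h) (ρ := 2/10 * e) (κ := κ) (L := 60/e) (by linarith)
    (fun s hs hw => by
      have hI : s ∈ Icc a b := ⟨hs.1.le, hs.2.le⟩
      have hC := h s hI
      refine ⟨_, ?_, ho.dw (hC.box hp hm) hC.q0⟩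
      have h1 := hC.w_bounds
      have hγ := gamma_bounds hm hC.u0 hC.u1
      have h2 := (thin_slope hp hC.q0.le hC.q1 hC.u0 hC.u1).1
      have h3 := mul_nonneg (sub_nonneg.2 (hu s hI)) he.le
      have hgs := hg s hI
      set W := y s / q s
      set g := 8 * (u s + μ)
      have h4 : -(12/100 * e) ≤ W * (g - W) := by
        rcases le_total 0 W with hW | hW
        · have h5 := mul_nonneg hW (show 0 ≤ g - W by linarith)
          linarith
        · have h5 := mul_le_mul_of_nonneg_left (show -W ≤ e/50 by linarith)
            (show 0 ≤ g - W by linarith)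
          have h6 := mul_le_mul_of_nonneg_right (show g - W ≤ 49/10 by linarith)
            (show 0 ≤ e/50 by linarith)
          linarith
      linarith) h60
    (by
      have h5 : 2/10 * e * (60/e) = 12 := by field_simp; norm_num
      rw [h5]
      linarith [(h a ⟨le_rfl, hab⟩).w_bounds.1]) s hs
  rwa [le_div_iff₀ (h s ⟨by linarith [hs.1], hs.2⟩).q0] at this

/-- Upper tracking of the slope by the instantaneous growth rate. -/
lemma Orb.track_hi (ho : Orb e η ζ μ q y u) (hp : Par e η ζ) (hm : MU (119/100) μ) {a b κ : ℝ}
    (h : ∀ s ∈ Icc a b, ThinC e (q s) (y s) (u s)) (hab : a ≤ b) (hκ0 : 1 ≤ κ)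
    (hg : ∀ s ∈ Icc a b, 8 * (u s + μ) ≤ κ - 5/100) :
    ∀ s ∈ Icc (a + 60/e) b, y s ≤ κ * q s := by
  have he := hp.e0
  have he1 := hp.e1
  have h60 : 0 ≤ 60/e := by positivity
  intro s hs
  have := reach_ge (f := fun s => -(y s / q s)) (ho.thin_w_cont h).neg (ρ := 4/100) (κ := -κ)
    (L := 60/e) (by norm_num)
    (fun s hs hw => by
      have hI : s ∈ Icc a b := ⟨hs.1.le, hs.2.le⟩
      have hC := h s hI
      refine ⟨_, ?_, ho.dW (hC.box hp hm) hC.q0⟩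
      have h2 := (thin_slope hp hC.q0.le hC.q1 hC.u0 hC.u1).2.1
      have hgs := hg s hI
      set W := y s / q s
      set g := 8 * (u s + μ)
      have hW : κ ≤ W := by linarith
      have h5 := mul_le_mul_of_nonneg_left (show 5/100 ≤ W - g by linarith)
        (show 0 ≤ W by linarith)
      linarith) h60
    (by
      have h5 : 60 ≤ 60/e := by rw [le_div_iff₀ he]; linarith
      have h6 : 6000000 ≤ 60/e := by rw [le_div_iff₀ he]; linarith
      linarith [(h a ⟨le_rfl, hab⟩).w_bounds.2]) s hs
  have h7 : y s / q s ≤ κ := by linarith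
  rwa [div_le_iff₀ (h s ⟨by linarith [hs.1], hs.2⟩).q0] at h7

lemma Thin.closed (hl : 119/100 ≤ ulo) {q y u : ℝ} (h : Thin e ulo q y u) : ThinC e q y u :=
  ⟨h.q0, h.q1.le, h.y0.le, h.y1.le, hl.trans h.u0.le, h.u1.le⟩

/-- An orbit that has turned back very close to the laminar plane rises again. -/
lemma Orb.regrow (ho : Orb e η ζ μ q y u) (hp : Par e η ζ) (hm : MU (119/100) μ)
    (hq0 : 0 < q 0) (hq1 : q 0 ≤ e/1000 * Real.exp (-(400/e))) (hy0 : -(e/100 * q 0) ≤ y 0)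
    (hy1 : y 0 ≤ 0) (hu0 : 119/100 < u 0) (hu1 : u 0 < 401/200) :
    ∃ t, 60/e ≤ t ∧ q t = e/1000 ∧ (∀ s ∈ Ico 0 t, q s < e/1000) ∧
      (∀ s ∈ Icc 0 t, ThinC e (q s) (y s) (u s) ∧ GU (119/100) (q s) (y s) (u s)) := by
  have he := hp.e0
  have he1 := hp.e1
  have hexp : Real.exp (-(400/e)) < 1 := Real.exp_lt_one_iff.2 (by rw [neg_lt_zero]; positivity)
  have hqs : q 0 < e/1000 := hq1.trans_lt (by
    have := mul_lt_mul_of_pos_left hexp (show 0 < e/1000 by positivity)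
    linarith)
  have heq := mul_pos he hq0
  have h0 : Thin e (119/100) (q 0) (y 0) (u 0) :=
    ⟨hq0, hqs, by linarith, by linarith, hu0, hu1⟩
  set B : ℝ := 2 + Real.log (e/1000 / q 0 * 2) / (3/100 * e) with hB
  have hlog : 0 < Real.log (e/1000 / q 0 * 2) := by
    apply Real.log_pos
    have : 1 < e/1000 / q 0 := by rwa [lt_div_iff₀ hq0, one_mul]
    linarith
  have hB2 : 2 < B := by
    have : 0 < Real.log (e/1000 / q 0 * 2) / (3/100 * e) := by positivity
    linarith
  have hlow : ∀ t, 1 ≤ t → (∀ s ∈ Icc 0 t, ThinC e (q s) (y s) (u s)) →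
      q 0 / 2 * Real.exp (3/100 * e * (t - 1)) ≤ q t := fun t ht h => by
    have hpos := ho.thin_pos hp hm h (by linarith)
    have h1 := exp_le_of_deriv_ge (f := q) (c := -(e/50)) (a := 0) (b := 1) zero_le_one
      ho.cq.continuousOn fun s hs => by
        have := h s ⟨hs.1.le, hs.2.le.trans ht⟩
        exact ⟨_, by linarith [this.y0], ho.dq s (this.box hp hm)⟩
    have h2 := exp_le_of_deriv_ge (f := q) (c := 3/100 * e) (a := 1) (b := t) ht
      ho.cq.continuousOn fun s hs => by
        have := h s ⟨by linarith [hs.1], hs.2.le⟩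
        exact ⟨_, hpos s ⟨by linarith [hs.1], hs.2.le⟩, ho.dq s (this.box hp hm)⟩
    have h3 : 1/2 ≤ Real.exp (-(e/50) * (1 - 0)) := by
      have := Real.add_one_le_exp (-(e/50) * (1 - 0))
      linarith
    have h4 := mul_le_mul_of_nonneg_left h3 hq0.le
    refine le_trans (mul_le_mul_of_nonneg_right ?_ (Real.exp_pos _).le) h2
    linarith
  rcases first_exit ho.cont3 (isOpen_Thin e (119/100)) h0 B with h | ⟨t, ht, hx, h⟩
  · exfalso
    have h1 := hlow B (by linarith) fun s hs => (h s hs).closed le_rfl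
    have h2 : Real.log (e/1000 / q 0 * 2) ≤ 3/100 * e * (B - 1) := by
      have : 3/100 * e * (B - 1) = 3/100 * e + Real.log (e/1000 / q 0 * 2) := by
        rw [hB]; field_simp; ring
      linarith
    have h3 := Real.exp_le_exp.2 h2
    rw [Real.exp_log (by positivity)] at h3
    have h4 := mul_le_mul_of_nonneg_left h3 (show 0 ≤ q 0 / 2 by positivity)
    have h5 : q 0 / 2 * (e/1000 / q 0 * 2) = e/1000 := by field_simp
    linarith [(h B ⟨by linarith, le_rfl⟩).q1]
  · obtain ⟨a1, a2, a3, a4, a5, a6⟩ := ho.thin_exit hp hm (by norm_num) ht.1 h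
    have hqt : q t = e/1000 := by
      by_contra hne
      exact hx ⟨a1, lt_of_le_of_ne a2 hne, a3, a4, a5, a6⟩
    have hT : ∀ s ∈ Icc 0 t, ThinC e (q s) (y s) (u s) ∧ GU (119/100) (q s) (y s) (u s) := by
      intro s hs
      rcases hs.2.lt_or_eq with h1 | h1
      · exact ⟨(h s ⟨hs.1, h1⟩).closed le_rfl, (h s ⟨hs.1, h1⟩).gu hp⟩
      · rw [h1]
        have := mul_pos he a1
        have := mul_le_mul_of_nonneg_right he1 a1.le
        exact ⟨⟨a1, a2, a3.le, a4.le, a5.le, a6.le⟩,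
          ⟨a1, by linarith, by linarith, by linarith, a5, a6⟩⟩
    refine ⟨t, ?_, hqt, fun s hs => (h s hs).q1, hT⟩
    have h1 := le_exp_of_deriv_le (f := q) (c := 6) ht.1.le ho.cq.continuousOn fun s hs => by
      have := (hT s ⟨hs.1.le, hs.2.le⟩).1
      exact ⟨_, this.y1, ho.dq s (this.box hp hm)⟩
    have h2 := h1.trans (mul_le_mul_of_nonneg_right hq1 (Real.exp_pos _).le)
    rw [hqt, mul_assoc, ← Real.exp_add] at h2
    have h3 : 1 ≤ Real.exp (-(400/e) + 6 * (t - 0)) :=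
      le_of_mul_le_mul_left (by linarith) (show 0 < e/1000 by positivity)
    rw [Real.one_le_exp_iff] at h3
    have h4 : 60/e * 6 ≤ 400/e := by
      rw [div_mul_eq_mul_div]
      exact div_le_div_of_nonneg_right (by norm_num) he.le
    linarith

end regrow

section descent
variable {e η ζ μ T : ℝ} {q y u : ℝ → ℝ}

lemma Desc.anti (hd : Desc e (119/100) μ q y u T) (ho : Orb e η ζ μ q y u) (hm : MU (119/100) μ)
    {a b : ℝ} (ha : 0 ≤ a) (hab : a ≤ b) (hb : b < T) : q b ≤ q a :=
  ho.q_anti hm hab fun s hs =>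
    ⟨(hd.gf s ⟨ha.trans hs.1, hs.2.trans_lt hb⟩).1, hd.y0 s ⟨ha.trans hs.1, hs.2.trans_lt hb⟩⟩

lemma Desc.lt_fortieth (hd : Desc e (119/100) μ q y u T) (ho : Orb e η ζ μ q y u)
    (hp : Par e η ζ) (hm : MU (119/100) μ) (hq : q 0 ≤ 2 - 2*e) :
    ∀ s ∈ Ico (27/e) T, q s < 1/40 := by
  intro s hs
  have he := hp.e0
  by_contra! hc
  have h27 : 0 < 27/e := by positivity
  have hs0 : 0 ≤ s := h27.le.trans hs.1
  have := ho.fall_time hp hm hs0 fun r hr => by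
    have hrT : r ∈ Ico 0 T := ⟨hr.1, hr.2.trans_lt hs.2⟩
    exact ⟨(hd.gf r hrT).1, hd.y0 r hrT, hc.trans (hd.anti ho hm hr.1 hr.2 hs.2),
      (hd.anti ho hm le_rfl hr.1 hrT.2).trans hq⟩
  have h26 : 26/e < 27/e := div_lt_div_of_pos_right (by norm_num) he
  linarith [hs.1]

/-- After a long descent the orbit is exponentially close to the laminar plane. -/
lemma Desc.small (hd : Desc e (119/100) μ q y u T) (ho : Orb e η ζ μ q y u)
    (hp : Par e η ζ) (hm : MU (119/100) μ) (hq : q 0 ≤ 2 - 2*e) (hT : 10^5/e^2 < T) :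
    ∀ s ∈ Icc (10^5/e^2) T, q s ≤ e/1000 * Real.exp (-(400/e)) := by
  have he := hp.e0
  have he1 := hp.e1
  have h27 : 0 < 27/e := by positivity
  have hinv : 100000 ≤ 1/e := by rw [le_div_iff₀ he]; linarith
  have hs27 : 27/e + 42500/e^2 ≤ 10^5/e^2 := by
    rw [show 27/e = 27 * (1/e) by ring, show 42500/e^2 = 42500 * (1/e)^2 by ring,
      show 10^5/e^2 = 10^5 * (1/e)^2 by ring]
    have := mul_le_mul_of_nonneg_right hinv (show 0 ≤ 1/e by positivity)
    linarith
  have h425 : 0 < 42500/e^2 := by positivity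
  have key : ∀ s ∈ Ico (10^5/e^2) T, q s ≤ e/1000 * Real.exp (-(400/e)) := by
    intro s hs
    have h27s : 27/e ≤ s := by linarith [hs.1]
    have hlt := hd.lt_fortieth ho hp hm hq
    have h1 := ho.q_decay hm (c := e/100) h27s fun r hr => by
      have hrT : r ∈ Ico 0 T := ⟨h27.le.trans hr.1, hr.2.trans_lt hs.2⟩
      obtain ⟨h1, h2⟩ := hd.gf r hrT
      refine ⟨h1, (h2.resolve_left ?_).le⟩
      exact not_lt.2 (hlt r ⟨hr.1, hrT.2⟩).le
    have h2 := (hlt (27/e) ⟨le_rfl, h27s.trans_lt hs.2⟩).le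
    have h3 : Real.exp (-(e/100) * (s - 27/e)) ≤ Real.exp (-(425/e)) := by
      apply Real.exp_le_exp.2
      have h4 := mul_le_mul_of_nonneg_left (show 42500/e^2 ≤ s - 27/e by linarith [hs.1])
        (show 0 ≤ e/100 by positivity)
      have h5 : e/100 * (42500/e^2) = 425/e := by field_simp; norm_num
      linarith
    have h4 := h1.trans (mul_le_mul h2 h3 (Real.exp_pos _).le (by norm_num))
    have h5 : Real.exp (-(425/e)) = Real.exp (-(400/e)) * Real.exp (-(25/e)) := by
      rw [← Real.exp_add]; congr 1; ring
    have h6 : Real.exp (-(25/e)) ≤ e/25 := by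
      rw [Real.exp_neg, inv_le_comm₀ (Real.exp_pos _) (by positivity), inv_div]
      linarith [Real.add_one_le_exp (25/e)]
    rw [h5] at h4
    have h7 := mul_le_mul_of_nonneg_left h6 (Real.exp_pos (-(400/e))).le
    linarith
  intro s hs
  rcases hs.2.lt_or_eq with h | h
  · exact key s ⟨hs.1, h⟩
  · rw [h]
    exact le_of_le_on_Ico hT ho.cq continuous_const key

lemma Desc.end_bounds (hd : Desc e (119/100) μ q y u T) (ho : Orb e η ζ μ q y u)
    (hm : MU (119/100) μ) (hT : 0 < T) (hu0 : 119/100 < u T) (hu1 : u T < 401/200) :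
    (∀ s ∈ Icc 0 T, GU (119/100) (q s) (y s) (u s)) ∧ y T ≤ 0 ∧ -(7 * q T) ≤ y T := by
  have hU : ∀ s ∈ Ico 0 T, GU (119/100) (q s) (y s) (u s) := fun s hs => (hd.gf s hs).1
  have hqp := ho.q_pos hm hT hU
  have hy0 : y T ≤ 0 := le_of_le_on_Ico hT ho.cy continuous_const hd.y0
  have hy7 : -(7 * q T) ≤ y T :=
    le_of_le_on_Ico hT (continuous_const.mul ho.cq).neg ho.cy hd.y7
  have hq : q T ≤ q 0 := le_of_le_on_Ico hT ho.cq continuous_const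
    fun s hs => hd.anti ho hm le_rfl hs.1 hs.2
  refine ⟨fun s hs => ?_, hy0, hy7⟩
  rcases hs.2.lt_or_eq with h | h
  · exact hU s ⟨hs.1, h⟩
  · rw [h]
    exact ⟨hqp, hq.trans_lt (hU 0 ⟨le_rfl, hT⟩).q1, by linarith, by linarith, hu0, hu1⟩

/-- The slow variable needs a long time for a macroscopic change. -/
lemma Desc.late (hd : Desc e (119/100) μ q y u T) (ho : Orb e η ζ μ q y u)
    (hp : Par e η ζ) (hm : MU (119/100) μ) (hT : 0 ≤ T) (hu : 9/10000 ≤ u T - u 0) :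
    10^5/e^2 < T := by
  by_contra! hc
  have he := hp.e0
  have h1 := (abs_le.1 (ho.u_drift hp hm hT fun s hs => (hd.gf s ⟨hs.1.le, hs.2⟩).1)).2
  have h2 := mul_le_mul hp.hsmall.2.1 hc hT (by positivity)
  have h3 : e^2/10^30 * (10^5/e^2) = 1/10^25 := by field_simp
  rw [sub_zero] at h1
  have h4 : 200 * η * T = 200 * (η * T) := by ring
  linarith

end descent

/-- Descent along a flow line, with the standard lower bound on the slow variable. -/
abbrev DescX (e : ℝ) (φ : ℝ → St → St) (x : St) (T : ℝ) : Prop :=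
  Desc e (119/100) x.2.2.2 (fun s => (φ s x).1) (fun s => (φ s x).2.1) (fun s => (φ s x).2.2.1) T

/-- Initial points that turn back above the landing manifold while `u` stays below `ℓ`. -/
def VL (φ : ℝ → St → St) (e ℓ : ℝ) : Set St :=
  Reach φ (SU (119/100) ∩ {x | x.2.2.1 < ℓ}) (SV e)

/-- Starting points on the section `q = 2 - 2e`. -/
structure StartT (e ub : ℝ) (x : St) : Prop where
  q : x.1 = 2 - 2*e
  y0 : -(8*e) ≤ x.2.1
  y1 : x.2.1 ≤ 0
  u : |x.2.2.1 - ub| ≤ e/500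
  mu : MT ub x.2.2.2

section level
variable {e η ζ μ ub qb ℓ : ℝ} {q y u : ℝ → ℝ} {φ : ℝ → St → St} {x : St}

lemma isOpen_VL (hφ : PFlow e η ζ φ) : IsOpen (VL φ e ℓ) :=
  isOpen_Reach hφ.cont ((isOpen_SU _).inter (isOpen_lt (by fun_prop) continuous_const)) (isOpen_SV e)

lemma VL_mono {ℓ' : ℝ} (h : ℓ ≤ ℓ') : VL φ e ℓ ⊆ VL φ e ℓ' := by
  rintro x ⟨t, ht, hV, hU⟩
  exact ⟨t, ht, hV, fun s hs => ⟨(hU s hs).1, (hU s hs).2.trans_le h⟩⟩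

lemma VL_subset_VC : VL φ e ℓ ⊆ VC φ e (119/100) := by
  rintro x ⟨t, ht, hV, hU⟩
  exact ⟨t, ht, hV, fun s hs => (hU s hs).1⟩

lemma MT.mu (hE : Eqm e ub qb) (hm : MT ub μ) : MU (119/100) μ := by
  have h1 := hE.u0
  have h2 := hE.u1
  exact ⟨le_rfl, by linarith [hm.1], by linarith [hm.2], by linarith [hm.1], by linarith [hm.2]⟩

lemma StartT.u_bounds (hx : StartT e ub x) :
    ub - e/500 ≤ x.2.2.1 ∧ x.2.2.1 ≤ ub + e/500 := by
  have := abs_le.1 hx.u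
  exact ⟨by linarith [this.1], by linarith [this.2]⟩

lemma StartT.gu (hx : StartT e ub x) (hp : Par e η ζ) (hE : Eqm e ub qb) :
    GU (119/100) x.1 x.2.1 x.2.2.1 := by
  have e0 := hp.e0
  have e1 := hp.e1
  have h1 := hE.u0
  have h2 := hE.u1
  have := hx.u_bounds
  rw [hx.q]
  exact ⟨by linarith, by linarith, by linarith [hx.y0], by linarith [hx.y1], by linarith, by linarith⟩

lemma Desc.of_lt {T : ℝ} (h : ∀ T' < T, Desc e (119/100) μ q y u T') : Desc e (119/100) μ q y u T := by
  have h1 : ∀ s < T, (s + T)/2 < T ∧ s < (s + T)/2 := fun s hs => ⟨by linarith, by linarith⟩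
  exact ⟨fun s hs => (h _ (h1 s hs.2).1).gf s ⟨hs.1, (h1 s hs.2).2⟩,
    fun s hs => (h _ (h1 s hs.2).1).y0 s ⟨hs.1, (h1 s hs.2).2⟩,
    fun s hs => (h _ (h1 s hs.2).1).y7 s ⟨hs.1, (h1 s hs.2).2⟩⟩

lemma StartT.desc (hx : StartT e ub x) (hφ : PFlow e η ζ φ) (hp : Par e η ζ) (hE : Eqm e ub qb)
    {T : ℝ}
    (hV : ∀ t ∈ Icc 0 T, (∀ s ∈ Icc 0 t, φ s x ∈ SU (119/100)) → φ t x ∉ SV e)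
    (hO : ∀ t ∈ Icc 0 T, (∀ s ∈ Icc 0 t, φ s x ∈ SF e (119/100)) → φ t x ∉ SO) :
    DescX e φ x T := by
  have e0 := hp.e0
  have e1 := hp.e1
  have hU := hx.gu hp hE
  refine (hφ.orb x).desc hp (hx.mu.mu hE) ?_ ?_ ?_ ?_ (Or.inl rfl) (fun t ht hs hq => ?_)
    fun t ht hs => ?_
  · simp only [hφ.zero, hx.q]; linarith
  · simp only [hφ.zero, hx.q]; exact le_rfl
  · simpa only [hφ.zero] using hU
  · simpa only [hφ.zero] using hx.y1
  · by_contra! hc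
    exact hV t ht hs ⟨hq, hc⟩
  · by_contra! hc
    exact hO t ht hs hc

/-- An orbit which does not fall through and does not turn back below the level `ℓ` reaches it. -/
lemma StartT.fall_level (hx : StartT e ub x) (hφ : PFlow e η ζ φ) (hp : Par e η ζ)
    (hE : Eqm e ub qb) (hℓ0 : ub + e/500 < ℓ) (hℓ1 : ℓ < 2) (hO : x ∉ OC φ e (119/100))
    (hV : x ∉ VL φ e ℓ) :
    ∃ T > 0, (φ T x).2.2.1 = ℓ ∧ (∀ s ∈ Ico 0 T, (φ s x).2.2.1 < ℓ) ∧ DescX e φ x T := by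
  have hd : ∀ T, (∀ s ∈ Icc 0 T, (φ s x).2.2.1 < ℓ) → DescX e φ x T := fun T hT =>
    hx.desc hφ hp hE
      (fun t ht hs hc => hV ⟨t, ht.1, hc, fun s hs' => ⟨hs s hs', hT s ⟨hs'.1, hs'.2.trans ht.2⟩⟩⟩)
      fun t ht hs hc => hO ⟨t, ht.1, hc, hs⟩
  have hcu := (hφ.orb x).cu
  have h0 : (φ 0 x).2.2.1 < ℓ := by
    rw [hφ.zero]; linarith [hx.u_bounds.2]
  have hop : IsOpen {z : ℝ | z < ℓ} := isOpen_Iio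
  by_cases hall : ∀ T, ∀ s ∈ Icc 0 T, (φ s x).2.2.1 < ℓ
  · have h1 := ((hφ.orb x).desc_lands hp (hx.mu.mu hE) (by simp only [hφ.zero, hx.q]; exact le_rfl)
      fun T => hd T (hall T)).2.2
    have h2 : (2:ℝ) ≤ ℓ := le_of_tendsto h1 ((eventually_ge_atTop 0).mono fun s hs =>
      (hall s s ⟨hs, le_rfl⟩).le)
    linarith
  · obtain ⟨b, hb⟩ := not_forall.1 hall
    obtain h1 | ⟨t, ht, h1, h2⟩ := first_exit hcu hop (a := 0) h0 b
    · exact absurd h1 hb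
    · refine ⟨t, ht.1, le_antisymm ?_ (not_lt.1 h1), h2, ?_⟩
      · exact le_of_le_on_Ico ht.1 hcu continuous_const fun s hs => (h2 s hs).le
      · exact Desc.of_lt fun T' hT' => hd T' fun s hs => h2 s ⟨hs.1, hs.2.trans_lt hT'⟩

/-- At a boundary point of the early turning set the orbit reaches the level on the upper side of
the landing manifold. -/
lemma boundary_VL (hφ : PFlow e η ζ φ) {T : ℝ} (hd : DescX e φ x T) (hcl : x ∈ closure (VL φ e ℓ))
    (hT : 0 ≤ T) (hu : (φ T x).2.2.1 = ℓ)
    (hb : Box (φ T x).1 (φ T x).2.1 (φ T x).2.2.1 x.2.2.2)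
    (hg : 0 < FU η ζ (φ T x).1 (φ T x).2.2.1 x.2.2.2) : -(e/100 * (φ T x).1) ≤ (φ T x).2.1 := by
  by_contra! hc
  have hcont : Continuous fun s => φ s x := hφ.cont.comp (by fun_prop : Continuous fun s : ℝ => (s, x))
  have hW : IsOpen ({z : St | 1/40 < z.1} ∪ {z : St | z.2.1 < -(e/100 * z.1)}) :=
    (isOpen_lt continuous_const (by fun_prop)).union (isOpen_lt (by fun_prop) (by fun_prop))
  set W : Set St := {z : St | 1/40 < z.1} ∪ {z : St | z.2.1 < -(e/100 * z.1)} with hWdef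
  have hTW : φ T x ∈ W := Or.inr hc
  obtain ⟨d, hd0, hd1⟩ := pos_right_of_deriv_pos ((hφ.du T x hb).sub_const ℓ) (by rw [hu, sub_self]) hg
  obtain ⟨d', hd'0, hd'1⟩ := Metric.mem_nhds_iff.1 ((hW.preimage hcont).mem_nhds hTW)
  obtain ⟨r, hr0, hr⟩ := exists_between (lt_min hd0 hd'0)
  have hr1 := hr.trans_le (min_le_left _ _)
  have hr2 := hr.trans_le (min_le_right _ _)
  have hin : ∀ s ∈ Icc 0 (T + r), φ s x ∈ W := by
    intro s hs
    rcases lt_or_ge s T with h | h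
    · exact (hd.gf s ⟨hs.1, h⟩).2
    · refine hd'1 ?_
      rw [Metric.mem_ball, Real.dist_eq, abs_of_nonneg (by linarith)]
      linarith [hs.2]
  have huT : φ (T + r) x ∈ {z : St | ℓ < z.2.2.1} := by
    have := hd1 (T + r) ⟨by linarith, by linarith⟩
    exact sub_pos.1 this
  have hop : IsOpen {z : St | ℓ < z.2.2.1} := isOpen_lt continuous_const (by fun_prop)
  have hcz : Continuous fun z => φ (T + r) z :=
    hφ.cont.comp (by fun_prop : Continuous fun z : St => (T + r, z))
  obtain ⟨z, ⟨hz1, hz2⟩, t, ht, hzV, hzU⟩ := mem_closure_iff_nhds.1 hcl _ (Filter.inter_mem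
    (eventually_forall_Icc hφ.cont hW hin) ((hop.preimage hcz).mem_nhds huT))
  have htT : t ≤ T + r := by
    by_contra! h
    have h3 : (φ (T + r) z).2.2.1 < ℓ := (hzU (T + r) ⟨by linarith, h.le⟩).2
    have h4 : ℓ < (φ (T + r) z).2.2.1 := hz2
    linarith
  obtain ⟨h5, h6⟩ : (φ t z).1 < 1/40 ∧ -(e/100 * (φ t z).1) < (φ t z).2.1 := hzV
  have h7 : 1/40 < (φ t z).1 ∨ (φ t z).2.1 < -(e/100 * (φ t z).1) := hz1 t ⟨ht, htT⟩
  rcases h7 with h | h <;> linarith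

lemma Orb.barrier_O' (ho : Orb e η ζ μ q y u) (hp : Par e η ζ) (hm : MU (119/100) μ) {a b : ℝ}
    (h0 : y a ≤ -(q a * (19/10 - q a)))
    (h : ∀ s ∈ Icc a b, GU (119/100) (q s) (y s) (u s) ∧ -(182/100) ≤ 8 * (u s + μ) ∧
      8 * (u s + μ) ≤ -(175/100)) :
    ∀ s ∈ Icc a b, y s ≤ -(q s * (19/10 - q s)) := by
  have e0 := hp.e0
  have e1 := hp.e1
  have cq := ho.cq
  have cy := ho.cy
  have := barrier_pos' (f := fun s => -(q s * (19/10 - q s)) - y s) (a := a) (b := b) (by fun_prop)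
    (by simpa using h0) (fun s hs _ hz => by
      obtain ⟨hU, hg, hg3⟩ := h s hs
      have hb := hU.box hm
      refine ⟨_, ?_, (((ho.dq s hb).mul ((ho.dq s hb).const_sub _)).neg).sub (ho.dy s hb)⟩
      have hy : y s = -(q s * (19/10 - q s)) := by linarith
      have h1 := hU.q0
      have h3 : (21/10 - u s) * e ≤ 1 * (1/100000) :=
        mul_le_mul (by linarith [hm.lo, hU.u0]) e1 e0.le (by norm_num)
      rw [FY, hy]
      have h4 : 0 ≤ q s * (-(17/10) - 8 * (u s + μ)) := mul_nonneg h1.le (by linarith)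
      have h5 : 0 < q s * (19/10 * (19/10 + 8 * (u s + μ)) + q s * (4 - 57/10 - 8 * (u s + μ))
        - 2 * ((21/10 - u s) * e)) := mul_pos h1 (by linarith)
      linarith)
  intro s hs
  rcases hs.1.eq_or_lt with h' | h'
  · rw [← h']; exact h0
  · linarith [this s ⟨h', hs.2⟩]

lemma StartT.u_near (hx : StartT e ub x) (hφ : PFlow e η ζ φ) (hp : Par e η ζ)
    (hE : Eqm e ub qb) {s : ℝ} (hs : s ∈ Icc 0 (201/e^2))
    (hU : ∀ r ∈ Ioo 0 s, GU (119/100) (φ r x).1 (φ r x).2.1 (φ r x).2.2.1) :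
    |(φ s x).2.2.1 - ub| ≤ 1/10^7 := by
  have h1 := (hφ.orb x).u_short hp (hx.mu.mu hE) hs.1
    (by have := hp.two_hundred.2.1; linarith [hs.2]) hU
  simp only [hφ.zero] at h1
  have h2 := abs_sub_le (φ s x).2.2.1 x.2.2.1 ub
  have h3 := hx.u
  have := hp.e1
  linarith

lemma StartT.left (hx : StartT e ub x) (hφ : PFlow e η ζ φ) (hp : Par e η ζ)
    (hE : Eqm e ub qb) (hm : x.2.2.2 = -ub - 275/1000) : x ∈ VL φ e (ub + 1/1000) := by
  by_contra hV
  have e0 := hp.e0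
  have e1 := hp.e1
  obtain ⟨a1, a2, a3⟩ := hp.two_hundred
  have hmu := hx.mu.mu hE
  have ho := hφ.orb x
  have hu : ∀ s ∈ Icc 0 (201/e^2), (∀ r ∈ Icc 0 s, GU (119/100) (φ r x).1 (φ r x).2.1 (φ r x).2.2.1) →
      8 * ((φ s x).2.2.1 + x.2.2.2) ≤ -(215/100) ∧ (φ s x).2.2.1 < ub + 1/1000 := by
    intro s hs hU
    have := abs_le.1 (hx.u_near hφ hp hE hs fun r hr => hU r ⟨hr.1.le, hr.2.le⟩)
    rw [hm]
    constructor <;> linarith [this.1, this.2]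
  have hV' : ∀ t ∈ Icc 0 (201/e^2), (∀ s ∈ Icc 0 t, φ s x ∈ SU (119/100)) → φ t x ∉ SV e :=
    fun t ht hs hc => hV ⟨t, ht.1, hc, fun s hs' => ⟨hs s hs', (hu s ⟨hs'.1, hs'.2.trans ht.2⟩
      fun r hr => hs r ⟨hr.1, hr.2.trans hs'.2⟩).2⟩⟩
  have h0 : 0 ≤ (φ 0 x).2.1 + (φ 0 x).1 * (21/10 - (φ 0 x).1) := by
    rw [hφ.zero, hx.q]
    have := hx.y0
    nlinarith
  have hd : DescX e φ x (201/e^2) := by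
    refine hx.desc hφ hp hE hV' fun s hs hU hc => ?_
    have h3 := ho.barrier_V hp hmu (a := 0) (b := s) h0
      (fun r hr => ⟨(hU r hr).1, (hu r ⟨hr.1, hr.2.trans hs.2⟩
      fun r' hr' => (hU r' ⟨hr'.1, hr'.2.trans hr.2⟩).1).1⟩) s ⟨hs.1, le_rfl⟩
    have h4 : 0 < (φ s x).1 := (hU s ⟨hs.1, le_rfl⟩).1.q0
    have h5 : (φ s x).2.1 < -(7 * (φ s x).1) := hc
    have h6 := mul_pos h4 h4
    linarith
  refine ho.forced_V hp hmu (T := 200/e^2) le_rfl ?_ ?_ h0 fun s hs => ?_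
  · simp only [hφ.zero, hx.q]; linarith
  · simp only [hφ.zero, hx.q]; exact le_rfl
  have hs' : s ∈ Ico 0 (201/e^2) := ⟨hs.1, by linarith [hs.2]⟩
  have hU : ∀ r ∈ Icc 0 s, GU (119/100) (φ r x).1 (φ r x).2.1 (φ r x).2.2.1 :=
    fun r hr => (hd.gf r ⟨hr.1, hr.2.trans_lt hs'.2⟩).1
  refine ⟨(hd.gf s hs').1, hd.y0 s hs', hd.y7 s hs', (hu s ⟨hs.1, hs'.2.le⟩ hU).1, fun hq => ?_⟩
  by_contra! hc
  exact hV' s ⟨hs.1, hs'.2.le⟩ hU ⟨hq, hc⟩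

lemma StartT.right (hx : StartT e ub x) (hφ : PFlow e η ζ φ) (hp : Par e η ζ)
    (hE : Eqm e ub qb) (hm : x.2.2.2 = -ub - 225/1000) : x ∈ OC φ e (119/100) := by
  by_contra hO
  have e0 := hp.e0
  have e1 := hp.e1
  obtain ⟨a1, a2, a3⟩ := hp.two_hundred
  have hmu := hx.mu.mu hE
  have ho := hφ.orb x
  have hu : ∀ s ∈ Icc 0 (201/e^2), (∀ r ∈ Icc 0 s, GU (119/100) (φ r x).1 (φ r x).2.1 (φ r x).2.2.1) →
      -(182/100) ≤ 8 * ((φ s x).2.2.1 + x.2.2.2) ∧ 8 * ((φ s x).2.2.1 + x.2.2.2) ≤ -(175/100) := by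
    intro s hs hU
    have := abs_le.1 (hx.u_near hφ hp hE hs fun r hr => hU r ⟨hr.1.le, hr.2.le⟩)
    rw [hm]
    constructor <;> linarith [this.1, this.2]
  have h0 : (φ 0 x).2.1 ≤ -((φ 0 x).1 * (19/10 - (φ 0 x).1)) := by
    rw [hφ.zero, hx.q]
    have := hx.y1
    nlinarith
  have hd : DescX e φ x (201/e^2) := by
    refine hx.desc hφ hp hE (fun s hs hU hc => ?_) fun t ht hs hc => hO ⟨t, ht.1, hc, hs⟩
    have h3 := ho.barrier_O' hp hmu (a := 0) (b := s) h0
      (fun r hr => ⟨hU r hr, hu r ⟨hr.1, hr.2.trans hs.2⟩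
      fun r' hr' => hU r' ⟨hr'.1, hr'.2.trans hr.2⟩⟩) s ⟨hs.1, le_rfl⟩
    have h4 : 0 < (φ s x).1 := (hU s ⟨hs.1, le_rfl⟩).q0
    obtain ⟨h5, h6⟩ : (φ s x).1 < 1/40 ∧ -(e/100 * (φ s x).1) < (φ s x).2.1 := hc
    nlinarith
  refine ho.forced_O hp hmu (T := 200/e^2) (κ := 19/10) (g := -(182/100)) le_rfl (by norm_num) ?_
    (by norm_num) (by norm_num) ?_ fun s hs => ?_
  · simp only [hφ.zero, hx.q]; linarith
  · simp only [hφ.zero, hx.q]; exact le_rfl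
  have hs' : s ∈ Ico 0 (201/e^2) := ⟨hs.1, by linarith [hs.2]⟩
  exact ⟨(hd.gf s hs').1, hd.y0 s hs', hd.y7 s hs', (hu s ⟨hs.1, hs'.2.le⟩ fun r hr =>
    (hd.gf r ⟨hr.1, hr.2.trans_lt hs'.2⟩).1).1⟩

end level

/-- An orbit that has come down to the thin region on the upper side of the landing manifold. -/
structure Turn (e : ℝ) (φ : ℝ → St → St) (x : St) (T : ℝ) : Prop where
  pos : 10^5/e^2 < T
  desc : DescX e φ x T
  gu : ∀ s ∈ Icc 0 T, GU (119/100) (φ s x).1 (φ s x).2.1 (φ s x).2.2.1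
  q : (φ T x).1 ≤ e/1000 * Real.exp (-(400/e))
  y0 : -(e/100 * (φ T x).1) ≤ (φ T x).2.1
  y1 : (φ T x).2.1 ≤ 0

section turn
variable {e η ζ μ ub qb ℓ : ℝ} {φ : ℝ → St → St} {x : St} {T : ℝ}

lemma FU_pos (hp : Par e η ζ) {q u : ℝ} (hq : q ≤ 1/40) (hu0 : 1 ≤ u) (hu : u ≤ 18/10)
    (hg : -(36/100) ≤ u + μ) : 0 < FU η ζ q u μ := by
  have h1 : q * (u - 1) ≤ 1/40 * (8/10) := mul_le_mul hq (by linarith) (by linarith) (by norm_num)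
  exact div_pos (mul_pos hp.h0 (by linarith)) (by linarith [hp.z])

lemma Par.late_time (hp : Par e η ζ) : 27/e < 10^5/e^2 ∧ 0 < 27/e := by
  have e0 := hp.e0
  refine ⟨?_, by positivity⟩
  rw [div_lt_div_iff₀ e0 (by positivity)]
  nlinarith [hp.e1]

lemma StartT.turn (hx : StartT e ub x) (hφ : PFlow e η ζ φ) (hp : Par e η ζ) (hE : Eqm e ub qb)
    (hT : 0 < T) (hd : DescX e φ x T) (hu0 : ub + 95/100000 ≤ (φ T x).2.2.1)
    (hu1 : (φ T x).2.2.1 ≤ ub + 9/16) (hy : -(e/100 * (φ T x).1) ≤ (φ T x).2.1) :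
    Turn e φ x T := by
  have e1 := hp.e1
  have h1 := hE.u0
  have h2 := hE.u1
  have ho := hφ.orb x
  have hmu := hx.mu.mu hE
  have hu := hx.u_bounds.2
  have hT' : 10^5/e^2 < T := hd.late ho hp hmu hT.le (by rw [hφ.zero]; linarith)
  obtain ⟨b1, b2, -⟩ := hd.end_bounds ho hmu hT (by linarith) (by linarith)
  exact ⟨hT', hd, b1, hd.small ho hp hmu (by rw [hφ.zero]; exact hx.q.le) hT' T ⟨hT'.le, le_rfl⟩,
    hy, b2⟩

lemma StartT.turn_boundary (hx : StartT e ub x) (hφ : PFlow e η ζ φ) (hp : Par e η ζ)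
    (hE : Eqm e ub qb) (hℓ0 : ub + 95/100000 ≤ ℓ) (hℓ1 : ℓ ≤ ub + 9/16)
    (hO : x ∉ OC φ e (119/100)) (hV : x ∉ VL φ e ℓ) (hcl : x ∈ closure (VL φ e ℓ)) :
    ∃ T, Turn e φ x T ∧ (φ T x).2.2.1 = ℓ ∧ ∀ s ∈ Ico 0 T, (φ s x).2.2.1 < ℓ := by
  have e1 := hp.e1
  have h1 := hE.u0
  have h2 := hE.u1
  have ho := hφ.orb x
  have hmu := hx.mu.mu hE
  have hu := hx.u_bounds.2
  obtain ⟨T, hT, hTu, hTl, hd⟩ := hx.fall_level hφ hp hE (ℓ := ℓ) (by linarith) (by linarith) hO hV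
  obtain ⟨b1, b2, -⟩ := hd.end_bounds ho hmu hT (by rw [hTu]; linarith) (by rw [hTu]; linarith)
  have hT' : 10^5/e^2 < T := hd.late ho hp hmu hT.le (by rw [hφ.zero, hTu]; linarith)
  have hq := hd.small ho hp hmu (by rw [hφ.zero]; exact hx.q.le) hT' T ⟨hT'.le, le_rfl⟩
  have hg := b1 T ⟨hT.le, le_rfl⟩
  have hexp : e/1000 * Real.exp (-(400/e)) ≤ e/1000 * 1 :=
    mul_le_mul_of_nonneg_left (Real.exp_le_one_iff.2 (by have := hp.e0; rw [neg_nonpos]; positivity))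
      (by linarith [hp.e0])
  have hF := FU_pos hp (μ := x.2.2.2) (q := (φ T x).1) (u := (φ T x).2.2.1) (by linarith) (by linarith [hg.u0])
    (by rw [hTu]; linarith) (by linarith [hg.u0, hmu.g0])
  exact ⟨T, hx.turn hφ hp hE hT hd (by rw [hTu]; linarith) (by rw [hTu]; exact hℓ1)
    (boundary_VL hφ hd hcl hT.le hTu (hg.box hmu) hF), hTu, hTl⟩

lemma StartT.turn_mid (hx : StartT e ub x) (hφ : PFlow e η ζ φ) (hp : Par e η ζ)
    (hE : Eqm e ub qb) (hO : x ∉ OC φ e (119/100)) (hV : x ∉ VL φ e (ub + 1/1000))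
    (hV' : x ∈ VL φ e (ub + 9/16)) : ∃ T, Turn e φ x T := by
  have e0 := hp.e0
  have e1 := hp.e1
  have h1 := hE.u0
  have h2 := hE.u1
  have ho := hφ.orb x
  have cq := ho.cq
  have cy := ho.cy
  have hmu := hx.mu.mu hE
  have hu := hx.u_bounds.2
  obtain ⟨T₁, hT₁, hu₁, -, hd₁⟩ := hx.fall_level hφ hp hE (ℓ := ub + 1/1000) (by linarith)
    (by linarith) hO hV
  obtain ⟨t, ht, htV, htU⟩ := hV'
  have hUt : ∀ s ∈ Icc 0 t, GU (119/100) (φ s x).1 (φ s x).2.1 (φ s x).2.2.1 := fun s hs => (htU s hs).1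
  have hLt : ∀ s ∈ Icc 0 t, (φ s x).2.2.1 < ub + 9/16 := fun s hs => (htU s hs).2
  obtain ⟨c1, c2⟩ : (φ t x).1 < 1/40 ∧ -(e/100 * (φ t x).1) < (φ t x).2.1 := htV
  have hcl : IsClosed {s : ℝ | (φ s x).1 ≤ 1/40 ∧ -(e/100 * (φ s x).1) ≤ (φ s x).2.1} :=
    (isClosed_le cq continuous_const).inter (isClosed_le (by fun_prop) cy)
  obtain ⟨T, ⟨⟨hT0, hTt⟩, hTq, hTy⟩, hleast⟩ := (isCompact_Icc.inter_right hcl).exists_isLeast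
    ⟨t, ⟨ht, le_rfl⟩, c1.le, c2.le⟩
  have hT : 0 < T := lt_of_le_of_ne hT0 (by
    rintro rfl
    rw [hφ.zero, hx.q] at hTq
    linarith)
  have hd : DescX e φ x T := Desc.of_lt fun T' hT' => hx.desc hφ hp hE
    (fun s hs _ hc => by
      obtain ⟨d1, d2⟩ : (φ s x).1 < 1/40 ∧ -(e/100 * (φ s x).1) < (φ s x).2.1 := hc
      have : T ≤ s := hleast ⟨⟨hs.1, by linarith [hs.2]⟩, d1.le, d2.le⟩
      linarith [hs.2])
    fun s hs hU hc => hO ⟨s, hs.1, hc, hU⟩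
  have hTT : T₁ ≤ T := by
    by_contra! hc
    rcases (hd₁.gf T ⟨hT0, hc⟩).2 with h | h <;> linarith
  have hl₁ : 10^5/e^2 < T₁ := hd₁.late ho hp hmu hT₁.le (by rw [hφ.zero, hu₁]; linarith)
  have hft := hd.lt_fortieth ho hp hmu (by rw [hφ.zero]; exact hx.q.le)
  have huT := ho.lt_u hp (ℓ := ub + 95/100000) (qm := 1/40) (a := T₁) (b := T) (by linarith)
    (by linarith) (by linarith) (fun s hs => ⟨(hUt s ⟨by linarith [hs.1], by linarith [hs.2]⟩).box hmu, by
      rcases hs.2.eq_or_lt with h | h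
      · rw [h]; exact hTq
      · exact (hft s ⟨by linarith [hp.late_time.1, hs.1], h⟩).le⟩) T ⟨hTT, le_rfl⟩
  exact ⟨T, hx.turn hφ hp hE hT hd huT.le (hLt T ⟨hT0, hTt⟩).le hTy⟩

/-- After turning back the orbit regrows to the level `e/1000`. -/
lemma Turn.hit (h : Turn e φ x T) (hx : StartT e ub x) (hφ : PFlow e η ζ φ) (hp : Par e η ζ)
    (hE : Eqm e ub qb) :
    ∃ t, T + 60/e ≤ t ∧ Hit φ (e/1000) (φ (10^5/e^2) x) (t - 10^5/e^2) ∧ (φ t x).1 = e/1000 ∧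
      (∀ s ∈ Icc T t, ThinC e (φ s x).1 (φ s x).2.1 (φ s x).2.2.1) ∧
      ∀ s ∈ Icc 0 t, GU (119/100) (φ s x).1 (φ s x).2.1 (φ s x).2.2.1 := by
  have e0 := hp.e0
  have e1 := hp.e1
  have ho := hφ.orb x
  have hmu := hx.mu.mu hE
  have hTpos : 0 < T := by linarith [h.pos, hp.late_time.1, hp.late_time.2]
  have hg := h.gu T ⟨hTpos.le, le_rfl⟩
  obtain ⟨t, ht, hqt, hlt, hth⟩ := (ho.shift T).regrow hp hmu (by simpa using hg.q0)
    (by simpa using h.q) (by simpa using h.y0) (by simpa using h.y1) (by simpa using hg.u0)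
    (by simpa using hg.u1)
  have h60 : 1 < 60/e := by rw [lt_div_iff₀ e0]; linarith
  have hthin : ∀ s ∈ Icc T (t + T), ThinC e (φ s x).1 (φ s x).2.1 (φ s x).2.2.1 := fun s hs => by
    have := (hth (s - T) ⟨by linarith [hs.1], by linarith [hs.2]⟩).1
    simpa only [sub_add_cancel] using this
  have hgu : ∀ s ∈ Icc T (t + T), GU (119/100) (φ s x).1 (φ s x).2.1 (φ s x).2.2.1 := fun s hs => by
    have := (hth (s - T) ⟨by linarith [hs.1], by linarith [hs.2]⟩).2
    simpa only [sub_add_cancel] using this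
  have hend := hthin (t + T) ⟨by linarith, le_rfl⟩
  have hpos := ho.thin_pos hp hmu hthin (by linarith) (t + T) ⟨by linarith, le_rfl⟩
  have hs := h.desc.small ho hp hmu (by rw [hφ.zero]; exact hx.q.le) h.pos
  have hexp : e/1000 * Real.exp (-(400/e)) < e/1000 * 1 :=
    mul_lt_mul_of_pos_left (Real.exp_lt_one_iff.2 (by rw [neg_lt_zero]; positivity)) (by linarith)
  have hflow : ∀ s, φ s (φ (10^5/e^2) x) = φ (s + 10^5/e^2) x := fun s => (hφ.add _ _ _).symm
  refine ⟨t + T, by linarith, Hit.of_pos hφ (by linarith [h.pos]) (fun s hs' => ?_) ?_ ?_ ?_, hqt,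
    hthin, fun s hs' => ?_⟩
  · rw [hflow]
    rcases le_or_gt (s + 10^5/e^2) T with h' | h'
    · linarith [hs (s + 10^5/e^2) ⟨by linarith [hs'.1], h'⟩]
    · have := hlt (s + 10^5/e^2 - T) ⟨by linarith, by linarith [hs'.2]⟩
      simpa only [sub_add_cancel] using this
  · rw [hflow, sub_add_cancel]; exact hqt
  · rw [hflow, sub_add_cancel]
    exact (mul_pos (by linarith) hend.q0).trans_le hpos
  · rw [hflow, hφ.mu, sub_add_cancel]
    exact hend.box hp hmu
  · rcases le_or_gt s T with h' | h'
    · exact h.gu s ⟨hs'.1, h'⟩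
    · exact hgu s ⟨h'.le, hs'.2⟩

end turn

section early
variable {e η ζ μ ub qb : ℝ} {q y u : ℝ → ℝ} {φ : ℝ → St → St} {x : St} {T t : ℝ}

lemma Par.ratio (hp : Par e η ζ) : 10^6/e ≤ ζ/η := by
  have e0 := hp.e0
  have h0 := hp.h0
  rw [div_le_div_iff₀ e0 h0]
  have h1 : 10^6 * η ≤ 2/5 * e := by linarith [hp.hsmall.1]
  exact h1.trans (mul_le_mul_of_nonneg_right hp.z.le e0.le)

/-- Duration bound for the descent up to the first level. -/
lemma Turn.time_le (h : Turn e φ x T) (hx : StartT e ub x) (hφ : PFlow e η ζ φ) (hp : Par e η ζ)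
    (hE : Eqm e ub qb) (hu : ∀ s ∈ Ico 0 T, (φ s x).2.2.1 < ub + 1/1000)
    (huT : (φ T x).2.2.1 = ub + 1/1000) : T ≤ 27/e + 132/100000 * (ζ/η) := by
  have e0 := hp.e0
  have h0 := hp.h0
  have hz := hp.z
  have h1 := hE.u0
  have h2 := hE.u1
  have ho := hφ.orb x
  have hmu := hx.mu.mu hE
  have hft := h.desc.lt_fortieth ho hp hmu (by rw [hφ.zero]; exact hx.q.le)
  obtain ⟨l1, l2⟩ := hp.late_time
  have hT : 27/e ≤ T := by linarith [h.pos]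
  have hr : 0 < η/ζ := by positivity
  have hmain := le_of_deriv_ge (f := fun s => (φ s x).2.2.1) (c := 77/100 * (η/ζ)) hT
    ho.cu.continuousOn fun s hs => by
      have hs0 : 0 ≤ s := by linarith [hs.1]
      have hg := h.gu s ⟨hs0, hs.2.le⟩
      have hq := hft s ⟨hs.1.le, hs.2⟩
      have hus := hu s ⟨hs0, hs.2⟩
      refine ⟨_, ?_, ho.du s (hg.box hmu)⟩
      have hv : 0 < (φ s x).2.2.1 + x.2.2.2 + ζ := by linarith [hg.u0, hmu.g0]
      have hv1 : (φ s x).2.2.1 + x.2.2.2 + ζ ≤ ζ := by linarith [hx.mu.2]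
      have h5 : (φ s x).1 * ((φ s x).2.2.1 - 1) ≤ 1/40 * (3/10) :=
        mul_le_mul hq.le (by linarith) (by linarith [hg.u0]) (by norm_num)
      rw [FU, ← mul_div_assoc]
      refine div_le_div₀ (mul_nonneg h0.le (by linarith)) ?_ hv hv1
      rw [mul_comm]
      exact mul_le_mul_of_nonneg_left (by linarith) h0.le
  have hnear := abs_le.1 (hx.u_near hφ hp hE (s := 27/e) ⟨l2.le, by
    rw [div_le_div_iff₀ e0 (by positivity)]; nlinarith [hp.e1]⟩ fun r hr =>
    h.gu r ⟨hr.1.le, by linarith [hr.2]⟩)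
  simp only [huT] at hmain
  have h6 : η/ζ * (T - 27/e) ≤ 132/100000 := by linarith [hnear.1]
  have h7 : η/ζ * (ζ/η) = 1 := by field_simp
  have h8 : η/ζ * (T - 27/e) ≤ η/ζ * (132/100000 * (ζ/η)) := by linarith
  linarith [le_of_mul_le_mul_left h8 hr]

/-- Turning at the first level, the orbit regrows well before the second level. -/
lemma Turn.early (h : Turn e φ x T) (hx : StartT e ub x) (hφ : PFlow e η ζ φ) (hp : Par e η ζ)
    (hE : Eqm e ub qb) (hu : ∀ s ∈ Ico 0 T, (φ s x).2.2.1 < ub + 1/1000)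
    (huT : (φ T x).2.2.1 = ub + 1/1000) (hTt : T + 60/e ≤ t)
    (hth : ∀ s ∈ Icc T t, ThinC e (φ s x).1 (φ s x).2.1 (φ s x).2.2.1) :
    (φ t x).2.2.1 ≤ ub + 7/16 := by
  by_contra! hc
  have e0 := hp.e0
  have e1 := hp.e1
  have h0 := hp.h0
  have hz := hp.z
  have h1 := hE.u0
  have h2 := hE.u1
  have ho := hφ.orb x
  have cq := ho.cq
  have hmu := hx.mu.mu hE
  obtain ⟨m1, m2⟩ := hx.mu
  have h60 : 1 < 60/e := by rw [lt_div_iff₀ e0]; linarith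
  have hTpos : 0 < T := by linarith [h.pos, hp.late_time.1, hp.late_time.2]
  have hr : 0 < η/ζ := by positivity
  have hrz : η/ζ * (ζ/η) = 1 := by field_simp
  have hbig := hp.ratio
  have hone : 1 ≤ 1/e := by rw [le_div_iff₀ e0]; linarith
  have r1 : 60/e = 60 * (1/e) := by ring
  have r2 : 10^6/e = 10^6 * (1/e) := by ring
  have r3 : 27/e = 27 * (1/e) := by ring
  rw [r2] at hbig
  obtain ⟨a, b, ha, hab, hb, hfa, hfb, hf⟩ := exists_subinterval
    (f := fun s => (φ s x).2.2.1 + x.2.2.2) (p := T) (q := t) (lo := 75/1000) (hi := 15/100)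
    (by linarith) (ho.cu.add continuous_const).continuousOn
    (by simp only [huT]; linarith) (by norm_num) (by linarith)
  have hab' := ge_of_deriv_le (f := fun s => (φ s x).2.2.1) (c := 1/2 * (η/ζ)) hab
    ho.cu.continuousOn fun s hs => by
      have hT := hth s ⟨by linarith [hs.1], by linarith [hs.2]⟩
      have hv := hf s ⟨hs.1.le, hs.2.le⟩
      refine ⟨_, ?_, ho.du s (hT.box hp hmu)⟩
      have h5 := mul_nonneg hT.q0.le (show 0 ≤ (φ s x).2.2.1 - 1 by linarith [hT.u0])
      rw [FU, ← mul_div_assoc]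
      refine div_le_div₀ (by positivity) ?_ (by linarith) (by linarith [hv.1])
      rw [mul_comm]
      exact mul_le_mul_of_nonneg_right (by linarith [hv.1]) h0.le
  have hlen : 15/100 * (ζ/η) ≤ b - a := by
    have h8 : η/ζ * (15/100 * (ζ/η)) ≤ η/ζ * (b - a) := by linarith
    exact le_of_mul_le_mul_left h8 hr
  have htr := ho.track_lo hp hmu (a := a) (b := b) (κ := 1/2)
    (fun s hs => hth s ⟨by linarith [hs.1], by linarith [hs.2]⟩) hab (by norm_num)
    (fun s hs => by linarith [(hf s hs).2]) (fun s hs => by linarith [(hf s hs).1])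
  have hpos := ho.thin_pos hp hmu hth (by linarith)
  have hT := h.time_le hx hφ hp hE hu huT
  have hd := exp_le_of_deriv_ge (f := fun s => (φ s x).1) (a := 0) (b := T + 1) (c := -7)
    (by linarith) cq.continuousOn fun s hs => by
      rcases lt_or_ge s T with h' | h'
      · have hg := h.gu s ⟨hs.1.le, h'.le⟩
        exact ⟨_, by have := h.desc.y7 s ⟨hs.1.le, h'⟩; linarith, ho.dq s (hg.box hmu)⟩
      · have hT := hth s ⟨h', by linarith [hs.2]⟩
        refine ⟨_, ?_, ho.dq s (hT.box hp hmu)⟩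
        have := mul_le_mul_of_nonneg_right hp.e1 hT.q0.le
        linarith [hT.y0, hT.q0]
  have hm := le_of_deriv_ge (f := fun s => (φ s x).1) (a := T + 1) (b := a + 60/e) (c := 0)
    (by linarith) cq.continuousOn fun s hs => by
      have hs' : s ∈ Icc T t := ⟨by linarith [hs.1], by linarith [hs.2]⟩
      refine ⟨_, ?_, ho.dq s ((hth s hs').box hp hmu)⟩
      exact (mul_nonneg (by linarith) (hth s hs').q0.le).trans (hpos s ⟨hs.1.le, hs'.2⟩)
  have hgr := exp_le_of_deriv_ge (f := fun s => (φ s x).1) (a := a + 60/e) (b := b) (c := 1/2)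
    (by linarith) cq.continuousOn fun s hs =>
      ⟨_, htr s ⟨hs.1.le, hs.2.le⟩,
        ho.dq s ((hth s ⟨by linarith [hs.1], by linarith [hs.2]⟩).box hp hmu)⟩
  simp only [hφ.zero, hx.q] at hd
  have hq1 : Real.exp (-7 * (T + 1 - 0)) ≤ (φ (a + 60/e) x).1 := by
    have := mul_le_mul_of_nonneg_right (show 1 ≤ 2 - 2*e by linarith)
      (Real.exp_pos (-7 * (T + 1 - 0))).le
    linarith
  have hq2 : 1 ≤ (φ b x).1 := by
    refine le_trans ?_ ((mul_le_mul_of_nonneg_right hq1 (Real.exp_pos _).le).trans hgr)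
    rw [← Real.exp_add]
    exact Real.one_le_exp (by linarith)
  linarith [(hth b ⟨by linarith, hb⟩).q1]

/-- Turning at the upper level, the orbit stays above the third level. -/
lemma StartT.late (hx : StartT e ub x) (hφ : PFlow e η ζ φ) (hp : Par e η ζ)
    (hE : Eqm e ub qb) (huT : (φ T x).2.2.1 = ub + 9/16) (hTt : T ≤ t)
    (hth : ∀ s ∈ Icc T t, ThinC e (φ s x).1 (φ s x).2.1 (φ s x).2.2.1) :
    ub + 56/100 < (φ t x).2.2.1 := by
  have h1 := hE.u0
  have h2 := hE.u1
  have e0 := hp.e0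
  have e1 := hp.e1
  have hmu := hx.mu.mu hE
  refine (hφ.orb x).lt_u hp (ℓ := ub + 56/100) (qm := 1/40) (a := T) (b := t) (by linarith)
    (by linarith) (by linarith) (fun s hs => ⟨(hth s ⟨hs.1.le, hs.2⟩).box hp hmu, ?_⟩) t
    ⟨hTt, le_rfl⟩
  linarith [(hth s ⟨hs.1.le, hs.2⟩).q1]

end early

/-- A regrown orbit of the unstable branch of the turbulent state. -/
structure Regrown (e ub qb : ℝ) (φ : ℝ → St → St) (x : St) (t : ℝ) : Prop where
  mu : MT ub x.2.2.2
  wedge : ∀ s ≤ 0, WedgeT e ub qb (φ s x).1 (φ s x).2.1 (φ s x).2.2.1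
  q0 : x.1 = 2 - 2*e
  turn : x ∈ VC φ e (119/100)
  t0 : 60/e ≤ t
  gu : ∀ s ∈ Icc 0 t, GU (119/100) (φ s x).1 (φ s x).2.1 (φ s x).2.2.1
  thin : ∀ s ∈ Icc (t - 60/e) t, ThinC e (φ s x).1 (φ s x).2.1 (φ s x).2.2.1
  q : (φ t x).1 = e/1000

section level
variable {e η ζ ub qb h : ℝ} {φ : ℝ → St → St} {x : St}

lemma Hit.unique {t t' : ℝ} (h1 : Hit φ h x t) (h2 : Hit φ h x t') : t = t' := by
  rcases lt_trichotomy t t' with hl | hl | hl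
  · exact absurd h1.at_eq (h2.before t ⟨h1.pos.le, hl⟩).ne
  · exact hl
  · exact absurd h2.at_eq (h1.before t' ⟨h2.pos.le, hl⟩).ne

lemma StartT.of_wedge (hφ : PFlow e η ζ φ) (hE : Eqm e ub qb) (hm : MT ub x.2.2.2)
    (hq : x.1 = 2 - 2*e) (h : WedgeT e ub qb (φ 0 x).1 (φ 0 x).2.1 (φ 0 x).2.2.1) :
    StartT e ub x := by
  rw [hφ.zero] at h
  have h1 := hE.q1
  obtain ⟨b1, b2, b3, b4, b5⟩ := h
  rw [hq] at b1 b3 b4 b5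
  exact ⟨hq, by linarith, by linarith, b5.trans (by linarith), hm⟩

/-- On a compact interval, the last parameter in an open set: the curve is at its boundary. -/
lemma exists_last {A : Set St} (hA : IsOpen A) {c : ℝ → St} {a b : ℝ} (hab : a ≤ b)
    (hc : ContinuousOn c (Icc a b)) (ha : c a ∈ A) (hb : c b ∉ A) :
    ∃ m ∈ Icc a b, c m ∈ closure A ∧ ∀ m' ∈ Icc m b, c m' ∉ A := by
  set S : Set ℝ := {m | m ∈ Icc a b ∧ c m ∈ A} with hS
  have hne : S.Nonempty := ⟨a, ⟨le_rfl, hab⟩, ha⟩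
  have hbd : BddAbove S := ⟨b, fun m hm => hm.1.2⟩
  have hle : ∀ m ∈ S, m ≤ sSup S := fun m hm => le_csSup hbd hm
  have hmem : sSup S ∈ Icc a b := ⟨hle a ⟨⟨le_rfl, hab⟩, ha⟩, csSup_le hne fun m hm => hm.1.2⟩
  have hnot : c (sSup S) ∉ A := by
    intro hin
    have hlt : sSup S < b := lt_of_le_of_ne hmem.2 fun h => hb (h ▸ hin)
    obtain ⟨m, ⟨h1, h2⟩, h3⟩ := (((hc _ hmem).mono_of_mem_nhdsWithin
      (Icc_mem_nhdsGT_of_mem ⟨hmem.1, hlt⟩)).eventually (hA.mem_nhds hin) |>.and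
        (Ioo_mem_nhdsGT hlt)).exists.imp fun m h => (⟨h, trivial⟩ : (_ ∧ _) ∧ True)
    exact absurd (hle m ⟨⟨hmem.1.trans h2.1.le, h2.2.le⟩, h1⟩) (not_le.2 h2.1)
  refine ⟨sSup S, hmem, ?_, fun m hm hin => ?_⟩
  · have h1 : ContinuousWithinAt c S (sSup S) := (hc _ hmem).mono fun m hm => hm.1
    refine closure_mono ?_ (h1.mem_closure_image (csSup_mem_closure hne hbd))
    rintro _ ⟨m, hm, rfl⟩
    exact hm.2
  · have h1 : m = sSup S := le_antisymm (hle m ⟨⟨hmem.1.trans hm.1, hm.2⟩, hin⟩) hm.1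
    exact hnot (h1 ▸ hin)

/-- A continuous family of regrown orbits sweeping the laminar level of `u`. -/
lemma exists_regrown (hφ : PFlow e η ζ φ) (hp : Par e η ζ) (hE : Eqm e ub qb) :
    ∃ (w : ℝ → St) (t : ℝ → ℝ) (a b : ℝ), a ≤ b ∧
      ContinuousOn (fun m => φ (t m) (w m)) (Icc a b) ∧
      (∀ m ∈ Icc a b, Regrown e ub qb φ (w m) (t m) ∧
        (φ (t m) (w m)).2.2.1 ∈ Icc (ub + 7/16) (ub + 56/100)) ∧
      (φ (t a) (w a)).2.2.1 = ub + 7/16 ∧ (φ (t b) (w b)).2.2.1 = ub + 56/100 := by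
  have e0 := hp.e0
  obtain ⟨w, hw, hwm⟩ := exists_turb_branch hφ hp hE
  set A := -ub - 275/1000 with hA
  set B := -ub - 225/1000 with hB
  have hAB : A ≤ B := by rw [hA, hB]; linarith
  have hst : ∀ m ∈ Icc A B, StartT e ub (w m) := fun m hm => by
    obtain ⟨h1, h2, h3⟩ := hwm m hm
    exact StartT.of_wedge hφ hE (h1.symm ▸ hm) h2 (h3 0 le_rfl)
  have hlev : ub + 1/1000 ≤ ub + 9/16 := by linarith
  have hl := (hst A ⟨le_rfl, hAB⟩).left hφ hp hE (hwm A ⟨le_rfl, hAB⟩).1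
  have hr := (hst B ⟨hAB, le_rfl⟩).right hφ hp hE (hwm B ⟨hAB, le_rfl⟩).1
  obtain ⟨mb, hmb, hbV, hbn, hbO⟩ := exists_first_neither (isOpen_VL hφ) (isOpen_OC hφ) hAB hw
    (fun m hm h => not_VC_OC hφ hp ((hst m hm).mu.mu hE) ⟨VL_subset_VC h.1, h.2⟩) (VL_mono hlev hl) hr
  have hsub : Icc A mb ⊆ Icc A B := Icc_subset_Icc_right hmb.2
  have hbcl : w mb ∈ closure (VL φ e (ub + 9/16)) := by
    have h1 : ContinuousWithinAt w (Ico A mb) mb :=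
      (hw mb ⟨hmb.1.le, hmb.2⟩).mono fun m hm => ⟨hm.1, hm.2.le.trans hmb.2⟩
    refine closure_mono ?_ (h1.mem_closure_image
      (by rw [closure_Ico hmb.1.ne]; exact ⟨hmb.1.le, le_rfl⟩))
    rintro _ ⟨m, hm, rfl⟩
    exact hbV m hm
  obtain ⟨ma, hma, hacl, han⟩ := exists_last (isOpen_VL hφ) hmb.1.le (hw.mono hsub) hl
    fun h => hbn (VL_mono hlev h)
  have hO : ∀ m ∈ Icc ma mb, w m ∉ OC φ e (119/100) := fun m hm h => by
    rcases hm.2.eq_or_lt with h' | h'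
    · exact hbO (h' ▸ h)
    · exact not_VC_OC hφ hp ((hst m (hsub ⟨hma.1.trans hm.1, hm.2⟩)).mu.mu hE)
        ⟨VL_subset_VC (hbV m ⟨hma.1.trans hm.1, h'⟩), h⟩
  have hin : ∀ m ∈ Icc ma mb, m ∈ Icc A B := fun m hm => hsub ⟨hma.1.trans hm.1, hm.2⟩
  obtain ⟨Tb, hTb, hTbu, -⟩ := (hst mb (hin mb ⟨hma.2, le_rfl⟩)).turn_boundary hφ hp hE
    (ℓ := ub + 9/16) (by linarith) le_rfl hbO hbn hbcl
  have hturn : ∀ m ∈ Icc ma mb, ∃ T, Turn e φ (w m) T := fun m hm => by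
    rcases hm.2.eq_or_lt with h' | h'
    · exact ⟨Tb, h' ▸ hTb⟩
    · exact (hst m (hin m hm)).turn_mid hφ hp hE (hO m hm) (han m hm)
        (hbV m ⟨hma.1.trans hm.1, h'⟩)
  have hhit : ∀ m ∈ Icc ma mb, ∃ t, Hit φ (e/1000) (φ (10^5/e^2) (w m)) (t - 10^5/e^2) ∧
      60/e ≤ t ∧ (φ t (w m)).1 = e/1000 ∧
      (∀ s ∈ Icc (t - 60/e) t, ThinC e (φ s (w m)).1 (φ s (w m)).2.1 (φ s (w m)).2.2.1) ∧
      ∀ s ∈ Icc 0 t, GU (119/100) (φ s (w m)).1 (φ s (w m)).2.1 (φ s (w m)).2.2.1 := by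
    intro m hm
    obtain ⟨T, hT⟩ := hturn m hm
    obtain ⟨t, h1, h2, h3, h4, h5⟩ := hT.hit (hst m (hin m hm)) hφ hp hE
    exact ⟨t, h2, by linarith [hT.pos, hp.late_time.1, hp.late_time.2], h3,
      fun s hs => h4 s ⟨by linarith [hs.1], hs.2⟩, h5⟩
  choose! t ht using hhit
  have hq0 : Continuous fun z : St => φ (10^5/e^2) z :=
    hφ.cont.comp (by fun_prop : Continuous fun z : St => ((10^5/e^2 : ℝ), z))
  have hcont : ContinuousOn (fun m => φ (t m) (w m)) (Icc ma mb) := by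
    have h1 := Hit.map_continuousOn hφ (hq0.comp_continuousOn (hw.mono hin))
      (τ := fun m => t m - 10^5/e^2) fun m hm => (ht m hm).1
    refine h1.congr fun m _ => ?_
    simp only [Function.comp_apply, ← hφ.add, sub_add_cancel]
  have h60 : 0 < 60/e := by positivity
  have hua : (φ (t ma) (w ma)).2.2.1 ≤ ub + 7/16 := by
    have hI : ma ∈ Icc ma mb := ⟨le_rfl, hma.2⟩
    have hs := hst ma (hin ma hI)
    obtain ⟨T, hT, hTu, hTl⟩ := hs.turn_boundary hφ hp hE (ℓ := ub + 1/1000) (by linarith)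
      hlev (hO ma hI) (han ma hI) hacl
    obtain ⟨t', h1, h2, -, h4, -⟩ := hT.hit hs hφ hp hE
    have := hT.early hs hφ hp hE hTl hTu h1 h4
    rwa [sub_left_injective (h2.unique (ht ma hI).1)] at this
  have hub : ub + 56/100 < (φ (t mb) (w mb)).2.2.1 := by
    have hI : mb ∈ Icc ma mb := ⟨hma.2, le_rfl⟩
    have hs := hst mb (hin mb hI)
    obtain ⟨t', h1, h2, -, h4, -⟩ := hTb.hit hs hφ hp hE
    have := hs.late hφ hp hE hTbu (by linarith) h4
    rwa [sub_left_injective (h2.unique (ht mb hI).1)] at this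
  obtain ⟨a, b, ha, hab, hb, hfa, hfb, hf⟩ := exists_subinterval hma.2
    (f := fun m => (φ (t m) (w m)).2.2.1)
    ((by fun_prop : Continuous fun z : St => z.2.2.1).comp_continuousOn hcont) hua
    (by linarith) hub.le
  have hbne : b < mb := lt_of_le_of_ne hb (by
    rintro rfl
    linarith)
  refine ⟨w, t, a, b, hab, hcont.mono (Icc_subset_Icc ha hb), fun m hm => ⟨?_, hf m hm⟩, hfa, hfb⟩
  have hI : m ∈ Icc ma mb := ⟨ha.trans hm.1, hm.2.trans hb⟩
  obtain ⟨h1, h2, h3⟩ := hwm m (hin m hI)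
  obtain ⟨-, g2, g3, g4, g5⟩ := ht m hI
  exact ⟨h1.symm ▸ hin m hI, h3, h2, VL_subset_VC (hbV m ⟨hma.1.trans hI.1, hm.2.trans_lt hbne⟩),
    g2, g5, g4, g3⟩

end level

section loops
variable {e η ζ ub qb μ : ℝ} {φ : ℝ → St → St} {x : St} {t : ℝ}

lemma MT.near (hE : Eqm e ub qb) (hm : MT ub μ) {q y u : ℝ} (hq : q ∈ Icc (2 - 2*e) 2)
    (hy : y ∈ Icc (-1) 15) (hu : u ∈ Icc (119/100) (401/200)) : NearT e q y u μ :=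
  ⟨hq.1, hq.2, hy.1, hy.2, hu.1, hu.2, by linarith [hu.1, hm.1, hE.u1],
    by linarith [hu.2, (hm.mu hE).g1]⟩

lemma Regrown.box (h : Regrown e ub qb φ x t) (hp : Par e η ζ) (hE : Eqm e ub qb) {s : ℝ}
    (hs : s ≤ t) : Box (φ s x).1 (φ s x).2.1 (φ s x).2.2.1 x.2.2.2 := by
  rcases le_total s 0 with h0 | h0
  · exact (h.wedge s h0).box hE hp h.mu
  · exact (h.gu s ⟨h0, hs⟩).box (h.mu.mu hE)

lemma Regrown.conn (h : Regrown e ub qb φ x t) (hφ : PFlow e η ζ φ) (hp : Par e η ζ)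
    (hE : Eqm e ub qb) {q₁ u₁ : ℝ}
    (hg : ∀ s, 0 ≤ s → GU (119/100) (φ s (φ t x)).1 (φ s (φ t x)).2.1 (φ s (φ t x)).2.2.1)
    (hl : Tendsto (fun s => (φ s (φ t x)).1) atTop (𝓝 q₁) ∧
      Tendsto (fun s => (φ s (φ t x)).2.1) atTop (𝓝 0) ∧
      Tendsto (fun s => (φ s (φ t x)).2.2.1) atTop (𝓝 u₁)) : Conn φ x qb ub q₁ u₁ := by
  refine ⟨fun s => ?_, (hφ.orb x).wedgeT_backward hp hE h.mu h.wedge, hφ.tendsto_shift hl⟩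
  rcases le_total s t with h0 | h0
  · exact h.box hp hE h0
  · have := (hg (s - t) (by linarith)).box (h.mu.mu hE)
    rwa [← hφ.add, sub_add_cancel] at this

lemma Regrown.u_near (h : Regrown e ub qb φ x t) (hφ : PFlow e η ζ φ) (hp : Par e η ζ)
    (hE : Eqm e ub qb) : ∀ s ∈ Icc (t - 60/e) t, |(φ t x).2.2.1 - (φ s x).2.2.1| ≤ 1/10^20 := by
  have e0 := hp.e0
  have e1 := hp.e1
  intro s hs
  have h60 : 60/e ≤ 10^4/e^2 := by
    rw [div_le_div_iff₀ e0 (by positivity)]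
    linarith [mul_le_mul_of_nonneg_left e1 e0.le, pow_two e]
  exact (hφ.orb x).u_short hp (h.mu.mu hE) hs.2 (by linarith [hs.1])
    fun r hr => h.gu r ⟨by linarith [h.t0, hs.1, hr.1], hr.2.le⟩

lemma Regrown.slope_lo (h : Regrown e ub qb φ x t) (hφ : PFlow e η ζ φ) (hp : Par e η ζ)
    (hE : Eqm e ub qb) {κ : ℝ} (hκ : κ ≤ 3) (hu : (φ t x).2.2.1 ≤ 179/100)
    (hg : κ + 6/100 ≤ 8 * ((φ t x).2.2.1 + x.2.2.2)) : κ * (φ t x).1 ≤ (φ t x).2.1 := by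
  have h60 : 0 < 60/e := div_pos (by norm_num) hp.e0
  have hn := h.u_near hφ hp hE
  refine (hφ.orb x).track_lo hp (h.mu.mu hE) h.thin (by linarith) hκ (fun s hs => ?_)
    (fun s hs => ?_) t ⟨by linarith, le_rfl⟩
  · linarith [(abs_le.1 (hn s hs)).1]
  · linarith [(abs_le.1 (hn s hs)).2]

lemma Regrown.slope_hi (h : Regrown e ub qb φ x t) (hφ : PFlow e η ζ φ) (hp : Par e η ζ)
    (hE : Eqm e ub qb) {κ : ℝ} (hκ : 1 ≤ κ)
    (hg : 8 * ((φ t x).2.2.1 + x.2.2.2) ≤ κ - 6/100) : (φ t x).2.1 ≤ κ * (φ t x).1 := by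
  have h60 : 0 < 60/e := div_pos (by norm_num) hp.e0
  have hn := h.u_near hφ hp hE
  refine (hφ.orb x).track_hi hp (h.mu.mu hE) h.thin (by linarith) hκ
    (fun s hs => ?_) t ⟨by linarith, le_rfl⟩
  linarith [(abs_le.1 (hn s hs)).1]

lemma Regrown.riseS (h : Regrown e ub qb φ x t) (hφ : PFlow e η ζ φ) (hp : Par e η ζ)
    (hE : Eqm e ub qb) (hu : (φ t x).2.2.1 ∈ Icc (ub + 7/16) (ub + 56/100)) :
    RiseS e (119/100) (φ t x).1 (φ t x).2.1 (φ t x).2.2.1 (φ t x).2.2.2 := by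
  have h60 : 0 < 60/e := div_pos (by norm_num) hp.e0
  have h0 := h.mu.1
  have h1 := hE.u0
  have h2 := hE.u1
  have hth := h.thin t ⟨by linarith, le_rfl⟩
  have hy := h.slope_lo hφ hp hE (κ := 12/10) (by norm_num) (by linarith [hu.2]) (by linarith [hu.1])
  rw [hφ.mu]
  exact ⟨h.q, by linarith [hth.q0], hth.y1, by linarith [hu.1], by linarith [hu.2],
    by linarith [hu.1]⟩

/-- The state of an orbit leaving the turbulent state, next to the laminar state. -/
structure AtLam (e ub : ℝ) (x : St) : Prop where
  q : x.1 = e/1000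
  y0 : 0 ≤ x.2.1
  y1 : x.2.1 ≤ 6 * x.1
  u : x.2.2.1 ∈ Icc (ub + 7/16) (ub + 56/100)

lemma RiseS.atLam {ulo : ℝ} (hp : Par e η ζ)
    (h : RiseS e ulo x.1 x.2.1 x.2.2.1 x.2.2.2) (hu : x.2.2.1 ∈ Icc (ub + 7/16) (ub + 56/100)) :
    AtLam e ub x := by
  have e0 := hp.e0
  have h1 := h.q0
  exact ⟨h.q0, by linarith [h.y0], h.y1, hu⟩

lemma exists_turb_lap (hφ : PFlow e η ζ φ) (hp : Par e η ζ) (hE : Eqm e ub qb) :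
    ∃ (w : ℝ → St) (t τ : ℝ → ℝ) (a b : ℝ),
      (∀ m ∈ Icc a b, Regrown e ub qb φ (w m) (t m) ∧ AtLam e ub (φ (t m) (w m)) ∧
        Rise e (119/100) φ (φ (t m) (w m)) (τ m)) ∧
      LapCurve (119/100) (fun m => φ (τ m) (φ (t m) (w m))) a b := by
  obtain ⟨w, t, a, b, hab, hc, hr, ha, hb⟩ := exists_regrown hφ hp hE
  have haI : a ∈ Icc a b := ⟨le_rfl, hab⟩
  have hbI : b ∈ Icc a b := ⟨hab, le_rfl⟩
  have hR : ∀ m ∈ Icc a b, RiseS e (119/100) (φ (t m) (w m)).1 (φ (t m) (w m)).2.1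
      (φ (t m) (w m)).2.2.1 (φ (t m) (w m)).2.2.2 :=
    fun m hm => (hr m hm).1.riseS hφ hp hE (hr m hm).2
  have h1 := (hr a haI).1.mu.2
  have h2 := (hr b hbI).1.mu.1
  have h3 := hE.u1
  obtain ⟨τ, hτ, hL⟩ := exists_lap_curve hφ hp (ulo := 119/100) hab hc
    (fun m hm => by rw [hφ.mu]; exact (hr m hm).1.mu.mu hE) hR
    ⟨(hr a haI).1.slope_hi hφ hp hE (by norm_num) (by linarith), by rw [hφ.mu]; linarith⟩
    ⟨(hr b hbI).1.slope_lo hφ hp hE (by norm_num) (by linarith) (by linarith),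
      by rw [hφ.mu]; linarith⟩
  exact ⟨w, t, τ, a, b, fun m hm => ⟨(hr m hm).1, (hR m hm).atLam hp (hr m hm).2, hτ m hm⟩, hL⟩

/-- A trapped lap ends at the turbulent state. -/
lemma trapped_turb (hφ : PFlow e η ζ φ) (hp : Par e η ζ) (hE : Eqm e ub qb) (hm : MT ub x.2.2.2)
    (h : ∀ s, 0 ≤ s → SRp e (φ s x).1 (φ s x).2.1 ∧
      LapI e (119/100) (φ s x).1 (φ s x).2.1 (φ s x).2.2.1) :
    Tendsto (fun s => (φ s x).1) atTop (𝓝 qb) ∧ Tendsto (fun s => (φ s x).2.1) atTop (𝓝 0) ∧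
      Tendsto (fun s => (φ s x).2.2.1) atTop (𝓝 ub) := by
  have e0 := hp.e0
  have e1 := hp.e1
  have h25 : 25/e < 26/e := by gcongr; norm_num
  have h0 : 0 < 25/e := by positivity
  refine (hφ.orb x).turb_forward hp hE hm (T := 26/e) fun s hs => ?_
  have hb := (hφ.orb x).band_time hp (hm.mu hE) (T := s) (by linarith)
    (fun r hr => (h r hr.1).symm) s ⟨by linarith, le_rfl⟩
  obtain ⟨hs1, hI⟩ := h s (by linarith)
  have hq := hI.q2
  exact hm.near hE ⟨hb.le, hq⟩ ⟨by linarith [hI.low], by linarith [hI.y7]⟩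
    ⟨hI.gu.u0.le, hI.gu.u1.le⟩

lemma Rise.gu_append {ulo : ℝ} {z : St} (hφ : PFlow e η ζ φ) (h : Rise e ulo φ z t)
    (hg : ∀ s, 0 ≤ s → GU ulo (φ s (φ t z)).1 (φ s (φ t z)).2.1 (φ s (φ t z)).2.2.1) :
    ∀ s, 0 ≤ s → GU ulo (φ s z).1 (φ s z).2.1 (φ s z).2.2.1 := fun s hs => by
  rcases le_total s t with h1 | h1
  · exact h.gu s ⟨hs, h1⟩
  · have := hg (s - t) (by linarith)
    rwa [← hφ.add, sub_add_cancel] at this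

/-- A simple impulse of the turbulent state. -/
lemma exists_turb_impulse (hφ : PFlow e η ζ φ) (hp : Par e η ζ) (hE : Eqm e ub qb) :
    ∃ x : St, Conn φ x qb ub qb ub ∧ ∃ s, AtLam e ub (φ s x) := by
  obtain ⟨w, t, τ, a, b, hr, hL⟩ := exists_turb_lap hφ hp hE
  obtain ⟨m, hm, -, h1, h2⟩ := hL.crit hφ hp
  have hI : m ∈ Icc a b := ⟨hm.1.le, hm.2⟩
  obtain ⟨hR, hA, hτ⟩ := hr m hI
  have htr := lap_trapped hφ hp (hL.mu m hI) (hL.st m hI) h1 h2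
  exact ⟨w m, hR.conn hφ hp hE (hτ.gu_append hφ fun s hs => (htr s hs).2.gu)
    (hφ.tendsto_shift (trapped_turb hφ hp hE (by simpa only [hφ.mu] using hR.mu) htr)), t m, hA⟩

/-- A connection from the turbulent state to the laminar state with an additional excursion. -/
lemma exists_back (hφ : PFlow e η ζ φ) (hp : Par e η ζ) (hE : Eqm e ub qb) :
    ∃ x : St, Conn φ x qb ub 0 2 ∧ ∃ s₁ s₂, s₁ < s₂ ∧ AtLam e ub (φ s₁ x) ∧
      2 - 2*e ≤ (φ s₂ x).1 ∧ (φ s₂ x).1 ≤ 2 ∧ |(φ s₂ x).2.1| ≤ 2*e/100 ∧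
      119/100 ≤ (φ s₂ x).2.2.1 ∧ (φ s₂ x).2.2.1 ≤ ub + 276/1000 := by
  obtain ⟨w, t, τ, a, b, hr, hL⟩ := exists_turb_lap hφ hp hE
  obtain ⟨m, hm, h0, h1, h2⟩ := hL.crit hφ hp
  rcases hL.back hφ hp hm h0 h1 h2 with ⟨m', hm', hl⟩ | ⟨Z, hZV, hZm, hZ1, hZ⟩
  · obtain ⟨hR, hA, hτ⟩ := hr m' hm'
    obtain ⟨hg, ht, s, hs, b1, b2, b3, b4, b5⟩ := hτ.land hφ hl
    refine ⟨w m', hR.conn hφ hp hE hg ht, t m', s + t m', by linarith, hA, ?_⟩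
    rw [hφ.mu] at b4
    rw [hφ.add]
    exact ⟨b1, b2, b3, b5.le, by linarith [hR.mu.1]⟩
  · obtain ⟨hR, -, -⟩ := hr m ⟨hm.1.le, hm.2⟩
    rw [hφ.mu, hφ.mu] at hZm
    have := turb_unique hφ hp hE hR.mu hZm (hZ1.trans hR.q0.symm)
      (fun s hs => hR.mu.near hE (hZ s hs).1 (hZ s hs).2.1 (hZ s hs).2.2) hR.wedge
    exact absurd (this ▸ hR.turn) hZV

end loops

lemma exists_eqm {r u : ℝ} (hr : 10^5 < r) (hu : u ∈ Ioo (6/5 : ℝ) (4/3)) (hK : Kc u r = 0) :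
    Eqm (1/(r + 1/10)) u (qbp r u) := by
  obtain ⟨hu0, hu1⟩ := hu
  have hr0 : 0 < r + 1/10 := by linarith
  set e := 1/(r + 1/10) with he
  have e0 : 0 < e := by positivity
  have e1 : e ≤ 1/100000 := by
    rw [he]
    exact one_div_le_one_div_of_le (by norm_num) (by linarith)
  have hre : (r + 1/10) * e = 1 := by rw [he]; field_simp
  have hx : (r + u - 2) / (r + 1/10) = 1 - (21/10 - u) * e := by
    rw [div_eq_iff hr0.ne']
    linear_combination (21/10 - u) * hre
  have hxe : (21/10 - u) * e ≤ 9/10 * e := mul_le_mul_of_nonneg_right (by linarith) e0.le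
  have hxe0 : 0 < (21/10 - u) * e := mul_pos (by linarith) e0
  unfold qbp
  rw [hx]
  set S := Real.sqrt (1 - (21/10 - u) * e) with hS
  have hS0 : 0 ≤ S := Real.sqrt_nonneg _
  have hSS : S^2 = 1 - (21/10 - u) * e := Real.sq_sqrt (by linarith)
  have hS1 : S < 1 := by
    rw [hS, Real.sqrt_lt' one_pos]
    linarith
  have hSe : 1 - e ≤ S := by
    apply Real.le_sqrt_of_sq_le
    linarith [mul_le_mul_of_nonneg_left e1 e0.le, pow_two e]
  have hKS : (2 * (u - 1) * S)^2 = (4 - 3*u)^2 := by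
    unfold Kc at hK
    rw [mul_pow, hSS]
    linear_combination e/10 * hK + ((4 - 3*u)^2 - 4*(u-1)^2) * hre
  have hlin : 2 * (u - 1) * S = 4 - 3*u :=
    (sq_eq_sq₀ (mul_nonneg (by linarith) hS0) (by linarith)).1 hKS
  refine ⟨by linear_combination (-1 : ℝ) * hSS, by linear_combination (-1 : ℝ) * hlin, by linarith, by linarith,
    hu0, ?_⟩
  have h1 : 2 * (u - 1) * (1 - e) ≤ 4 - 3*u :=
    hlin ▸ mul_le_mul_of_nonneg_left hSe (by linarith)
  have h2 : (u - 1) * e ≤ 1/3 * e := mul_le_mul_of_nonneg_right (by linarith) e0.le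
  linarith

lemma dist3_le {e ub qb : ℝ} (he : e ≤ 1/100000) (hE : Eqm e ub qb) {a b : ℝ × ℝ × ℝ}
    (h : (a.1 - b.1)^2 + (a.2.1 - b.2.1)^2 + (a.2.2 - b.2.2)^2 ≤ 1/2) :
    dist3 a b ≤ dist3 (0, 0, 2) (qb, 0, ub) / 3 := by
  have h1 : dist3 a b ≤ Real.sqrt (1/2) := Real.sqrt_le_sqrt h
  have h2 : Real.sqrt (1/2) * 3 ≤ dist3 (0, 0, 2) (qb, 0, ub) := by
    unfold dist3
    apply Real.le_sqrt_of_sq_le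
    rw [mul_pow, Real.sq_sqrt (by norm_num)]
    have hq : (199/100 : ℝ)^2 ≤ qb^2 := pow_le_pow_left₀ (by norm_num) (by linarith [hE.q0]) 2
    have hu : (79/100 : ℝ)^2 ≤ (2 - ub)^2 := pow_le_pow_left₀ (by norm_num) (by linarith [hE.u1]) 2
    norm_num at hq hu ⊢
    linarith
  linarith

lemma sq_add_le {a b c : ℝ} (ha : |a| ≤ 1/10) (hb : |b| ≤ 1/10) (hc : |c| ≤ 6/10) :
    a^2 + b^2 + c^2 ≤ 1/2 := by
  have h1 := sq_le_sq' (abs_le.1 ha).1 (abs_le.1 ha).2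
  have h2 := sq_le_sq' (abs_le.1 hb).1 (abs_le.1 hb).2
  have h3 := sq_le_sq' (abs_le.1 hc).1 (abs_le.1 hc).2
  norm_num at h1 h2 h3 ⊢
  linarith

/-- Undo the rescaling of the independent variable. -/
lemma Conn.exists_sol {r ζ ε : ℝ} {φ : ℝ → St → St} {x : St} {q₀ u₀ q₁ u₁ : ℝ} (hr : 0 < r)
    (hζ : 2/5 < ζ) (hφ : PFlow (1/(r + 1/10)) (ε * (1/(r + 1/10)) / 4) ζ φ)
    (h : Conn φ x q₀ u₀ q₁ u₁) :
    ∃ Q P U : ℝ → ℝ, IsTWSol (1/(r + 1/10)/32) x.2.2.2 (-ζ - x.2.2.2) ε r Q P U ∧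
      Tendsto (fun ξ => (Q ξ, P ξ, U ξ)) atBot (𝓝 (q₀, 0, u₀)) ∧
      Tendsto (fun ξ => (Q ξ, P ξ, U ξ)) atTop (𝓝 (q₁, 0, u₁)) ∧
      ∀ s, Q (s / (4 * (r + 1/10))) = (φ s x).1 ∧
        P (s / (4 * (r + 1/10))) = 4 * (r + 1/10) * (φ s x).2.1 ∧
        U (s / (4 * (r + 1/10))) = (φ s x).2.2.1 := by
  have hr0 : 0 < r + 1/10 := by linarith
  set k := 4 * (r + 1/10) with hk
  have hk0 : 0 < k := by positivity
  have hd : ∀ ξ, HasDerivAt (fun ξ : ℝ => k * ξ) k ξ := fun ξ =>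
    ((hasDerivAt_id ξ).const_mul k).congr_deriv (mul_one k)
  have hb : Tendsto (fun ξ : ℝ => k * ξ) atBot atBot := tendsto_id.const_mul_atBot hk0
  have ht : Tendsto (fun ξ : ℝ => k * ξ) atTop atTop := tendsto_id.const_mul_atTop hk0
  have hne : ∀ ξ, (φ (k * ξ) x).2.2.1 + x.2.2.2 + ζ ≠ 0 := fun ξ => by
    obtain ⟨-, -, -, -, -, -, -, -, h1⟩ := h.box (k * ξ)
    exact (by linarith : 0 < (φ (k * ξ) x).2.2.1 + x.2.2.2 + ζ).ne'
  refine ⟨fun ξ => (φ (k * ξ) x).1, fun ξ => k * (φ (k * ξ) x).2.1,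
    fun ξ => (φ (k * ξ) x).2.2.1, ⟨fun ξ h0 => hne ξ (by linarith), fun ξ => ?_, fun ξ => ?_,
    fun ξ => ?_⟩, ?_, ?_, fun s => ?_⟩
  · exact ((hφ.dq _ x (h.box (k * ξ))).comp ξ (hd ξ)).congr_deriv (mul_comm _ _)
  · refine (((hφ.dy _ x (h.box (k * ξ))).comp ξ (hd ξ)).const_mul k).congr_deriv ?_
    unfold FY fq
    rw [hk]
    field_simp
    ring
  · refine ((hφ.du _ x (h.box (k * ξ))).comp ξ (hd ξ)).congr_deriv ?_
    have h1 := hne ξ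
    have h2 : (φ (k * ξ) x).2.2.1 - (-ζ - x.2.2.2) = (φ (k * ξ) x).2.2.1 + x.2.2.2 + ζ := by ring
    rw [h2]
    unfold FU gq
    rw [hk] at h1 ⊢
    field_simp
  · have := ((h.bot.2.1.comp hb).const_mul k)
    rw [mul_zero] at this
    exact (h.bot.1.comp hb).prodMk_nhds (this.prodMk_nhds (h.bot.2.2.comp hb))
  · have := ((h.top.2.1.comp ht).const_mul k)
    rw [mul_zero] at this
    exact (h.top.1.comp ht).prodMk_nhds (this.prodMk_nhds (h.top.2.2.comp ht))
  · have h1 : k * (s / k) = s := by field_simp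
    simp only [h1, and_self]

lemma nonconst_of_tendsto {Q P U : ℝ → ℝ} {q p u s : ℝ}
    (h : Tendsto (fun ξ => (Q ξ, P ξ, U ξ)) atTop (𝓝 (q, p, u))) (hs : Q s ≠ q) :
    ∃ ξ₁ ξ₂ : ℝ, (Q ξ₁, P ξ₁, U ξ₁) ≠ (Q ξ₂, P ξ₂, U ξ₂) := by
  by_contra! hc
  have h1 : Tendsto (fun ξ : ℝ => (Q s, P s, U s)) atTop (𝓝 (q, p, u)) :=
    h.congr fun ξ => hc ξ s
  exact hs (congrArg Prod.fst (tendsto_nhds_unique tendsto_const_nhds h1))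

theorem stmt18 (ub : ℝ → ℝ)
    (hub : ∀ r : ℝ, 2/3 < r → ub r ∈ Set.Ioo (6/5 : ℝ) (4/3) ∧ Kc (ub r) r = 0) :
    ∃ r₁ : ℝ, 2/3 < r₁ ∧ ∀ r : ℝ, r₁ < r → ∀ ζ : ℝ, 2/5 < ζ →
      ∃ ε₀ > 0, ∀ ε ∈ Set.Ioo (0:ℝ) ε₀,
        let X1 : ℝ × ℝ × ℝ := (0, 0, 2)
        let X2 : ℝ × ℝ × ℝ := (qbp r (ub r), 0, ub r)
        let δ : ℝ := dist3 X1 X2 / 3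
        -- (i) a simple impulse of X₁
        (∃ D : ℝ, 0 < D ∧ ∃ μ : ℝ, ∃ Q P U : ℝ → ℝ,
          IsTWSol D μ (-ζ - μ) ε r Q P U ∧
          (∃ ξ₁ ξ₂ : ℝ, (Q ξ₁, P ξ₁, U ξ₁) ≠ (Q ξ₂, P ξ₂, U ξ₂)) ∧
          Tendsto (fun ξ => (Q ξ, P ξ, U ξ)) atBot (nhds X1) ∧
          Tendsto (fun ξ => (Q ξ, P ξ, U ξ)) atTop (nhds X1) ∧
          (∃ ξ : ℝ, dist3 (Q ξ, P ξ, U ξ) X2 ≤ δ)) ∧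
        -- (ii) a simple impulse of X₂
        (∃ D : ℝ, 0 < D ∧ ∃ μ : ℝ, ∃ Q P U : ℝ → ℝ,
          IsTWSol D μ (-ζ - μ) ε r Q P U ∧
          (∃ ξ₁ ξ₂ : ℝ, (Q ξ₁, P ξ₁, U ξ₁) ≠ (Q ξ₂, P ξ₂, U ξ₂)) ∧
          Tendsto (fun ξ => (Q ξ, P ξ, U ξ)) atBot (nhds X2) ∧
          Tendsto (fun ξ => (Q ξ, P ξ, U ξ)) atTop (nhds X2) ∧
          (∃ ξ : ℝ, dist3 (Q ξ, P ξ, U ξ) X1 ≤ δ)) ∧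
        -- (iii) a 1-back
        (∃ D : ℝ, 0 < D ∧ ∃ μ : ℝ, ∃ Q P U : ℝ → ℝ,
          IsTWSol D μ (-ζ - μ) ε r Q P U ∧
          Tendsto (fun ξ => (Q ξ, P ξ, U ξ)) atBot (nhds X2) ∧
          Tendsto (fun ξ => (Q ξ, P ξ, U ξ)) atTop (nhds X1) ∧
          (∃ ξ₁ ξ₂ : ℝ, ξ₁ < ξ₂ ∧
            dist3 (Q ξ₁, P ξ₁, U ξ₁) X1 ≤ δ ∧
            dist3 (Q ξ₂, P ξ₂, U ξ₂) X2 ≤ δ)) := by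
  refine ⟨10^5, by norm_num, fun r hr ζ hζ => ?_⟩
  have hr0 : 0 < r + 1/10 := by linarith
  have hE := exists_eqm hr (hub r (by linarith)).1 (hub r (by linarith)).2
  set e := 1/(r + 1/10) with he
  have e0 : 0 < e := by positivity
  have e1 : e ≤ 1/100000 := by
    rw [he]
    exact one_div_le_one_div_of_le (by norm_num) (by linarith)
  have hke : 4 * (r + 1/10) * e = 4 := by rw [he]; field_simp
  have hk0 : 0 < 4 * (r + 1/10) := by linarith
  refine ⟨4 * e^3/10^20, by positivity, fun ε hε => ?_⟩
  have hp : Par e (ε * e / 4) ζ := ⟨e0, e1, by have := hε.1; positivity, by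
    have := mul_le_mul_of_nonneg_right hε.2.le e0.le
    have h4 : 4 * e^3/10^20 * e = 4 * (e^4/10^20) := by ring
    linarith, hζ⟩
  obtain ⟨φ, hφ⟩ := exists_pflow e (ε * e / 4) ζ hζ
  have hturb : ∀ {q p u : ℝ}, 2 - 2*e ≤ q → q ≤ 2 → |p| ≤ 2*e/100 → 119/100 ≤ u →
      u ≤ 179/100 → dist3 (q, 4 * (r + 1/10) * p, u) (qbp r (ub r), 0, ub r) ≤
        dist3 (0, 0, 2) (qbp r (ub r), 0, ub r) / 3 := fun {q p u} h1 h2 h3 h4 h5 => by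
    have a1 := hE.q0
    have a2 := hE.q1
    have a3 := hE.u0
    have a4 := hE.u1
    refine dist3_le e1 hE (sq_add_le (abs_le.2 ⟨by dsimp only; linarith, by dsimp only; linarith⟩) ?_
      (abs_le.2 ⟨by dsimp only; linarith, by dsimp only; linarith⟩))
    simp only [sub_zero]
    rw [abs_mul, abs_of_pos hk0]
    have := mul_le_mul_of_nonneg_left h3 hk0.le
    linarith
  have hlam : ∀ {z : St}, AtLam e (ub r) z →
      dist3 (z.1, 4 * (r + 1/10) * z.2.1, z.2.2.1) (0, 0, 2) ≤
        dist3 (0, 0, 2) (qbp r (ub r), 0, ub r) / 3 := fun {z} h => by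
    have a3 := hE.u0
    have a4 := hE.u1
    have b0 := h.q
    have b1 := h.y0
    have b2 := h.u.1
    have b3 := h.u.2
    refine dist3_le e1 hE (sq_add_le (abs_le.2 ⟨by dsimp only; linarith, by dsimp only; linarith⟩) ?_
      (abs_le.2 ⟨by dsimp only; linarith, by dsimp only; linarith⟩))
    simp only [sub_zero]
    rw [abs_of_nonneg (mul_nonneg hk0.le b1)]
    have := mul_le_mul_of_nonneg_left h.y1 hk0.le
    rw [b0] at this
    linarith
  refine ⟨?_, ?_, ?_⟩
  · obtain ⟨x, hx, s, h1, h2, h3, h4, h5⟩ := exists_lam_impulse hφ hp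
    obtain ⟨Q, P, U, hS, hb, ht, hs⟩ := hx.exists_sol (by linarith) hζ hφ
    obtain ⟨g1, g2, g3⟩ := hs s
    refine ⟨_, by positivity, _, Q, P, U, hS, nonconst_of_tendsto ht (s := s / (4 * (r + 1/10))) ?_,
      hb, ht, s / (4 * (r + 1/10)), ?_⟩
    · rw [g1]
      exact (by linarith : 0 < (φ s x).1).ne'
    · rw [g1, g2, g3]
      exact hturb h1 h2 h3 (by linarith) h5
  · obtain ⟨x, hx, s, h1⟩ := exists_turb_impulse hφ hp hE
    obtain ⟨Q, P, U, hS, hb, ht, hs⟩ := hx.exists_sol (by linarith) hζ hφ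
    obtain ⟨g1, g2, g3⟩ := hs s
    refine ⟨_, by positivity, _, Q, P, U, hS, nonconst_of_tendsto ht (s := s / (4 * (r + 1/10))) ?_,
      hb, ht, s / (4 * (r + 1/10)), ?_⟩
    · rw [g1, h1.q]
      exact (by linarith [hE.q0] : e/1000 < qbp r (ub r)).ne
    · rw [g1, g2, g3]
      exact hlam h1
  · obtain ⟨x, hx, s₁, s₂, hlt, h1, h2, h3, h4, h5, h6⟩ := exists_back hφ hp hE
    obtain ⟨Q, P, U, hS, hb, ht, hs⟩ := hx.exists_sol (by linarith) hζ hφ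
    obtain ⟨f1, f2, f3⟩ := hs s₁
    obtain ⟨g1, g2, g3⟩ := hs s₂
    refine ⟨_, by positivity, _, Q, P, U, hS, hb, ht, s₁ / (4 * (r + 1/10)),
      s₂ / (4 * (r + 1/10)), div_lt_div_of_pos_right hlt hk0, ?_, ?_⟩
    · rw [f1, f2, f3]
      exact hlam h1
    · rw [g1, g2, g3]
      exact hturb h2 h3 h4 h5 (by linarith [hE.u1])
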